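/- The nonzero Banach representation Π := B(α)/L(α) of GL₂(ℚ_p) is topologically irreducible: its only closed GL₂(ℚ_p)-stable subspaces are 0 and Π itself. -/

import Mathlib

open Filter Topology Classical

noncomputable section

namespace Paper

variable (p : ℕ) [Fact p.Prime]
variable (L : Type) [NontriviallyNormedField L] [NormedAlgebra ℚ_[p] L]

/-- The canonical embedding `ℚ_p → L`. -/
noncomputable def iotaL : ℚ_[p] → L := algebraMap ℚ_[p] L

/-- The binomial coefficient `binom(z, n) = z(z-1)⋯(z-n+1)/n!` of a `p`-adic
integer, computed in `ℚ_p`. -/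
noncomputable def binomQ (z : ℤ_[p]) (n : ℕ) : ℚ_[p] :=
  (∏ i ∈ Finset.range n, ((z : ℚ_[p]) - (i : ℚ_[p]))) / (n.factorial : ℚ_[p])

/-- The Mahler coefficients `a_n(f) = ∑_{i=0}^n (-1)^i binom(n,i) f(n-i)`. -/
noncomputable def mahlerCoeff (f : ℤ_[p] → L) (n : ℕ) : L :=
  ∑ i ∈ Finset.range (n + 1), (-1 : L) ^ i * (n.choose i : L) * f (((n - i : ℕ) : ℤ_[p]))

/-- `f : ℤ_p → L` is of class `C^r` : the scaled Mahler coefficients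
`n^r a_n(f)` tend to `0`, and `f` is the sum of its Mahler expansion. -/
def IsCr (r : ℝ) (f : ℤ_[p] → L) : Prop :=
  Tendsto (fun n : ℕ => (n : ℝ) ^ r * ‖mahlerCoeff p L f n‖) atTop (nhds 0) ∧
  ∀ z : ℤ_[p], HasSum (fun n : ℕ => mahlerCoeff p L f n * iotaL p L (binomQ p z n)) (f z)

/-- The norm `‖f‖_r = sup_n (n+1)^r ‖a_n(f)‖` on `C^r(ℤ_p, L)`. -/
noncomputable def crNorm (r : ℝ) (f : ℤ_[p] → L) : ℝ :=
  ⨆ n : ℕ, ((n : ℝ) + 1) ^ r * ‖mahlerCoeff p L f n‖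

/-- A continuous (= bounded) linear functional on `C^r(ℤ_p, L)`, i.e. a tempered
distribution of order `r`. -/
structure CrDual (r : ℝ) where
  toFun : (ℤ_[p] → L) → L
  map_add' : ∀ f g : ℤ_[p] → L, IsCr p L r f → IsCr p L r g →
    toFun (f + g) = toFun f + toFun g
  map_smul' : ∀ (c : L) (f : ℤ_[p] → L), IsCr p L r f → toFun (c • f) = c * toFun f
  bound' : ∃ C : ℝ, ∀ f : ℤ_[p] → L, IsCr p L r f → ‖toFun f‖ ≤ C * crNorm p L r f

/-- The function `z ↦ 1_{a + pⁿℤ_p}(z) (z - a)^j`. -/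
noncomputable def indPoly (a : ℤ_[p]) (n : ℕ) (j : ℕ) : ℤ_[p] → L := fun z =>
  if ‖z - a‖ ≤ (p : ℝ) ^ (-(n : ℤ)) then (iotaL p L ((z : ℚ_[p]) - (a : ℚ_[p]))) ^ j else 0

/-- The norm `‖μ‖_{r,d} = sup_{a, 0 ≤ j ≤ d, n} p^{n(j-r)} ‖∫_{a+pⁿℤ_p} (z-a)^j dμ‖`. -/
noncomputable def dualNormRD (r : ℝ) (d : ℕ) (μ : CrDual p L r) : ℝ :=
  ⨆ (a : ℤ_[p]) (j : Fin (d + 1)) (n : ℕ),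
    (p : ℝ) ^ ((n : ℝ) * (((j : ℕ) : ℝ) - r)) * ‖μ.toFun (indPoly p L a n j)‖

/-- `f : ℤ_p → L` is locally polynomial of local degree at most `d`. -/
def IsLocPoly (d : ℕ) (f : ℤ_[p] → L) : Prop :=
  ∃ n : ℕ, ∀ a : ℤ_[p], ∃ P : Polynomial L, P.natDegree ≤ d ∧
    ∀ z : ℤ_[p], ‖z - a‖ ≤ (p : ℝ) ^ (-(n : ℤ)) → f z = Polynomial.eval (iotaL p L (z : ℚ_[p])) P

/-- A linear functional on `Pol^d(ℤ_p, L)`. -/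
structure PolDual (d : ℕ) where
  toFun : (ℤ_[p] → L) → L
  map_add' : ∀ f g : ℤ_[p] → L, IsLocPoly p L d f → IsLocPoly p L d g →
    toFun (f + g) = toFun f + toFun g
  map_smul' : ∀ (c : L) (f : ℤ_[p] → L), IsLocPoly p L d f → toFun (c • f) = c * toFun f

/-- The valuation `val(x) = -log_p ‖x‖` on `L`, normalized by `val(p) = 1`. -/
noncomputable def valL (x : L) : ℝ := -Real.logb p ‖x‖

/-- `g : ℤ_p → L` is a class-`C^{val α}` extension of
`z ↦ (αp/β)^{val z} z^{k-2} f(1/z)` from `ℤ_p ∖ {0}` to `ℤ_p`. -/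
def Ext2 (k : ℕ) (α β : L) (f : ℚ_[p] → L) (g : ℤ_[p] → L) : Prop :=
  IsCr p L (valL p L α) g ∧ ∀ z : ℤ_[p], z ≠ 0 →
    g z = (α * (p : L) / β) ^ ((z : ℚ_[p]).valuation) *
      (iotaL p L (z : ℚ_[p])) ^ (k - 2) * f (((z : ℚ_[p]))⁻¹)

/-- Membership in the Banach space `B(α)`. -/
def MemB (k : ℕ) (α β : L) (f : ℚ_[p] → L) : Prop :=
  IsCr p L (valL p L α) (fun z : ℤ_[p] => f ((p : ℚ_[p]) * (z : ℚ_[p]))) ∧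
  ∃ g : ℤ_[p] → L, Ext2 p L k α β f g

/-- The extension `f₂` of `z ↦ (αp/β)^{val z} z^{k-2} f(1/z)` to `ℤ_p`
(it is unique when it exists). -/
noncomputable def ext2 (k : ℕ) (α β : L) (f : ℚ_[p] → L) : ℤ_[p] → L :=
  if h : ∃ g : ℤ_[p] → L, Ext2 p L k α β f g then h.choose else 0

/-- The norm `‖f‖ = max(‖f₁‖_{val α}, ‖f₂‖_{val α})` on `B(α)`. -/
noncomputable def bNorm (k : ℕ) (α β : L) (f : ℚ_[p] → L) : ℝ :=
  max (crNorm p L (valL p L α) (fun z : ℤ_[p] => f ((p : ℚ_[p]) * (z : ℚ_[p]))))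
      (crNorm p L (valL p L α) (ext2 p L k α β f))

/-- Determinant of a 2×2 matrix. -/
noncomputable def det2 (m : Matrix (Fin 2) (Fin 2) ℚ_[p]) : ℚ_[p] :=
  m 0 0 * m 1 1 - m 0 1 * m 1 0

/-- The action of `g = (a b; c d) ∈ GL₂(ℚ_p)` on `B(α)`:
`(g·f)(z) = α^{-val(ad-bc)} (αp/β)^{val(-cz+a)} (-cz+a)^{k-2} f((dz-b)/(-cz+a))`,
the value at the pole `-cz+a = 0` being the one prescribed by the extension `f₂`. -/
noncomputable def gAct (k : ℕ) (α β : L) (m : Matrix (Fin 2) (Fin 2) ℚ_[p])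
    (f : ℚ_[p] → L) : ℚ_[p] → L := fun z =>
  if -(m 1 0) * z + m 0 0 = 0 then
    α ^ (-(det2 p m).valuation) * (α * (p : L) / β) ^ ((det2 p m / m 1 0).valuation) *
      (iotaL p L (det2 p m / m 1 0)) ^ (k - 2) * ext2 p L k α β f 0
  else
    α ^ (-(det2 p m).valuation) * (α * (p : L) / β) ^ ((-(m 1 0) * z + m 0 0).valuation) *
      (iotaL p L (-(m 1 0) * z + m 0 0)) ^ (k - 2) *
      f ((m 1 1 * z - m 0 1) / (-(m 1 0) * z + m 0 0))

/-- The monomial function `z ↦ z^j` on `ℚ_p`. -/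
noncomputable def monomialFun (j : ℕ) : ℚ_[p] → L := fun z => (iotaL p L z) ^ j

/-- The function `z ↦ (αp/β)^{val(z-a)} (z-a)^{k-2-j}` (extended by `0` at `z = a`). -/
noncomputable def specFun (k : ℕ) (α β : L) (a : ℚ_[p]) (j : ℕ) : ℚ_[p] → L := fun z =>
  if z = a then 0 else
    (α * (p : L) / β) ^ ((z - a).valuation) * (iotaL p L (z - a)) ^ (k - 2 - j)

/-- The generators of `L(α)` : the functions `z^j` and
`(αp/β)^{val(z-a)}(z-a)^{k-2-j}` for `0 ≤ j < val(α)` and `a ∈ ℚ_p`. -/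
def lGen (k : ℕ) (α β : L) : Set (ℚ_[p] → L) :=
  {f | ∃ j : ℕ, (j : ℝ) < valL p L α ∧
    (f = monomialFun p L j ∨ ∃ a : ℚ_[p], f = specFun p L k α β a j)}

/-- Membership in `L(α)`, the closure in `B(α)` of the span of the special
functions. -/
def MemLalpha (k : ℕ) (α β : L) (f : ℚ_[p] → L) : Prop :=
  MemB p L k α β f ∧ ∀ ε : ℝ, 0 < ε →
    ∃ g ∈ Submodule.span L (lGen p L k α β), bNorm p L k α β (f - g) < ε

/-- The quotient (semi)norm on `Π(V) = B(α)/L(α)`. -/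
noncomputable def qNorm (k : ℕ) (α β : L) (f : ℚ_[p] → L) : ℝ :=
  sInf {x : ℝ | ∃ g : ℚ_[p] → L, MemLalpha p L k α β g ∧ x = bNorm p L k α β (f - g)}

/-- `h : ℚ_p → L` is locally constant. -/
def LocConst (h : ℚ_[p] → L) : Prop :=
  ∀ x : ℚ_[p], ∃ n : ℕ, ∀ y : ℚ_[p], ‖y - x‖ ≤ (p : ℝ) ^ (-(n : ℤ)) → h y = h x

/-- `h` belongs to the smooth induced representation: `h` is locally constant and
`z ↦ (αp/β)^{val z} h(1/z)` extends to a locally constant function on `ℚ_p`. -/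
def IndCond (α β : L) (h : ℚ_[p] → L) : Prop :=
  LocConst p L h ∧ ∃ h' : ℚ_[p] → L, LocConst p L h' ∧
    ∀ z : ℚ_[p], z ≠ 0 → h' z = (α * (p : L) / β) ^ z.valuation * h z⁻¹

/-- The generators `z ↦ P(z) h(z)` of the locally algebraic representation `π(α)`. -/
def piGen (k : ℕ) (α β : L) : Set (ℚ_[p] → L) :=
  {f | ∃ (P : Polynomial L) (h : ℚ_[p] → L), P.natDegree ≤ k - 2 ∧ IndCond p L α β h ∧
    f = fun z => Polynomial.eval (iotaL p L z) P * h z}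

/-- The locally algebraic representation `π(α)`, as a subspace of functions
`ℚ_p → L`. -/
noncomputable def piRep (k : ℕ) (α β : L) : Submodule L (ℚ_[p] → L) :=
  Submodule.span L (piGen p L k α β)

/-- The standing hypotheses on `(k, α, β)` coming from an absolutely irreducible,
`φ`-semisimple crystalline representation: `k ≥ 2`, `α ≠ β`,
`0 < val(β) ≤ val(α)` and `val(α) + val(β) = k - 1`. -/
def Hyps (k : ℕ) (α β : L) : Prop :=
  2 ≤ k ∧ α ≠ β ∧ 0 < valL p L α ∧ 0 < valL p L β ∧
    valL p L α + valL p L β = (k : ℝ) - 1 ∧ valL p L β ≤ valL p L α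

/-- `Λ` is a `GL₂(ℚ_p)`-stable `𝒪_L`-lattice in `π(α)`: an `𝒪_L`-submodule of
`π(α)` generating it over `L`, containing no `L`-line and stable by the action. -/
def IsLatticeStable (k : ℕ) (α β : L) (Λ : Set (ℚ_[p] → L)) : Prop :=
  (∀ f ∈ Λ, f ∈ piRep p L k α β) ∧ ((0 : ℚ_[p] → L) ∈ Λ) ∧
  (∀ f ∈ Λ, ∀ g ∈ Λ, f + g ∈ Λ) ∧
  (∀ c : L, ‖c‖ ≤ 1 → ∀ f ∈ Λ, c • f ∈ Λ) ∧
  (∀ f ∈ piRep p L k α β, ∃ c : L, c ≠ 0 ∧ c • f ∈ Λ) ∧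
  (∀ f, f ∈ piRep p L k α β → f ≠ 0 → ¬ ∀ c : L, c • f ∈ Λ) ∧
  (∀ m : Matrix (Fin 2) (Fin 2) ℚ_[p], det2 p m ≠ 0 → ∀ f ∈ Λ, gAct p L k α β m f ∈ Λ)

end Paper

namespace Paper

set_option linter.unusedSectionVars false

set_option linter.unusedVariables false
set_option linter.unusedSimpArgs false

section

variable {L : Type} [NontriviallyNormedField L] [IsUltrametricDist L]

lemma norm_sum_le_of {ι : Type*} {s : Finset ι} {f : ι → L} {C : ℝ} (hC : 0 ≤ C)
    (h : ∀ i ∈ s, ‖f i‖ ≤ C) : ‖∑ i ∈ s, f i‖ ≤ C :=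
  IsUltrametricDist.norm_sum_le_of_forall_le_of_nonneg hC h

lemma norm_add_le_of {x y : L} {C : ℝ} (hx : ‖x‖ ≤ C) (hy : ‖y‖ ≤ C) : ‖x + y‖ ≤ C :=
  (IsUltrametricDist.norm_add_le_max x y).trans (max_le hx hy)

lemma norm_sub_le_of {x y : L} {C : ℝ} (hx : ‖x‖ ≤ C) (hy : ‖y‖ ≤ C) : ‖x - y‖ ≤ C := by
  rw [sub_eq_add_neg]; exact norm_add_le_of hx (by rwa [norm_neg])

lemma norm_hasSum_le_of {ι : Type*} {f : ι → L} {a : L} {C : ℝ} (hC : 0 ≤ C)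
    (h : ∀ i, ‖f i‖ ≤ C) (ha : HasSum f a) : ‖a‖ ≤ C :=
  le_of_tendsto ha.norm (Eventually.of_forall fun s => norm_sum_le_of hC fun i _ => h i)

end

section

variable {p : ℕ} [hp : Fact p.Prime]
variable {L : Type} [NontriviallyNormedField L] [NormedAlgebra ℚ_[p] L]

lemma norm_iotaL (x : ℚ_[p]) : ‖iotaL p L x‖ = ‖x‖ := norm_algebraMap' L x

lemma continuous_iotaL : Continuous (iotaL p L) := continuous_algebraMap ℚ_[p] L

@[simp] lemma iotaL_add (x y : ℚ_[p]) : iotaL p L (x + y) = iotaL p L x + iotaL p L y :=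
  map_add _ _ _
@[simp] lemma iotaL_sub (x y : ℚ_[p]) : iotaL p L (x - y) = iotaL p L x - iotaL p L y :=
  map_sub _ _ _
@[simp] lemma iotaL_neg (x : ℚ_[p]) : iotaL p L (-x) = -iotaL p L x := map_neg _ _
@[simp] lemma iotaL_mul (x y : ℚ_[p]) : iotaL p L (x * y) = iotaL p L x * iotaL p L y :=
  map_mul _ _ _
@[simp] lemma iotaL_div (x y : ℚ_[p]) : iotaL p L (x / y) = iotaL p L x / iotaL p L y :=
  map_div₀ _ _ _
@[simp] lemma iotaL_inv (x : ℚ_[p]) : iotaL p L (x⁻¹) = (iotaL p L x)⁻¹ := map_inv₀ _ _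
@[simp] lemma iotaL_pow (x : ℚ_[p]) (n : ℕ) : iotaL p L (x ^ n) = iotaL p L x ^ n :=
  map_pow _ _ _
@[simp] lemma iotaL_zpow (x : ℚ_[p]) (n : ℤ) : iotaL p L (x ^ n) = iotaL p L x ^ n :=
  map_zpow₀ _ _ _
@[simp] lemma iotaL_one : iotaL p L 1 = 1 := map_one _
@[simp] lemma iotaL_natCast (n : ℕ) : iotaL p L (n : ℚ_[p]) = n := map_natCast _ _
@[simp] lemma iotaL_eq_zero {x : ℚ_[p]} : iotaL p L x = 0 ↔ x = 0 :=
  map_eq_zero _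

variable (p L) in
lemma norm_natCast_prime : ‖(p : L)‖ = (p : ℝ)⁻¹ := by
  rw [← iotaL_natCast (p := p), norm_iotaL, Padic.norm_p]

lemma norm_natCast_le_one (p : ℕ) [Fact p.Prime] (L : Type) [NontriviallyNormedField L]
    [NormedAlgebra ℚ_[p] L] (n : ℕ) : ‖(n : L)‖ ≤ 1 := by
  rw [← iotaL_natCast (p := p), norm_iotaL]
  exact by exact_mod_cast Padic.norm_int_le_one (p := p) n

variable (p) in
lemma one_lt_p : (1 : ℝ) < p := by exact_mod_cast hp.out.one_lt

variable (p) in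
lemma p_pos : (0 : ℝ) < p := by linarith [one_lt_p p]

variable (p L) in
lemma natCast_prime_ne_zero : (p : L) ≠ 0 := by
  rw [← norm_pos_iff, norm_natCast_prime p L]; exact inv_pos.2 (p_pos p)

variable (p L) in
/-- The binomial function `z ↦ binom(z, N)` with values in `L`. -/
def bin (N : ℕ) : ℤ_[p] → L := fun z => iotaL p L (binomQ p z N)

lemma binomQ_natCast (n N : ℕ) : binomQ p (n : ℤ_[p]) N = (n.choose N : ℚ_[p]) := by
  unfold binomQ
  rw [div_eq_iff (by exact_mod_cast N.factorial_ne_zero)]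
  have h := descPochhammer_eval_eq_prod_range N (n : ℚ_[p])
  rw [descPochhammer_eval_eq_descFactorial, Nat.descFactorial_eq_factorial_mul_choose] at h
  push_cast at h ⊢
  rw [← h, mul_comm]

lemma continuous_binomQ (N : ℕ) : Continuous (fun z : ℤ_[p] => binomQ p z N) := by
  unfold binomQ
  fun_prop

lemma binomQ_eq_choose (z : ℤ_[p]) (N : ℕ) : binomQ p z N = ((Ring.choose z N : ℤ_[p]) : ℚ_[p]) := by
  have := PadicInt.denseRange_natCast (p := p) |>.equalizer (continuous_binomQ N)
    (continuous_subtype_val.comp (PadicInt.continuous_choose N)) (by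
      ext n
      change binomQ p (n : ℤ_[p]) N = ((Ring.choose (n : ℤ_[p]) N : ℤ_[p]) : ℚ_[p])
      rw [binomQ_natCast, Ring.choose_natCast, PadicInt.coe_natCast])
  exact congrFun this z

lemma continuous_bin (N : ℕ) : Continuous (bin p L N) :=
  continuous_iotaL.comp (continuous_binomQ N)

lemma bin_eq (N : ℕ) (z : ℤ_[p]) : bin p L N z = iotaL p L ((Ring.choose z N : ℤ_[p]) : ℚ_[p]) := by
  rw [bin, binomQ_eq_choose]

lemma norm_bin_le (N : ℕ) (z : ℤ_[p]) : ‖bin p L N z‖ ≤ 1 := by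
  rw [bin_eq, norm_iotaL]; exact PadicInt.norm_le_one _

lemma bin_natCast (n N : ℕ) : bin p L N (n : ℤ_[p]) = (n.choose N : L) := by
  rw [bin, binomQ_natCast, iotaL_natCast]

lemma bin_zero_right (z : ℤ_[p]) : bin p L 0 z = 1 := by
  simp [bin, binomQ]

lemma bin_one_right (z : ℤ_[p]) : bin p L 1 z = iotaL p L z := by
  simp [bin, binomQ]

lemma bin_apply_zero (N : ℕ) : bin p L N 0 = if N = 0 then 1 else 0 := by
  have := bin_natCast (p := p) (L := L) 0 N
  rw [Nat.cast_zero] at this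
  rw [this]
  cases N <;> simp

lemma bin_succ_add_one (N : ℕ) (z : ℤ_[p]) :
    bin p L (N + 1) (z + 1) = bin p L N z + bin p L (N + 1) z := by
  simp only [bin_eq]
  rw [← iotaL_add, Ring.choose_succ_succ, PadicInt.coe_add]

lemma bin_add (N : ℕ) (x y : ℤ_[p]) :
    bin p L N (x + y) = ∑ ij ∈ Finset.HasAntidiagonal.antidiagonal N, bin p L ij.1 x * bin p L ij.2 y := by
  simp only [bin_eq]
  rw [Ring.add_choose_eq N (Commute.all x y)]
  change ((algebraMap ℚ_[p] L).comp PadicInt.Coe.ringHom) _ = _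
  rw [map_sum]
  simp only [map_mul]
  rfl

variable (p L) in
/-- Translation `f ↦ f(· + b)` on functions on `ℤ_p`. -/
def tau (b : ℤ_[p]) : Module.End L (ℤ_[p] → L) := LinearMap.funLeft L L (fun x => x + b)

@[simp] lemma tau_apply (b : ℤ_[p]) (f : ℤ_[p] → L) (x : ℤ_[p]) : tau p L b f x = f (x + b) := rfl

lemma tau_pow (b : ℤ_[p]) (n : ℕ) : tau p L b ^ n = tau p L (n * b) := by
  induction n with
  | zero => ext f x; simp [tau]
  | succ n ih =>
    ext f x
    rw [pow_succ, ih]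
    simp [Module.End.mul_apply, tau, LinearMap.funLeft_apply]
    ring_nf

variable (p L) in
/-- The forward difference operator. -/
def del : Module.End L (ℤ_[p] → L) := tau p L 1 - 1

lemma del_apply (f : ℤ_[p] → L) (x : ℤ_[p]) : del p L f x = f (x + 1) - f x := rfl

lemma mahlerCoeff_eq (f : ℤ_[p] → L) (N : ℕ) : mahlerCoeff p L f N = (del p L ^ N) f 0 := by
  have h := (Commute.one_left (tau p L 1)).neg_left.symm.add_pow' N
  rw [← sub_eq_add_neg] at h
  rw [del, h, Finset.Nat.sum_antidiagonal_eq_sum_range_succ_mk, LinearMap.sum_apply, Finset.sum_apply,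
    mahlerCoeff, ← Finset.sum_flip]
  refine Finset.sum_congr rfl fun i hi => ?_
  have hi' : i ≤ N := Nat.lt_succ_iff.1 (Finset.mem_range.1 hi)
  rw [tau_pow, show N - (N - i) = i by omega, Nat.choose_symm hi']
  have : ((-1 : Module.End L (ℤ_[p] → L)) ^ (N - i)) f = ((-1 : L) ^ (N - i)) • f := by
    generalize N - i = j
    induction j with
    | zero => simp
    | succ j ih => rw [pow_succ', Module.End.mul_apply, ih, pow_succ']; simp
  rw [LinearMap.smul_apply, Module.End.mul_apply, this]
  simp [nsmul_eq_mul]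
  ring

variable (p L) in
/-- The Mahler coefficient as a linear functional. -/
def mc (N : ℕ) : (ℤ_[p] → L) →ₗ[L] L := LinearMap.proj 0 ∘ₗ (del p L ^ N)

lemma mc_eq (N : ℕ) (f : ℤ_[p] → L) : mc p L N f = mahlerCoeff p L f N := (mahlerCoeff_eq f N).symm

lemma mc_apply (N : ℕ) (f : ℤ_[p] → L) : mc p L N f = (del p L ^ N) f 0 := rfl

lemma mc_sum (N : ℕ) (f : ℤ_[p] → L) : mc p L N f =
    ∑ i ∈ Finset.range (N + 1), (-1 : L) ^ i * (N.choose i : L) * f (((N - i : ℕ) : ℤ_[p])) := by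
  rw [mc_eq, mahlerCoeff]

lemma del_bin_succ (N : ℕ) : del p L (bin p L (N + 1)) = bin p L N := by
  ext x; rw [del_apply, bin_succ_add_one]; ring

lemma del_bin_zero : del p L (bin p L 0) = 0 := by
  ext x; simp [del_apply, bin_zero_right]

lemma mc_bin (N M : ℕ) : mc p L N (bin p L M) = if N = M then 1 else 0 := by
  rw [mc_apply]
  induction N generalizing M with
  | zero => simp [bin_apply_zero, eq_comm]
  | succ N ih =>
    rw [pow_succ, Module.End.mul_apply]
    cases M with
    | zero => rw [del_bin_zero]; simp
    | succ M => rw [del_bin_succ, ih]; simp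

section ultra

variable [IsUltrametricDist L]

lemma norm_mc_le (N : ℕ) {f : ℤ_[p] → L} {C : ℝ} (hC : 0 ≤ C) (h : ∀ x, ‖f x‖ ≤ C) :
    ‖mc p L N f‖ ≤ C := by
  rw [mc_sum]
  refine norm_sum_le_of hC fun i _ => ?_
  rw [norm_mul, norm_mul, norm_pow, norm_neg, norm_one, one_pow, one_mul]
  calc _ ≤ 1 * ‖f _‖ := by gcongr; exact norm_natCast_le_one p L _
    _ ≤ C := by rw [one_mul]; exact h _

end ultra

end

section

variable {p : ℕ} [hp : Fact p.Prime]
variable {L : Type} [NontriviallyNormedField L] [NormedAlgebra ℚ_[p] L] [IsUltrametricDist L]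

/-- The weight `(n + 1) ^ r`. -/
def wt (r : ℝ) (n : ℕ) : ℝ := ((n : ℝ) + 1) ^ r

lemma wt_pos (r : ℝ) (n : ℕ) : 0 < wt r n := Real.rpow_pos_of_pos (by positivity) r

lemma one_le_wt {r : ℝ} (hr : 0 ≤ r) (n : ℕ) : 1 ≤ wt r n :=
  Real.one_le_rpow (by linarith [n.cast_nonneg (α := ℝ)]) hr

/-- Class `C^r`, in terms of continuity and decay of Mahler coefficients. -/
def Cr (r : ℝ) (f : ℤ_[p] → L) : Prop :=
  Continuous f ∧ Tendsto (fun n : ℕ => wt r n * ‖mc p L n f‖) atTop (𝓝 0)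

/-- Class `C^r` with norm at most `C`. -/
def CrB (r C : ℝ) (f : ℤ_[p] → L) : Prop :=
  Cr r f ∧ ∀ n : ℕ, wt r n * ‖mc p L n f‖ ≤ C

lemma fwdDiff_iter_eq_mc (f : ℤ_[p] → L) (n : ℕ) : (fwdDiff 1)^[n] f 0 = mc p L n f := by
  rw [mc_apply]
  suffices h : (fwdDiff 1)^[n] f = (del p L ^ n) f by rw [h]
  induction n generalizing f with
  | zero => simp
  | succ n ih => rw [Function.iterate_succ_apply, pow_succ, Module.End.mul_apply, ih]; rfl

variable [CompleteSpace L]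

lemma hasSum_mahler_of_continuous {f : ℤ_[p] → L} (hf : Continuous f) (z : ℤ_[p]) :
    HasSum (fun n => mc p L n f * bin p L n z) (f z) := by
  let _ : Module ℤ_[p] L := Module.compHom L (PadicInt.Coe.ringHom (p := p))
  have : IsBoundedSMul ℤ_[p] L := IsBoundedSMul.of_norm_smul_le fun a x => by
    change ‖((a : ℚ_[p]) • x)‖ ≤ _
    rw [norm_smul]; rfl
  have h := PadicInt.hasSum_mahler (⟨f, hf⟩ : C(ℤ_[p], L))
  have h2 := h.map (ContinuousMap.evalCLM ℤ_[p] z : C(ℤ_[p], L) →L[ℤ_[p]] L) (by fun_prop)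
  have h3 : ∀ n, (PadicInt.mahlerTerm ((fwdDiff 1)^[n] (⟨f, hf⟩ : C(ℤ_[p], L)) 0) n : C(ℤ_[p], L)) z
      = mc p L n f * bin p L n z := fun n => by
    rw [PadicInt.mahlerTerm_apply, mul_comm, ← fwdDiff_iter_eq_mc, bin_eq]
    exact Algebra.smul_def ((Ring.choose z n : ℤ_[p]) : ℚ_[p]) ((fwdDiff 1)^[n] f 0)
  simp only [← h3]
  exact h2

lemma continuous_of_hasSum {f : ℤ_[p] → L} {a : ℕ → L} (ha : Tendsto a atTop (𝓝 0))
    (h : ∀ z, HasSum (fun n => a n * bin p L n z) (f z)) : Continuous f := by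
  refine continuous_of_uniform_approx_of_continuous fun u hu => ?_
  obtain ⟨ε, hε, hεu⟩ := Metric.mem_uniformity_dist.1 hu
  obtain ⟨N, hN⟩ := (Metric.tendsto_atTop.1 ha) (ε / 2) (by positivity)
  refine ⟨fun z => ∑ n ∈ Finset.range N, a n * bin p L n z,
    continuous_finsetSum _ fun n _ => continuous_const.mul (continuous_bin n), fun z => hεu ?_⟩
  have h1 := (hasSum_nat_add_iff' N).2 (h z)
  rw [dist_eq_norm]
  refine lt_of_le_of_lt (norm_hasSum_le_of (C := ε / 2) (by positivity) (fun n => ?_) h1) (by linarith)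
  rw [norm_mul]
  have := hN (n + N) (by omega)
  rw [dist_zero_right] at this
  calc _ ≤ ‖a (n + N)‖ * 1 := by gcongr; exact norm_bin_le _ _
    _ ≤ _ := by linarith

lemma tendsto_of_wt_mul {r : ℝ} (hr : 0 ≤ r) {a : ℕ → L}
    (h : Tendsto (fun n : ℕ => wt r n * ‖a n‖) atTop (𝓝 0)) : Tendsto a atTop (𝓝 0) := by
  rw [tendsto_zero_iff_norm_tendsto_zero]
  refine squeeze_zero (fun n => norm_nonneg _) (fun n => ?_) h
  have := one_le_wt hr n
  nlinarith [norm_nonneg (a n)]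

lemma isCr_iff {r : ℝ} (hr : 0 ≤ r) (f : ℤ_[p] → L) : IsCr p L r f ↔ Cr r f := by
  have key : Tendsto (fun n : ℕ => (n : ℝ) ^ r * ‖mahlerCoeff p L f n‖) atTop (nhds 0) ↔
      Tendsto (fun n : ℕ => wt r n * ‖mc p L n f‖) atTop (𝓝 0) := by
    constructor
    · intro h
      have h2 := h.const_mul ((2 : ℝ) ^ r)
      rw [mul_zero] at h2
      refine squeeze_zero' (Eventually.of_forall fun n => by
        have := wt_pos r n; positivity) ?_ h2
      filter_upwards [eventually_ge_atTop 1] with n hn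
      rw [mc_eq, ← mul_assoc, ← Real.mul_rpow (by norm_num) (by positivity)]
      have : (1 : ℝ) ≤ n := by exact_mod_cast hn
      unfold wt
      gcongr
      linarith
    · intro h
      refine squeeze_zero (fun n => by positivity) (fun n => ?_) h
      rw [mc_eq]
      unfold wt
      gcongr
      linarith
  constructor
  · rintro ⟨h1, h2⟩
    have h1' := key.1 h1
    refine ⟨continuous_of_hasSum (tendsto_of_wt_mul hr h1') fun z => ?_, h1'⟩
    convert h2 z using 2
    rw [mc_eq, bin]
  · rintro ⟨h1, h2⟩
    refine ⟨key.2 h2, fun z => ?_⟩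
    convert hasSum_mahler_of_continuous h1 z using 2
    rw [mc_eq, bin]

lemma CrB.nonneg {r C : ℝ} {f : ℤ_[p] → L} (h : CrB r C f) : 0 ≤ C :=
  (mul_nonneg (wt_pos r 0).le (norm_nonneg _)).trans (h.2 0)

lemma CrB.mono {r C C' : ℝ} {f : ℤ_[p] → L} (h : CrB r C f) (hC : C ≤ C') : CrB r C' f :=
  ⟨h.1, fun n => (h.2 n).trans hC⟩

lemma Cr.crB {r : ℝ} {f : ℤ_[p] → L} (h : Cr r f) : CrB r (crNorm p L r f) f := by
  refine ⟨h, fun n => ?_⟩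
  have hb := h.2.bddAbove_range
  unfold crNorm
  have := le_ciSup hb n
  simpa only [wt, mc_eq] using this

lemma CrB.crNorm_le {r C : ℝ} {f : ℤ_[p] → L} (h : CrB r C f) : crNorm p L r f ≤ C := by
  unfold crNorm
  refine ciSup_le fun n => ?_
  have := h.2 n
  simpa only [wt, mc_eq] using this

lemma CrB.norm_le {r C : ℝ} {f : ℤ_[p] → L} (hr : 0 ≤ r) (h : CrB r C f) (x : ℤ_[p]) :
    ‖f x‖ ≤ C := by
  refine norm_hasSum_le_of h.nonneg (fun n => ?_) (hasSum_mahler_of_continuous h.1.1 x)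
  rw [norm_mul]
  calc _ ≤ ‖mc p L n f‖ * 1 := by gcongr; exact norm_bin_le _ _
    _ ≤ wt r n * ‖mc p L n f‖ := by
      rw [mul_comm]; gcongr; exact one_le_wt hr n
    _ ≤ C := h.2 n

lemma CrB.zero {r C : ℝ} (hC : 0 ≤ C) : CrB r C (0 : ℤ_[p] → L) := by
  refine ⟨⟨continuous_const, ?_⟩, fun n => ?_⟩
  · simp
  · simpa using hC

lemma CrB.add {r C : ℝ} {f g : ℤ_[p] → L} (hf : CrB r C f) (hg : CrB r C g) : CrB r C (f + g) := by
  have key : ∀ n, wt r n * ‖mc p L n (f + g)‖ ≤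
      max (wt r n * ‖mc p L n f‖) (wt r n * ‖mc p L n g‖) := fun n => by
    rw [map_add, ← mul_max_of_nonneg _ _ (wt_pos r n).le]
    gcongr
    · exact (wt_pos r n).le
    · exact IsUltrametricDist.norm_add_le_max _ _
  refine ⟨⟨hf.1.1.add hg.1.1, ?_⟩, fun n => (key n).trans (max_le (hf.2 n) (hg.2 n))⟩
  refine squeeze_zero (fun n => mul_nonneg (wt_pos r n).le (norm_nonneg _)) key ?_
  simpa using hf.1.2.max hg.1.2

lemma CrB.smul {r C : ℝ} {f : ℤ_[p] → L} (c : L) (hf : CrB r C f) : CrB r (‖c‖ * C) (c • f) := by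
  have key : ∀ n, wt r n * ‖mc p L n (c • f)‖ = ‖c‖ * (wt r n * ‖mc p L n f‖) := fun n => by
    rw [map_smul, norm_smul]; ring
  refine ⟨⟨continuous_const.smul hf.1.1, ?_⟩, fun n => ?_⟩
  · simp_rw [key]; simpa using hf.1.2.const_mul ‖c‖
  · rw [key]; gcongr; exact hf.2 n

lemma CrB.neg {r C : ℝ} {f : ℤ_[p] → L} (hf : CrB r C f) : CrB r C (-f) := by
  have := hf.smul (-1); simpa using this

lemma CrB.sub {r C : ℝ} {f g : ℤ_[p] → L} (hf : CrB r C f) (hg : CrB r C g) : CrB r C (f - g) := by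
  rw [sub_eq_add_neg]; exact hf.add hg.neg

lemma CrB.sum {r C : ℝ} (hC : 0 ≤ C) {ι : Type*} {s : Finset ι} {f : ι → ℤ_[p] → L}
    (h : ∀ i ∈ s, CrB r C (f i)) : CrB r C (∑ i ∈ s, f i) := by
  induction s using Finset.induction_on with
  | empty => simpa using CrB.zero hC
  | insert a s ha ih =>
    rw [Finset.sum_insert ha]
    exact (h a (by simp)).add (ih fun i hi => h i (by simp [hi]))

lemma crB_bin (r : ℝ) (N : ℕ) : CrB r (wt r N) (bin p L N) := by
  refine ⟨⟨continuous_bin N, ?_⟩, fun n => ?_⟩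
  · refine tendsto_const_nhds.congr' ?_
    filter_upwards [eventually_gt_atTop N] with n hn
    rw [mc_bin, if_neg (by omega)]; simp
  · rw [mc_bin]; split_ifs with h
    · subst h; simp
    · simpa using (wt_pos r N).le

lemma hasSum_mc {ι : Type*} {F : ι → ℤ_[p] → L} {f : ℤ_[p] → L} (h : ∀ x, HasSum (fun i => F i x) (f x))
    (n : ℕ) : HasSum (fun i => mc p L n (F i)) (mc p L n f) := by
  simp only [mc_sum]
  exact hasSum_sum fun j _ => (h _).mul_left _

/-- A superposition of functions of class `C^r` whose norms tend to zero. -/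
lemma CrB.of_hasSum {r C : ℝ} (hr : 0 ≤ r) (hC : 0 ≤ C) {F : ℕ → ℤ_[p] → L} {K : ℕ → ℝ}
    {f : ℤ_[p] → L}
    (hF : ∀ i, CrB r (K i) (F i)) (hK : Tendsto K atTop (𝓝 0)) (hKC : ∀ i, K i ≤ C)
    (h : ∀ x, HasSum (fun i => F i x) (f x)) : CrB r C f := by
  have tail : ∀ ε > 0, ∃ N, (∀ n, wt r n * ‖mc p L n (f - ∑ i ∈ Finset.range N, F i)‖ ≤ ε) ∧
      ∀ x, ‖f x - ∑ i ∈ Finset.range N, F i x‖ ≤ ε := by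
    intro ε hε
    obtain ⟨N, hN⟩ := (Metric.tendsto_atTop.1 hK) ε hε
    have hN' : ∀ i ≥ N, K i ≤ ε := fun i hi => by
      have := hN i hi
      rw [Real.dist_0_eq_abs] at this
      exact (le_abs_self _).trans this.le
    have ht : ∀ x, HasSum (fun i => F (i + N) x) ((f - ∑ i ∈ Finset.range N, F i) x) := fun x => by
      have := (hasSum_nat_add_iff' N).2 (h x)
      simpa using this
    refine ⟨N, fun n => ?_, fun x => ?_⟩
    · rw [← le_div_iff₀' (wt_pos r n)]
      refine norm_hasSum_le_of (div_nonneg hε.le (wt_pos r n).le) (fun i => ?_) (hasSum_mc ht n)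
      rw [le_div_iff₀' (wt_pos r n)]
      exact ((hF _).2 n).trans (hN' _ (by omega))
    · have := norm_hasSum_le_of hε.le (fun i => ((hF _).norm_le hr x).trans (hN' (i + N) (by omega))) (ht x)
      simpa using this
  refine ⟨⟨?_, ?_⟩, fun n => ?_⟩
  · refine continuous_of_uniform_approx_of_continuous fun u hu => ?_
    obtain ⟨ε, hε, hεu⟩ := Metric.mem_uniformity_dist.1 hu
    obtain ⟨N, -, hN⟩ := tail (ε / 2) (by positivity)
    refine ⟨fun z => ∑ i ∈ Finset.range N, F i z,
      continuous_finsetSum _ fun i _ => (hF i).1.1, fun z => hεu ?_⟩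
    rw [dist_eq_norm]; linarith [hN z]
  · rw [Metric.tendsto_atTop]
    intro ε hε
    obtain ⟨N, hN, -⟩ := tail (ε / 2) (by positivity)
    have h1 : Cr r (∑ i ∈ Finset.range N, F i) :=
      (CrB.sum (C := C) hC fun i _ => (hF i).mono (hKC i)).1
    obtain ⟨M, hM⟩ := (Metric.tendsto_atTop.1 h1.2) (ε / 2) (by positivity)
    refine ⟨M, fun n hn => ?_⟩
    have h2 := hM n hn
    rw [Real.dist_0_eq_abs, abs_of_nonneg (mul_nonneg (wt_pos r n).le (norm_nonneg _))] at h2 ⊢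
    have h3 : mc p L n f = mc p L n (f - ∑ i ∈ Finset.range N, F i) +
        mc p L n (∑ i ∈ Finset.range N, F i) := by rw [← map_add]; simp
    have h4 := hN n
    rw [h3]
    have h5 := mul_le_mul_of_nonneg_left (IsUltrametricDist.norm_add_le_max
      (mc p L n (f - ∑ i ∈ Finset.range N, F i)) (mc p L n (∑ i ∈ Finset.range N, F i))) (wt_pos r n).le
    rw [mul_max_of_nonneg _ _ (wt_pos r n).le] at h5
    exact h5.trans_lt (max_lt (by linarith) (by linarith))
  · rw [← le_div_iff₀' (wt_pos r n)]
    refine norm_hasSum_le_of (div_nonneg hC (wt_pos r n).le) (fun i => ?_) (hasSum_mc h n)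
    rw [le_div_iff₀' (wt_pos r n)]
    exact ((hF _).2 n).trans (hKC i)

/-- Weighted composition operators bounded on binomials are bounded on `C^r`. -/
lemma CrB.weightedComp {r C K : ℝ} (hr : 0 ≤ r) {f : ℤ_[p] → L} (hf : CrB r C f) (hK : 0 ≤ K)
    {c : ℤ_[p] → L} {σ : ℤ_[p] → ℤ_[p]}
    (h : ∀ N, CrB r (K * wt r N) (fun x => c x * bin p L N (σ x))) :
    CrB r (K * C) (fun x => c x * f (σ x)) := by
  refine CrB.of_hasSum hr (mul_nonneg hK hf.nonneg)
    (F := fun N => mc p L N f • fun x => c x * bin p L N (σ x))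
    (K := fun N => ‖mc p L N f‖ * (K * wt r N)) (fun N => (h N).smul _) ?_ (fun N => ?_) fun x => ?_
  · have := hf.1.2.const_mul K
    rw [mul_zero] at this
    exact this.congr fun n => by ring
  · calc _ = K * (wt r N * ‖mc p L N f‖) := by ring
      _ ≤ _ := by gcongr; exact hf.2 N
  · have := (hasSum_mahler_of_continuous hf.1.1 (σ x)).mul_left (c x)
    have e : (fun N => c x * (mc p L N f * bin p L N (σ x))) =
        fun N => (mc p L N f • fun x => c x * bin p L N (σ x)) x := by
      ext N; simp only [Pi.smul_apply, smul_eq_mul]; ring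
    rwa [e] at this

end

section

variable (L : Type) [NontriviallyNormedField L] [IsUltrametricDist L]

/-- The closed unit ball of `L` as a subring. -/
def OL : Subring L where
  carrier := {x | ‖x‖ ≤ 1}
  mul_mem' {a b} ha hb := by
    simp only [Set.mem_ofPred_eq, norm_mul] at *
    exact mul_le_one₀ ha (norm_nonneg _) hb
  one_mem' := by simp
  add_mem' ha hb := norm_add_le_of ha hb
  zero_mem' := by simp
  neg_mem' {a} ha := by simpa using ha

end

section

variable {p : ℕ} [hp : Fact p.Prime]
variable {L : Type} [NontriviallyNormedField L] [NormedAlgebra ℚ_[p] L] [IsUltrametricDist L]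

lemma OL.norm_le (x : OL L) : ‖(x : L)‖ ≤ 1 := x.2

lemma norm_iotaL_le_one (x : ℤ_[p]) : ‖iotaL p L x‖ ≤ 1 := by
  rw [norm_iotaL]; exact PadicInt.norm_le_one x

lemma inv_p_lt_one (p : ℕ) [Fact p.Prime] : (p : ℝ)⁻¹ < 1 := inv_lt_one_of_one_lt₀ (one_lt_p p)

variable (L) in
/-- A `p`-adic integer as an element of the unit ball of `L`. -/
def toOL (x : ℤ_[p]) : OL L := ⟨iotaL p L x, norm_iotaL_le_one x⟩

variable (L) in
/-- The element `p x` of the unit ball of `L`. -/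
def pI (x : ℤ_[p]) : OL L := toOL L ((p : ℤ_[p]) * x)

lemma coe_pI (x : ℤ_[p]) : (pI L x : L) = (p : L) * iotaL p L x := by
  simp [pI, toOL]

/-- Uniform limits of integral polynomials in `p x`. -/
def LA0 (h : ℤ_[p] → L) : Prop :=
  ∀ ε > 0, ∃ Q : Polynomial (OL L), ∀ x, ‖h x - ((Q.eval (pI L x) : OL L) : L)‖ ≤ ε

lemma LA0.of_poly (Q : Polynomial (OL L)) : LA0 (fun x : ℤ_[p] => ((Q.eval (pI L x) : OL L) : L)) :=
  fun ε hε => ⟨Q, fun x => by simpa using hε.le⟩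

lemma LA0.const {c : L} (hc : ‖c‖ ≤ 1) : LA0 (fun _ : ℤ_[p] => c) := by
  simpa using LA0.of_poly (p := p) (Polynomial.C (⟨c, hc⟩ : OL L))

lemma LA0.p_mul : LA0 (fun x : ℤ_[p] => (p : L) * iotaL p L x) := by
  simpa [coe_pI] using LA0.of_poly (p := p) (Polynomial.X : Polynomial (OL L))

lemma LA0.limit {h : ℤ_[p] → L} (H : ∀ ε > 0, ∃ g, LA0 g ∧ ∀ x, ‖h x - g x‖ ≤ ε) : LA0 h := by
  intro ε hε
  obtain ⟨g, hg, hgh⟩ := H ε hε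
  obtain ⟨Q, hQ⟩ := hg ε hε
  refine ⟨Q, fun x => ?_⟩
  have := norm_add_le_of (hgh x) (hQ x)
  simpa using this

lemma LA0.norm_le {h : ℤ_[p] → L} (H : LA0 h) (x : ℤ_[p]) : ‖h x‖ ≤ 1 := by
  obtain ⟨Q, hQ⟩ := H 1 one_pos
  have := norm_add_le_of (hQ x) (OL.norm_le (Q.eval (pI L x)))
  simpa using this

lemma LA0.add {g h : ℤ_[p] → L} (hg : LA0 g) (hh : LA0 h) : LA0 (fun x => g x + h x) := by
  intro ε hε
  obtain ⟨P, hP⟩ := hg ε hε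
  obtain ⟨Q, hQ⟩ := hh ε hε
  refine ⟨P + Q, fun x => ?_⟩
  have := norm_add_le_of (hP x) (hQ x)
  simpa [add_sub_add_comm] using this

lemma LA0.mul {g h : ℤ_[p] → L} (hg : LA0 g) (hh : LA0 h) : LA0 (fun x => g x * h x) := by
  intro ε hε
  obtain ⟨P, hP⟩ := hg ε hε
  obtain ⟨Q, hQ⟩ := hh ε hε
  refine ⟨P * Q, fun x => ?_⟩
  have e : g x * h x - (((P * Q).eval (pI L x) : OL L) : L) =
      (g x - ((P.eval (pI L x) : OL L) : L)) * h x + ((P.eval (pI L x) : OL L) : L) * (h x - ((Q.eval (pI L x) : OL L) : L)) := by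
    simp; ring
  rw [e]
  refine norm_add_le_of ?_ ?_ <;> rw [norm_mul]
  · calc _ ≤ ε * 1 := by gcongr; exacts [hP x, hh.norm_le x]
      _ = ε := mul_one _
  · calc _ ≤ 1 * ε := by gcongr; exacts [OL.norm_le _, hQ x]
      _ = ε := one_mul _

lemma LA0.neg {h : ℤ_[p] → L} (hh : LA0 h) : LA0 (fun x => -h x) := by
  have := (LA0.const (p := p) (c := (-1 : L)) (by simp)).mul hh
  simpa using this

lemma LA0.sub {g h : ℤ_[p] → L} (hg : LA0 g) (hh : LA0 h) : LA0 (fun x => g x - h x) := by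
  simpa [sub_eq_add_neg] using hg.add hh.neg

lemma LA0.pow {h : ℤ_[p] → L} (hh : LA0 h) (n : ℕ) : LA0 (fun x => h x ^ n) := by
  induction n with
  | zero => simpa using LA0.const (p := p) (c := (1 : L)) (by simp)
  | succ n ih => simpa [pow_succ] using ih.mul hh

lemma LA0.sum {ι : Type*} {s : Finset ι} {f : ι → ℤ_[p] → L} (h : ∀ i ∈ s, LA0 (f i)) :
    LA0 (fun x => ∑ i ∈ s, f i x) := by
  induction s using Finset.induction_on with
  | empty => simpa using LA0.const (p := p) (c := (0 : L)) (by simp)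
  | insert a s ha ih =>
    simp only [Finset.sum_insert ha]
    exact (h a (by simp)).add (ih fun i hi => h i (by simp [hi]))

lemma LA0.prod {ι : Type*} {s : Finset ι} {f : ι → ℤ_[p] → L} (h : ∀ i ∈ s, LA0 (f i)) :
    LA0 (fun x => ∏ i ∈ s, f i x) := by
  induction s using Finset.induction_on with
  | empty => simpa using LA0.const (p := p) (c := (1 : L)) (by simp)
  | insert a s ha ih =>
    simp only [Finset.prod_insert ha]
    exact (h a (by simp)).mul (ih fun i hi => h i (by simp [hi]))

lemma LA0.comp {h : ℤ_[p] → L} (hh : LA0 h) {σ : ℤ_[p] → ℤ_[p]}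
    (hσ : LA0 (fun x => (p : L) * iotaL p L (σ x))) : LA0 (fun x => h (σ x)) := by
  refine LA0.limit fun ε hε => ?_
  obtain ⟨Q, hQ⟩ := hh ε hε
  refine ⟨fun x => ((Q.eval (pI L (σ x)) : OL L) : L), ?_, fun x => hQ _⟩
  have e : ∀ x, ((Q.eval (pI L (σ x)) : OL L) : L) =
      ∑ i ∈ Q.support, (Q.coeff i : L) * ((p : L) * iotaL p L (σ x)) ^ i := fun x => by
    rw [Polynomial.eval_eq_sum, Polynomial.sum]
    push_cast
    simp only [coe_pI]
  simp only [e]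
  exact LA0.sum fun i _ => (LA0.const (OL.norm_le _)).mul (hσ.pow i)

lemma LA0.inv_one_add {h : ℤ_[p] → L} (hh : LA0 h) (hn : ∀ x, ‖h x‖ ≤ (p : ℝ)⁻¹) :
    LA0 (fun x => (1 + h x)⁻¹) := by
  refine LA0.limit fun ε hε => ?_
  obtain ⟨n, hn'⟩ := exists_pow_lt_of_lt_one hε (inv_p_lt_one p)
  refine ⟨fun x => ∑ i ∈ Finset.range n, (-h x) ^ i, LA0.sum fun i _ => hh.neg.pow i, fun x => ?_⟩
  have h1 : ‖h x‖ < 1 := (hn x).trans_lt (inv_p_lt_one p)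
  have hu : ‖1 + h x‖ = 1 := by
    rw [IsUltrametricDist.norm_add_eq_max_of_norm_ne_norm (by simpa using h1.ne')]
    simpa using h1.le
  have hne : 1 + h x ≠ 0 := by rw [← norm_ne_zero_iff, hu]; norm_num
  have e : (1 + h x)⁻¹ - ∑ i ∈ Finset.range n, (-h x) ^ i = (1 + h x)⁻¹ * (-h x) ^ n := by
    have := mul_neg_geom_sum (-h x) n
    rw [sub_neg_eq_add] at this
    field_simp
    rw [this]; ring
  rw [e, norm_mul, norm_inv, hu, norm_pow, norm_neg]
  calc _ ≤ 1⁻¹ * ((p : ℝ)⁻¹) ^ n := by gcongr; exact hn x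
    _ ≤ ε := by rw [inv_one, one_mul]; exact hn'.le

/-- Functions that are integral limits of polynomials in `p x` in the coordinate `x` of every
coset `y + p^n x`. -/
def LA (n : ℕ) (h : ℤ_[p] → L) : Prop := ∀ y : ℤ_[p], LA0 (fun x => h (y + (p : ℤ_[p]) ^ n * x))

lemma LA.norm_le {n : ℕ} {h : ℤ_[p] → L} (H : LA n h) (x : ℤ_[p]) : ‖h x‖ ≤ 1 := by
  simpa using (H x).norm_le 0

lemma LA.add {n : ℕ} {g h : ℤ_[p] → L} (hg : LA n g) (hh : LA n h) : LA n (g + h) :=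
  fun y => (hg y).add (hh y)

lemma LA.sub {n : ℕ} {g h : ℤ_[p] → L} (hg : LA n g) (hh : LA n h) : LA n (g - h) :=
  fun y => (hg y).sub (hh y)

lemma LA.smul {n : ℕ} {h : ℤ_[p] → L} (hh : LA n h) {c : L} (hc : ‖c‖ ≤ 1) : LA n (c • h) :=
  fun y => (LA0.const hc).mul (hh y)

lemma LA.tau {n : ℕ} {h : ℤ_[p] → L} (hh : LA n h) (b : ℤ_[p]) : LA n (tau p L b h) := fun y => by
  have := hh (y + b)
  simpa [add_right_comm] using this

lemma LA.tau_sub_one {n : ℕ} {h : ℤ_[p] → L} (hh : LA n h) :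
    LA n ((p : L)⁻¹ • (Paper.tau p L ((p : ℤ_[p]) ^ n) h - h)) := fun y => by
  have hpL := natCast_prime_ne_zero p L
  refine LA0.limit fun ε hε => ?_
  obtain ⟨Q, hQ⟩ := hh y (‖(p : L)‖ * ε) (mul_pos (norm_pos_iff.2 hpL) hε)
  obtain ⟨R, hR⟩ := Polynomial.sub_dvd_eval_sub (Polynomial.X + Polynomial.C (pI L (1 : ℤ_[p])))
    (Polynomial.X : Polynomial (OL L)) (Q.map Polynomial.C)
  refine ⟨_, LA0.of_poly R, fun x => ?_⟩
  have h1 := congrArg (Polynomial.eval (pI L x)) hR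
  have e1 : ∀ S : Polynomial (OL L), Polynomial.eval (pI L x) (Polynomial.eval S (Q.map Polynomial.C)) =
      Q.eval (S.eval (pI L x)) := fun S => by
    rw [Polynomial.eval_map, ← Polynomial.comp, Polynomial.eval_comp]
  rw [Polynomial.eval_sub, e1, e1, Polynomial.eval_mul] at h1
  simp only [add_sub_cancel_left, Polynomial.eval_add, Polynomial.eval_X, Polynomial.eval_C] at h1
  have e2 : pI L x + pI L (1 : ℤ_[p]) = pI L (x + 1) := by
    ext; simp [coe_pI]; ring
  rw [e2] at h1
  have h2 := congrArg (fun t : OL L => (t : L)) h1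
  simp only [AddSubgroupClass.coe_sub, Subring.coe_mul, coe_pI, PadicInt.coe_one, iotaL_one, mul_one] at h2
  simp only [Pi.smul_apply, Pi.sub_apply, tau_apply, smul_eq_mul]
  have e3 : (p : L)⁻¹ * (h (y + (p : ℤ_[p]) ^ n * x + (p : ℤ_[p]) ^ n) - h (y + (p : ℤ_[p]) ^ n * x)) -
      ((R.eval (pI L x) : OL L) : L) = (p : L)⁻¹ * ((h (y + (p : ℤ_[p]) ^ n * (x + 1)) - ((Q.eval (pI L (x + 1)) : OL L) : L)) -
        (h (y + (p : ℤ_[p]) ^ n * x) - ((Q.eval (pI L x) : OL L) : L))) := by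
    have e4 : y + (p : ℤ_[p]) ^ n * x + (p : ℤ_[p]) ^ n = y + (p : ℤ_[p]) ^ n * (x + 1) := by ring
    rw [e4, eq_inv_mul_iff_mul_eq₀ hpL, mul_sub, ← h2, mul_inv_cancel_left₀ hpL]; ring
  rw [e3, norm_mul, norm_inv]
  calc _ ≤ ‖(p : L)‖⁻¹ * (‖(p : L)‖ * ε) := by
        gcongr
        exact norm_sub_le_of (hQ _) (hQ _)
    _ = ε := by field_simp

lemma LA.aeval_tau {n : ℕ} {h : ℤ_[p] → L} (hh : LA n h) (Q : Polynomial ℤ) :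
    LA n (Polynomial.aeval (Paper.tau p L 1) Q h) := by
  induction Q using Polynomial.induction_on' with
  | add P Q hP hQ => rw [map_add, LinearMap.add_apply]; exact hP.add hQ
  | monomial k c =>
    rw [Polynomial.aeval_monomial, tau_pow, Module.End.mul_apply]
    have : (algebraMap ℤ (Module.End L (ℤ_[p] → L)) c) (Paper.tau p L ((k : ℤ_[p]) * 1) h) =
        (c : L) • Paper.tau p L ((k : ℤ_[p]) * 1) h := by
      ext x
      simp [Module.End.intCast_apply]
    rw [this]
    refine (hh.tau _).smul ?_
    have := Padic.norm_int_le_one (p := p) c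
    rwa [← norm_iotaL (L := L), iotaL, map_intCast] at this

lemma LA.del_pow {n : ℕ} {h : ℤ_[p] → L} (hh : LA n h) :
    ∃ h', LA n h' ∧ (del p L ^ p ^ n) h = (p : L) • h' := by
  obtain ⟨R, hR⟩ := exists_add_pow_prime_pow_eq hp.out (Polynomial.X - 1 : Polynomial ℤ) 1 n
  have h1 := congrArg (Polynomial.aeval (Paper.tau p L 1)) hR
  rw [sub_add_cancel, one_pow] at h1
  simp only [map_add, map_mul, map_pow, map_sub, map_one, Polynomial.aeval_X, mul_one, map_natCast] at h1
  rw [tau_pow] at h1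
  refine ⟨(p : L)⁻¹ • (Paper.tau p L ((p : ℤ_[p]) ^ n) h - h) -
    del p L (Polynomial.aeval (Paper.tau p L 1) R h), hh.tau_sub_one.sub ?_, ?_⟩
  · exact ((hh.aeval_tau R).tau 1).sub (hh.aeval_tau R)
  · have h2 := congrArg (fun T : Module.End L (ℤ_[p] → L) => T h) h1
    simp only [LinearMap.add_apply, Module.End.mul_apply, Module.End.one_apply, mul_one] at h2
    rw [smul_sub, smul_inv_smul₀ (natCast_prime_ne_zero p L)]
    rw [Nat.cast_pow] at h2
    rw [h2]
    have e : ∀ g : ℤ_[p] → L, ((p : Module.End L (ℤ_[p] → L))) g = (p : L) • g := fun g => by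
      ext x; simp [Module.End.natCast_apply]
    rw [e, del]
    abel

lemma LA.del_pow_mul {n : ℕ} {h : ℤ_[p] → L} (hh : LA n h) (q : ℕ) :
    ∃ h', LA n h' ∧ (del p L ^ (p ^ n * q)) h = (p : L) ^ q • h' := by
  induction q with
  | zero => exact ⟨h, hh, by simp⟩
  | succ q ih =>
    obtain ⟨h', h1, h2⟩ := ih
    obtain ⟨h'', h3, h4⟩ := h1.del_pow
    refine ⟨h'', h3, ?_⟩
    rw [mul_add, mul_one, add_comm, pow_add, Module.End.mul_apply, h2, map_smul, h4, smul_smul, pow_succ]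

lemma LA.norm_mc {n : ℕ} {h : ℤ_[p] → L} (hh : LA n h) (N : ℕ) :
    ‖mc p L N h‖ ≤ ((p : ℝ)⁻¹) ^ (N / p ^ n) := by
  obtain ⟨h', h1, h2⟩ := hh.del_pow_mul (N / p ^ n)
  have : mc p L N h = (p : L) ^ (N / p ^ n) * mc p L (N % p ^ n) h' := by
    rw [mc_apply, mc_apply]
    conv_lhs => rw [← Nat.mod_add_div N (p ^ n), pow_add, Module.End.mul_apply, h2, map_smul]
    rfl
  rw [this, norm_mul, norm_pow, norm_natCast_prime p L]
  calc _ ≤ ((p : ℝ)⁻¹) ^ (N / p ^ n) * 1 := by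
        gcongr; exact norm_mc_le _ zero_le_one fun x => h1.norm_le x
    _ = _ := mul_one _

end

section

variable {p : ℕ} [hp : Fact p.Prime]
variable {L : Type} [NontriviallyNormedField L] [NormedAlgebra ℚ_[p] L] [IsUltrametricDist L]

lemma LA0.norm_sub_le {h : ℤ_[p] → L} (H : LA0 h) (x y : ℤ_[p]) : ‖h x - h y‖ ≤ ‖x - y‖ := by
  refine le_of_forall_pos_le_add fun ε hε => ?_
  obtain ⟨Q, hQ⟩ := H ε hε
  obtain ⟨c, hc⟩ := Polynomial.sub_dvd_eval_sub (pI L x) (pI L y) Q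
  have h2 := congrArg (fun t : OL L => (t : L)) hc
  simp only [AddSubgroupClass.coe_sub, Subring.coe_mul, coe_pI] at h2
  have e : h x - h y = ((h x - ((Q.eval (pI L x) : OL L) : L)) - (h y - ((Q.eval (pI L y) : OL L) : L))) +
      ((p : L) * iotaL p L (x - y)) * (c : L) := by
    have : (p : L) * iotaL p L ((x : ℚ_[p]) - (y : ℚ_[p])) * (c : L) =
        (p * iotaL p L x - p * iotaL p L y) * (c : L) := by rw [iotaL_sub]; ring
    rw [this, ← h2]; ring
  rw [e]
  refine norm_add_le_of ((norm_sub_le_of (hQ x) (hQ y)).trans (by simp)) ?_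
  have h3 : ‖(p : L) * iotaL p L ((x : ℚ_[p]) - (y : ℚ_[p])) * (c : L)‖ ≤ 1 * ‖x - y‖ * 1 := by
    rw [norm_mul, norm_mul]
    gcongr
    · exact norm_natCast_le_one p L p
    · rw [norm_iotaL, ← PadicInt.coe_sub]; exact le_of_eq rfl
    · exact OL.norm_le c
  linarith

lemma mem_coset_of_norm_le {n : ℕ} {z y : ℤ_[p]} (h : ‖z - y‖ ≤ ((p : ℝ)⁻¹) ^ n) :
    ∃ x, z = y + (p : ℤ_[p]) ^ n * x := by
  rw [inv_pow, ← zpow_natCast, ← zpow_neg, PadicInt.norm_le_pow_iff_mem_span_pow,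
    Ideal.mem_span_singleton] at h
  obtain ⟨x, hx⟩ := h
  exact ⟨x, by rw [← hx]; ring⟩

lemma LA.norm_sub_le {n : ℕ} {h : ℤ_[p] → L} (H : LA n h) (x y : ℤ_[p]) :
    ‖h x - h y‖ ≤ (p : ℝ) ^ n * ‖x - y‖ := by
  have hp0 := p_pos p
  by_cases hxy : ‖x - y‖ ≤ ((p : ℝ)⁻¹) ^ n
  · obtain ⟨w, rfl⟩ := mem_coset_of_norm_le hxy
    have := (H y).norm_sub_le w 0
    simp only [mul_zero, add_zero, sub_zero] at this
    rw [add_sub_cancel_left, norm_mul, norm_pow, PadicInt.norm_p, ← mul_assoc, ← mul_pow,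
      mul_inv_cancel₀ hp0.ne', one_pow, one_mul]
    exact this
  · push Not at hxy
    calc _ ≤ 1 := norm_sub_le_of (H.norm_le x) (H.norm_le y)
      _ = (p : ℝ) ^ n * ((p : ℝ)⁻¹) ^ n := by rw [← mul_pow, mul_inv_cancel₀ hp0.ne', one_pow]
      _ ≤ _ := by gcongr

lemma LA.continuous {n : ℕ} {h : ℤ_[p] → L} (H : LA n h) : Continuous h :=
  (LipschitzWith.of_dist_le_mul (K := (p : NNReal) ^ n) fun x y => by
    rw [dist_eq_norm, dist_eq_norm]; simpa using H.norm_sub_le x y).continuous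

lemma exists_wt_mul_inv_pow_le (p : ℕ) [Fact p.Prime] (r : ℝ) :
    ∃ K : ℝ, 1 ≤ K ∧ ∀ q : ℕ, wt r q * ((p : ℝ)⁻¹) ^ q ≤ K := by
  obtain ⟨k, hk⟩ := exists_nat_ge r
  have h1 := tendsto_pow_const_mul_const_pow_of_abs_lt_one k (r := (p : ℝ)⁻¹)
    (by rw [abs_of_nonneg (by positivity)]; exact inv_p_lt_one p)
  have h2 := h1.comp (tendsto_add_atTop_nat 1)
  obtain ⟨K, hK⟩ := h2.bddAbove_range
  refine ⟨max 1 (p * K), le_max_left _ _, fun q => le_max_of_le_right ?_⟩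
  have h3 := hK ⟨q, rfl⟩
  simp only [Function.comp] at h3
  have hp0 := p_pos p
  calc wt r q * ((p : ℝ)⁻¹) ^ q ≤ ((q : ℝ) + 1) ^ k * ((p : ℝ)⁻¹) ^ q := by
        gcongr
        rw [wt, ← Real.rpow_natCast]
        exact Real.rpow_le_rpow_of_exponent_le (by simp) hk
    _ = p * (((q + 1 : ℕ) : ℝ) ^ k * ((p : ℝ)⁻¹) ^ (q + 1)) := by
        rw [pow_succ]; push_cast; field_simp
    _ ≤ p * K := by gcongr

/-- An upper bound for `(q+1)^r p^{-q}`. -/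
def KL (p : ℕ) [Fact p.Prime] (r : ℝ) : ℝ := (exists_wt_mul_inv_pow_le p r).choose

lemma one_le_KL (r : ℝ) : 1 ≤ KL p r := (exists_wt_mul_inv_pow_le p r).choose_spec.1

lemma wt_mul_inv_pow_le (r : ℝ) (q : ℕ) : wt r q * ((p : ℝ)⁻¹) ^ q ≤ KL p r :=
  (exists_wt_mul_inv_pow_le p r).choose_spec.2 q

lemma LA.wt_mul_norm_mc {n : ℕ} {h : ℤ_[p] → L} (H : LA n h) {r : ℝ} (hr : 0 ≤ r) (N : ℕ) :
    wt r N * ‖mc p L N h‖ ≤ KL p r * ((p : ℝ) ^ r) ^ n := by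
  have hp0 := p_pos p
  have h1 : wt r N ≤ ((p : ℝ) ^ r) ^ n * wt r (N / p ^ n) := by
    rw [← Real.rpow_natCast ((p : ℝ) ^ r), ← Real.rpow_mul hp0.le, mul_comm r, Real.rpow_mul hp0.le,
      Real.rpow_natCast, wt, wt, ← Real.mul_rpow (by positivity) (by positivity)]
    refine Real.rpow_le_rpow (by positivity) ?_ hr
    have := Nat.lt_mul_div_succ N (pow_pos hp.out.pos n)
    exact_mod_cast this
  calc _ ≤ (((p : ℝ) ^ r) ^ n * wt r (N / p ^ n)) * ((p : ℝ)⁻¹) ^ (N / p ^ n) := by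
        gcongr
        · exact (mul_pos (by positivity) (wt_pos _ _)).le
        · exact H.norm_mc N
    _ = ((p : ℝ) ^ r) ^ n * (wt r (N / p ^ n) * ((p : ℝ)⁻¹) ^ (N / p ^ n)) := by ring
    _ ≤ ((p : ℝ) ^ r) ^ n * KL p r := by gcongr; exact wt_mul_inv_pow_le r _
    _ = _ := mul_comm _ _

lemma LA.crB {n : ℕ} {h : ℤ_[p] → L} (H : LA n h) {r : ℝ} (hr : 0 ≤ r) :
    CrB r (KL p r * ((p : ℝ) ^ r) ^ n) h := by
  refine ⟨⟨H.continuous, ?_⟩, H.wt_mul_norm_mc hr⟩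
  have h1 : Tendsto (fun N : ℕ => KL p (r + 1) * ((p : ℝ) ^ (r + 1)) ^ n * ((N : ℝ) + 1)⁻¹) atTop (𝓝 0) := by
    have := (tendsto_one_div_add_atTop_nhds_zero_nat (𝕜 := ℝ)).const_mul
      (KL p (r + 1) * ((p : ℝ) ^ (r + 1)) ^ n)
    simpa using this
  refine squeeze_zero (fun N => mul_nonneg (wt_pos _ _).le (norm_nonneg _)) (fun N => ?_) h1
  rw [← div_eq_mul_inv, le_div_iff₀ (by positivity)]
  have := H.wt_mul_norm_mc (r := r + 1) (by linarith) N
  rw [wt, Real.rpow_add (by positivity), Real.rpow_one] at this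
  rw [wt]; linarith

lemma bin_succ_mul (j : ℕ) (w : ℤ_[p]) :
    bin p L (j + 1) w * ((j : L) + 1) = bin p L j w * (iotaL p L w - j) := by
  have hj : ((j : ℚ_[p]) + 1) ≠ 0 := by exact_mod_cast Nat.succ_ne_zero j
  have hf : ((j.factorial : ℕ) : ℚ_[p]) ≠ 0 := by exact_mod_cast j.factorial_ne_zero
  have : binomQ p w (j + 1) * ((j : ℚ_[p]) + 1) = binomQ p w j * ((w : ℚ_[p]) - j) := by
    rw [binomQ, binomQ, Finset.prod_range_succ, Nat.factorial_succ]
    push_cast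
    field_simp
  have := congrArg (iotaL p L) this
  simpa [bin] using this

lemma natCast_succ_ne_zero' (p : ℕ) [Fact p.Prime] (L : Type) [NontriviallyNormedField L]
    [NormedAlgebra ℚ_[p] L] (j : ℕ) : ((j : L) + 1) ≠ 0 := by
  have : iotaL p L ((j : ℚ_[p]) + 1) ≠ 0 := by
    rw [Ne, iotaL_eq_zero]; exact_mod_cast Nat.succ_ne_zero j
  simpa using this

lemma bin_succ_eq_prod (j : ℕ) (w : ℤ_[p]) : bin p L (j + 1) w =
    iotaL p L w / ((j : L) + 1) * ∏ i ∈ Finset.range j, (iotaL p L w / ((i : L) + 1) - 1) := by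
  induction j with
  | zero => simp [bin_one_right]
  | succ j ih =>
    have h1 := natCast_succ_ne_zero' p L j
    have h2 := natCast_succ_ne_zero' p L (j + 1)
    have := bin_succ_mul (L := L) (j + 1) w
    rw [ih] at this
    rw [Finset.prod_range_succ, ← mul_left_inj' h2, this]
    push_cast at h2 ⊢
    field_simp

lemma norm_natCast_succ_ge {n i : ℕ} (h : i + 1 < p ^ n) : ((p : ℝ)⁻¹) ^ n ≤ ‖((i : L) + 1)‖ * (p : ℝ)⁻¹ := by
  have hp0 := p_pos p
  have e : ‖((i : L) + 1)‖ = ‖((i + 1 : ℕ) : ℚ_[p])‖ := by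
    rw [← norm_iotaL (L := L)]; simp
  rw [e, Padic.norm_eq_zpow_neg_valuation (by exact_mod_cast Nat.succ_ne_zero i), Padic.valuation_natCast]
  have h1 : padicValNat p (i + 1) < n := by
    have := padicValNat_le_nat_log (p := p) (i + 1)
    exact this.trans_lt (Nat.log_lt_of_lt_pow (Nat.succ_ne_zero i) h)
  rw [zpow_neg, zpow_natCast, ← inv_pow, ← pow_succ]
  exact pow_le_pow_of_le_one (by positivity) (inv_p_lt_one p).le (by omega)

lemma LA0.div_natCast {n i : ℕ} (h : i + 1 < p ^ n) :
    LA0 (fun x : ℤ_[p] => iotaL p L (((p : ℤ_[p]) ^ n * x : ℤ_[p]) : ℚ_[p]) / ((i : L) + 1)) := by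
  have hpL := natCast_prime_ne_zero p L
  have hi := natCast_succ_ne_zero' p L i
  have hc : ‖(p : L) ^ n / (p : L) / ((i : L) + 1)‖ ≤ 1 := by
    rw [norm_div, norm_div, norm_pow, norm_natCast_prime p L, div_le_one (norm_pos_iff.2 hi),
      div_le_iff₀ (by have := p_pos p; positivity)]
    exact norm_natCast_succ_ge h
  have := (LA0.const (p := p) hc).mul (LA0.p_mul (p := p) (L := L))
  refine (congrArg LA0 (funext fun x => ?_)).mp this
  simp
  field_simp

lemma LA_bin {n N : ℕ} (h : N < p ^ n) : LA n (bin p L N) := fun y => by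
  simp only [bin_add]
  refine LA0.sum fun ij hij => (LA0.const (norm_bin_le _ _)).mul ?_
  have h2 : ij.2 ≤ N := by
    have := Finset.HasAntidiagonal.mem_antidiagonal.1 hij; omega
  obtain ⟨i, j⟩ := ij
  cases j with
  | zero => simpa [bin_zero_right] using LA0.const (p := p) (c := (1 : L)) (by simp)
  | succ j =>
    simp only at h2
    simp only [bin_succ_eq_prod]
    refine (LA0.div_natCast (by omega)).mul (LA0.prod fun i hi => ?_)
    have := Finset.mem_range.1 hi
    exact (LA0.div_natCast (by omega)).sub (LA0.const (by simp))

lemma pow_log_le_wt {r : ℝ} (hr : 0 ≤ r) (N : ℕ) : ((p : ℝ) ^ r) ^ (Nat.log p N) ≤ wt r N := by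
  have hp0 := p_pos p
  rw [← Real.rpow_natCast ((p : ℝ) ^ r), ← Real.rpow_mul hp0.le, mul_comm r, Real.rpow_mul hp0.le,
      Real.rpow_natCast, wt]
  refine Real.rpow_le_rpow (by positivity) ?_ hr
  rcases eq_or_ne N 0 with rfl | hN
  · simp
  · have := Nat.pow_log_le_self p hN
    have : ((p ^ Nat.log p N : ℕ) : ℝ) ≤ N := by exact_mod_cast this
    push_cast at this; linarith

variable (p) in
/-- The norm constant of weighted composition operators on functions of class `C^r`. -/
def KO (r : ℝ) : ℝ := KL p r * (p : ℝ) ^ r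

lemma one_le_KO {r : ℝ} (hr : 0 ≤ r) : 1 ≤ KO p r :=
  one_le_mul_of_one_le_of_one_le (one_le_KL r) (Real.one_le_rpow (one_lt_p p).le hr)

variable [CompleteSpace L]

lemma CrB.comp_of_LA {r C : ℝ} (hr : 0 ≤ r) {f : ℤ_[p] → L} (hf : CrB r C f) (e : ℕ)
    {c : ℤ_[p] → L} {σ : ℤ_[p] → ℤ_[p]}
    (h : ∀ n g, LA n g → LA (n + e) (fun x => c x * g (σ x))) :
    CrB r (KO p r * ((p : ℝ) ^ r) ^ e * C) (fun x => c x * f (σ x)) := by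
  have hp0 := p_pos p
  have hK : 0 ≤ KO p r := zero_le_one.trans (one_le_KO hr)
  refine hf.weightedComp hr (by positivity) fun N => ?_
  have h1 := (h _ _ (LA_bin (L := L) (Nat.lt_pow_succ_log_self hp.out.one_lt N))).crB hr
  refine h1.mono ?_
  calc _ = KO p r * ((p : ℝ) ^ r) ^ e * ((p : ℝ) ^ r) ^ (Nat.log p N) := by
        rw [KO, pow_add, pow_succ]; ring
    _ ≤ _ := by gcongr; exact pow_log_le_wt hr N

end

section

variable {p : ℕ} [hp : Fact p.Prime]
variable {L : Type} [NontriviallyNormedField L] [NormedAlgebra ℚ_[p] L] [IsUltrametricDist L]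

lemma norm_p_mul_le (z : ℤ_[p]) : ‖(p : ℤ_[p]) * z‖ ≤ (p : ℝ)⁻¹ := by
  have := p_pos p
  rw [norm_mul, PadicInt.norm_p]
  exact mul_le_of_le_one_right (by positivity) (PadicInt.norm_le_one z)

lemma norm_one_add_p_mul (z : ℤ_[p]) : ‖1 + (p : ℤ_[p]) * z‖ = 1 := by
  have h1 : ‖(p : ℤ_[p]) * z‖ < 1 := (norm_p_mul_le z).trans_lt (inv_p_lt_one p)
  rw [IsUltrametricDist.norm_add_eq_max_of_norm_ne_norm (by simpa using h1.ne')]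
  simpa using h1.le

/-- The inverse of the unit `1 + p z`. -/
def uinv (z : ℤ_[p]) : ℤ_[p] := (1 + (p : ℤ_[p]) * z).inv

lemma mul_uinv (z : ℤ_[p]) : (1 + (p : ℤ_[p]) * z) * uinv z = 1 :=
  PadicInt.mul_inv (norm_one_add_p_mul z)

lemma iotaL_uinv (z : ℤ_[p]) : iotaL p L (uinv z : ℚ_[p]) = (1 + (p : L) * iotaL p L z)⁻¹ := by
  have h := congrArg (fun t : ℤ_[p] => iotaL p L (t : ℚ_[p])) (mul_uinv z)
  simp only [PadicInt.coe_mul, PadicInt.coe_add, PadicInt.coe_one, iotaL_mul, iotaL_add, iotaL_one,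
    PadicInt.coe_natCast, iotaL_natCast] at h
  exact (DivisionMonoid.inv_eq_of_mul _ _ h).symm

lemma LA0.iotaL_p_mul_comp {a : ℤ_[p]} : LA0 (fun x : ℤ_[p] => (p : L) * iotaL p L ((a * x : ℤ_[p]) : ℚ_[p])) := by
  have := (LA0.const (p := p) (norm_iotaL_le_one (L := L) a)).mul (LA0.p_mul (p := p) (L := L))
  refine (congrArg LA0 (funext fun x => ?_)).mp this
  simp; ring

/-- Fractional linear substitutions preserve `LA n`. -/
lemma LA.moebius {n : ℕ} {g : ℤ_[p] → L} (hg : LA n g) (d : ℕ) {A B D : ℤ_[p]} {σ : ℤ_[p] → ℤ_[p]}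
    (hσ : ∀ x, σ x * (1 + (p : ℤ_[p]) * D * x) = A + B * x) :
    LA n (fun x => iotaL p L ((1 + (p : ℤ_[p]) * D * x : ℤ_[p]) : ℚ_[p]) ^ d * g (σ x)) := by
  intro y
  set v : ℤ_[p] := (B - A * ((p : ℤ_[p]) * D)) * uinv (D * y) with hv
  have hτ : ∀ x, σ (y + (p : ℤ_[p]) ^ n * x) = σ y + (p : ℤ_[p]) ^ n * (v * x * uinv (D * (y + (p : ℤ_[p]) ^ n * x))) := by
    intro x
    have h1 := mul_uinv (D * (y + (p : ℤ_[p]) ^ n * x))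
    have h2 := mul_uinv (D * y)
    have h3 := hσ (y + (p : ℤ_[p]) ^ n * x)
    have h4 := hσ y
    have e1 : σ (y + (p : ℤ_[p]) ^ n * x) = (A + B * (y + (p : ℤ_[p]) ^ n * x)) * uinv (D * (y + (p : ℤ_[p]) ^ n * x)) := by
      rw [← h3]; linear_combination (-σ (y + (p : ℤ_[p]) ^ n * x)) * h1
    have e2 : σ y = (A + B * y) * uinv (D * y) := by
      rw [← h4]; linear_combination (-σ y) * h2
    rw [e1, e2, hv]
    linear_combination (-(A + B * (y + (p : ℤ_[p]) ^ n * x)) * uinv (D * (y + (p : ℤ_[p]) ^ n * x))) * h2 +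
      ((A + B * y) * uinv (D * y)) * h1
  simp only [hτ]
  have hlin : LA0 (fun x : ℤ_[p] => (p : L) * iotaL p L ((D * (y + (p : ℤ_[p]) ^ n * x) : ℤ_[p]) : ℚ_[p])) := by
    have := (LA0.const (p := p) (norm_iotaL_le_one (L := L) ((p : ℤ_[p]) * (D * y)))).add
      (LA0.iotaL_p_mul_comp (L := L) (a := D * (p : ℤ_[p]) ^ n))
    refine (congrArg LA0 (funext fun x => ?_)).mp this
    simp; ring
  refine LA0.mul ?_ ((hg (σ y)).comp ?_)
  · refine LA0.pow ?_ d
    refine (congrArg LA0 (funext fun x => ?_)).mp ((LA0.const (p := p) (c := (1 : L)) (by simp)).add hlin)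
    simp; ring
  · have h5 := hlin.inv_one_add fun x => by
      rw [← iotaL_natCast (p := p), ← iotaL_mul, norm_iotaL]
      exact_mod_cast norm_p_mul_le (D * (y + (p : ℤ_[p]) ^ n * x))
    refine (congrArg LA0 (funext fun x => ?_)).mp ((LA0.iotaL_p_mul_comp (L := L) (a := v)).mul h5)
    rw [PadicInt.coe_mul (v * x), iotaL_mul, iotaL_uinv, mul_assoc]

lemma LA.affine {n : ℕ} {g : ℤ_[p] → L} (hg : LA n g) (A B : ℤ_[p]) :
    LA n (fun x => g (A + B * x)) := by
  have := hg.moebius 0 (A := A) (B := B) (D := 0) (σ := fun x => A + B * x) (by simp)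
  simpa using this

lemma LA.dilate {n i : ℕ} (hi : i ≤ n) {g : ℤ_[p] → L} (hg : LA n g) (b : ℤ_[p]) :
    LA (n - i) (fun x => g (b + (p : ℤ_[p]) ^ i * x)) := fun y => by
  refine (congrArg LA0 (funext fun x => congrArg g ?_)).mp (hg (b + (p : ℤ_[p]) ^ i * y))
  have : (p : ℤ_[p]) ^ n = (p : ℤ_[p]) ^ i * (p : ℤ_[p]) ^ (n - i) := by rw [← pow_add]; congr 1; omega
  rw [this]; ring

variable (L) in
/-- The function supported on `b + p^n ℤ_p` given there by `b + p^n x ↦ f x`. -/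
def PL (b : ℤ_[p]) (n : ℕ) (f : ℤ_[p] → L) : ℤ_[p] → L := fun z =>
  if h : ∃ w, z = b + (p : ℤ_[p]) ^ n * w then f h.choose else 0

lemma p_pow_ne_zero (n : ℕ) : (p : ℤ_[p]) ^ n ≠ 0 := pow_ne_zero _ (by exact_mod_cast hp.out.ne_zero)

lemma coset_inj {b : ℤ_[p]} {n : ℕ} {w w' : ℤ_[p]} (h : b + (p : ℤ_[p]) ^ n * w = b + (p : ℤ_[p]) ^ n * w') : w = w' :=
  mul_left_cancel₀ (p_pow_ne_zero n) (add_left_cancel h)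

lemma PL_apply (b : ℤ_[p]) (n : ℕ) (f : ℤ_[p] → L) (w : ℤ_[p]) : PL L b n f (b + (p : ℤ_[p]) ^ n * w) = f w := by
  have h : ∃ w', b + (p : ℤ_[p]) ^ n * w = b + (p : ℤ_[p]) ^ n * w' := ⟨w, rfl⟩
  rw [PL, dif_pos h, ← coset_inj h.choose_spec]

lemma PL_of_not {b : ℤ_[p]} {n : ℕ} (f : ℤ_[p] → L) {z : ℤ_[p]} (h : ¬ ∃ w, z = b + (p : ℤ_[p]) ^ n * w) :
    PL L b n f z = 0 := by rw [PL, dif_neg h]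

lemma PL_eq_mul (b : ℤ_[p]) (n : ℕ) : ∃ (c : ℤ_[p] → L) (σ : ℤ_[p] → ℤ_[p]),
    ∀ f : ℤ_[p] → L, PL L b n f = fun x => c x * f (σ x) := by
  refine ⟨fun z => if ∃ w, z = b + (p : ℤ_[p]) ^ n * w then 1 else 0,
    fun z => if h : ∃ w, z = b + (p : ℤ_[p]) ^ n * w then h.choose else 0, fun f => ?_⟩
  ext z
  by_cases h : ∃ w, z = b + (p : ℤ_[p]) ^ n * w
  · simp only [PL, dif_pos h, if_pos h, one_mul]
  · simp only [PL, dif_neg h, if_neg h, zero_mul]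

lemma LA.PL {n' : ℕ} {g : ℤ_[p] → L} (hg : LA n' g) (b : ℤ_[p]) (n : ℕ) : LA (n' + n) (Paper.PL L b n g) := by
  intro y
  by_cases h : ∃ w, y = b + (p : ℤ_[p]) ^ n * w
  · obtain ⟨w, rfl⟩ := h
    refine (congrArg LA0 (funext fun x => ?_)).mp (hg w)
    rw [← PL_apply b n g]; congr 1; ring
  · refine (congrArg LA0 (funext fun x => ?_)).mp (LA0.const (p := p) (c := (0 : L)) (by simp))
    rw [PL_of_not]
    rintro ⟨w, hw⟩
    exact h ⟨w - (p : ℤ_[p]) ^ n' * x, by rw [mul_sub, ← add_sub_assoc, ← hw]; ring⟩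

variable [CompleteSpace L]

lemma CrB.PL {r C : ℝ} (hr : 0 ≤ r) {f : ℤ_[p] → L} (hf : CrB r C f) (b : ℤ_[p]) (n : ℕ) :
    CrB r (KO p r * ((p : ℝ) ^ r) ^ n * C) (Paper.PL L b n f) := by
  obtain ⟨c, σ, h⟩ := PL_eq_mul (L := L) b n
  rw [h]
  refine hf.comp_of_LA hr n fun n' g hg => ?_
  rw [← h]; exact hg.PL b n

lemma CrB.moebius {r C : ℝ} (hr : 0 ≤ r) {f : ℤ_[p] → L} (hf : CrB r C f) (d : ℕ) {A B D : ℤ_[p]}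
    {σ : ℤ_[p] → ℤ_[p]} (hσ : ∀ x, σ x * (1 + (p : ℤ_[p]) * D * x) = A + B * x) :
    CrB r (KO p r * C) (fun x => iotaL p L ((1 + (p : ℤ_[p]) * D * x : ℤ_[p]) : ℚ_[p]) ^ d * f (σ x)) := by
  simpa using hf.comp_of_LA hr 0 fun n g hg => hg.moebius d hσ

lemma CrB.affine {r C : ℝ} (hr : 0 ≤ r) {f : ℤ_[p] → L} (hf : CrB r C f) (A B : ℤ_[p]) :
    CrB r (KO p r * C) (fun x => f (A + B * x)) := by
  simpa using hf.comp_of_LA hr 0 (c := fun _ => 1) (σ := fun x => A + B * x)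
    fun n g hg => by simpa using hg.affine A B

end

section polynomials

variable {p : ℕ} [hp : Fact p.Prime]
variable {L : Type} [NontriviallyNormedField L] [NormedAlgebra ℚ_[p] L] [IsUltrametricDist L]

lemma LA_pow (y : ℤ_[p]) (m : ℕ) : LA 1 (fun x : ℤ_[p] => iotaL p L ((x : ℚ_[p]) - y) ^ m) := fun z => by
  refine LA0.pow ?_ m
  refine (congrArg LA0 (funext fun x => ?_)).mp
    ((LA0.const (p := p) (norm_iotaL_le_one (L := L) (z - y))).add (LA0.p_mul (p := p) (L := L)))
  simp; ring

/-- Polynomials whose `m`-th coefficient is bounded by `t^m`. -/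
def PB (t : ℝ) (Q : Polynomial L) : Prop := ∀ m, ‖Q.coeff m‖ ≤ t ^ m

lemma PB.mul {t : ℝ} (ht : 0 ≤ t) {P Q : Polynomial L} (hP : PB t P) (hQ : PB t Q) : PB t (P * Q) := fun m => by
  rw [Polynomial.coeff_mul]
  refine norm_sum_le_of (by positivity) fun ij hij => ?_
  rw [← Finset.HasAntidiagonal.mem_antidiagonal.1 hij, norm_mul, pow_add]
  exact mul_le_mul (hP _) (hQ _) (norm_nonneg _) (by positivity)

lemma PB.one {t : ℝ} (ht : 0 ≤ t) : PB t (1 : Polynomial L) := fun m => by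
  rw [Polynomial.coeff_one]; split_ifs with h
  · simp [h]
  · simpa using pow_nonneg ht m

lemma PB.prod {t : ℝ} (ht : 0 ≤ t) {ι : Type*} {s : Finset ι} {f : ι → Polynomial L}
    (h : ∀ i ∈ s, PB t (f i)) : PB t (∏ i ∈ s, f i) := by
  induction s using Finset.induction_on with
  | empty => simpa using PB.one ht
  | insert a s ha ih =>
    rw [Finset.prod_insert ha]
    exact (h a (by simp)).mul ht (ih fun i hi => h i (by simp [hi]))

lemma PB.linear {t : ℝ} (ht : 0 ≤ t) {a b : L} (ha : ‖a‖ ≤ t) (hb : ‖b‖ ≤ 1) :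
    PB t (Polynomial.C a * Polynomial.X + Polynomial.C b) := fun m => by
  rcases m with _ | _ | m
  · simpa using hb
  · simpa [Polynomial.coeff_C] using ha
  · simpa [Polynomial.coeff_X, Polynomial.coeff_C] using pow_nonneg ht _

variable (L) in
/-- The binomial polynomial. -/
def binPoly (N : ℕ) : Polynomial L := match N with
  | 0 => 1
  | j + 1 => (Polynomial.C ((j : L) + 1)⁻¹ * Polynomial.X + Polynomial.C 0) *
      ∏ i ∈ Finset.range j, (Polynomial.C ((i : L) + 1)⁻¹ * Polynomial.X + Polynomial.C (-1))

lemma eval_binPoly (N : ℕ) (x : ℤ_[p]) : (binPoly L N).eval (iotaL p L x) = bin p L N x := by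
  cases N with
  | zero => simp [binPoly, bin_zero_right]
  | succ j =>
    rw [bin_succ_eq_prod, binPoly, Polynomial.eval_mul, Polynomial.eval_prod]
    simp [div_eq_inv_mul, sub_eq_add_neg]

lemma PB_binPoly {N n : ℕ} (h : N < p ^ (n + 1)) : PB ((p : ℝ) ^ n) (binPoly L N) := by
  have hp0 := p_pos p
  have key : ∀ i, i + 1 ≤ N → ‖((i : L) + 1)⁻¹‖ ≤ (p : ℝ) ^ n := fun i hi => by
    have h1 := norm_natCast_succ_ge (L := L) (p := p) (n := n + 1) (i := i) (by omega)
    rw [pow_succ] at h1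
    have h2 := le_of_mul_le_mul_right h1 (by positivity)
    rw [norm_inv]
    refine inv_le_of_inv_le₀ (by positivity) ?_
    rwa [← inv_pow]
  cases N with
  | zero => exact PB.one (by positivity)
  | succ j =>
    refine (PB.linear (by positivity) (key j le_rfl) (by simp)).mul (by positivity)
      (PB.prod (by positivity) fun i hi => PB.linear (by positivity) (key i ?_) (by simp))
    have := Finset.mem_range.1 hi; omega

end polynomials

section

variable {p : ℕ} [hp : Fact p.Prime]
variable {L : Type} [NontriviallyNormedField L] [NormedAlgebra ℚ_[p] L] [IsUltrametricDist L]
  [CompleteSpace L]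

variable (p L) in
/-- The monomial `x^m` on `ℤ_p`. -/
def mon (m : ℕ) : ℤ_[p] → L := fun x => iotaL p L x ^ m

lemma LA_mon (m : ℕ) : LA 1 (mon p L m) := by
  have := LA_pow (p := p) (L := L) 0 m
  simp only [PadicInt.coe_zero, sub_zero] at this
  exact this

lemma crB_mon {r : ℝ} (hr : 0 ≤ r) (m : ℕ) : CrB r (KO p r) (mon p L m) := by
  simpa [KO] using (LA_mon m).crB hr

lemma mon_dilate (m i : ℕ) (c : L) : (fun x : ℤ_[p] => (c • mon p L m) ((p : ℤ_[p]) ^ i * x)) =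
    (c * (p : L) ^ (i * m)) • mon p L m := by
  ext x; simp [mon, mul_pow, pow_mul]; ring

variable (p L) in
/-- The binomial function minus its Taylor polynomial of degree `< J`. -/
def binTail (J N : ℕ) : ℤ_[p] → L :=
  bin p L N - ∑ m ∈ Finset.range J, (binPoly L N).coeff m • mon p L m

lemma binTail_eq (J N : ℕ) : ∃ M, J ≤ M ∧
    binTail p L J N = ∑ m ∈ Finset.Ico J M, (binPoly L N).coeff m • mon p L m := by
  refine ⟨max J ((binPoly L N).natDegree + 1), le_max_left _ _, ?_⟩
  rw [binTail, sub_eq_iff_eq_add', Finset.sum_range_add_sum_Ico _ (le_max_left _ _)]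
  ext x
  rw [← eval_binPoly, Polynomial.eval_eq_sum_range' (n := max J ((binPoly L N).natDegree + 1))
    (lt_of_lt_of_le (Nat.lt_succ_self _) (le_max_right _ _))]
  simp [mon, Finset.sum_apply]

lemma pow_le_rpow_cases {t r : ℝ} (ht : 0 < t) (m : ℕ) (h : (1 ≤ t ∧ (m : ℝ) ≤ r) ∨ (t ≤ 1 ∧ r ≤ m)) :
    t ^ m ≤ t ^ r := by
  rw [← Real.rpow_natCast]
  rcases h with ⟨h1, h2⟩ | ⟨h1, h2⟩
  · exact Real.rpow_le_rpow_of_exponent_le h1 h2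
  · exact Real.rpow_le_rpow_of_exponent_ge ht h1 h2

lemma pow_div_rpow (r : ℝ) (n i : ℕ) :
    ((p : ℝ) ^ n / (p : ℝ) ^ i) ^ r = ((p : ℝ) ^ r) ^ n / ((p : ℝ) ^ r) ^ i := by
  have hp0 := p_pos p
  have e : ∀ n : ℕ, ((p : ℝ) ^ n) ^ r = ((p : ℝ) ^ r) ^ n := fun n => by
    rw [← Real.rpow_natCast, ← Real.rpow_natCast, ← Real.rpow_mul hp0.le, ← Real.rpow_mul hp0.le, mul_comm]
  rw [Real.div_rpow (by positivity) (by positivity), e, e]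

lemma norm_coeff_mul_le {N n : ℕ} (h : N < p ^ (n + 1)) (i m : ℕ) :
    ‖(binPoly L N).coeff m * (p : L) ^ (i * m)‖ ≤ ((p : ℝ) ^ n / (p : ℝ) ^ i) ^ m := by
  rw [norm_mul, norm_pow, norm_natCast_prime p L, div_pow, pow_mul, div_eq_mul_inv, ← inv_pow, ← inv_pow]
  gcongr
  exact PB_binPoly h m

lemma crB_binTerm {r : ℝ} (hr : 0 ≤ r) {N n : ℕ} (h : N < p ^ (n + 1)) (i m : ℕ) :
    CrB r (KO p r * ((p : ℝ) ^ n / (p : ℝ) ^ i) ^ m)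
      (fun x : ℤ_[p] => ((binPoly L N).coeff m • mon p L m) ((p : ℤ_[p]) ^ i * x)) := by
  rw [mon_dilate, mul_comm]
  refine ((crB_mon hr m).smul _).mono ?_
  have := zero_le_one.trans (one_le_KO (p := p) hr)
  gcongr
  exact norm_coeff_mul_le h i m

lemma crB_binTail_of_le {r t : ℝ} (hr : 0 ≤ r) {N n J i : ℕ} (h : N < p ^ (n + 1))
    (ht : 0 ≤ t) (H : ∀ m, J ≤ m → ((p : ℝ) ^ n / (p : ℝ) ^ i) ^ m ≤ t) :
    CrB r (KO p r * t) (fun x : ℤ_[p] => binTail p L J N ((p : ℤ_[p]) ^ i * x)) := by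
  have := zero_le_one.trans (one_le_KO (p := p) hr)
  obtain ⟨M, -, hM⟩ := binTail_eq (p := p) (L := L) J N
  have e : (fun x : ℤ_[p] => binTail p L J N ((p : ℤ_[p]) ^ i * x)) = ∑ m ∈ Finset.Ico J M,
      (fun x : ℤ_[p] => ((binPoly L N).coeff m • mon p L m) ((p : ℤ_[p]) ^ i * x)) := by
    ext x; rw [hM, Finset.sum_apply, Finset.sum_apply]
  rw [e]
  refine CrB.sum (by positivity) fun m hm => (crB_binTerm hr h i m).mono ?_
  gcongr
  exact H m (Finset.mem_Ico.1 hm).1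

/-- Binomials without their low-degree part are flat at the origin. -/
lemma crB_binTail {r : ℝ} (hr : 0 ≤ r) {N n J : ℕ} (h : N < p ^ (n + 1))
    (hJ1 : ∀ m < J, (m : ℝ) ≤ r) (hJ2 : r ≤ J) (i : ℕ) :
    CrB r (KO p r * (((p : ℝ) ^ r) ^ n / ((p : ℝ) ^ r) ^ i))
      (fun x : ℤ_[p] => binTail p L J N ((p : ℤ_[p]) ^ i * x)) := by
  have hp0 := p_pos p
  have hA : 0 < (p : ℝ) ^ r := Real.rpow_pos_of_pos hp0 r
  have hK := zero_le_one.trans (one_le_KO (p := p) hr)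
  have hp1 := one_lt_p p
  rcases le_total n i with hi | hi
  · refine crB_binTail_of_le hr h (by positivity) fun m hm => ?_
    rw [← pow_div_rpow]
    refine pow_le_rpow_cases (by positivity) m (Or.inr ⟨?_, hJ2.trans (by exact_mod_cast hm)⟩)
    rw [div_le_one (by positivity)]
    exact pow_le_pow_right₀ hp1.le hi
  · have e : (fun x : ℤ_[p] => binTail p L J N ((p : ℤ_[p]) ^ i * x)) =
        (fun x => bin p L N ((p : ℤ_[p]) ^ i * x)) - ∑ m ∈ Finset.range J,
          (fun x : ℤ_[p] => ((binPoly L N).coeff m • mon p L m) ((p : ℤ_[p]) ^ i * x)) := by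
      ext x; simp [binTail, Finset.sum_apply]
    rw [e]
    refine CrB.sub ?_ (CrB.sum (by positivity) fun m hm => (crB_binTerm hr h i m).mono ?_)
    · have h1 := ((LA_bin (L := L) h).dilate (by omega : i ≤ n + 1) 0).crB hr
      simp only [zero_add] at h1
      refine h1.mono (le_of_eq ?_)
      have : n + 1 - i = (n - i) + 1 := by omega
      rw [this, pow_succ, KO, pow_sub₀ _ hA.ne' hi]; field_simp
    · gcongr
      rw [← pow_div_rpow]
      refine pow_le_rpow_cases (by positivity) m (Or.inl ⟨?_, hJ1 m (Finset.mem_range.1 hm)⟩)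
      rw [one_le_div (by positivity)]
      exact pow_le_pow_right₀ hp1.le hi

lemma exists_pow_mul_le {C x ε : ℝ} (hC : 0 ≤ C) (hx0 : 0 ≤ x) (hx1 : x < 1) (hε : 0 < ε) (n : ℕ) :
    ∃ I, n ≤ I ∧ C * x ^ I ≤ ε := by
  have h := (tendsto_pow_atTop_nhds_zero_of_lt_one hx0 hx1).const_mul C
  rw [mul_zero] at h
  obtain ⟨I, h1, h2⟩ := ((h.eventually (ge_mem_nhds hε)).and (eventually_ge_atTop n)).exists
  exact ⟨I, h2, h1⟩

lemma exists_crB_binTail_le {r : ℝ} (hr : 0 ≤ r) (N : ℕ) {J : ℕ} (hJ : r < J) {ε : ℝ} (hε : 0 < ε) :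
    ∃ I, CrB r (ε / ((p : ℝ) ^ r) ^ I)
      (fun x : ℤ_[p] => binTail p L J N ((p : ℤ_[p]) ^ I * x)) := by
  have hp0 := p_pos p
  have hp1 := one_lt_p p
  have hA : 0 < (p : ℝ) ^ r := Real.rpow_pos_of_pos hp0 r
  have hK := zero_le_one.trans (one_le_KO (p := p) hr)
  set n := Nat.log p N
  have h : N < p ^ (n + 1) := Nat.lt_pow_succ_log_self hp.out.one_lt N
  have hx : (p : ℝ) ^ r / (p : ℝ) ^ J < 1 := by
    rw [div_lt_one (by positivity), ← Real.rpow_natCast]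
    exact Real.rpow_lt_rpow_of_exponent_lt hp1 hJ
  obtain ⟨I, hI, hI2⟩ := exists_pow_mul_le (C := KO p r * ((p : ℝ) ^ n) ^ J) (by positivity)
    (by positivity) hx hε n
  refine ⟨I, (crB_binTail_of_le (t := ((p : ℝ) ^ n / (p : ℝ) ^ I) ^ J) hr h (by positivity)
    fun m hm => ?_).mono ?_⟩
  · refine pow_le_pow_of_le_one (by positivity) ?_ hm
    rw [div_le_one (by positivity)]
    exact pow_le_pow_right₀ hp1.le hI
  · rw [le_div_iff₀ (by positivity)]
    refine le_trans (le_of_eq ?_) hI2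
    rw [div_pow, div_pow, ← pow_mul, ← pow_mul, ← pow_mul, mul_comm I J]; ring

variable (p) in
/-- The function `x ↦ lam^{val x} x^e`, extended by `0` at the origin. -/
def eta (lam : L) (e : ℕ) : ℤ_[p] → L := fun x =>
  if x = 0 then 0 else lam ^ (x : ℚ_[p]).valuation * iotaL p L x ^ e

/-- `x^e` restricted to units. -/
lemma LA_unitMon (e : ℕ) : LA 1 (fun x : ℤ_[p] => if ‖x‖ = 1 then iotaL p L x ^ e else 0) := fun y => by
  have hn : ∀ x : ℤ_[p], ‖y + (p : ℤ_[p]) ^ 1 * x‖ = 1 ↔ ‖y‖ = 1 := fun x => by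
    have h1 : ‖(p : ℤ_[p]) ^ 1 * x‖ < 1 := by rw [pow_one]; exact (norm_p_mul_le x).trans_lt (inv_p_lt_one p)
    constructor
    · intro h
      have e : y = (y + (p : ℤ_[p]) ^ 1 * x) + -((p : ℤ_[p]) ^ 1 * x) := by ring
      rw [e, IsUltrametricDist.norm_add_eq_max_of_norm_ne_norm (by rw [h, norm_neg]; exact h1.ne'), h,
        norm_neg]
      exact max_eq_left h1.le
    · intro h
      rw [IsUltrametricDist.norm_add_eq_max_of_norm_ne_norm (by rw [h]; exact h1.ne'), h]
      exact max_eq_left h1.le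
  simp only [hn]
  by_cases h : ‖y‖ = 1
  · simp only [h, if_true]; exact LA_mon e y
  · simp only [h, if_false]; exact LA0.const (by simp)

lemma crB_eta {r : ℝ} (hr : 0 ≤ r) {lam : L} {e : ℕ} (hl : ‖lam‖ * ((p : ℝ)⁻¹) ^ e * (p : ℝ) ^ r < 1) :
    CrB r (KO p r * KO p r) (eta p lam e) := by
  have hp0 := p_pos p
  have hA : 0 < (p : ℝ) ^ r := Real.rpow_pos_of_pos hp0 r
  have hK := zero_le_one.trans (one_le_KO (p := p) hr)
  set t := ‖lam‖ * ((p : ℝ)⁻¹) ^ e * (p : ℝ) ^ r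
  have ht : 0 ≤ t := by positivity
  set u : ℤ_[p] → L := fun x => if ‖x‖ = 1 then iotaL p L x ^ e else 0
  have hu : CrB r (KO p r) u := by simpa [KO] using (LA_unitMon (p := p) (L := L) e).crB hr
  have key := CrB.of_hasSum (C := KO p r * KO p r) hr (by positivity)
    (F := fun i => Paper.PL L 0 i ((lam ^ i * (p : L) ^ (i * e)) • u))
    (K := fun i => KO p r * KO p r * t ^ i) (f := eta p lam e)
  refine key (fun i => ?_) ?_ (fun i => ?_) fun x => ?_
  · refine ((hu.smul _).PL hr 0 i).mono (le_of_eq ?_)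
    rw [norm_mul, norm_pow, norm_pow, norm_natCast_prime p L, mul_comm i e, pow_mul]
    simp only [t, mul_pow]; ring
  · have := (tendsto_pow_atTop_nhds_zero_of_lt_one ht hl).const_mul (KO p r * KO p r)
    simpa using this
  · exact mul_le_of_le_one_right (by positivity) (pow_le_one₀ ht hl.le)
  · by_cases hx : x = 0
    · subst hx
      have : (fun i => Paper.PL L (0 : ℤ_[p]) i ((lam ^ i * (p : L) ^ (i * e)) • u) 0) = fun _ => 0 := by
        ext i
        have := PL_apply (L := L) (0 : ℤ_[p]) i ((lam ^ i * (p : L) ^ (i * e)) • u) 0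
        rw [mul_zero, add_zero] at this
        rw [this]; simp [u]
      rw [this]; simp [eta]
    · have hx' := PadicInt.unitCoeff_spec hx
      set w := PadicInt.unitCoeff hx
      set v := x.valuation
      have hxi : ∀ i, i ≠ v → Paper.PL L (0 : ℤ_[p]) i ((lam ^ i * (p : L) ^ (i * e)) • u) x = 0 := by
        intro i hi
        by_cases h : ∃ y, x = 0 + (p : ℤ_[p]) ^ i * y
        · obtain ⟨y, hy⟩ := h
          have hy1 : ‖y‖ ≠ 1 := fun h1 => hi <| by
            have h2 : ‖x‖ = ((p : ℝ)⁻¹) ^ i := by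
              rw [hy, zero_add, norm_mul, norm_pow, PadicInt.norm_p, h1, mul_one]
            have h3 : ‖x‖ = ((p : ℝ)⁻¹) ^ v := by
              rw [PadicInt.norm_eq_zpow_neg_valuation hx, zpow_neg, zpow_natCast, inv_pow]
            rw [h2] at h3
            exact pow_right_injective₀ (by positivity) (inv_p_lt_one p).ne h3
          rw [hy, PL_apply]; simp [u, hy1]
        · exact PL_of_not _ h
      have hxv : Paper.PL L (0 : ℤ_[p]) v ((lam ^ v * (p : L) ^ (v * e)) • u) x = eta p lam e x := by
        have e1 : x = 0 + (p : ℤ_[p]) ^ v * (w : ℤ_[p]) := by rw [hx']; ring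
        rw [eta, if_neg hx]
        conv_lhs => rw [e1, PL_apply]
        have hw : ‖(w : ℤ_[p])‖ = 1 := PadicInt.norm_units w
        simp only [u, Pi.smul_apply, hw, if_true, smul_eq_mul]
        have e2 : (x : ℚ_[p]).valuation = (v : ℤ) := by simp [v]
        rw [e2, zpow_natCast]
        conv_rhs => rw [e1]
        simp [mul_pow, pow_mul]; ring
      rw [← hxv]
      exact hasSum_single v fun i hi => hxi i hi

end

section

variable (p : ℕ) [hp : Fact p.Prime]
variable (L : Type) [NontriviallyNormedField L] [NormedAlgebra ℚ_[p] L] 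

/-- The numerical data attached to `(k, α, β)`: the exponent `d = k - 2`, the orders `r = val α` and
`r' = val β`, the scalar `lam = αp/β` and the scalar `chi = p^{k-1}/β` by which the diagonal matrix
`(p, 1)` acts. -/
structure Par where
  d : ℕ
  r : ℝ
  r' : ℝ
  lam : L
  chi : L
  hr : 0 < r
  hr' : 0 < r'
  hrr' : r' ≤ r
  hsum : r + r' = d + 1
  norm_chi : ‖chi‖ = ((p : ℝ) ^ r)⁻¹
  norm_lam : ‖lam‖ * ((p : ℝ)⁻¹) ^ d = (((p : ℝ) ^ r)⁻¹) ^ 2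
  lam_ne : lam ≠ p

end

section

variable {p : ℕ} [hp : Fact p.Prime]
variable {L : Type} [NontriviallyNormedField L] [NormedAlgebra ℚ_[p] L] [IsUltrametricDist L]
  [CompleteSpace L]

lemma norm_le_of_mem_coset {b : ℚ_[p]} {n : ℤ} (x : ℤ_[p]) :
    ‖(b + (p : ℚ_[p]) ^ n * x) - b‖ ≤ (p : ℝ) ^ (-n) := by
  rw [add_sub_cancel_left, norm_mul, Padic.norm_p_zpow]
  exact mul_le_of_le_one_right (zpow_nonneg (p_pos p).le _) (PadicInt.norm_le_one x)

lemma pQ_ne_zero : (p : ℚ_[p]) ≠ 0 := by exact_mod_cast hp.out.ne_zero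

lemma exists_coset {b z : ℚ_[p]} {n : ℤ} (h : ‖z - b‖ ≤ (p : ℝ) ^ (-n)) :
    ∃ x : ℤ_[p], z = b + (p : ℚ_[p]) ^ n * x := by
  have hn : (p : ℚ_[p]) ^ n ≠ 0 := zpow_ne_zero _ pQ_ne_zero
  have h0 : (0 : ℝ) < (p : ℝ) ^ (-n) := zpow_pos (p_pos p) _
  refine ⟨⟨(z - b) / (p : ℚ_[p]) ^ n, ?_⟩, ?_⟩
  · rw [norm_div, Padic.norm_p_zpow, div_le_one h0]; exact h
  · show z = b + (p : ℚ_[p]) ^ n * ((z - b) / (p : ℚ_[p]) ^ n)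
    field_simp; ring

/-- Extension by zero of a function on `ℤ_p`. -/
def blk (h : ℤ_[p] → L) : ℚ_[p] → L := fun z => if hz : ‖z‖ ≤ 1 then h ⟨z, hz⟩ else 0

lemma blk_coe (h : ℤ_[p] → L) (x : ℤ_[p]) : blk h (x : ℚ_[p]) = h x := by
  exact dif_pos x.2

lemma blk_of_not (h : ℤ_[p] → L) {z : ℚ_[p]} (hz : ¬ ‖z‖ ≤ 1) : blk h z = 0 := by
  rw [blk, dif_neg hz]

lemma blk_add (g h : ℤ_[p] → L) : blk (g + h) = blk g + blk h := by
  ext z; by_cases hz : ‖z‖ ≤ 1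
  · simp only [blk, hz, dite_true, Pi.add_apply]; rfl
  · simp [blk, hz]

lemma blk_smul (c : L) (h : ℤ_[p] → L) : blk (c • h) = c • blk h := by
  ext z; by_cases hz : ‖z‖ ≤ 1
  · simp only [blk, hz, dite_true, Pi.smul_apply]; rfl
  · simp [blk, hz]

namespace Par

variable (D : Par p L)

/-- The number `p^r`. -/
def A : ℝ := (p : ℝ) ^ D.r

lemma A_pos : 0 < D.A := Real.rpow_pos_of_pos (p_pos p) _

lemma one_le_A : 1 ≤ D.A := Real.one_le_rpow (one_lt_p p).le D.hr.le

/-- The norm constant of weighted composition operators. -/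
def K : ℝ := KO p D.r

lemma one_le_K : 1 ≤ D.K := one_le_KO D.hr.le

lemma K_pos : 0 < D.K := zero_lt_one.trans_le D.one_le_K

lemma norm_chi' : ‖D.chi‖ = D.A⁻¹ := D.norm_chi

lemma norm_lam' : ‖D.lam‖ * ((p : ℝ)⁻¹) ^ D.d = (D.A⁻¹) ^ 2 := D.norm_lam

lemma chi_ne : D.chi ≠ 0 := by
  rw [← norm_ne_zero_iff, D.norm_chi']; exact (inv_pos.2 D.A_pos).ne'

lemma lam_ne_zero : D.lam ≠ 0 := by
  intro h
  have := D.norm_lam'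
  rw [h, norm_zero, zero_mul] at this
  exact (pow_pos (inv_pos.2 D.A_pos) 2).ne this

/-- Membership in the Banach space with both norms bounded by `C`. -/
def BB (C : ℝ) (f : ℚ_[p] → L) : Prop :=
  CrB D.r C (fun z : ℤ_[p] => f ((p : ℚ_[p]) * z)) ∧
  ∃ g : ℤ_[p] → L, CrB D.r C g ∧ ∀ z : ℤ_[p], z ≠ 0 →
    g z = D.lam ^ ((z : ℚ_[p]).valuation) * iotaL p L z ^ D.d * f ((z : ℚ_[p])⁻¹)

variable {D}

lemma BB.nonneg {C : ℝ} {f : ℚ_[p] → L} (h : D.BB C f) : 0 ≤ C := h.1.nonneg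

lemma BB.mono {C C' : ℝ} {f : ℚ_[p] → L} (h : D.BB C f) (hC : C ≤ C') : D.BB C' f := by
  obtain ⟨h1, g, h2, h3⟩ := h
  exact ⟨h1.mono hC, g, h2.mono hC, h3⟩

lemma BB.add {C : ℝ} {f f' : ℚ_[p] → L} (h : D.BB C f) (h' : D.BB C f') : D.BB C (f + f') := by
  obtain ⟨h1, g, h2, h3⟩ := h
  obtain ⟨h1', g', h2', h3'⟩ := h'
  refine ⟨h1.add h1', g + g', h2.add h2', fun z hz => ?_⟩
  simp only [Pi.add_apply, h3 z hz, h3' z hz]; ring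

lemma BB.smul {C : ℝ} {f : ℚ_[p] → L} (c : L) (h : D.BB C f) : D.BB (‖c‖ * C) (c • f) := by
  obtain ⟨h1, g, h2, h3⟩ := h
  refine ⟨h1.smul c, c • g, h2.smul c, fun z hz => ?_⟩
  simp only [Pi.smul_apply, h3 z hz, smul_eq_mul]; ring

lemma BB.zero {C : ℝ} (hC : 0 ≤ C) : D.BB C 0 :=
  ⟨CrB.zero hC, 0, CrB.zero hC, fun z _ => by simp⟩

lemma BB.sum {C : ℝ} (hC : 0 ≤ C) {ι : Type*} {s : Finset ι} {f : ι → ℚ_[p] → L}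
    (h : ∀ i ∈ s, D.BB C (f i)) : D.BB C (∑ i ∈ s, f i) := by
  induction s using Finset.induction_on with
  | empty => simpa using BB.zero hC
  | insert a s ha ih =>
    rw [Finset.sum_insert ha]
    exact (h a (by simp)).add (ih fun i hi => h i (by simp [hi]))

variable (D)

/-- The action of the affine matrix `(p^n b; 0 1)`. -/
def T (n : ℤ) (b : ℚ_[p]) : (ℚ_[p] → L) →ₗ[L] (ℚ_[p] → L) :=
  D.chi ^ n • LinearMap.funLeft L L (fun z => (z - b) / (p : ℚ_[p]) ^ n)

lemma T_apply (n : ℤ) (b : ℚ_[p]) (f : ℚ_[p] → L) (z : ℚ_[p]) :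
    D.T n b f z = D.chi ^ n * f ((z - b) / (p : ℚ_[p]) ^ n) := rfl

lemma T_T (n m : ℤ) (b c : ℚ_[p]) (f : ℚ_[p] → L) :
    D.T n b (D.T m c f) = D.T (n + m) (b + (p : ℚ_[p]) ^ n * c) f := by
  have hp0 := pQ_ne_zero (p := p)
  ext z
  simp only [T_apply]
  rw [zpow_add₀ D.chi_ne, zpow_add₀ hp0, mul_assoc]
  congr 3
  field_simp
  ring

lemma T_zero (f : ℚ_[p] → L) : D.T 0 0 f = f := by
  ext z; simp [T_apply]

lemma T_blk_coset (n : ℤ) (b : ℚ_[p]) (h : ℤ_[p] → L) (x : ℤ_[p]) :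
    D.T n b (blk h) (b + (p : ℚ_[p]) ^ n * x) = D.chi ^ n * h x := by
  have hn : (p : ℚ_[p]) ^ n ≠ 0 := zpow_ne_zero _ pQ_ne_zero
  rw [T_apply, add_sub_cancel_left, mul_div_cancel_left₀ _ hn, blk_coe]

lemma T_blk_of_not (n : ℤ) (b : ℚ_[p]) (h : ℤ_[p] → L) {z : ℚ_[p]} (hz : ¬ ‖z - b‖ ≤ (p : ℝ) ^ (-n)) :
    D.T n b (blk h) z = 0 := by
  rw [T_apply, blk_of_not, mul_zero]
  rwa [norm_div, Padic.norm_p_zpow, div_le_one (zpow_pos (p_pos p) _)]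

lemma norm_chi_zpow (n : ℤ) : ‖D.chi ^ n‖ = D.A ^ (-n) := by
  rw [norm_zpow, D.norm_chi', inv_zpow, zpow_neg]

/-- Blocks supported in `pℤ_p` are bounded. -/
lemma BB_block_small {C : ℝ} {h : ℤ_[p] → L} (hh : CrB D.r C h) (b : ℤ_[p]) (m : ℕ) :
    D.BB (D.K * C) (D.T (m + 1) ((p : ℚ_[p]) * b) (blk h)) := by
  have hC := hh.nonneg
  have hA := D.A_pos
  have hp0 := p_pos p
  refine ⟨?_, 0, CrB.zero (by have := D.K_pos; positivity), fun z hz => ?_⟩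
  · have e : (fun z : ℤ_[p] => D.T (m + 1) ((p : ℚ_[p]) * b) (blk h) ((p : ℚ_[p]) * z)) =
        D.chi ^ (m + 1) • Paper.PL L b m h := by
      ext z
      have hz : ((p : ℚ_[p]) * z - (p : ℚ_[p]) * b) / (p : ℚ_[p]) ^ ((m : ℤ) + 1) =
          ((z : ℚ_[p]) - b) / (p : ℚ_[p]) ^ m := by
        have := pQ_ne_zero (p := p)
        rw [zpow_add_one₀ this, zpow_natCast]
        field_simp
      have hc : D.chi ^ ((m : ℤ) + 1) = D.chi ^ (m + 1) := by exact_mod_cast rfl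
      rw [T_apply, hz, Pi.smul_apply, smul_eq_mul, hc]
      congr 1
      by_cases hw : ∃ w, z = b + (p : ℤ_[p]) ^ m * w
      · obtain ⟨w, rfl⟩ := hw
        rw [PL_apply, ← blk_coe h w]
        congr 1
        have := pow_ne_zero m (pQ_ne_zero (p := p))
        push_cast
        field_simp
        ring
      · rw [PL_of_not _ hw, blk_of_not]
        intro h1
        obtain ⟨w, hw'⟩ : ∃ w : ℤ_[p], (w : ℚ_[p]) = ((z : ℚ_[p]) - b) / (p : ℚ_[p]) ^ m := ⟨⟨_, h1⟩, rfl⟩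
        refine hw ⟨w, PadicInt.ext ?_⟩
        have := pow_ne_zero m (pQ_ne_zero (p := p))
        push_cast
        rw [hw']
        field_simp
        ring
    rw [e]
    refine ((hh.PL D.hr.le b m).smul _).mono ?_
    rw [norm_pow, D.norm_chi']
    have hK := D.K_pos
    calc _ = D.A⁻¹ * (D.K * C) * ((D.A)⁻¹ * D.A) ^ m := by rw [mul_pow, K, A]; ring
      _ = D.A⁻¹ * (D.K * C) := by rw [inv_mul_cancel₀ hA.ne', one_pow, mul_one]
      _ ≤ 1 * (D.K * C) := by gcongr; exact inv_le_one_of_one_le₀ D.one_le_A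
      _ = _ := one_mul _
  · have hz' : (z : ℚ_[p]) ≠ 0 := by simpa using hz
    rw [T_blk_of_not, mul_zero]; · rfl
    rw [not_le]
    have h1 : ‖(p : ℚ_[p]) * b‖ < 1 := by
      have := (norm_p_mul_le b).trans_lt (inv_p_lt_one p); exact_mod_cast this
    have h2 : 1 ≤ ‖(z : ℚ_[p])⁻¹‖ := by
      rw [norm_inv]; exact (one_le_inv₀ (norm_pos_iff.2 hz')).2 (PadicInt.norm_le_one z)
    have h3 : ‖(z : ℚ_[p])⁻¹ - (p : ℚ_[p]) * b‖ = ‖(z : ℚ_[p])⁻¹‖ := by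
      rw [sub_eq_add_neg, IsUltrametricDist.norm_add_eq_max_of_norm_ne_norm
        (by rw [norm_neg]; exact (h1.trans_le h2).ne'), norm_neg]
      exact max_eq_left (h1.trans_le h2).le
    rw [h3]
    refine lt_of_lt_of_le ?_ h2
    exact zpow_lt_one_of_neg₀ (one_lt_p p) (by omega)

/-- The function with second component `h`, vanishing on `pℤ_p`. -/
def Inf (h : ℤ_[p] → L) : ℚ_[p] → L := fun z =>
  if ‖z‖ < 1 then 0 else D.lam ^ z.valuation * iotaL p L z ^ D.d * blk h z⁻¹

lemma Inf_add (g h : ℤ_[p] → L) : D.Inf (g + h) = D.Inf g + D.Inf h := by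
  ext z; simp only [Inf, blk_add, Pi.add_apply]; split_ifs <;> ring

lemma Inf_smul (c : L) (h : ℤ_[p] → L) : D.Inf (c • h) = c • D.Inf h := by
  ext z; simp only [Inf, blk_smul, Pi.smul_apply, smul_eq_mul]; split_ifs <;> ring

lemma Inf_inv (h : ℤ_[p] → L) {y : ℤ_[p]} (hy : y ≠ 0) : D.Inf h (y : ℚ_[p])⁻¹ =
    D.lam ^ (-(y : ℚ_[p]).valuation) * (iotaL p L y)⁻¹ ^ D.d * h y := by
  have hy' : (y : ℚ_[p]) ≠ 0 := by simpa using hy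
  have h2 : ¬ ‖(y : ℚ_[p])⁻¹‖ < 1 := by
    rw [not_lt, norm_inv]; exact (one_le_inv₀ (norm_pos_iff.2 hy')).2 (PadicInt.norm_le_one y)
  rw [Inf, if_neg h2, inv_inv, blk_coe, Padic.valuation_inv, iotaL_inv]

lemma exists_inv_of_not_lt {z : ℚ_[p]} (hz : ¬ ‖z‖ < 1) : ∃ y : ℤ_[p], y ≠ 0 ∧ z = (y : ℚ_[p])⁻¹ := by
  rw [not_lt] at hz
  have hz0 : z ≠ 0 := by rintro rfl; norm_num at hz
  refine ⟨⟨z⁻¹, by rw [norm_inv]; exact inv_le_one_of_one_le₀ hz⟩, ?_, ?_⟩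
  · intro h; exact inv_ne_zero hz0 (congrArg (fun t : ℤ_[p] => (t : ℚ_[p])) h)
  · exact (inv_inv z).symm

lemma BB_Inf {C : ℝ} {h : ℤ_[p] → L} (hh : CrB D.r C h) : D.BB C (D.Inf h) := by
  refine ⟨?_, h, hh, fun y hy => ?_⟩
  · have : (fun z : ℤ_[p] => D.Inf h ((p : ℚ_[p]) * z)) = 0 := by
      ext z
      have h1 : ‖(p : ℚ_[p]) * z‖ < 1 := by
        have := (norm_p_mul_le z).trans_lt (inv_p_lt_one p); exact_mod_cast this
      rw [Inf, if_pos h1]; rfl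
    rw [this]; exact CrB.zero hh.nonneg
  · have hy' : iotaL p L (y : ℚ_[p]) ≠ 0 := by simpa using hy
    rw [D.Inf_inv h hy, zpow_neg, inv_pow]
    have := zpow_ne_zero (y : ℚ_[p]).valuation D.lam_ne_zero
    field_simp

end Par

end

section

variable {p : ℕ} [hp : Fact p.Prime]
variable {L : Type} [NontriviallyNormedField L] [NormedAlgebra ℚ_[p] L] [IsUltrametricDist L]
  [CompleteSpace L]

lemma valuation_of_norm {z : ℚ_[p]} {n : ℤ} (h : ‖z‖ = (p : ℝ) ^ (-n)) : z.valuation = n := by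
  have hz : z ≠ 0 := by
    rw [← norm_ne_zero_iff, h]; exact (zpow_pos (p_pos p) _).ne'
  rw [Padic.norm_eq_zpow_neg_valuation hz] at h
  have := zpow_right_injective₀ (p_pos p) (one_lt_p p).ne' h
  omega

lemma exists_unit_factor {c : ℤ_[p]} (hc : c ≠ 0) :
    ∃ (j : ℕ) (c0 b0 : ℤ_[p]), c = (p : ℤ_[p]) ^ j * c0 ∧ c0 * b0 = 1 :=
  ⟨c.valuation, PadicInt.unitCoeff hc, ((PadicInt.unitCoeff hc)⁻¹ : (ℤ_[p])ˣ),
    (PadicInt.unitCoeff_spec hc).trans (mul_comm _ _), Units.mul_inv _⟩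

lemma norm_eq_one_of_mul {c0 b0 : ℤ_[p]} (h : c0 * b0 = 1) : ‖c0‖ = 1 :=
  PadicInt.isUnit_iff.1 (IsUnit.of_mul_eq_one _ h)

/-- The weighted composition by an involutive Möbius map fixing `0`. -/
def mobW (d : ℕ) (b : ℤ_[p]) (m : ℕ) (h : ℤ_[p] → L) : ℤ_[p] → L := fun x =>
  iotaL p L ((1 + (p : ℤ_[p]) * (b * (p : ℤ_[p]) ^ m) * x : ℤ_[p]) : ℚ_[p]) ^ d *
    h (-b ^ 2 * x * uinv (b * (p : ℤ_[p]) ^ m * x))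

lemma CrB.mobW {r C : ℝ} (hr : 0 ≤ r) {h : ℤ_[p] → L} (hh : CrB r C h) (d : ℕ) (b : ℤ_[p]) (m : ℕ) :
    CrB r (KO p r * C) (Paper.mobW d b m h) := by
  refine hh.moebius hr d (A := 0) (B := -b ^ 2) (D := b * (p : ℤ_[p]) ^ m)
    (σ := fun x => -b ^ 2 * x * uinv (b * (p : ℤ_[p]) ^ m * x)) fun x => ?_
  have := mul_uinv (b * (p : ℤ_[p]) ^ m * x)
  linear_combination (-b ^ 2 * x) * this

lemma mobW_mobW {b c : ℤ_[p]} (hbc : b * c = 1) (d m : ℕ) (h : ℤ_[p] → L) :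
    mobW d b m (mobW d c m h) = h := by
  ext x
  simp only [mobW]
  set u := uinv (b * (p : ℤ_[p]) ^ m * x) with hu
  have h1 := mul_uinv (b * (p : ℤ_[p]) ^ m * x)
  rw [← hu] at h1
  have h2 := mul_uinv (c * (p : ℤ_[p]) ^ m * (-b ^ 2 * x * u))
  set v := uinv (c * (p : ℤ_[p]) ^ m * (-b ^ 2 * x * u)) with hv
  have h3 : 1 - b * ((p : ℤ_[p]) * (p : ℤ_[p]) ^ m) * x * u = u := by linear_combination -h1
  have h2' : u * v = 1 := by
    linear_combination h2 + (-v) * h3 + (b * ((p : ℤ_[p]) * (p : ℤ_[p]) ^ m) * x * u * v) * hbc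
  have e1 : -c ^ 2 * (-b ^ 2 * x * u) * v = x := by
    linear_combination x * (b * c + 1) * hbc + b ^ 2 * c ^ 2 * x * h2'
  have e2 : (1 + (p : ℤ_[p]) * (b * (p : ℤ_[p]) ^ m) * x) *
      (1 + (p : ℤ_[p]) * (c * (p : ℤ_[p]) ^ m) * (-b ^ 2 * x * u)) = 1 := by
    linear_combination h1 + (1 + b * ((p : ℤ_[p]) * (p : ℤ_[p]) ^ m) * x) * h3 -
      (1 + b * ((p : ℤ_[p]) * (p : ℤ_[p]) ^ m) * x) * (b * ((p : ℤ_[p]) * (p : ℤ_[p]) ^ m) * x * u) * hbc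
  rw [e1, ← mul_assoc, ← mul_pow, ← iotaL_mul, ← PadicInt.coe_mul, e2]
  simp

namespace Par

variable (D : Par p L)

lemma T_blk_eq_Inf {c c0 b0 : ℤ_[p]} {j : ℕ} (hc : c = (p : ℤ_[p]) ^ j * c0) (hb : c0 * b0 = 1) (m : ℕ)
    (h : ℤ_[p] → L) : D.T ((m : ℤ) + 1 - j) (c : ℚ_[p])⁻¹ (blk h) =
      (D.lam ^ j * D.chi ^ ((m : ℤ) + 1 - j) * iotaL p L c ^ D.d) •
        D.Inf (PL L c (m + 1 + j) (mobW D.d b0 m h)) := by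
  have hp0 := pQ_ne_zero (p := p)
  have hpI : (p : ℤ_[p]) ≠ 0 := by exact_mod_cast hp.out.ne_zero
  have hc0 := norm_eq_one_of_mul hb
  have hc00 : c0 ≠ 0 := by rintro rfl; simp at hc0
  have hcne : c ≠ 0 := by rw [hc]; exact mul_ne_zero (pow_ne_zero _ hpI) hc00
  have hcne' : (c : ℚ_[p]) ≠ 0 := by simpa using hcne
  have hcn : ‖(c : ℚ_[p])⁻¹‖ = (p : ℝ) ^ j := by
    rw [norm_inv, hc, PadicInt.coe_mul, norm_mul, PadicInt.norm_def.symm.trans hc0]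
    simp
  have h1p := one_lt_p p
  have hbQ : (c0 : ℚ_[p]) * b0 = 1 := by exact_mod_cast congrArg (fun t : ℤ_[p] => (t : ℚ_[p])) hb
  have hcQ : (c : ℚ_[p]) = (p : ℚ_[p]) ^ j * c0 := by rw [hc]; push_cast; rfl
  have hc0Q : (c0 : ℚ_[p]) ≠ 0 := left_ne_zero_of_mul_eq_one hbQ
  have hN : (p : ℚ_[p]) ^ ((m : ℤ) + 1 - j) = (p : ℚ_[p]) ^ (m + 1) / (p : ℚ_[p]) ^ j := by
    rw [zpow_sub₀ hp0, zpow_natCast]; norm_cast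
  ext z
  rw [Pi.smul_apply, smul_eq_mul]
  by_cases hz : ‖z‖ < 1
  · rw [Inf, if_pos hz, mul_zero, T_blk_of_not]
    have h1 : ‖z - (c : ℚ_[p])⁻¹‖ = ‖(c : ℚ_[p])⁻¹‖ := by
      have hlt : ‖z‖ < ‖(c : ℚ_[p])⁻¹‖ := by
        rw [hcn]; exact hz.trans_le (one_le_pow₀ h1p.le)
      rw [sub_eq_add_neg, IsUltrametricDist.norm_add_eq_max_of_norm_ne_norm
        (by rw [norm_neg]; exact hlt.ne), norm_neg]
      exact max_eq_right hlt.le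
    rw [h1, hcn, not_le, ← zpow_natCast]
    exact zpow_lt_zpow_right₀ h1p (by omega)
  obtain ⟨y, hy, rfl⟩ := exists_inv_of_not_lt hz
  have hy' : (y : ℚ_[p]) ≠ 0 := by simpa using hy
  rw [D.Inf_inv _ hy]
  by_cases hw : ∃ w, y = c + (p : ℤ_[p]) ^ (m + 1 + j) * w
  · obtain ⟨x, rfl⟩ := hw
    set y := c + (p : ℤ_[p]) ^ (m + 1 + j) * x with hyd
    set u := uinv (b0 * (p : ℤ_[p]) ^ m * x) with hu
    have hu1 : (1 + (p : ℚ_[p]) * (b0 * (p : ℚ_[p]) ^ m * x)) * u = 1 := by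
      have := congrArg (fun t : ℤ_[p] => (t : ℚ_[p])) (mul_uinv (b0 * (p : ℤ_[p]) ^ m * x))
      simpa using this
    have hyc : (y : ℚ_[p]) = c * (1 + (p : ℚ_[p]) * (b0 * (p : ℚ_[p]) ^ m * x)) := by
      rw [hyd, hcQ, ]; push_cast
      rw [hcQ]
      linear_combination (-(p : ℚ_[p]) ^ (m + 1 + j) * x) * hbQ
    have hne : (1 + (p : ℚ_[p]) * (b0 * (p : ℚ_[p]) ^ m * x)) ≠ 0 := left_ne_zero_of_mul_eq_one hu1
    have hval : (y : ℚ_[p]).valuation = j := by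
      apply valuation_of_norm
      have h5 : ‖((1 + (p : ℤ_[p]) * (b0 * (p : ℤ_[p]) ^ m * x) : ℤ_[p]))‖ = 1 :=
        norm_eq_one_of_mul (mul_uinv (b0 * (p : ℤ_[p]) ^ m * x))
      have h6 : ‖(1 + (p : ℚ_[p]) * (b0 * (p : ℚ_[p]) ^ m * x))‖ = 1 := by
        rw [PadicInt.norm_def] at h5; push_cast at h5; exact h5
      have h7 : ‖(c : ℚ_[p])‖ = (p : ℝ) ^ (-(j : ℤ)) := by
        rw [norm_inv] at hcn
        rw [zpow_neg, zpow_natCast, ← hcn, inv_inv]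
      rw [hyc, norm_mul, h6, mul_one, h7]
    have hinv : (y : ℚ_[p])⁻¹ = (c : ℚ_[p])⁻¹ + (p : ℚ_[p]) ^ ((m : ℤ) + 1 - j) *
        ((-b0 ^ 2 * x * u : ℤ_[p]) : ℚ_[p]) := by
      have hb0 : (b0 : ℚ_[p]) = (c0 : ℚ_[p])⁻¹ := eq_inv_of_mul_eq_one_right hbQ
      have hu2 : (u : ℚ_[p]) = (1 + (p : ℚ_[p]) * (b0 * (p : ℚ_[p]) ^ m * x))⁻¹ :=
        eq_inv_of_mul_eq_one_right hu1
      rw [hN, hyc]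
      push_cast
      rw [hu2, hcQ]
      rw [hb0] at hne ⊢
      have := pow_ne_zero j hp0
      have hne2 : (c0 : ℚ_[p]) + (p : ℚ_[p]) * ((p : ℚ_[p]) ^ m * x) ≠ 0 := by
        intro h0
        apply hne
        field_simp
        linear_combination h0
      field_simp
      have hne3 : (c0 : ℚ_[p]) + (p : ℚ_[p]) * (p : ℚ_[p]) ^ m * x ≠ 0 := by
        intro h0; apply hne2; rw [← h0]; ring
      field_simp
      ring
    rw [hval, PL_apply, hinv, T_blk_coset, mobW, ← hu]
    have e3 : iotaL p L (y : ℚ_[p]) = iotaL p L c *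
        iotaL p L ((1 + (p : ℤ_[p]) * (b0 * (p : ℤ_[p]) ^ m) * x : ℤ_[p]) : ℚ_[p]) := by
      rw [hyc, iotaL_mul]; push_cast; rw [mul_assoc (p : ℚ_[p])]
    have e4 : iotaL p L (y : ℚ_[p]) ≠ 0 := by simpa using hy
    rw [zpow_neg, zpow_natCast, inv_pow]
    have := pow_ne_zero j D.lam_ne_zero
    have e5 : iotaL p L (y : ℚ_[p]) ^ D.d = iotaL p L c ^ D.d *
        iotaL p L ((1 + (p : ℤ_[p]) * (b0 * (p : ℤ_[p]) ^ m) * x : ℤ_[p]) : ℚ_[p]) ^ D.d := by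
      rw [e3, mul_pow]
    have e6 := pow_ne_zero D.d e4
    field_simp
    rw [e5]; ring
  · rw [PL_of_not _ hw, mul_zero, mul_zero, T_blk_of_not]
    intro h1
    obtain ⟨w, hw'⟩ := exists_coset h1
    refine hw ⟨-c0 ^ 2 * w * uinv (c0 * (p : ℤ_[p]) ^ m * w), PadicInt.ext ?_⟩
    have hu1 : (1 + (p : ℚ_[p]) * (c0 * (p : ℚ_[p]) ^ m * w)) * uinv (c0 * (p : ℤ_[p]) ^ m * w) = 1 := by
      have := congrArg (fun t : ℤ_[p] => (t : ℚ_[p])) (mul_uinv (c0 * (p : ℤ_[p]) ^ m * w))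
      simpa using this
    have hne := left_ne_zero_of_mul_eq_one hu1
    have hu2 := eq_inv_of_mul_eq_one_right hu1
    have hyy : (y : ℚ_[p]) = ((c : ℚ_[p])⁻¹ + (p : ℚ_[p]) ^ ((m : ℤ) + 1 - j) * w)⁻¹ := by
      rw [← hw', inv_inv]
    have e7 : ((c : ℚ_[p])⁻¹ + (p : ℚ_[p]) ^ ((m : ℤ) + 1 - j) * w) =
        (c : ℚ_[p])⁻¹ * (1 + (p : ℚ_[p]) * (c0 * (p : ℚ_[p]) ^ m * w)) := by
      rw [hN, hcQ]
      have := pow_ne_zero j hp0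
      field_simp
      ring
    rw [hyy, e7, mul_inv, inv_inv, ← hu2]
    push_cast
    rw [hcQ]
    linear_combination ((p : ℚ_[p]) ^ j * c0) * hu1

lemma norm_blockConst {c c0 b0 : ℤ_[p]} {j : ℕ} (hc : c = (p : ℤ_[p]) ^ j * c0) (hb : c0 * b0 = 1)
    (m : ℕ) : ‖D.lam ^ j * D.chi ^ ((m : ℤ) + 1 - j) * iotaL p L c ^ D.d‖ = (D.A ^ (m + 1 + j))⁻¹ := by
  have hA := D.A_pos
  have e : ‖iotaL p L c‖ = (p : ℝ)⁻¹ ^ j := by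
    rw [norm_iotaL, hc, PadicInt.coe_mul, norm_mul, PadicInt.norm_def.symm.trans (norm_eq_one_of_mul hb)]
    simp
  rw [norm_mul, norm_mul, norm_chi_zpow, norm_pow, norm_pow, e]
  have e3 : ‖D.lam‖ ^ j * D.A ^ (-((m : ℤ) + 1 - j)) * ((p : ℝ)⁻¹ ^ j) ^ D.d =
    (‖D.lam‖ * (p : ℝ)⁻¹ ^ D.d) ^ j * D.A ^ (-((m : ℤ) + 1 - j)) := by
    rw [mul_pow, ← pow_mul, ← pow_mul, mul_comm j]; ring
  rw [e3, D.norm_lam', neg_sub, zpow_sub₀ hA.ne', zpow_natCast]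
  norm_cast
  have e4 : (D.A⁻¹ ^ 2) ^ j = (D.A ^ j)⁻¹ * (D.A ^ j)⁻¹ := by
    rw [inv_pow, inv_pow, ← mul_inv, ← pow_mul, ← pow_add]; congr 2; ring
  rw [pow_add _ (m + 1), e4]
  field_simp

/-- Blocks around a point `1/c` are bounded uniformly. -/
lemma BB_block_inv {C : ℝ} {h : ℤ_[p] → L} (hh : CrB D.r C h) {c c0 b0 : ℤ_[p]} {j : ℕ}
    (hc : c = (p : ℤ_[p]) ^ j * c0) (hb : c0 * b0 = 1) (m : ℕ) :
    D.BB (D.K * (D.K * C)) (D.T ((m : ℤ) + 1 - j) (c : ℚ_[p])⁻¹ (blk h)) := by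
  rw [D.T_blk_eq_Inf hc hb]
  have hA := D.A_pos
  have hK := D.K_pos
  have hC := hh.nonneg
  refine ((D.BB_Inf ((hh.mobW D.hr.le D.d b0 m).PL D.hr.le c (m + 1 + j))).smul _).mono ?_
  rw [D.norm_blockConst hc hb]
  change _ * (D.K * D.A ^ (m + 1 + j) * (D.K * C)) ≤ _
  field_simp
  exact le_rfl

/-- Every ball of radius at most `1/p` carries uniformly bounded blocks. -/
lemma BB_block {C : ℝ} {h : ℤ_[p] → L} (hh : CrB D.r C h) {n : ℤ} (b : ℚ_[p])
    (hn : 1 ≤ n ∨ (p : ℝ) ^ (-n) < ‖b‖) :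
    D.BB (D.K * (D.K * C)) (D.T n b (blk h)) := by
  by_cases hb : ‖b‖ < 1
  · have hn1 : 1 ≤ n := by
      rcases hn with hn | hn
      · exact hn
      · have := (zpow_lt_one_iff_right₀ (one_lt_p p)).1 (hn.trans hb)
        omega
    obtain ⟨b', rfl⟩ : ∃ b' : ℤ_[p], b = (p : ℚ_[p]) * b' := by
      have h1 : ‖b - 0‖ ≤ (p : ℝ) ^ (-(1 : ℤ)) := by
        obtain ⟨b', rfl⟩ : ∃ b' : ℤ_[p], (b' : ℚ_[p]) = b := ⟨⟨b, hb.le⟩, rfl⟩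
        have h2 := (PadicInt.norm_le_pow_iff_mem_span_pow b' 1).2
            (by rw [pow_one]; exact Ideal.mem_span_singleton.2
                  ((PadicInt.norm_lt_one_iff_dvd b').1 (by rwa [PadicInt.norm_def])))
        rw [sub_zero, ← PadicInt.norm_def]
        exact_mod_cast h2
      obtain ⟨x, hx⟩ := exists_coset h1
      exact ⟨x, by rw [hx]; simp⟩
    obtain ⟨m, rfl⟩ : ∃ m : ℕ, n = m + 1 := ⟨(n - 1).toNat, by omega⟩
    have hK := D.one_le_K
    have hC := hh.nonneg
    refine (D.BB_block_small hh b' m).mono ?_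
    have : 1 * C ≤ D.K * C := by gcongr
    gcongr
    linarith
  · obtain ⟨c, hc, rfl⟩ := exists_inv_of_not_lt hb
    obtain ⟨j, c0, b0, hcj, hcb⟩ := exists_unit_factor hc
    have hcn : ‖(c : ℚ_[p])⁻¹‖ = (p : ℝ) ^ j := by
      rw [norm_inv, hcj, PadicInt.coe_mul, norm_mul,
        PadicInt.norm_def.symm.trans (norm_eq_one_of_mul hcb)]
      simp
    have hnj : 1 ≤ n + j := by
      rcases hn with hn | hn
      · omega
      · rw [hcn, ← zpow_natCast] at hn
        have := (zpow_lt_zpow_iff_right₀ (one_lt_p p)).1 hn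
        omega
    obtain ⟨m, hm⟩ : ∃ m : ℕ, n + j = m + 1 := ⟨(n + j - 1).toNat, by omega⟩
    have : n = (m : ℤ) + 1 - j := by omega
    rw [this]
    exact D.BB_block_inv hh hcj hcb m

/-- The part of a function near a nonzero `c`, seen at infinity, is a block. -/
lemma Inf_PL_eq_T_blk {c c0 b0 : ℤ_[p]} {j : ℕ} (hc : c = (p : ℤ_[p]) ^ j * c0) (hb : c0 * b0 = 1) (m : ℕ)
    (h : ℤ_[p] → L) : D.Inf (PL L c (m + 1 + j) h) =
      (D.lam ^ j * D.chi ^ ((m : ℤ) + 1 - j) * iotaL p L c ^ D.d)⁻¹ •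
        D.T ((m : ℤ) + 1 - j) (c : ℚ_[p])⁻¹ (blk (mobW D.d c0 m h)) := by
  rw [D.T_blk_eq_Inf hc hb, mobW_mobW (by rw [mul_comm]; exact hb), inv_smul_smul₀]
  have hpI : (p : ℤ_[p]) ≠ 0 := by exact_mod_cast hp.out.ne_zero
  have hc00 : c0 ≠ 0 := left_ne_zero_of_mul_eq_one hb
  have hcne : c ≠ 0 := by rw [hc]; exact mul_ne_zero (pow_ne_zero _ hpI) hc00
  have : iotaL p L (c : ℚ_[p]) ≠ 0 := by simpa using hcne
  exact mul_ne_zero (mul_ne_zero (pow_ne_zero _ D.lam_ne_zero) (zpow_ne_zero _ D.chi_ne))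
    (pow_ne_zero _ this)

end Par

end

section

variable {p : ℕ} [hp : Fact p.Prime]
variable {L : Type} [NontriviallyNormedField L] [NormedAlgebra ℚ_[p] L] [IsUltrametricDist L]
  [CompleteSpace L]

lemma exists_digit (x : ℤ_[p]) (e : ℕ) : ∃ a < p ^ e, ∃ w, x = (a : ℤ_[p]) + (p : ℤ_[p]) ^ e * w := by
  have h := PadicInt.appr_spec e x
  obtain ⟨w, hw⟩ := Ideal.mem_span_singleton.1 h
  exact ⟨x.appr e, PadicInt.appr_lt x e, w, by rw [← hw]; ring⟩

lemma digit_unique {e a a' : ℕ} {w w' : ℤ_[p]} (ha : a < p ^ e) (ha' : a' < p ^ e)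
    (h : (a : ℤ_[p]) + (p : ℤ_[p]) ^ e * w = (a' : ℤ_[p]) + (p : ℤ_[p]) ^ e * w') : a = a' := by
  have h1 := congrArg (PadicInt.toZModPow e) h
  have h2 : (PadicInt.toZModPow e) ((p : ℤ_[p]) ^ e) = 0 := by
    rw [map_pow, map_natCast]; exact_mod_cast ZMod.natCast_self (p ^ e)
  simp only [map_add, map_mul, h2, zero_mul, add_zero, map_natCast] at h1
  rw [ZMod.natCast_eq_natCast_iff', Nat.mod_eq_of_lt ha, Nat.mod_eq_of_lt ha'] at h1
  exact h1

/-- A function on `ℤ_p` is the sum of its restrictions to the cosets of `p^e ℤ_p`. -/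
lemma eq_sum_PL (h : ℤ_[p] → L) (e : ℕ) : h = ∑ a ∈ Finset.range (p ^ e),
    PL L (a : ℤ_[p]) e (fun x => h ((a : ℤ_[p]) + (p : ℤ_[p]) ^ e * x)) := by
  ext x
  obtain ⟨a, ha, w, rfl⟩ := exists_digit x e
  rw [Finset.sum_apply, Finset.sum_eq_single_of_mem a (Finset.mem_range.2 ha), PL_apply]
  intro b hb hba
  rw [PL_of_not]
  rintro ⟨w', hw'⟩
  exact hba (digit_unique (Finset.mem_range.1 hb) ha hw'.symm)

/-- Extension by zero as a linear map. -/
def blkL : (ℤ_[p] → L) →ₗ[L] (ℚ_[p] → L) where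
  toFun := blk
  map_add' := blk_add
  map_smul' := blk_smul

lemma blk_sum {ι : Type*} (s : Finset ι) (h : ι → ℤ_[p] → L) : blk (∑ i ∈ s, h i) = ∑ i ∈ s, blk (h i) :=
  map_sum (blkL (p := p) (L := L)) h s

namespace Par

variable (D : Par p L)

lemma T_blk_eq_blk_PL (e : ℕ) (a : ℤ_[p]) (h : ℤ_[p] → L) :
    D.T e (a : ℚ_[p]) (blk h) = D.chi ^ e • blk (PL L a e h) := by
  have hp0 := pQ_ne_zero (p := p)
  have hp1 := pow_ne_zero e hp0
  ext z
  rw [Pi.smul_apply, smul_eq_mul]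
  by_cases hz : ‖z - a‖ ≤ (p : ℝ) ^ (-(e : ℤ))
  · obtain ⟨x, rfl⟩ := exists_coset hz
    rw [T_blk_coset]
    have : (a : ℚ_[p]) + (p : ℚ_[p]) ^ (e : ℤ) * x = ((a + (p : ℤ_[p]) ^ e * x : ℤ_[p]) : ℚ_[p]) := by
      push_cast; rw [zpow_natCast]
    rw [this, blk_coe, PL_apply, zpow_natCast]
  · rw [T_blk_of_not _ _ _ _ hz]
    symm
    rw [mul_eq_zero]; right
    by_cases h1 : ‖z‖ ≤ 1
    · obtain ⟨y, rfl⟩ : ∃ y : ℤ_[p], (y : ℚ_[p]) = z := ⟨⟨z, h1⟩, rfl⟩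
      rw [blk_coe, PL_of_not]
      rintro ⟨w, rfl⟩
      apply hz
      have := norm_le_of_mem_coset (b := (a : ℚ_[p])) (n := e) w
      push_cast
      exact_mod_cast this
    · rw [blk_of_not _ h1]

lemma T_blk_eq_sum (n : ℤ) (b : ℚ_[p]) (h : ℤ_[p] → L) (e : ℕ) : D.T n b (blk h) =
    ∑ a ∈ Finset.range (p ^ e), (D.chi ^ e)⁻¹ • D.T (n + e) (b + (p : ℚ_[p]) ^ n * a)
      (blk fun x => h ((a : ℤ_[p]) + (p : ℤ_[p]) ^ e * x)) := by
  conv_lhs => rw [eq_sum_PL h e]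
  rw [blk_sum, map_sum]
  refine Finset.sum_congr rfl fun a _ => ?_
  have := D.T_blk_eq_blk_PL e (a : ℤ_[p]) fun x => h ((a : ℤ_[p]) + (p : ℤ_[p]) ^ e * x)
  rw [← D.T_T n e b a, ← map_smul]
  push_cast at this
  rw [this, smul_smul, inv_mul_cancel₀ (pow_ne_zero _ D.chi_ne), one_smul]

lemma BB_block_any (n : ℤ) (b : ℚ_[p]) : ∃ C0, 0 ≤ C0 ∧ ∀ (h : ℤ_[p] → L) (C : ℝ), CrB D.r C h →
    D.BB (C0 * C) (D.T n b (blk h)) := by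
  set e := (1 - n).toNat with he
  have hK := D.K_pos
  have hA := D.A_pos
  refine ⟨D.A ^ e * (D.K * (D.K * D.K)), by positivity, fun h C hh => ?_⟩
  have hC := hh.nonneg
  rw [D.T_blk_eq_sum n b h e]
  refine BB.sum (by positivity) fun a _ => ?_
  refine ((D.BB_block (hh.affine D.hr.le _ _) _ (Or.inl (by omega))).smul _).mono ?_
  rw [norm_inv, norm_pow, D.norm_chi', inv_pow, inv_inv]
  apply le_of_eq; rw [← K]; ring

lemma Inf_PL_zero_of_lt {N : ℕ} (h : ℤ_[p] → L) {z : ℚ_[p]} (hz : ‖z‖ < (p : ℝ) ^ N) :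
    D.Inf (PL L 0 N h) z = 0 := by
  by_cases h1 : ‖z‖ < 1
  · rw [Inf, if_pos h1]
  obtain ⟨y, hy, rfl⟩ := exists_inv_of_not_lt h1
  rw [D.Inf_inv _ hy, PL_of_not, mul_zero]
  rintro ⟨w, rfl⟩
  rw [zero_add, norm_inv] at hz
  refine hz.not_ge (le_inv_of_le_inv₀ ?_ ?_)
  · refine norm_pos_iff.2 ?_
    rw [zero_add] at hy
    simpa using hy
  · push_cast
    rw [norm_mul, norm_pow, Padic.norm_p, inv_pow]
    exact mul_le_of_le_one_right (by positivity) (PadicInt.norm_le_one w)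

lemma Inf_PL_zero_inv {N : ℕ} (h : ℤ_[p] → L) {x : ℤ_[p]} (hx : x ≠ 0) :
    D.Inf (PL L 0 N h) ((p : ℚ_[p]) ^ N * x)⁻¹ =
      D.lam ^ (-((N : ℤ) + (x : ℚ_[p]).valuation)) * (iotaL p L ((p : ℚ_[p]) ^ N * x))⁻¹ ^ D.d * h x := by
  have hpI : (p : ℤ_[p]) ≠ 0 := by exact_mod_cast hp.out.ne_zero
  have hx' : (x : ℚ_[p]) ≠ 0 := by simpa using hx
  have hp0 := pow_ne_zero N (pQ_ne_zero (p := p))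
  have e : (p : ℚ_[p]) ^ N * x = ((0 + (p : ℤ_[p]) ^ N * x : ℤ_[p]) : ℚ_[p]) := by push_cast; ring
  have hv : ((p : ℚ_[p]) ^ N * x).valuation = N + (x : ℚ_[p]).valuation := by
    rw [Padic.valuation_mul hp0 hx', Padic.valuation_pow, Padic.valuation_p, mul_one]
  rw [e, D.Inf_inv _ (by rw [zero_add]; exact mul_ne_zero (pow_ne_zero _ hpI) hx), PL_apply, ← e, hv]

lemma T_Inf_PL_zero {n : ℤ} {b : ℚ_[p]} {N N' : ℕ} (hN : (N : ℤ) = N' + n) {E : ℤ_[p]}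
    (hE : (p : ℚ_[p]) ^ N' * b = (p : ℚ_[p]) * E) (h : ℤ_[p] → L) :
    D.T n b (D.Inf (PL L 0 N h)) = (D.chi ^ n * D.lam ^ (-n) * iotaL p L ((p : ℚ_[p]) ^ (-n)) ^ D.d) •
      D.Inf (PL L 0 N' (fun x => iotaL p L ((1 + (p : ℤ_[p]) * (-E) * x : ℤ_[p]) : ℚ_[p]) ^ D.d *
        h (x * uinv (-E * x)))) := by
  have hp0 := pQ_ne_zero (p := p)
  have h1p := one_lt_p p
  have hpn : ∀ n : ℕ, (0 : ℝ) < (p : ℝ) ^ n := fun n => pow_pos (p_pos p) n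
  have hb : ‖b‖ < (p : ℝ) ^ N' := by
    have h1 : ‖(p : ℚ_[p]) ^ N' * b‖ < 1 := by
      rw [hE]; have := (norm_p_mul_le E).trans_lt (inv_p_lt_one p); exact_mod_cast this
    rw [norm_mul, norm_pow, Padic.norm_p, inv_pow, inv_mul_lt_iff₀ (hpn N'), mul_one] at h1
    exact h1
  ext z
  rw [T_apply, Pi.smul_apply, smul_eq_mul]
  by_cases hz : ‖z‖ < (p : ℝ) ^ N'
  · rw [D.Inf_PL_zero_of_lt _ hz, mul_zero, Inf_PL_zero_of_lt, mul_zero]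
    rw [norm_div, Padic.norm_p_zpow, div_lt_iff₀ (zpow_pos (p_pos p) _), ← zpow_natCast,
      ← zpow_add₀ (p_pos p).ne', hN, add_neg_cancel_right, zpow_natCast]
    rw [sub_eq_add_neg]
    refine (IsUltrametricDist.norm_add_le_max z (-b)).trans_lt (max_lt hz ?_)
    rwa [norm_neg]
  · rw [not_lt] at hz
    have hz0 : z ≠ 0 := by rintro rfl; rw [norm_zero] at hz; exact (hpn N').not_ge hz
    obtain ⟨x, hx⟩ : ∃ x : ℤ_[p], (x : ℚ_[p]) = (z * (p : ℚ_[p]) ^ N')⁻¹ := by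
      refine ⟨⟨_, ?_⟩, rfl⟩
      rw [norm_inv, norm_mul, norm_pow, Padic.norm_p, inv_pow]
      apply inv_le_one_of_one_le₀
      rw [← div_eq_mul_inv, one_le_div (hpn N')]
      exact hz
    have hpN := pow_ne_zero N' hp0
    have hx0 : (x : ℚ_[p]) ≠ 0 := by rw [hx]; exact inv_ne_zero (mul_ne_zero hz0 hpN)
    have hx0' : x ≠ 0 := by simpa using hx0
    have hzx : z = ((p : ℚ_[p]) ^ N' * x)⁻¹ := by rw [hx]; field_simp
    have hu := mul_uinv (-E * x)
    set u := uinv (-E * x) with hud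
    have hu1 : (1 + (p : ℚ_[p]) * (-E * x)) * u = 1 := by
      have := congrArg (fun t : ℤ_[p] => (t : ℚ_[p])) hu
      simpa using this
    have hu0 : u ≠ 0 := right_ne_zero_of_mul_eq_one hu
    have hu0' : (u : ℚ_[p]) ≠ 0 := right_ne_zero_of_mul_eq_one hu1
    have hu2 : (1 + (p : ℚ_[p]) * (-E * x)) = (u : ℚ_[p])⁻¹ := eq_inv_of_mul_eq_one_left hu1
    have hpNn : (p : ℚ_[p]) ^ N = (p : ℚ_[p]) ^ N' * (p : ℚ_[p]) ^ n := by
      rw [← zpow_natCast, hN, zpow_add₀ hp0, zpow_natCast]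
    have hpn0 : (p : ℚ_[p]) ^ n ≠ 0 := zpow_ne_zero _ hp0
    have e1 : (z - b) / (p : ℚ_[p]) ^ n = ((p : ℚ_[p]) ^ N * ((x * u : ℤ_[p]) : ℚ_[p]))⁻¹ := by
      rw [PadicInt.coe_mul, ← mul_assoc, mul_inv _ (u : ℚ_[p]), ← hu2, hpNn, hzx]
      field_simp
      linear_combination (-(x : ℚ_[p])) * hE
    rw [e1, D.Inf_PL_zero_inv _ (mul_ne_zero hx0' hu0), hzx, D.Inf_PL_zero_inv _ hx0']
    have hval : ((x * u : ℤ_[p]) : ℚ_[p]).valuation = (x : ℚ_[p]).valuation := by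
      rw [PadicInt.coe_mul, Padic.valuation_mul hx0 hu0', valuation_of_norm (z := (u : ℚ_[p])) (n := 0), add_zero]
      have := norm_eq_one_of_mul (by rw [mul_comm] at hu; exact hu : u * _ = 1)
      rw [PadicInt.norm_def] at this
      simpa using this
    rw [hval]
    have e2 : D.lam ^ (-((N : ℤ) + (x : ℚ_[p]).valuation)) =
        D.lam ^ (-n) * D.lam ^ (-((N' : ℤ) + (x : ℚ_[p]).valuation)) := by
      rw [← zpow_add₀ D.lam_ne_zero]; congr 1; omega
    have e3 : (iotaL p L ((p : ℚ_[p]) ^ N * ((x * u : ℤ_[p]) : ℚ_[p])))⁻¹ =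
        iotaL p L ((p : ℚ_[p]) ^ (-n)) * (iotaL p L ((p : ℚ_[p]) ^ N' * x))⁻¹ *
          iotaL p L ((1 + (p : ℤ_[p]) * (-E) * x : ℤ_[p]) : ℚ_[p]) := by
      rw [← iotaL_inv, ← iotaL_inv, ← iotaL_mul, ← iotaL_mul]
      congr 1
      have h9 : ((1 + (p : ℤ_[p]) * (-E) * x : ℤ_[p]) : ℚ_[p]) = (u : ℚ_[p])⁻¹ := by
        rw [← hu2]; push_cast; ring
      rw [h9, PadicInt.coe_mul, hpNn, zpow_neg]
      field_simp
    rw [e2, e3, mul_pow, mul_pow]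
    ring

lemma Inf_sum {ι : Type*} (s : Finset ι) (h : ι → ℤ_[p] → L) :
    D.Inf (∑ i ∈ s, h i) = ∑ i ∈ s, D.Inf (h i) := by
  let φ : (ℤ_[p] → L) →ₗ[L] (ℚ_[p] → L) := ⟨⟨D.Inf, D.Inf_add⟩, D.Inf_smul⟩
  exact map_sum φ h s

/-- Away from `∞`, the second component consists of blocks. -/
lemma exists_block_Inf {c : ℤ_[p]} {N : ℕ} (hc : (p : ℝ) ^ (-(N : ℤ)) < ‖c‖) :
    ∃ (n : ℤ) (b : ℚ_[p]) (k : L) (c0 : ℤ_[p]) (m : ℕ), ‖k‖ = D.A ^ N ∧ (p : ℝ) ^ (-n) < ‖b‖ ∧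
      ∀ h, D.Inf (PL L c N h) = k • D.T n b (blk (mobW D.d c0 m h)) := by
  have hc0 : c ≠ 0 := by
    rintro rfl; rw [norm_zero] at hc; exact (zpow_pos (p_pos p) _).not_gt hc
  obtain ⟨j, c0, b0, hcj, hcb⟩ := exists_unit_factor hc0
  have hn : ‖c‖ = (p : ℝ) ^ (-(j : ℤ)) := by
    rw [hcj, norm_mul, norm_eq_one_of_mul hcb]; simp
  have hjN : j < N := by
    rw [hn] at hc
    have := (zpow_lt_zpow_iff_right₀ (one_lt_p p)).1 hc
    omega
  obtain ⟨m, rfl⟩ : ∃ m, N = m + 1 + j := ⟨N - 1 - j, by omega⟩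
  refine ⟨_, _, _, c0, m, ?_, ?_, fun h => D.Inf_PL_eq_T_blk hcj hcb m h⟩
  · rw [norm_inv, D.norm_blockConst hcj hcb, inv_inv]
  · rw [norm_inv, ← PadicInt.norm_def, hn, ← zpow_neg]
    exact zpow_lt_zpow_right₀ (one_lt_p p) (by omega)

lemma norm_natCast_gt {a N : ℕ} (h0 : a ≠ 0) (h : a < p ^ N) : (p : ℝ) ^ (-(N : ℤ)) < ‖(a : ℤ_[p])‖ := by
  rw [← not_le, PadicInt.norm_le_pow_iff_mem_span_pow, Ideal.mem_span_singleton]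
  rintro ⟨w, hw⟩
  exact h0 (digit_unique (w := 0) (w' := w) h (pow_pos hp.out.pos N) (by rw [hw]; simp))

/-- An element of the Banach space is the sum of a block on `pℤ_p` and a function at infinity. -/
lemma eq_block_add_Inf {f : ℚ_[p] → L} {g : ℤ_[p] → L} (hg : ∀ z : ℤ_[p], z ≠ 0 →
    g z = D.lam ^ ((z : ℚ_[p]).valuation) * iotaL p L z ^ D.d * f ((z : ℚ_[p])⁻¹)) :
    f = D.chi⁻¹ • D.T 1 0 (blk fun z => f ((p : ℚ_[p]) * z)) + D.Inf g := by
  ext z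
  rw [Pi.add_apply, Pi.smul_apply, smul_eq_mul]
  by_cases hz : ‖z‖ < 1
  · have h1 : ‖z - 0‖ ≤ (p : ℝ) ^ (-(1 : ℤ)) := by
      obtain ⟨b', rfl⟩ : ∃ b' : ℤ_[p], (b' : ℚ_[p]) = z := ⟨⟨z, hz.le⟩, rfl⟩
      have h2 := (PadicInt.norm_le_pow_iff_mem_span_pow b' 1).2
          (by rw [pow_one]; exact Ideal.mem_span_singleton.2
                ((PadicInt.norm_lt_one_iff_dvd b').1 (by rwa [PadicInt.norm_def])))
      rw [sub_zero, ← PadicInt.norm_def]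
      exact_mod_cast h2
    obtain ⟨x, hx⟩ := exists_coset h1
    rw [Inf, if_pos hz, add_zero, hx, T_blk_coset, zpow_one, zpow_one, inv_mul_cancel_left₀ D.chi_ne,
      zero_add]
  · rw [T_blk_of_not, mul_zero, zero_add]
    · obtain ⟨y, hy, rfl⟩ := exists_inv_of_not_lt hz
      rw [D.Inf_inv _ hy, hg y hy, zpow_neg, inv_pow]
      have h1 : iotaL p L (y : ℚ_[p]) ≠ 0 := by simpa using hy
      have := zpow_ne_zero (y : ℚ_[p]).valuation D.lam_ne_zero
      field_simp
    · rw [sub_zero]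
      intro h
      apply hz
      refine h.trans_lt ?_
      rw [zpow_neg, zpow_one]; exact inv_p_lt_one p

/-- The affine group acts by bounded operators. -/
lemma T_bounded (n : ℤ) (b : ℚ_[p]) : ∃ C0, 0 ≤ C0 ∧ ∀ (f : ℚ_[p] → L) (C : ℝ), D.BB C f →
    D.BB (C0 * C) (D.T n b f) := by
  have hA := D.A_pos
  have hK := D.K_pos
  have hp0 := pQ_ne_zero (p := p)
  obtain ⟨N', hN1, hN2⟩ : ∃ N' : ℕ, ‖b‖ * p ≤ (p : ℝ) ^ N' ∧ -n ≤ N' := by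
    obtain ⟨e, he⟩ := pow_unbounded_of_one_lt (‖b‖ * p) (one_lt_p p)
    exact ⟨e + (-n).toNat, he.le.trans (pow_le_pow_right₀ (one_lt_p p).le (by omega)), by omega⟩
  obtain ⟨N, hN⟩ : ∃ N : ℕ, (N : ℤ) = N' + n := ⟨(N' + n).toNat, by omega⟩
  obtain ⟨E, hE⟩ : ∃ E : ℤ_[p], (p : ℚ_[p]) ^ N' * b = (p : ℚ_[p]) * E := by
    have h1 : ‖(p : ℚ_[p]) ^ N' * b - 0‖ ≤ (p : ℝ) ^ (-(1 : ℤ)) := by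
      rw [sub_zero, norm_mul, norm_pow, Padic.norm_p, zpow_neg, zpow_one, inv_pow,
        inv_mul_le_iff₀ (pow_pos (p_pos p) _), ← div_eq_mul_inv, le_div_iff₀ (p_pos p)]
      exact hN1
    obtain ⟨E, hE⟩ := exists_coset h1
    exact ⟨E, by rw [hE]; simp⟩
  obtain ⟨C1, hC1, H1⟩ := D.BB_block_any (n + 1) (b + (p : ℚ_[p]) ^ n * 0)
  choose! n' b' k c0 m hk _ hkT using fun (a : ℕ) (ha : a ≠ 0 ∧ a < p ^ N) =>
    D.exists_block_Inf (c := (a : ℤ_[p])) (norm_natCast_gt ha.1 ha.2)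
  choose C2 hC2 H2 using fun a : ℕ => D.BB_block_any (n + n' a) (b + (p : ℚ_[p]) ^ n * b' a)
  set k0 := D.chi ^ n * D.lam ^ (-n) * iotaL p L ((p : ℚ_[p]) ^ (-n)) ^ D.d with hk0
  set CC := ‖D.chi⁻¹‖ * C1 + (‖k0‖ * (D.K * D.A ^ N' * (D.K * D.K)) +
    ∑ a ∈ Finset.range (p ^ N), ‖k a‖ * (C2 a * (D.K * D.K))) with hCC
  have hs : 0 ≤ ∑ a ∈ Finset.range (p ^ N), ‖k a‖ * (C2 a * (D.K * D.K)) :=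
    Finset.sum_nonneg fun a _ => by have := hC2 a; positivity
  refine ⟨CC, by positivity, fun f C hf => ?_⟩
  have hC := hf.nonneg
  obtain ⟨h1, g, h2, h3⟩ := hf
  rw [D.eq_block_add_Inf h3, map_add, map_smul, T_T]
  refine BB.add (((H1 _ _ h1).smul _).mono ?_) ?_
  · rw [← mul_assoc, hCC]; gcongr
    have : 0 ≤ ‖k0‖ * (D.K * D.A ^ N' * (D.K * D.K)) := by positivity
    linarith
  rw [eq_sum_PL g N, D.Inf_sum, map_sum]
  refine BB.sum (by positivity) fun a ha => ?_
  rw [Finset.mem_range] at ha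
  by_cases ha0 : a = 0
  · subst ha0
    rw [Nat.cast_zero, D.T_Inf_PL_zero hN hE, ← hk0]
    have h5 := (h2.affine D.hr.le 0 ((p : ℤ_[p]) ^ N)).moebius D.hr.le D.d (A := 0) (B := 1) (D := -E)
      (σ := fun x => x * uinv (-E * x)) (fun x => by
        have := mul_uinv (-E * x)
        linear_combination x * this)
    refine ((D.BB_Inf (h5.PL D.hr.le 0 N')).smul _).mono ?_
    have e : ‖k0‖ * (KO p D.r * (↑p ^ D.r) ^ N' * (KO p D.r * (KO p D.r * C))) =
      ‖k0‖ * (D.K * D.A ^ N' * (D.K * D.K)) * C := by rw [K, A]; ring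
    rw [e, hCC]; gcongr
    have : 0 ≤ ‖D.chi⁻¹‖ * C1 := by positivity
    linarith
  · rw [hkT a ⟨ha0, ha⟩, map_smul, T_T]
    refine ((H2 a _ _ ((h2.affine D.hr.le _ _).mobW D.hr.le _ _ _)).smul _).mono ?_
    have h6 : ‖k a‖ * (C2 a * (D.K * D.K)) ≤ ∑ a ∈ Finset.range (p ^ N), ‖k a‖ * (C2 a * (D.K * D.K)) :=
      Finset.single_le_sum (f := fun a => ‖k a‖ * (C2 a * (D.K * D.K)))
        (fun a _ => by have := hC2 a; positivity) (Finset.mem_range.2 ha)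
    have e : ‖k a‖ * (C2 a * (KO p D.r * (KO p D.r * C))) = ‖k a‖ * (C2 a * (D.K * D.K)) * C := by
      rw [K]; ring
    rw [e, hCC]; gcongr
    have : 0 ≤ ‖D.chi⁻¹‖ * C1 := by positivity
    have : 0 ≤ ‖k0‖ * (D.K * D.A ^ N' * (D.K * D.K)) := by positivity
    linarith

end Par

end

section

variable {p : ℕ} [hp : Fact p.Prime]
variable {L : Type} [NontriviallyNormedField L] [NormedAlgebra ℚ_[p] L] [IsUltrametricDist L]
  [CompleteSpace L]

/-- Mahler expansion of a bounded functional. -/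
lemma hasSum_functional {r C C0 : ℝ} (ψ : (ℤ_[p] → L) →ₗ[L] L)
    (hψ : ∀ (h : ℤ_[p] → L) (C : ℝ), CrB r C h → ‖ψ h‖ ≤ C0 * C) {h : ℤ_[p] → L} (hh : CrB r C h) :
    HasSum (fun N => mc p L N h * ψ (bin p L N)) (ψ h) := by
  have hC0 : 0 ≤ C0 := by
    have := hψ _ _ (crB_bin r 0)
    have h1 : wt r 0 = 1 := by simp [wt]
    rw [h1, mul_one] at this
    exact (norm_nonneg _).trans this
  have hlim : Tendsto (fun N => mc p L N h * ψ (bin p L N)) atTop (𝓝 0) := by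
    have h2 : Tendsto (fun N => C0 * (wt r N * ‖mc p L N h‖)) atTop (𝓝 0) := by
      simpa using hh.1.2.const_mul C0
    refine squeeze_zero_norm (fun N => ?_) h2
    rw [norm_mul]
    have := hψ _ _ (crB_bin r N)
    calc _ ≤ ‖mc p L N h‖ * (C0 * wt r N) := by gcongr
      _ = _ := by ring
  have hs : Summable (fun N => mc p L N h * ψ (bin p L N)) :=
    NonarchimedeanAddGroup.summable_of_tendsto_cofinite_zero (by rwa [Nat.cofinite_eq_atTop])
  have h3 := hs.hasSum.tendsto_sum_nat
  suffices H : Tendsto (fun n => ∑ N ∈ Finset.range n, mc p L N h * ψ (bin p L N)) atTop (𝓝 (ψ h)) by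
    rw [← tendsto_nhds_unique h3 H]; exact hs.hasSum
  rw [Metric.tendsto_atTop]
  intro ε hε
  have hε' : 0 < ε / (C0 + 1) := by positivity
  obtain ⟨M, hM⟩ := (Metric.tendsto_atTop.1 hh.1.2) _ hε'
  refine ⟨M, fun n hn => ?_⟩
  have hmc : ∀ K, mc p L K (h - ∑ N ∈ Finset.range n, mc p L N h • bin p L N) =
      if K < n then 0 else mc p L K h := by
    intro K
    rw [map_sub, map_sum]
    simp only [map_smul, mc_bin, smul_eq_mul, mul_ite, mul_one, mul_zero, Finset.sum_ite_eq,
      Finset.mem_range]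
    split_ifs <;> simp
  have hrem : CrB r (ε / (C0 + 1)) (h - ∑ N ∈ Finset.range n, mc p L N h • bin p L N) := by
    refine ⟨⟨hh.1.1.sub ?_, ?_⟩, fun K => ?_⟩
    · exact (CrB.sum (C := ∑ N ∈ Finset.range n, ‖mc p L N h‖ * wt r N)
        (Finset.sum_nonneg fun i _ => mul_nonneg (norm_nonneg _) (wt_pos r i).le)
        fun i hi => ((crB_bin r i).smul _).mono
          (Finset.single_le_sum (f := fun i => ‖mc p L i h‖ * wt r i)
            (fun i _ => mul_nonneg (norm_nonneg _) (wt_pos r i).le) hi)).1.1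
    · refine squeeze_zero (fun K => mul_nonneg (wt_pos r K).le (norm_nonneg _)) (fun K => ?_) hh.1.2
      rw [hmc]; split_ifs
      · simpa using mul_nonneg (wt_pos r K).le (norm_nonneg _)
      · exact le_rfl
    · rw [hmc]; split_ifs with hK
      · simpa using hε'.le
      · have := hM K (by omega)
        rw [Real.dist_0_eq_abs] at this
        exact (le_abs_self _).trans this.le
  rw [dist_comm, dist_eq_norm]
  have h5 := hψ _ _ hrem
  rw [map_sub, map_sum] at h5
  simp only [map_smul, smul_eq_mul] at h5
  refine h5.trans_lt ?_
  rw [mul_div_assoc', div_lt_iff₀ (by positivity)]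
  nlinarith

lemma norm_functional_le {r C C0 c : ℝ} (hc : 0 ≤ c) (ψ : (ℤ_[p] → L) →ₗ[L] L)
    (hψ : ∀ (h : ℤ_[p] → L) (C : ℝ), CrB r C h → ‖ψ h‖ ≤ C0 * C)
    (hb : ∀ N, ‖ψ (bin p L N)‖ ≤ c * wt r N) {h : ℤ_[p] → L} (hh : CrB r C h) :
    ‖ψ h‖ ≤ c * C := by
  have hC := hh.nonneg
  refine norm_hasSum_le_of (by positivity) (fun N => ?_) (hasSum_functional ψ hψ hh)
  rw [norm_mul]
  have := hh.2 N
  have h1 := hb N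
  calc _ ≤ ‖mc p L N h‖ * (c * wt r N) := by gcongr
    _ = c * (wt r N * ‖mc p L N h‖) := by ring
    _ ≤ _ := by gcongr

namespace Par

variable (D : Par p L)

/-- Bounded linear functionals on the Banach space. -/
def Bdd (R : (ℚ_[p] → L) →ₗ[L] L) : Prop :=
  ∃ C, 0 ≤ C ∧ ∀ (f : ℚ_[p] → L) (B : ℝ), D.BB B f → ‖R f‖ ≤ C * B

/-- The special functions. -/
def spec (a : ℚ_[p]) (j : ℕ) : ℚ_[p] → L := fun z =>
  if z = a then 0 else D.lam ^ ((z - a).valuation) * iotaL p L (z - a) ^ (D.d - j)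

/-- The functional `h ↦ R(T n b (blk h))`. -/
def blkF (R : (ℚ_[p] → L) →ₗ[L] L) (n : ℤ) (b : ℚ_[p]) : (ℤ_[p] → L) →ₗ[L] L :=
  R ∘ₗ D.T n b ∘ₗ blkL

lemma blkF_apply (R : (ℚ_[p] → L) →ₗ[L] L) (n : ℤ) (b : ℚ_[p]) (h : ℤ_[p] → L) :
    D.blkF R n b h = R (D.T n b (blk h)) := rfl

/-- Boundedness on all blocks. -/
def CN (R : (ℚ_[p] → L) →ₗ[L] L) (c : ℝ) : Prop :=
  ∀ (n : ℤ) (b : ℚ_[p]) (h : ℤ_[p] → L) (C : ℝ), CrB D.r C h → ‖R (D.T n b (blk h))‖ ≤ c * C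

/-- The bounded functionals killing the special functions. -/
def Dual (R : (ℚ_[p] → L) →ₗ[L] L) : Prop :=
  D.Bdd R ∧ ∀ j : ℕ, (j : ℝ) < D.r → R (monomialFun p L j) = 0 ∧ ∀ a, R (D.spec a j) = 0

variable {D}

lemma Bdd.blkF {R : (ℚ_[p] → L) →ₗ[L] L} (hR : D.Bdd R) (n : ℤ) (b : ℚ_[p]) :
    ∃ C0, ∀ (h : ℤ_[p] → L) (C : ℝ), CrB D.r C h → ‖D.blkF R n b h‖ ≤ C0 * C := by
  obtain ⟨C1, hC1, h1⟩ := hR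
  obtain ⟨C0, hC0, h0⟩ := D.BB_block_any n b
  exact ⟨C1 * C0, fun h C hh => (h1 _ _ (h0 h C hh)).trans_eq (by ring)⟩

lemma Bdd.T {R : (ℚ_[p] → L) →ₗ[L] L} (hR : D.Bdd R) (n : ℤ) (b : ℚ_[p]) :
    D.Bdd (R ∘ₗ D.T n b) := by
  obtain ⟨C1, hC1, h1⟩ := hR
  obtain ⟨C0, hC0, h0⟩ := D.T_bounded n b
  exact ⟨C1 * C0, by positivity, fun f C hf => (h1 _ _ (h0 f C hf)).trans_eq (by ring)⟩

lemma CN.T {R : (ℚ_[p] → L) →ₗ[L] L} {c : ℝ} (hR : D.CN R c) (n : ℤ) (b : ℚ_[p]) :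
    D.CN (R ∘ₗ D.T n b) c := fun m b' h C hh => by
  rw [LinearMap.comp_apply, T_T]; exact hR _ _ h C hh

lemma CN.nonneg {R : (ℚ_[p] → L) →ₗ[L] L} {c : ℝ} (hR : D.CN R c) : 0 ≤ c := by
  have := hR 0 0 _ _ (crB_bin D.r 0)
  rw [show wt D.r 0 = 1 by simp [wt], mul_one] at this
  exact (norm_nonneg _).trans this

/-- Flat functions on large balls. -/
lemma norm_flat_block {R : (ℚ_[p] → L) →ₗ[L] L} {C1 : ℝ} (hC1 : 0 ≤ C1)
    (hR : ∀ (f : ℚ_[p] → L) (C' : ℝ), D.BB C' f → ‖R f‖ ≤ C1 * C') (m : ℕ) :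
    ∀ (h : ℤ_[p] → L) (K0 : ℝ), (∀ i, CrB D.r (K0 / D.A ^ i) (fun x => h ((p : ℤ_[p]) ^ i * x))) →
    ‖R (D.T (1 - m) 0 (blk h))‖ ≤ C1 * (D.A * D.K ^ 3) * K0 := by
  have hA := D.A_pos
  have hK := D.one_le_K
  have hA1 := D.one_le_A
  induction m with
  | zero =>
    intro h K0 hh
    have h0 : CrB D.r K0 h := by simpa using hh 0
    have hK0 := h0.nonneg
    have := hR _ _ (D.BB_block h0 (n := 1) 0 (Or.inl le_rfl))
    simp only [Nat.cast_zero, sub_zero]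
    refine this.trans ?_
    rw [mul_assoc]
    refine mul_le_mul_of_nonneg_left ?_ hC1
    calc D.K * (D.K * K0) = 1 * (D.K ^ 2 * 1) * K0 := by ring
      _ ≤ D.A * (D.K ^ 2 * D.K) * K0 := by gcongr
      _ = _ := by ring
  | succ m ih =>
    intro h K0 hh
    have h0 : CrB D.r K0 h := by simpa using hh 0
    have hK0 := h0.nonneg
    rw [D.T_blk_eq_sum _ _ _ 1, map_sum]
    refine norm_sum_le_of (by positivity) fun a ha => ?_
    rw [map_smul, norm_smul, norm_inv, norm_pow, D.norm_chi', pow_one, inv_inv]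
    rw [show (1 - ((m + 1 : ℕ) : ℤ) + ((1 : ℕ) : ℤ)) = 1 - (m : ℤ) by push_cast; ring]
    rcases Nat.eq_zero_or_pos a with rfl | ha0
    · have h2 := ih (fun x => h ((p : ℤ_[p]) * x)) (K0 / D.A) fun i => by
        have := hh (i + 1)
        have t := this.mono (C' := K0 / D.A / D.A ^ i) (le_of_eq (by rw [pow_succ]; field_simp))
        refine (congrArg (CrB D.r _) (funext fun x => ?_)).mp t
        congr 1; ring
      simp only [Nat.cast_zero, mul_zero, add_zero, zero_add, pow_one]
      calc _ ≤ D.A * (C1 * (D.A * D.K ^ 3) * (K0 / D.A)) := by gcongr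
        _ = _ := by field_simp
    · have hap : a < p := by simpa using ha
      have h3 := (h0.affine D.hr.le (a : ℤ_[p]) ((p : ℤ_[p]) ^ 1))
      have h4 := hR _ _ (D.BB_block h3 (n := 1 - (m : ℤ)) (0 + (p : ℚ_[p]) ^ (1 - ((m + 1 : ℕ) : ℤ)) * a)
        (Or.inr ?_))
      · calc _ ≤ D.A * (C1 * (D.K * (D.K * (D.K * K0)))) := by gcongr; exact h4
          _ = _ := by ring
      · have h5 : ‖(a : ℚ_[p])‖ = 1 := by
          have h6 : ¬ p ∣ a := fun h => absurd (Nat.le_of_dvd ha0 h) (by omega)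
          have := (PadicInt.norm_natCast_eq_one_iff (p := p) (n := a)).2
            ((Nat.Prime.coprime_iff_not_dvd hp.out).2 h6)
          exact_mod_cast this
        rw [zero_add, norm_mul, h5, mul_one, Padic.norm_p_zpow]
        refine zpow_lt_zpow_right₀ (one_lt_p p) ?_
        push_cast; linarith

end Par

end

section

variable {p : ℕ} [hp : Fact p.Prime]
variable {L : Type} [NontriviallyNormedField L] [NormedAlgebra ℚ_[p] L] [IsUltrametricDist L]
  [CompleteSpace L]

lemma norm_coeff_binPoly_le (p : ℕ) [hp : Fact p.Prime] {L : Type} [NontriviallyNormedField L]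
    [NormedAlgebra ℚ_[p] L] [IsUltrametricDist L] [CompleteSpace L] {r : ℝ} (hr : 0 ≤ r) (N : ℕ) {j : ℕ} (hj : (j : ℝ) ≤ r) :
    ‖(binPoly L N).coeff j‖ ≤ wt r N := by
  have h1 := norm_coeff_mul_le (p := p) (L := L) (Nat.lt_pow_succ_log_self hp.out.one_lt N) 0 j
  simp only [zero_mul, pow_zero, mul_one, div_one] at h1
  refine h1.trans (le_trans ?_ (pow_log_le_wt (p := p) hr N))
  have hp0 := p_pos p
  rw [← pow_mul, mul_comm, pow_mul]
  refine pow_le_pow_left₀ (by positivity) ?_ _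
  rw [← Real.rpow_natCast]
  exact Real.rpow_le_rpow_of_exponent_le (one_lt_p p).le hj

namespace Par

variable (D : Par p L)

lemma r_lt : D.r < D.d + 1 := by have := D.hsum; have := D.hr'; linarith

lemma le_d {j : ℕ} (hj : (j : ℝ) ≤ D.r) : j ≤ D.d := by
  have := D.r_lt
  have h : (j : ℝ) < ((D.d + 1 : ℕ) : ℝ) := by push_cast; linarith
  have := Nat.cast_lt.1 h
  omega

lemma norm_lam_sub {j : ℕ} (hj : j ≤ D.d) :
    ‖D.lam‖ * ((p : ℝ)⁻¹) ^ (D.d - j) = (D.A⁻¹) ^ 2 * (p : ℝ) ^ j := by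
  have h := D.norm_lam'
  have hp0 := p_pos p
  rw [← h, mul_assoc, ← Nat.sub_add_cancel hj, pow_add, mul_assoc]
  simp only [Nat.add_sub_cancel]
  rw [← mul_pow, inv_mul_cancel₀ hp0.ne', one_pow, mul_one]

lemma p_pow_lt_A {j : ℕ} (hj : (j : ℝ) < D.r) : (p : ℝ) ^ j < D.A := by
  rw [← Real.rpow_natCast]; exact Real.rpow_lt_rpow_of_exponent_lt (one_lt_p p) hj

lemma p_pow_le_A {j : ℕ} (hj : (j : ℝ) ≤ D.r) : (p : ℝ) ^ j ≤ D.A := by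
  rw [← Real.rpow_natCast]; exact Real.rpow_le_rpow_of_exponent_le (one_lt_p p).le hj

lemma crB_etaD {j : ℕ} (hj : (j : ℝ) < D.r) : CrB D.r (D.K * D.K) (eta p D.lam (D.d - j)) := by
  refine crB_eta D.hr.le ?_
  have hA := D.A_pos
  rw [D.norm_lam_sub (D.le_d hj.le)]
  change D.A⁻¹ ^ 2 * (p : ℝ) ^ j * D.A < 1
  have := D.p_pow_lt_A hj
  calc _ = (p : ℝ) ^ j / D.A := by field_simp
    _ < 1 := (div_lt_one hA).2 this

lemma T_monomial (m : ℕ) {j : ℕ} (hj : j ≤ D.d) : D.T (-m) 0 (monomialFun p L j) =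
    D.T (-m) 0 (blk (mon p L j)) + (D.chi ^ (-m : ℤ) * (p : L) ^ (m * j) * D.lam ^ (m + 1) *
      (p : L) ^ ((m + 1) * (D.d - j))) • D.Inf (PL L 0 (m + 1) (eta p D.lam (D.d - j))) := by
  have hp0 := pQ_ne_zero (p := p)
  have hpL := natCast_prime_ne_zero p L
  ext z
  rw [Pi.add_apply, Pi.smul_apply, smul_eq_mul]
  by_cases hz : ‖z - 0‖ ≤ (p : ℝ) ^ (-(-(m : ℤ)))
  · rw [D.Inf_PL_zero_of_lt, mul_zero, add_zero]
    · obtain ⟨x, rfl⟩ := exists_coset hz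
      rw [T_blk_coset, T_apply, monomialFun, mon]
      congr 3
      rw [zero_add, sub_zero, mul_div_cancel_left₀ _ (zpow_ne_zero _ hp0)]
    · rw [sub_zero, neg_neg, zpow_natCast] at hz
      exact hz.trans_lt (pow_lt_pow_right₀ (one_lt_p p) (Nat.lt_succ_self m))
  · rw [T_blk_of_not _ _ _ _ hz, zero_add, T_apply, monomialFun, sub_zero]
    rw [sub_zero, neg_neg, not_le] at hz
    have hz0 : z ≠ 0 := by
      rintro rfl; rw [norm_zero] at hz; exact (zpow_pos (p_pos p) _).not_gt hz
    have hv : ‖(z⁻¹ : ℚ_[p]) - 0‖ ≤ (p : ℝ) ^ (-((m : ℤ) + 1)) := by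
      rw [sub_zero, Padic.norm_le_pow_iff_norm_lt_pow_add_one, neg_add, neg_add_cancel_right,
        norm_inv, zpow_neg]
      exact inv_strictAnti₀ (zpow_pos (p_pos p) _) hz
    obtain ⟨x, hx⟩ := exists_coset hv
    rw [zero_add] at hx
    have hx0 : x ≠ 0 := by
      rintro rfl; simp at hx; exact hz0 hx
    have hzx : z = ((p : ℚ_[p]) ^ (m + 1) * x)⁻¹ := by
      rw [← inv_inv z, hx]; norm_cast
    have hxQ : (x : ℚ_[p]) ≠ 0 := by simpa using hx0
    rw [hzx, D.Inf_PL_zero_inv _ hx0, eta, if_neg hx0]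
    have hiL : iotaL p L (x : ℚ_[p]) ≠ 0 := by simpa using hx0
    simp only [iotaL_div, iotaL_inv, iotaL_mul, iotaL_pow, iotaL_zpow, iotaL_natCast]
    obtain ⟨e, he⟩ := Nat.exists_eq_add_of_le hj
    rw [he, Nat.add_sub_cancel_left]
    have hl := D.lam_ne_zero
    have hlv : D.lam ^ (x : ℚ_[p]).valuation ≠ 0 := zpow_ne_zero _ hl
    have hc : D.chi ^ (-m : ℤ) ≠ 0 := zpow_ne_zero _ D.chi_ne
    rw [zpow_neg D.lam, zpow_add₀ hl, zpow_natCast, zpow_neg (p : L), zpow_natCast (p : L)]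
    generalize D.lam ^ (x : ℚ_[p]).valuation = u at *
    generalize D.chi ^ (-m : ℤ) = c at *
    generalize iotaL p L (x : ℚ_[p]) = y at *
    have e1 : ((p : L) ^ (m + 1) * y)⁻¹ / ((p : L) ^ m)⁻¹ = (p * y)⁻¹ := by field_simp; ring
    rw [e1, inv_pow, inv_pow, mul_pow, mul_pow, ← pow_mul, mul_add, pow_add, pow_add y,
      add_mul m 1 j, pow_add, one_mul]
    field_simp
    ring

lemma norm_large_monomial (m : ℕ) {j : ℕ} (hj : (j : ℝ) < D.r) : D.BB (D.A⁻¹ * (p : ℝ) ^ j * D.K ^ 3)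
    ((D.chi ^ (-m : ℤ) * (p : L) ^ (m * j) * D.lam ^ (m + 1) *
      (p : L) ^ ((m + 1) * (D.d - j))) • D.Inf (PL L 0 (m + 1) (eta p D.lam (D.d - j)))) := by
  have hA := D.A_pos
  have hp0 := p_pos p
  refine (D.BB_Inf (((D.crB_etaD hj).PL D.hr.le) 0 (m + 1))).smul _ |>.mono (le_of_eq ?_)
  have h := D.norm_lam_sub (D.le_d hj.le)
  change _ * (D.K * D.A ^ (m + 1) * (D.K * D.K)) = _
  rw [norm_mul, norm_mul, norm_mul, norm_chi_zpow, norm_pow, norm_pow, norm_pow,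
    norm_natCast_prime p L, mul_comm (m + 1) (D.d - j), pow_mul (p : ℝ)⁻¹ (D.d - j), neg_neg, zpow_natCast,
    mul_assoc (D.A ^ m * _), ← mul_pow, h]
  rw [mul_comm m j, pow_mul, mul_pow, inv_pow, ← pow_mul, mul_comm 2, pow_mul, inv_pow, inv_pow]
  field_simp
  ring

variable {D}

/-- Functionals killing the special functions are uniformly bounded on all blocks. -/
theorem Dual.exists_CN {R : (ℚ_[p] → L) →ₗ[L] L} (hR : D.Dual R) : ∃ c, D.CN R c := by
  have hA := D.A_pos
  have hK := D.one_le_K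
  have hp0 := p_pos p
  have hr := D.hr.le
  have hB := hR.1
  obtain ⟨⟨C1, hC1, h1⟩, h2⟩ := hR
  have key : ∃ c, 0 ≤ c ∧ ∀ (m : ℕ) (N : ℕ), ‖R (D.T (-m) 0 (blk (bin p L N)))‖ ≤ c * wt D.r N := by
    refine ⟨C1 * (D.A * D.K ^ 3) * D.K + C1 * D.K ^ 3, by positivity, fun m N => ?_⟩
    set J := ⌈D.r⌉₊ with hJ
    have hJlt : ∀ j < J, (j : ℝ) < D.r := fun j hj => Nat.lt_ceil.1 hj
    have hb : bin p L N = binTail p L J N + ∑ j ∈ Finset.range J, (binPoly L N).coeff j • mon p L j := by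
      rw [binTail, sub_add_cancel]
    have hw := wt_pos D.r N
    rw [hb, blk_add, blk_sum, map_add, map_add, map_sum, map_sum]
    refine norm_add_le_of ?_ (norm_sum_le_of (by positivity) fun j hj => ?_)
    · have := norm_flat_block hC1 h1 (m + 1) (binTail p L J N) (D.K * D.A ^ (Nat.log p N)) fun i => by
        rw [mul_div_assoc]
        exact crB_binTail hr (Nat.lt_pow_succ_log_self hp.out.one_lt N) (fun m hm => (hJlt m hm).le)
          (Nat.le_ceil _) i
      rw [show (1 - ((m + 1 : ℕ) : ℤ)) = -(m : ℤ) by push_cast; ring] at this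
      refine this.trans ?_
      have h4 : D.A ^ (Nat.log p N) ≤ wt D.r N := pow_log_le_wt hr N
      calc _ ≤ C1 * (D.A * D.K ^ 3) * (D.K * wt D.r N) := by gcongr
        _ = C1 * (D.A * D.K ^ 3) * D.K * wt D.r N + 0 := by ring
        _ ≤ C1 * (D.A * D.K ^ 3) * D.K * wt D.r N + C1 * D.K ^ 3 * wt D.r N := by gcongr; positivity
        _ = _ := by ring
    · have hjr := hJlt j (Finset.mem_range.1 hj)
      have h5 : R (D.T (-m) 0 (monomialFun p L j)) = 0 := by
        have : D.T (-m) 0 (monomialFun p L j) =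
            (D.chi ^ (-m : ℤ) * (p : L) ^ (m * j)) • monomialFun p L j := by
          ext z
          simp only [T_apply, monomialFun, Pi.smul_apply, smul_eq_mul, sub_zero, iotaL_div, iotaL_zpow,
            iotaL_natCast]
          rw [zpow_neg (p : L), zpow_natCast, div_inv_eq_mul, mul_pow, ← pow_mul]; ring
        rw [this, map_smul, (h2 j hjr).1, smul_zero]
      rw [D.T_monomial m (D.le_d hjr.le), map_add] at h5
      have h6 := h1 _ _ (D.norm_large_monomial m hjr)
      rw [blk_smul, map_smul, map_smul, norm_smul, eq_neg_of_add_eq_zero_left h5, norm_neg]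
      have h7 := norm_coeff_binPoly_le p (L := L) hr N hjr.le
      have h8 : D.A⁻¹ * (p : ℝ) ^ j ≤ 1 := by
        rw [inv_mul_le_iff₀ hA, mul_one]; exact D.p_pow_le_A hjr.le
      calc _ ≤ wt D.r N * (C1 * (D.A⁻¹ * (p : ℝ) ^ j * D.K ^ 3)) := by gcongr
        _ ≤ wt D.r N * (C1 * (1 * D.K ^ 3)) := by gcongr
        _ = 0 + C1 * D.K ^ 3 * wt D.r N := by ring
        _ ≤ C1 * (D.A * D.K ^ 3) * D.K * wt D.r N + C1 * D.K ^ 3 * wt D.r N := by gcongr; positivity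
        _ = _ := by ring
  obtain ⟨c, hc, hcN⟩ := key
  refine ⟨c * D.K + C1 * (D.K * D.K), fun n b h C hh => ?_⟩
  have hC := hh.nonneg
  by_cases hn : 1 ≤ n ∨ (p : ℝ) ^ (-n) < ‖b‖
  · refine (h1 _ _ (D.BB_block hh b hn)).trans ?_
    calc _ = 0 + C1 * (D.K * D.K) * C := by ring
      _ ≤ c * D.K * C + C1 * (D.K * D.K) * C := by gcongr; positivity
      _ = _ := by ring
  · push Not at hn
    obtain ⟨m, rfl⟩ : ∃ m : ℕ, n = -m := ⟨(-n).toNat, by omega⟩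
    obtain ⟨x, hx⟩ := exists_coset (b := 0) (by rw [sub_zero]; exact hn.2)
    rw [zero_add] at hx
    have h3 : D.T (-m) b (blk h) = D.T (-m) 0 (blk (PL L x 0 h)) := by
      have := D.T_blk_eq_blk_PL 0 x h
      rw [pow_zero, one_smul] at this
      rw [← this, T_T, hx]; simp
    rw [h3]
    obtain ⟨C0, hC0⟩ := hB.blkF (-m) 0
    have h4 := norm_functional_le hc (D.blkF R (-m) 0) hC0 (fun N => hcN m N) (hh.PL hr x 0)
    rw [blkF_apply, pow_zero, mul_one] at h4
    refine h4.trans ?_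
    change c * (D.K * C) ≤ _
    calc _ = c * D.K * C + 0 := by ring
      _ ≤ c * D.K * C + C1 * (D.K * D.K) * C := by gcongr; positivity
      _ = _ := by ring

end Par

end

section

variable {p : ℕ} [hp : Fact p.Prime]
variable {L : Type} [NontriviallyNormedField L] [NormedAlgebra ℚ_[p] L] [IsUltrametricDist L]
  [CompleteSpace L]

lemma PL_sum {ι : Type*} (b : ℤ_[p]) (n : ℕ) (s : Finset ι) (f : ι → ℤ_[p] → L) :
    PL L b n (∑ i ∈ s, f i) = ∑ i ∈ s, PL L b n (f i) := by
  obtain ⟨c, σ, h⟩ := PL_eq_mul (L := L) b n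
  ext x
  simp only [h, Finset.sum_apply, Finset.mul_sum]

lemma PL_PL (b c : ℤ_[p]) (n m : ℕ) (f : ℤ_[p] → L) :
    PL L b n (PL L c m f) = PL L (b + (p : ℤ_[p]) ^ n * c) (n + m) f := by
  ext x
  by_cases h : ∃ w, x = b + (p : ℤ_[p]) ^ n * w
  · obtain ⟨w, rfl⟩ := h
    rw [PL_apply]
    by_cases h' : ∃ v, w = c + (p : ℤ_[p]) ^ m * v
    · obtain ⟨v, rfl⟩ := h'
      rw [PL_apply, show b + (p : ℤ_[p]) ^ n * (c + (p : ℤ_[p]) ^ m * v) =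
        b + (p : ℤ_[p]) ^ n * c + (p : ℤ_[p]) ^ (n + m) * v by ring, PL_apply]
    · rw [PL_of_not _ h', PL_of_not]
      rintro ⟨v, hv⟩
      refine h' ⟨v, coset_inj (b := b) (n := n) ?_⟩
      rw [hv]; ring
  · rw [PL_of_not _ h, PL_of_not]
    rintro ⟨v, hv⟩
    exact h ⟨c + (p : ℤ_[p]) ^ m * v, by rw [hv]; ring⟩

lemma PL_zero_zero (f : ℤ_[p] → L) : PL L 0 0 f = f := by
  ext x
  have := PL_apply (L := L) 0 0 f x
  simpa using this

namespace Par

variable (D : Par p L)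

/-- Functions on `ℤ_p` that are flat at the origin. -/
def Flat (K0 : ℝ) (h : ℤ_[p] → L) : Prop :=
  (∀ i, CrB D.r (K0 / D.A ^ i) (fun x => h ((p : ℤ_[p]) ^ i * x))) ∧
  ∀ ε > 0, ∃ I, CrB D.r (ε / D.A ^ I) (fun x => h ((p : ℤ_[p]) ^ I * x))

/-- `Inf` as a linear map. -/
def InfL : (ℤ_[p] → L) →ₗ[L] (ℚ_[p] → L) := ⟨⟨D.Inf, D.Inf_add⟩, D.Inf_smul⟩

lemma InfL_apply (h : ℤ_[p] → L) : D.InfL h = D.Inf h := rfl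

lemma flat_mon {m : ℕ} (hm : D.r < m) : D.Flat D.K (mon p L m) := by
  have hA := D.A_pos
  have hp0 := p_pos p
  have hK := D.one_le_K
  have hlt : D.A < (p : ℝ) ^ m := by
    rw [← Real.rpow_natCast]; exact Real.rpow_lt_rpow_of_exponent_lt (one_lt_p p) hm
  have h1 : ∀ i, CrB D.r (D.K / ((p : ℝ) ^ m) ^ i) (fun x => mon p L m ((p : ℤ_[p]) ^ i * x)) := by
    intro i
    have := (crB_mon (p := p) (L := L) D.hr.le m).smul ((p : L) ^ (m * i))
    rw [norm_pow, norm_natCast_prime p L, pow_mul, inv_pow, inv_pow, inv_mul_eq_div] at this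
    refine (congrArg (CrB D.r _) (funext fun x => ?_)).mp this
    simp only [mon, Pi.smul_apply, smul_eq_mul]
    push_cast
    simp only [iotaL_mul, iotaL_pow, iotaL_natCast, mul_pow]
    ring
  refine ⟨fun i => (h1 i).mono ?_, fun ε hε => ?_⟩
  · gcongr
  · obtain ⟨I, hI⟩ := exists_pow_lt_of_lt_one (div_pos hε D.K_pos) ((div_lt_one (by positivity)).2 hlt)
    refine ⟨I, (h1 I).mono ?_⟩
    rw [div_pow, lt_div_iff₀ D.K_pos] at hI
    rw [div_le_div_iff₀ (by positivity) (by positivity)]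
    rw [div_mul_eq_mul_div, div_lt_iff₀ (by positivity)] at hI
    linarith

variable {D}

lemma norm_Inf_flat {R : (ℚ_[p] → L) →ₗ[L] L} {c : ℝ} (hB : D.Bdd R) (hR : D.CN R c) {K0 : ℝ}
    {h : ℤ_[p] → L} (hh : D.Flat K0 h) : ‖R (D.Inf h)‖ ≤ c * (D.A * D.K ^ 2) * K0 := by
  have hA := D.A_pos
  have hK := D.one_le_K
  have hc := hR.nonneg
  obtain ⟨C1, hC1, h1⟩ := hB
  have hK0 : 0 ≤ K0 := by have := (hh.1 0).nonneg; simpa using this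
  have step : ∀ I, ‖R (D.Inf h)‖ ≤ max (c * (D.A * D.K ^ 2) * K0)
      ‖R (D.Inf (PL L 0 I fun x => h ((p : ℤ_[p]) ^ I * x)))‖ := by
    intro I
    induction I with
    | zero => simp [PL_zero_zero]
    | succ I ih =>
      refine ih.trans (max_le (le_max_left _ _) ?_)
      rw [eq_sum_PL (fun x => h ((p : ℤ_[p]) ^ I * x)) 1, PL_sum, Inf_sum, map_sum]
      refine norm_sum_le_of (by positivity) fun a ha => ?_
      have hap : a < p := by simpa using ha
      rw [PL_PL]
      rcases Nat.eq_zero_or_pos a with rfl | ha0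
      · refine le_trans (le_of_eq ?_) (le_max_right _ _)
        congr 3
        simp only [Nat.cast_zero, mul_zero, add_zero, zero_add, pow_succ, pow_zero, one_mul, mul_assoc]
      · refine le_trans ?_ (le_max_left _ _)
        have h5 : ‖(a : ℤ_[p])‖ = 1 := by
          have h6 : ¬ p ∣ a := fun h => absurd (Nat.le_of_dvd ha0 h) (by omega)
          exact (PadicInt.norm_natCast_eq_one_iff (p := p) (n := a)).2
            ((Nat.Prime.coprime_iff_not_dvd hp.out).2 h6)
        obtain ⟨n, b, k, c0, m, hk, -, hkh⟩ := D.exists_block_Inf (c := 0 + (p : ℤ_[p]) ^ I * a) (N := I + 1) (by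
          rw [zero_add, norm_mul, h5, mul_one, PadicInt.norm_p_pow]
          exact zpow_lt_zpow_right₀ (one_lt_p p) (by push_cast; linarith))
        rw [hkh, map_smul, norm_smul, hk]
        have h7 := hR n b _ _ (CrB.mobW D.hr.le ((hh.1 I).affine D.hr.le (a : ℤ_[p]) ((p : ℤ_[p]) ^ 1)) D.d c0 m)
        calc _ ≤ D.A ^ (I + 1) * (c * (D.K * (D.K * (K0 / D.A ^ I)))) := by gcongr; exact h7
          _ = _ := by rw [pow_succ]; field_simp
  by_contra hlt
  rw [not_le] at hlt
  have hpos : 0 < ‖R (D.Inf h)‖ := lt_of_le_of_lt (by positivity) hlt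
  obtain ⟨I, hI⟩ := hh.2 (‖R (D.Inf h)‖ / (2 * ((C1 + 1) * D.K))) (by positivity)
  rcases le_max_iff.1 (step I) with h2 | h2
  · exact hlt.not_ge h2
  · have h3 := h1 _ _ (D.BB_Inf (hI.PL D.hr.le 0 I))
    change _ ≤ C1 * (D.K * D.A ^ I * _) at h3
    have h4 : C1 * (D.K * D.A ^ I * (‖R (D.Inf h)‖ / (2 * ((C1 + 1) * D.K)) / D.A ^ I)) =
        (C1 / (2 * (C1 + 1))) * ‖R (D.Inf h)‖ := by field_simp
    rw [h4] at h3
    have h5 : C1 / (2 * (C1 + 1)) < 1 := by rw [div_lt_one (by positivity)]; linarith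
    nlinarith

/-- The special function at a point of `pℤ_p`, decomposed. -/
lemma spec_eq (a : ℤ_[p]) {j : ℕ} (hj : j ≤ D.d) : D.spec ((p : ℚ_[p]) * a) j =
    D.chi⁻¹ • D.T 1 0 (blk ((D.lam * (p : L) ^ (D.d - j)) • fun x => eta p D.lam (D.d - j) (-a + 1 * x))) +
    D.Inf (fun y => iotaL p L y ^ j * iotaL p L ((1 - (p : ℤ_[p]) * a * y : ℤ_[p]) : ℚ_[p]) ^ (D.d - j)) := by
  have hp0 := pQ_ne_zero (p := p)
  have hl := D.lam_ne_zero
  have key := D.eq_block_add_Inf (f := D.spec ((p : ℚ_[p]) * a) j)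
    (g := fun y => iotaL p L y ^ j * iotaL p L ((1 - (p : ℤ_[p]) * a * y : ℤ_[p]) : ℚ_[p]) ^ (D.d - j)) ?_
  · rw [key]
    congr 4
    ext x
    simp only [Pi.smul_apply, smul_eq_mul, spec, eta]
    by_cases hx : x = a
    · subst hx; simp
    · have h1 : (p : ℚ_[p]) * x ≠ (p : ℚ_[p]) * a := fun h => hx (PadicInt.ext (mul_left_cancel₀ hp0 h))
      have h2 : -a + 1 * x ≠ 0 := fun h => hx (by linear_combination h)
      have h3 : ((-a + 1 * x : ℤ_[p]) : ℚ_[p]) ≠ 0 := fun h => h2 (PadicInt.ext h)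
      rw [if_neg h1, if_neg h2, show (p : ℚ_[p]) * x - (p : ℚ_[p]) * a = (p : ℚ_[p]) * ((-a + 1 * x : ℤ_[p]) : ℚ_[p]) by
        push_cast; ring, Padic.valuation_mul hp0 h3, Padic.valuation_p, zpow_add₀ hl, zpow_one, iotaL_mul,
        mul_pow, iotaL_natCast]
      ring
  · intro y hy
    have hyQ : (y : ℚ_[p]) ≠ 0 := by simpa using hy
    have hn : ‖(1 - (p : ℤ_[p]) * a * y : ℤ_[p])‖ = 1 := by
      have := norm_one_add_p_mul (p := p) (-(a * y))
      rw [← this]; congr 1; ring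
    have hn' : ((1 - (p : ℤ_[p]) * a * y : ℤ_[p]) : ℚ_[p]) ≠ 0 := by
      rw [← norm_ne_zero_iff, ← PadicInt.norm_def, hn]; exact one_ne_zero
    have e1 : (y : ℚ_[p])⁻¹ - (p : ℚ_[p]) * a = ((1 - (p : ℤ_[p]) * a * y : ℤ_[p]) : ℚ_[p]) * (y : ℚ_[p])⁻¹ := by
      push_cast; field_simp
    have hne : (y : ℚ_[p])⁻¹ ≠ (p : ℚ_[p]) * a := by
      rw [← sub_ne_zero, e1]; exact mul_ne_zero hn' (inv_ne_zero hyQ)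
    have hv : ((1 - (p : ℤ_[p]) * a * y : ℤ_[p]) : ℚ_[p]).valuation = 0 :=
      valuation_of_norm (by rw [← PadicInt.norm_def, hn]; simp)
    rw [spec, if_neg hne, e1, Padic.valuation_mul hn' (inv_ne_zero hyQ), hv, zero_add, Padic.valuation_inv,
      iotaL_mul, iotaL_inv, mul_pow, zpow_neg]
    have hlv : D.lam ^ (y : ℚ_[p]).valuation ≠ 0 := zpow_ne_zero _ hl
    have hiL : iotaL p L (y : ℚ_[p]) ≠ 0 := by simpa using hy
    obtain ⟨e, he⟩ := Nat.exists_eq_add_of_le hj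
    rw [he, Nat.add_sub_cancel_left]
    generalize iotaL p L ((1 - (p : ℤ_[p]) * a * y : ℤ_[p]) : ℚ_[p]) = w
    generalize iotaL p L (y : ℚ_[p]) = y' at *
    generalize D.lam ^ (y : ℚ_[p]).valuation = l at *
    rw [pow_add, inv_pow]
    field_simp

end Par

end

section

variable {p : ℕ} [hp : Fact p.Prime]
variable {L : Type} [NontriviallyNormedField L] [NormedAlgebra ℚ_[p] L] [IsUltrametricDist L]
  [CompleteSpace L]

namespace Par

variable (D : Par p L)

variable {D}

lemma norm_Inf_spec {R : (ℚ_[p] → L) →ₗ[L] L} {c : ℝ} (hD : D.Dual R) (hR : D.CN R c) (a : ℤ_[p]) {j : ℕ}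
    (hj : (j : ℝ) < D.r) :
    ‖R (D.Inf (fun y => iotaL p L y ^ j *
      iotaL p L ((1 - (p : ℤ_[p]) * a * y : ℤ_[p]) : ℚ_[p]) ^ (D.d - j)))‖ ≤ D.K ^ 3 * c := by
  have hA := D.A_pos
  have hK := D.one_le_K
  have hc := hR.nonneg
  have h := (hD.2 j hj).2 ((p : ℚ_[p]) * a)
  rw [spec_eq a (D.le_d hj.le), map_add, map_smul] at h
  rw [eq_neg_of_add_eq_zero_right h, norm_neg, norm_smul, norm_inv, D.norm_chi', inv_inv]
  have h1 := hR 1 0 _ _ ((((D.crB_etaD hj).affine D.hr.le (-a) 1)).smul (D.lam * (p : L) ^ (D.d - j)))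
  rw [norm_mul, norm_pow, norm_natCast_prime p L, D.norm_lam_sub (D.le_d hj.le)] at h1
  have h2 := D.p_pow_le_A hj.le
  calc _ ≤ D.A * (c * (D.A⁻¹ ^ 2 * (p : ℝ) ^ j * (D.K * (D.K * D.K)))) := by gcongr; exact h1
    _ ≤ D.A * (c * (D.A⁻¹ ^ 2 * D.A * (D.K * (D.K * D.K)))) := by gcongr
    _ = _ := by field_simp

lemma norm_Inf_mon_lt {R : (ℚ_[p] → L) →ₗ[L] L} {c : ℝ} (hD : D.Dual R) (hR : D.CN R c) {j : ℕ}
    (hj : (j : ℝ) < D.r) : ‖R (D.Inf (mon p L j))‖ ≤ D.K ^ 3 * c := by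
  have h := norm_Inf_spec hD hR 0 hj
  refine (congrArg (fun t => ‖R (D.Inf t)‖ ≤ D.K ^ 3 * c) (funext fun y => ?_)).mp h
  simp [mon]

lemma exists_norm_Inf_mon_eq (D : Par p L) {j : ℕ} (hj : (j : ℝ) = D.r) :
    ∃ C, ∀ (R : (ℚ_[p] → L) →ₗ[L] L) (c : ℝ), D.Dual R → D.CN R c → ‖R (D.Inf (mon p L j))‖ ≤ C * c := by
  have hA := D.A_pos
  have hK := D.one_le_K
  have hjpos : 0 < j := by
    have := D.hr; rw [← hj] at this; exact_mod_cast this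
  obtain ⟨i, rfl⟩ : ∃ i, j = i + 1 := ⟨j - 1, by omega⟩
  have hi : (i : ℝ) < D.r := by rw [← hj]; push_cast; linarith
  have hid := D.le_d hj.le
  obtain ⟨e, he⟩ : ∃ e, D.d - i = e + 1 := ⟨D.d - i - 1, by omega⟩
  have : CharZero L := charZero_of_injective_algebraMap (algebraMap ℚ_[p] L).injective
  have hk : ((e + 1 : ℕ) : L) * (p : L) ≠ 0 :=
    mul_ne_zero (by exact_mod_cast Nat.succ_ne_zero e) (natCast_prime_ne_zero p L)
  refine ⟨‖((e + 1 : ℕ) : L) * (p : L)‖⁻¹ * (D.K ^ 3 + (D.A * D.K ^ 2) * D.K), fun R c hD hR => ?_⟩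
  have hc := hR.nonneg
  have h1 := norm_Inf_spec hD hR 1 hi
  have h2 := norm_Inf_mon_lt hD hR hi
  have expand : (fun y : ℤ_[p] => iotaL p L y ^ i *
      iotaL p L ((1 - (p : ℤ_[p]) * 1 * y : ℤ_[p]) : ℚ_[p]) ^ (D.d - i)) =
      mon p L i - (((e + 1 : ℕ) : L) * (p : L)) • mon p L (i + 1) +
      ∑ m ∈ Finset.range e, ((-(p : L)) ^ (m + 2) * ((e + 1).choose (m + 2) : L)) • mon p L (i + m + 2) := by
    ext y
    simp only [Pi.add_apply, Pi.sub_apply, Pi.smul_apply, Finset.sum_apply, smul_eq_mul, mon, he]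
    push_cast
    simp only [iotaL_sub, iotaL_mul, iotaL_one, iotaL_natCast, mul_one]
    generalize iotaL p L (y : ℚ_[p]) = Y
    rw [sub_eq_neg_add, add_pow]
    simp only [one_pow, mul_one]
    rw [Finset.sum_range_succ', Finset.sum_range_succ', mul_add, mul_add, Finset.mul_sum]
    simp only [Nat.choose_zero_right, zero_add, Nat.choose_one_right]
    rw [show (∑ m ∈ Finset.range e, Y ^ i * ((-((p : L) * Y)) ^ (m + 1 + 1) * ((e + 1).choose (m + 1 + 1) : L))) =
      ∑ m ∈ Finset.range e, (-(p : L)) ^ (m + 2) * ((e + 1).choose (m + 2) : L) * Y ^ (i + m + 2) from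
      Finset.sum_congr rfl fun m _ => by ring]
    push_cast
    ring
  rw [expand, ← InfL_apply, map_add, map_sub, map_smul, map_sum, map_add, map_sub, map_smul, map_sum] at h1
  simp only [map_smul, InfL_apply] at h1
  have h3 : ‖∑ m ∈ Finset.range e, ((-(p : L)) ^ (m + 2) * ((e + 1).choose (m + 2) : L)) •
      R (D.Inf (mon p L (i + m + 2)))‖ ≤ c * (D.A * D.K ^ 2) * D.K := by
    refine norm_sum_le_of (by positivity) fun m _ => ?_
    have h4 := norm_Inf_flat hD.1 hR (D.flat_mon (m := i + m + 2) (by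
      rw [← hj]; push_cast; have : (0 : ℝ) ≤ m := m.cast_nonneg
      linarith))
    rw [norm_smul]
    have h5 : ‖(-(p : L)) ^ (m + 2) * ((e + 1).choose (m + 2) : L)‖ ≤ 1 := by
      rw [norm_mul, norm_pow, norm_neg]
      exact mul_le_one₀ (pow_le_one₀ (norm_nonneg _) (norm_natCast_le_one p L p)) (norm_nonneg _)
        (norm_natCast_le_one p L _)
    exact (mul_le_of_le_one_left (norm_nonneg _) h5).trans h4
  set X := R (D.Inf (mon p L i))
  set Y := R (D.Inf (mon p L (i + 1)))
  set Z := ∑ m ∈ Finset.range e, ((-(p : L)) ^ (m + 2) * ((e + 1).choose (m + 2) : L)) •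
      R (D.Inf (mon p L (i + m + 2)))
  set k := ((e + 1 : ℕ) : L) * (p : L)
  set W := X - k • Y + Z
  have hY : Y = k⁻¹ * (X + Z - W) := by
    simp only [W, smul_eq_mul]; field_simp; ring
  rw [hY, norm_mul, norm_inv, mul_assoc]
  refine mul_le_mul_of_nonneg_left ?_ (inv_nonneg.2 (norm_nonneg _))
  have hb1 : D.K ^ 3 * c ≤ (D.K ^ 3 + D.A * D.K ^ 2 * D.K) * c := by gcongr; linarith [show 0 ≤ D.A * D.K ^ 2 * D.K by positivity]
  have hb2 : c * (D.A * D.K ^ 2) * D.K ≤ (D.K ^ 3 + D.A * D.K ^ 2 * D.K) * c := by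
    nlinarith [show 0 ≤ D.K ^ 3 * c by positivity]
  exact norm_sub_le_of (norm_add_le_of (h2.trans hb1) (h3.trans hb2)) (h1.trans hb1)

lemma exists_norm_Inf_bin (D : Par p L) : ∃ C, 0 ≤ C ∧ ∀ (R : (ℚ_[p] → L) →ₗ[L] L) (c : ℝ), D.Dual R → D.CN R c →
    ∀ N, ‖R (D.Inf (bin p L N))‖ ≤ C * c * wt D.r N := by
  have hA := D.A_pos
  have hK := D.one_le_K
  have hr := D.hr.le
  have hmon : ∃ C, D.K ^ 3 ≤ C ∧ ∀ (R : (ℚ_[p] → L) →ₗ[L] L) (c : ℝ), D.Dual R → D.CN R c →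
      ∀ j : ℕ, (j : ℝ) ≤ D.r → ‖R (D.Inf (mon p L j))‖ ≤ C * c := by
    by_cases h : ∃ j : ℕ, (j : ℝ) = D.r
    · obtain ⟨j0, hj0⟩ := h
      obtain ⟨C, hC⟩ := exists_norm_Inf_mon_eq D hj0
      refine ⟨max (D.K ^ 3) C, le_max_left _ _, fun R c hD hR j hj => ?_⟩
      rcases hj.lt_or_eq with hlt | heq
      · exact (norm_Inf_mon_lt hD hR hlt).trans (mul_le_mul_of_nonneg_right (le_max_left _ _) hR.nonneg)
      · obtain rfl : j = j0 := by rw [← hj0] at heq; exact_mod_cast heq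
        exact (hC R c hD hR).trans (mul_le_mul_of_nonneg_right (le_max_right _ _) hR.nonneg)
    · exact ⟨D.K ^ 3, le_rfl, fun R c hD hR j hj => norm_Inf_mon_lt hD hR (lt_of_le_of_ne hj fun h' => h ⟨j, h'⟩)⟩
  obtain ⟨C, hCK, hC⟩ := hmon
  have hC0 : 0 ≤ C := le_trans (by positivity) hCK
  refine ⟨max C (D.A * D.K ^ 2 * D.K), le_max_of_le_left hC0, fun R c hD hR N => ?_⟩
  have hc := hR.nonneg
  have hw := wt_pos D.r N
  set J := ⌊D.r⌋₊ + 1 with hJ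
  have hJle : ∀ j < J, (j : ℝ) ≤ D.r := fun j hj => (Nat.le_floor_iff hr).1 (by omega)
  have hrJ : D.r < J := by rw [hJ]; push_cast; exact Nat.lt_floor_add_one _
  have hb : bin p L N = binTail p L J N + ∑ j ∈ Finset.range J, (binPoly L N).coeff j • mon p L j := by
    rw [binTail, sub_add_cancel]
  rw [hb, Inf_add, Inf_sum, map_add, map_sum]
  refine norm_add_le_of ?_ (norm_sum_le_of (by positivity) fun j hj => ?_)
  · have hfl : D.Flat (D.K * D.A ^ (Nat.log p N)) (binTail p L J N) :=
      ⟨fun i => by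
        rw [mul_div_assoc]
        exact crB_binTail hr (Nat.lt_pow_succ_log_self hp.out.one_lt N) hJle hrJ.le i,
      fun ε hε => exists_crB_binTail_le hr N hrJ hε⟩
    refine (norm_Inf_flat hD.1 hR hfl).trans ?_
    have h4 : D.A ^ (Nat.log p N) ≤ wt D.r N := pow_log_le_wt hr N
    calc _ ≤ c * (D.A * D.K ^ 2) * (D.K * wt D.r N) := by gcongr
      _ = D.A * D.K ^ 2 * D.K * c * wt D.r N := by ring
      _ ≤ _ := by gcongr; exact le_max_right _ _
  · have hjr := hJle j (Finset.mem_range.1 hj)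
    rw [Inf_smul, map_smul, norm_smul]
    have h7 := norm_coeff_binPoly_le p (L := L) hr N hjr
    calc _ ≤ wt D.r N * (C * c) := by gcongr; exact hC R c hD hR j hjr
      _ = C * c * wt D.r N := by ring
      _ ≤ _ := by gcongr; exact le_max_left _ _

/-- A functional killing the special functions is controlled by its values on blocks. -/
theorem exists_CV (D : Par p L) : ∃ C, 0 ≤ C ∧ ∀ (R : (ℚ_[p] → L) →ₗ[L] L) (c : ℝ), D.Dual R → D.CN R c →
    ∀ (f : ℚ_[p] → L) (C' : ℝ), D.BB C' f → ‖R f‖ ≤ C * c * C' := by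
  have hA := D.A_pos
  obtain ⟨C, hC0, hC⟩ := exists_norm_Inf_bin D
  refine ⟨max C D.A, le_max_of_le_left hC0, fun R c hD hR f C' hf => ?_⟩
  have hc := hR.nonneg
  have hC' := hf.nonneg
  obtain ⟨hf1, g, hg, hfg⟩ := hf
  rw [D.eq_block_add_Inf hfg, map_add, map_smul]
  refine norm_add_le_of ?_ ?_
  · rw [norm_smul, norm_inv, D.norm_chi', inv_inv]
    calc _ ≤ D.A * (c * C') := by gcongr; exact hR 1 0 _ _ hf1
      _ = D.A * c * C' := by ring
      _ ≤ _ := by gcongr; exact le_max_right _ _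
  · obtain ⟨C1, hC1, h1⟩ := hD.1
    have := norm_functional_le (r := D.r) (C0 := C1) (c := C * c) (by positivity) (R ∘ₗ D.InfL)
      (fun h C hh => h1 _ _ (D.BB_Inf hh)) (fun N => hC R c hD hR N) hg
    calc _ ≤ C * c * C' := this
      _ ≤ _ := by gcongr; exact le_max_left _ _

end Par

end

section

variable {L : Type} [NontriviallyNormedField L] [IsUltrametricDist L] [ProperSpace L]

/-- A nonempty family of pairwise intersecting closed ultrametric balls has a common point. -/
lemma exists_mem_closedBall {ι : Type*} [Nonempty ι] (c : ι → L) (ρ : ι → ℝ) (h0 : ∀ i, 0 ≤ ρ i)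
    (h : ∀ i j, dist (c i) (c j) ≤ max (ρ i) (ρ j)) : ∃ t, ∀ i, dist t (c i) ≤ ρ i := by
  have : (⋂ i, Metric.closedBall (c i) (ρ i)).Nonempty := by
    by_contra hne
    rw [Set.not_nonempty_iff_eq_empty] at hne
    obtain ⟨i0⟩ := ‹Nonempty ι›
    have := (isCompact_closedBall (c i0) (ρ i0)).elim_finite_subfamily_closed
      (fun i => Metric.closedBall (c i) (ρ i)) (fun i => Metric.isClosed_closedBall)
      (by rw [hne, Set.inter_empty])
    obtain ⟨u, hu⟩ := this
    obtain ⟨j, hj, hmin⟩ := Finset.exists_min_image (insert i0 u) ρ ⟨i0, Finset.mem_insert_self _ _⟩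
    have hmem : c j ∈ Metric.closedBall (c i0) (ρ i0) ∩ ⋂ i ∈ u, Metric.closedBall (c i) (ρ i) := by
      have hall : ∀ i ∈ insert i0 u, c j ∈ Metric.closedBall (c i) (ρ i) := fun i hi => by
        rw [Metric.mem_closedBall]
        exact (h j i).trans (max_le (hmin i hi) le_rfl)
      refine ⟨hall i0 (Finset.mem_insert_self _ _), ?_⟩
      simp only [Set.mem_iInter]
      exact fun i hi => hall i (Finset.mem_insert_of_mem hi)
    rw [hu] at hmem
    exact hmem
  obtain ⟨t, ht⟩ := this
  exact ⟨t, fun i => Metric.mem_closedBall.1 (Set.mem_iInter.1 ht i)⟩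

variable {E : Type*} [AddCommGroup E] [Module L E]

lemma exists_extend_step {q : E → ℝ} (q0 : ∀ x, 0 ≤ q x) (qa : ∀ x y, q (x + y) ≤ max (q x) (q y))
    (qs : ∀ (c : L) x, q (c • x) = ‖c‖ * q x) (f : E →ₗ.[L] L) (hf : ∀ x : f.domain, ‖f x‖ ≤ q x)
    (hdom : f.domain ≠ ⊤) : ∃ g : E →ₗ.[L] L, f < g ∧ ∀ x : g.domain, ‖g x‖ ≤ q x := by
  obtain ⟨v, -, hv⟩ := SetLike.exists_of_lt (lt_top_iff_ne_top.2 hdom)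
  have qn : ∀ x, q (-x) = q x := fun x => by
    have := qs (-1) x; rwa [neg_one_smul, norm_neg, norm_one, one_mul] at this
  obtain ⟨t, ht⟩ := exists_mem_closedBall (fun w : f.domain => -f w) (fun w : f.domain => q ((w : E) + v))
    (fun w => q0 _) (fun w w' => by
      rw [dist_eq_norm, show -f w - -f w' = f (w' - w) by rw [f.map_sub]; ring]
      refine (hf _).trans ?_
      have := qa ((w' : E) + v) (-((w : E) + v))
      rw [qn, max_comm] at this
      refine le_trans (le_of_eq ?_) this
      congr 1; push_cast; abel)
  refine ⟨f.supSpanSingleton v t hv, ?_, ?_⟩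
  · refine lt_iff_le_not_ge.2 ⟨f.left_le_sup _ _, fun H => ?_⟩
    replace H := LinearPMap.domain_mono.monotone H
    rw [LinearPMap.domain_supSpanSingleton, sup_le_iff, Submodule.span_le, Set.singleton_subset_iff] at H
    exact hv H.2
  · rintro ⟨z, hz⟩
    obtain ⟨x, hx, y', hy', rfl⟩ := Submodule.mem_sup.1 hz
    obtain ⟨c, rfl⟩ := Submodule.mem_span_singleton.1 hy'
    rw [LinearPMap.supSpanSingleton_apply_mk _ _ _ _ _ hx, RingHom.id_apply]
    by_cases hc : c = 0
    · subst hc; simpa using hf ⟨x, hx⟩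
    · have h1 := ht (c⁻¹ • ⟨x, hx⟩)
      rw [dist_eq_norm, sub_neg_eq_add, f.map_smul] at h1
      have h2 : f ⟨x, hx⟩ + c • t = c * (t + c⁻¹ • f ⟨x, hx⟩) := by
        simp only [smul_eq_mul]; field_simp; ring
      rw [h2, norm_mul]
      have h3 : x + c • v = c • (c⁻¹ • x + v) := by rw [smul_add, smul_inv_smul₀ hc]
      change _ ≤ q (x + c • v)
      rw [h3, qs]
      exact mul_le_mul_of_nonneg_left h1 (norm_nonneg _)

/-- The ultrametric Hahn–Banach theorem over a locally compact field. -/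
theorem exists_functional {q : E → ℝ} (q0 : ∀ x, 0 ≤ q x) (qa : ∀ x y, q (x + y) ≤ max (q x) (q y))
    (qs : ∀ (c : L) x, q (c • x) = ‖c‖ * q x) {x0 : E} (hx0 : 0 < q x0) :
    ∃ φ : E →ₗ[L] L, φ x0 ≠ 0 ∧ ∀ x, ‖φ x‖ ≤ q x := by
  have hne : x0 ≠ 0 := by
    rintro rfl
    have := qs 0 0; rw [zero_smul, norm_zero, zero_mul] at this
    exact hx0.ne' this
  obtain ⟨y, hy0, hy⟩ := NormedField.exists_norm_lt L hx0
  set f : E →ₗ.[L] L := LinearPMap.mkSpanSingleton x0 y hne with hfdef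
  have hf : ∀ x : f.domain, ‖f x‖ ≤ q x := by
    rintro ⟨x, hx⟩
    obtain ⟨c, rfl⟩ := Submodule.mem_span_singleton.1 hx
    have h1 : f ⟨c • x0, hx⟩ = c • y := LinearPMap.mkSpanSingleton'_apply x0 y _ c hx
    rw [h1]
    change _ ≤ q (c • x0)
    rw [qs, norm_smul]
    exact mul_le_mul_of_nonneg_left hy.le (norm_nonneg _)
  set s := {g : E →ₗ.[L] L | ∀ x : g.domain, ‖g x‖ ≤ q x} with hs
  obtain ⟨g, hfg, hg⟩ := zorn_le_nonempty₀ s (by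
    intro c hcs hc y hy
    clear hfdef
    have hdir : DirectedOn (· ≤ ·) c := hc.directedOn
    refine ⟨LinearPMap.sSup c hdir, ?_, fun _ => LinearPMap.le_sSup hdir⟩
    rintro ⟨x, hx⟩
    have cne : c.Nonempty := ⟨y, hy⟩
    have hdir' : DirectedOn (· ≤ ·) (LinearPMap.domain '' c) :=
      directedOn_image.2 (hdir.mono LinearPMap.domain_mono.monotone)
    obtain ⟨_, ⟨g, hgc, rfl⟩, hgx⟩ := (Submodule.mem_sSup_of_directed (cne.image _) hdir').1 hx
    have := hcs hgc ⟨x, hgx⟩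
    rwa [← (LinearPMap.le_sSup hdir hgc).2 (x := ⟨x, hgx⟩) (y := ⟨x, hx⟩) rfl]) f hf
  have htop : g.domain = ⊤ := by
    by_contra hdom
    obtain ⟨g', hlt, hg'⟩ := exists_extend_step q0 qa qs g hg.1 hdom
    exact hlt.not_ge (hg.2 hg' hlt.le)
  refine ⟨g.toFun ∘ₗ (LinearMap.codRestrict g.domain LinearMap.id fun x => htop ▸ Submodule.mem_top), ?_, fun x => hg.1 _⟩
  have h1 := hfg.2 (x := ⟨x0, Submodule.mem_span_singleton_self x0⟩) (y := ⟨x0, htop ▸ Submodule.mem_top⟩) rfl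
  have h2 : f ⟨x0, Submodule.mem_span_singleton_self x0⟩ = y :=
    LinearPMap.mkSpanSingleton'_apply_self x0 y _ _
  rw [h2] at h1
  change g ⟨x0, _⟩ ≠ 0
  rw [← h1]
  exact norm_pos_iff.1 hy0

end

section

variable {p : ℕ} [hp : Fact p.Prime]
variable {L : Type} [NontriviallyNormedField L] [NormedAlgebra ℚ_[p] L] [IsUltrametricDist L]
  [CompleteSpace L]

namespace Par

variable (D : Par p L)

/-- The Banach space as a subspace of all functions. -/
def BS : Submodule L (ℚ_[p] → L) where
  carrier := {f | ∃ C, D.BB C f}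
  add_mem' := by
    rintro f g ⟨C, hC⟩ ⟨C', hC'⟩
    exact ⟨max C C', (hC.mono (le_max_left _ _)).add (hC'.mono (le_max_right _ _))⟩
  zero_mem' := ⟨0, BB.zero le_rfl⟩
  smul_mem' := by
    rintro c f ⟨C, hC⟩
    exact ⟨_, hC.smul c⟩

lemma mem_BS {f : ℚ_[p] → L} : f ∈ D.BS ↔ ∃ C, D.BB C f := Iff.rfl

/-- Elements outside a closed subspace are detected by bounded functionals. -/
theorem exists_separating [ProperSpace L] {S : Submodule L (ℚ_[p] → L)} (hS : S ≤ D.BS)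
    {f0 : ℚ_[p] → L} (hf0 : f0 ∈ D.BS) {ε : ℝ} (hε : 0 < ε) (hcl : ∀ s ∈ S, ¬ D.BB ε (f0 - s)) :
    ∃ R : (ℚ_[p] → L) →ₗ[L] L, D.Bdd R ∧ (∀ s ∈ S, R s = 0) ∧ R f0 ≠ 0 := by
  set X : D.BS → Set ℝ := fun f => {C | ∃ s ∈ S, D.BB C ((f : ℚ_[p] → L) - s)} with hX
  have Xbdd : ∀ f, BddBelow (X f) := fun f => ⟨0, by rintro C ⟨s, -, h⟩; exact h.nonneg⟩
  have Xne : ∀ f, (X f).Nonempty := fun f => by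
    obtain ⟨C, hC⟩ := f.2
    exact ⟨C, 0, S.zero_mem, by simpa using hC⟩
  set q : D.BS → ℝ := fun f => sInf (X f) with hq
  have q0 : ∀ f, 0 ≤ q f := fun f => le_csInf (Xne f) (by rintro C ⟨s, -, h⟩; exact h.nonneg)
  have qa : ∀ f g, q (f + g) ≤ max (q f) (q g) := by
    intro f g
    refine le_of_forall_gt_imp_ge_of_dense fun t ht => ?_
    obtain ⟨C, ⟨s, hs, hC⟩, hlt⟩ := (csInf_lt_iff (Xbdd f) (Xne f)).1 ((le_max_left _ _).trans_lt ht)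
    obtain ⟨C', ⟨s', hs', hC'⟩, hlt'⟩ := (csInf_lt_iff (Xbdd g) (Xne g)).1 ((le_max_right _ _).trans_lt ht)
    refine csInf_le (Xbdd _) ⟨s + s', S.add_mem hs hs', ?_⟩
    have := (hC.mono hlt.le).add (hC'.mono hlt'.le)
    refine (congrArg (D.BB t) ?_).mp this
    push_cast; abel
  have qs1 : ∀ (c : L) f, q (c • f) ≤ ‖c‖ * q f := by
    intro c f
    by_cases hc : c = 0
    · subst hc
      rw [norm_zero, zero_mul]
      exact csInf_le (Xbdd _) ⟨0, S.zero_mem, by simpa using BB.zero le_rfl⟩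
    · have hc' := norm_pos_iff.2 hc
      rw [← div_le_iff₀' hc']
      refine le_csInf (Xne f) ?_
      rintro C ⟨s, hs, hC⟩
      rw [div_le_iff₀' hc']
      refine csInf_le (Xbdd _) ⟨c • s, S.smul_mem c hs, ?_⟩
      have := hC.smul c
      rwa [smul_sub] at this
  have qs : ∀ (c : L) f, q (c • f) = ‖c‖ * q f := by
    intro c f
    refine le_antisymm (qs1 c f) ?_
    by_cases hc : c = 0
    · subst hc; simpa using q0 _
    · have := qs1 c⁻¹ (c • f)
      rw [inv_smul_smul₀ hc, norm_inv] at this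
      have hc' := norm_pos_iff.2 hc
      rwa [inv_mul_eq_div, le_div_iff₀' hc'] at this
  have hpos : 0 < q ⟨f0, hf0⟩ := by
    refine lt_of_lt_of_le hε (le_csInf (Xne _) ?_)
    rintro C ⟨s, hs, hC⟩
    by_contra hlt
    exact hcl s hs (hC.mono (not_le.1 hlt).le)
  obtain ⟨φ, hφ0, hφ⟩ := exists_functional q0 qa qs hpos
  obtain ⟨R, hR⟩ := LinearMap.exists_extend φ
  have hRφ : ∀ f (hf : f ∈ D.BS), R f = φ ⟨f, hf⟩ := fun f hf => by rw [← hR]; rfl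
  refine ⟨R, ⟨1, zero_le_one, fun f C hf => ?_⟩, fun s hs => ?_, ?_⟩
  · rw [hRφ f ⟨C, hf⟩, one_mul]
    exact (hφ _).trans (csInf_le (Xbdd _) ⟨0, S.zero_mem, by simpa using hf⟩)
  · rw [hRφ s (hS hs), ← norm_le_zero_iff]
    exact (hφ _).trans (csInf_le (Xbdd _) ⟨s, hs, by simpa using BB.zero le_rfl⟩)
  · rw [hRφ f0 hf0]; exact hφ0

end Par

end

section

variable {p : ℕ} [hp : Fact p.Prime]
variable {L : Type} [NontriviallyNormedField L] [NormedAlgebra ℚ_[p] L] [IsUltrametricDist L]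
  [CompleteSpace L]

lemma _root_.HasSum.congr_fun' {ι : Type*} {f g : ι → L} {a : L} (h : HasSum g a) (e : ∀ i, f i = g i) :
    HasSum f a := by rwa [funext e]

lemma summable_of_norm_tendsto {ι : Type*} {f : ι → L} (h : Tendsto (fun i => ‖f i‖) cofinite (𝓝 0)) :
    Summable f :=
  NonarchimedeanAddGroup.summable_of_tendsto_cofinite_zero (tendsto_zero_iff_norm_tendsto_zero.2 h)

lemma summable_of_norm_le {f : ℕ → L} {u : ℕ → ℝ} (hu : Tendsto u atTop (𝓝 0)) (h : ∀ n, ‖f n‖ ≤ u n) :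
    Summable f := by
  refine summable_of_norm_tendsto ?_
  rw [Nat.cofinite_eq_atTop]
  exact squeeze_zero (fun _ => norm_nonneg _) h hu

/-- Ultrametric dominated convergence for series. -/
lemma tendsto_tsum_of_ultrametric {f : ℕ → ℕ → L} {g : ℕ → L} {u : ℕ → ℝ} (hu : Tendsto u atTop (𝓝 0))
    (hf : ∀ m N, ‖f m N‖ ≤ u N) (hg : ∀ N, Tendsto (fun m => f m N) atTop (𝓝 (g N))) :
    Tendsto (fun m => ∑' N, f m N) atTop (𝓝 (∑' N, g N)) := by
  have hgu : ∀ N, ‖g N‖ ≤ u N := fun N => le_of_tendsto (hg N).norm (Eventually.of_forall fun m => hf m N)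
  have sf := fun m => summable_of_norm_le hu (hf m)
  have sg := summable_of_norm_le hu hgu
  rw [Metric.tendsto_atTop]
  intro ε hε
  obtain ⟨N0, hN0⟩ := (hu.eventually (ge_mem_nhds (half_pos hε))).exists_forall_of_atTop
  have h1 : ∀ᶠ m in atTop, ∀ N ∈ Finset.range N0, ‖f m N - g N‖ ≤ ε / 2 := by
    rw [Filter.eventually_all_finset]
    intro N _
    have := ((hg N).sub_const (g N)).norm
    rw [sub_self, norm_zero] at this
    exact this.eventually (ge_mem_nhds (half_pos hε))
  obtain ⟨M, hM⟩ := h1.exists_forall_of_atTop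
  refine ⟨M, fun m hm => ?_⟩
  rw [dist_eq_norm]
  refine lt_of_le_of_lt (norm_hasSum_le_of (half_pos hε).le (fun N => ?_) ((sf m).hasSum.sub sg.hasSum)) (half_lt_self hε)
  by_cases hN : N < N0
  · exact hM m hm N (Finset.mem_range.2 hN)
  · exact norm_sub_le_of ((hf m N).trans (hN0 N (not_lt.1 hN))) ((hgu N).trans (hN0 N (not_lt.1 hN)))

lemma wt_mono {r : ℝ} (hr : 0 ≤ r) {m n : ℕ} (h : m ≤ n) : wt r m ≤ wt r n :=
  Real.rpow_le_rpow (by positivity) (by have : (m : ℝ) ≤ n := by exact_mod_cast h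
                                        linarith) hr

lemma wt_mul_wt_le {r s : ℝ} (hr : 0 ≤ r) (hs : 0 ≤ s) (i j : ℕ) : wt r i * wt s j ≤ wt (r + s) (i + j) := by
  have h : wt (r + s) (i + j) = wt r (i + j) * wt s (i + j) := Real.rpow_add (by positivity) r s
  rw [h]
  exact mul_le_mul (wt_mono hr (Nat.le_add_right _ _)) (wt_mono hs (Nat.le_add_left _ _)) (wt_pos _ _).le (wt_pos _ _).le

/-- The space of functions of class `C^r` as a subspace of all functions. -/
def CrS (p : ℕ) [Fact p.Prime] (L : Type) [NontriviallyNormedField L] [NormedAlgebra ℚ_[p] L] [IsUltrametricDist L]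
    [CompleteSpace L] (r : ℝ) : Submodule L (ℤ_[p] → L) where
  carrier := {h | Cr r h}
  add_mem' := fun {f g} hf hg =>
    ((hf.crB.mono (le_max_left _ (crNorm p L r g))).add (hg.crB.mono (le_max_right _ _))).1
  zero_mem' := (CrB.zero (r := r) le_rfl).1
  smul_mem' := fun c _ hf => (hf.crB.smul c).1

lemma mc_del_pow (N i : ℕ) (h : ℤ_[p] → L) : mc p L N ((del p L ^ i) h) = mc p L (N + i) h := by
  rw [mc_apply, mc_apply, pow_add]; rfl

lemma Cr.continuous_del_pow {h : ℤ_[p] → L} (hh : Continuous h) (i : ℕ) : Continuous ((del p L ^ i) h) := by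
  induction i with
  | zero => simpa using hh
  | succ i ih =>
    rw [pow_succ']
    change Continuous (fun x => (del p L ^ i) h (x + 1) - (del p L ^ i) h x)
    fun_prop

lemma CrB.del_pow {r C : ℝ} (hr : 0 ≤ r) {h : ℤ_[p] → L} (hh : CrB r C h) (i : ℕ) : CrB r C ((del p L ^ i) h) := by
  have key : ∀ N, wt r N * ‖mc p L N ((del p L ^ i) h)‖ ≤ wt r (N + i) * ‖mc p L (N + i) h‖ := fun N => by
    rw [mc_del_pow]
    exact mul_le_mul_of_nonneg_right (wt_mono hr (Nat.le_add_right _ _)) (norm_nonneg _)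
  refine ⟨⟨Cr.continuous_del_pow hh.1.1 i, ?_⟩, fun N => (key N).trans (hh.2 _)⟩
  exact squeeze_zero (fun N => mul_nonneg (wt_pos _ _).le (norm_nonneg _)) key
    ((tendsto_add_atTop_iff_nat i).2 hh.1.2)

lemma Cr.del_pow {r : ℝ} (hr : 0 ≤ r) {h : ℤ_[p] → L} (hh : Cr r h) (i : ℕ) : Cr r ((del p L ^ i) h) :=
  (hh.crB.del_pow hr i).1

/-- Power series whose coefficients grow at most like `C (N+1)^r`. -/
def Gr (r C : ℝ) (F : PowerSeries L) : Prop := ∀ N, ‖PowerSeries.coeff N F‖ ≤ C * wt r N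

/-- The pairing of a power series with a function through Mahler coefficients. -/
def pr (p : ℕ) [Fact p.Prime] {L : Type} [NontriviallyNormedField L] [NormedAlgebra ℚ_[p] L] (F : PowerSeries L)
    (h : ℤ_[p] → L) : L := ∑' N, PowerSeries.coeff N F * mc p L N h

lemma Gr.nonneg {r C : ℝ} {F : PowerSeries L} (hF : Gr r C F) : 0 ≤ C :=
  nonneg_of_mul_nonneg_left ((norm_nonneg _).trans (hF 0)) (wt_pos r 0)

lemma Gr.mono {r C C' : ℝ} {F : PowerSeries L} (hF : Gr r C F) (h : C ≤ C') : Gr r C' F :=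
  fun N => (hF N).trans (mul_le_mul_of_nonneg_right h (wt_pos _ _).le)

lemma Gr.mono_exp {r s C : ℝ} {F : PowerSeries L} (hF : Gr r C F) (h : r ≤ s) : Gr s C F :=
  fun N => (hF N).trans (mul_le_mul_of_nonneg_left
    (Real.rpow_le_rpow_of_exponent_le (by linarith [N.cast_nonneg (α := ℝ)]) h) hF.nonneg)

lemma Gr.sub {r C : ℝ} {F G : PowerSeries L} (hF : Gr r C F) (hG : Gr r C G) : Gr r C (F - G) := fun N => by
  rw [map_sub]; exact norm_sub_le_of (hF N) (hG N)

lemma Gr.add {r C : ℝ} {F G : PowerSeries L} (hF : Gr r C F) (hG : Gr r C G) : Gr r C (F + G) := fun N => by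
  rw [map_add]; exact norm_add_le_of (hF N) (hG N)

lemma Gr.smul {r C : ℝ} {F : PowerSeries L} (hF : Gr r C F) (c : L) : Gr r (‖c‖ * C) (c • F) := fun N => by
  rw [PowerSeries.coeff_smul, norm_smul, mul_assoc]
  exact mul_le_mul_of_nonneg_left (hF N) (norm_nonneg _)

lemma Gr.mul {r s C C' : ℝ} (hr : 0 ≤ r) (hs : 0 ≤ s) {F G : PowerSeries L} (hF : Gr r C F) (hG : Gr s C' G) :
    Gr (r + s) (C * C') (F * G) := fun N => by
  have := hF.nonneg
  have := hG.nonneg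
  rw [PowerSeries.coeff_mul]
  refine norm_sum_le_of (mul_nonneg (by positivity) (wt_pos _ _).le) fun ij hij => ?_
  rw [← Finset.HasAntidiagonal.mem_antidiagonal.1 hij, norm_mul]
  calc _ ≤ (C * wt r ij.1) * (C' * wt s ij.2) := mul_le_mul (hF _) (hG _) (norm_nonneg _)
        (mul_nonneg ‹_› (wt_pos _ _).le)
    _ = C * C' * (wt r ij.1 * wt s ij.2) := by ring
    _ ≤ _ := mul_le_mul_of_nonneg_left (wt_mul_wt_le hr hs _ _) (by positivity)

lemma Gr.norm_term_le {r C : ℝ} {F : PowerSeries L} (hF : Gr r C F) (h : ℤ_[p] → L) (N : ℕ) :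
    ‖PowerSeries.coeff N F * mc p L N h‖ ≤ C * (wt r N * ‖mc p L N h‖) := by
  rw [norm_mul, ← mul_assoc]
  exact mul_le_mul_of_nonneg_right (hF N) (norm_nonneg _)

lemma Gr.hasSum {r C : ℝ} {F : PowerSeries L} (hF : Gr r C F) {h : ℤ_[p] → L} (hh : Cr r h) :
    HasSum (fun N => PowerSeries.coeff N F * mc p L N h) (pr p F h) :=
  (summable_of_norm_le (by simpa using hh.2.const_mul C) (hF.norm_term_le h)).hasSum

lemma Gr.norm_pr_le {r C C' : ℝ} {F : PowerSeries L} (hF : Gr r C F) {h : ℤ_[p] → L} (hh : CrB r C' h) :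
    ‖pr p F h‖ ≤ C * C' :=
  norm_hasSum_le_of (mul_nonneg hF.nonneg hh.nonneg)
    (fun N => (hF.norm_term_le h N).trans (mul_le_mul_of_nonneg_left (hh.2 N) hF.nonneg)) (hF.hasSum hh.1)

lemma Gr.pr_add {r C : ℝ} {F : PowerSeries L} (hF : Gr r C F) {h h' : ℤ_[p] → L} (hh : Cr r h) (hh' : Cr r h') :
    pr p F (h + h') = pr p F h + pr p F h' := by
  refine ((hF.hasSum hh).add (hF.hasSum hh')).unique ?_ |>.symm
  convert hF.hasSum ((CrS p L r).add_mem hh hh') using 2 with N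
  rw [map_add]; ring

lemma pr_smul (F : PowerSeries L) (c : L) (h : ℤ_[p] → L) : pr p F (c • h) = c * pr p F h := by
  rw [pr, pr, ← tsum_mul_left]
  congr 1; ext N; rw [map_smul, smul_eq_mul]; ring

lemma Gr.pr_sub {r C : ℝ} {F : PowerSeries L} (hF : Gr r C F) {h h' : ℤ_[p] → L} (hh : Cr r h) (hh' : Cr r h') :
    pr p F (h - h') = pr p F h - pr p F h' := by
  have e : h - h' = h + (-1 : L) • h' := by rw [neg_one_smul, sub_eq_add_neg]
  rw [e, hF.pr_add hh ((CrS p L r).smul_mem _ hh'), pr_smul]; ring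

lemma pr_zero (F : PowerSeries L) : pr p F (0 : ℤ_[p] → L) = 0 := by simp [pr]

lemma Gr.pr_sum {r C : ℝ} {F : PowerSeries L} (hF : Gr r C F) {ι : Type*} {s : Finset ι} {h : ι → ℤ_[p] → L}
    (hh : ∀ i ∈ s, Cr r (h i)) : pr p F (∑ i ∈ s, h i) = ∑ i ∈ s, pr p F (h i) := by
  induction s using Finset.induction_on with
  | empty => simp [pr_zero]
  | insert a s ha ih =>
    rw [Finset.sum_insert ha, Finset.sum_insert ha, hF.pr_add (hh _ (Finset.mem_insert_self _ _))
      ((CrS p L r).sum_mem fun i hi => hh i (Finset.mem_insert_of_mem hi)),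
      ih fun i hi => hh i (Finset.mem_insert_of_mem hi)]

lemma Gr.pr_sub_left {r C C' : ℝ} {F G : PowerSeries L} (hF : Gr r C F) (hG : Gr r C' G) {h : ℤ_[p] → L}
    (hh : Cr r h) : pr p (F - G) h = pr p F h - pr p G h := by
  refine HasSum.unique ?_ ((hF.hasSum hh).sub (hG.hasSum hh))
  refine (((hF.mono (le_max_left C C')).sub (hG.mono (le_max_right C C'))).hasSum hh).congr_fun' fun N => ?_
  rw [map_sub]; ring

lemma pr_smul_left (F : PowerSeries L) (c : L) (h : ℤ_[p] → L) : pr p (c • F) h = c * pr p F h := by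
  rw [pr, pr, ← tsum_mul_left]
  congr 1; ext N; rw [PowerSeries.coeff_smul, smul_eq_mul, mul_assoc]

lemma pr_bin (F : PowerSeries L) (N : ℕ) : pr p F (bin p L N) = PowerSeries.coeff N F := by
  rw [pr, tsum_eq_single N fun M hM => by rw [mc_bin, if_neg hM, mul_zero]]
  rw [mc_bin, if_pos rfl, mul_one]

/-- Multiplication of power series is dual to convolution with difference operators. -/
theorem Gr.hasSum_pr_mul {r s C C' : ℝ} (hr : 0 ≤ r) (hs : 0 ≤ s) {F G : PowerSeries L} (hF : Gr r C F)
    (hG : Gr s C' G) {h : ℤ_[p] → L} (hh : Cr (r + s) h) :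
    HasSum (fun i => PowerSeries.coeff i F * pr p G ((del p L ^ i) h)) (pr p (F * G) h) := by
  have hCC : 0 ≤ C * C' := mul_nonneg hF.nonneg hG.nonneg
  set u : ℕ × ℕ → L := fun ij => PowerSeries.coeff ij.1 F * PowerSeries.coeff ij.2 G * mc p L (ij.1 + ij.2) h with hu
  set v : ℕ → ℝ := fun N => C * C' * (wt (r + s) N * ‖mc p L N h‖) with hv
  have hv0 : Tendsto v atTop (𝓝 0) := by simpa using hh.2.const_mul (C * C')
  have huv : ∀ ij, ‖u ij‖ ≤ v (ij.1 + ij.2) := fun ij => by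
    rw [hu, hv]
    simp only [norm_mul]
    rw [← mul_assoc (C * C')]
    refine mul_le_mul_of_nonneg_right ?_ (norm_nonneg _)
    calc _ ≤ (C * wt r ij.1) * (C' * wt s ij.2) := mul_le_mul (hF _) (hG _) (norm_nonneg _)
          (mul_nonneg hF.nonneg (wt_pos _ _).le)
      _ = C * C' * (wt r ij.1 * wt s ij.2) := by ring
      _ ≤ _ := mul_le_mul_of_nonneg_left (wt_mul_wt_le hr hs _ _) hCC
  have hsum : Summable u := by
    refine summable_of_norm_tendsto ?_
    rw [Metric.tendsto_nhds]
    intro ε hε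
    obtain ⟨N0, hN0⟩ := (hv0.eventually (gt_mem_nhds hε)).exists_forall_of_atTop
    rw [Filter.eventually_cofinite]
    refine ((Set.finite_Iio N0).prod (Set.finite_Iio N0)).subset fun ij hij => ?_
    by_contra hc
    refine hij ?_
    rw [dist_zero_right, norm_norm]
    refine (huv ij).trans_lt (hN0 _ ?_)
    simp only [Set.mem_prod, Set.mem_Iio, not_and_or, not_lt] at hc
    omega
  have h1 : HasSum (fun i => PowerSeries.coeff i F * pr p G ((del p L ^ i) h)) (∑' ij, u ij) := by
    refine hsum.hasSum.prod_fiberwise fun i => ?_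
    have hd : Cr s ((del p L ^ i) h) := by
      refine ⟨Cr.continuous_del_pow hh.1 i, ?_⟩
      refine squeeze_zero (fun N => mul_nonneg (wt_pos _ _).le (norm_nonneg _)) (fun N => ?_)
        ((tendsto_add_atTop_iff_nat i).2 hh.2)
      rw [mc_del_pow]
      refine mul_le_mul_of_nonneg_right ?_ (norm_nonneg _)
      calc wt s N ≤ wt r i * wt s N := le_mul_of_one_le_left (wt_pos _ _).le (one_le_wt hr i)
        _ ≤ _ := by rw [add_comm N i]; exact wt_mul_wt_le hr hs _ _
    refine ((hG.hasSum hd).mul_left (PowerSeries.coeff i F)).congr_fun' fun j => ?_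
    rw [mc_del_pow, hu]; simp only; rw [add_comm j i]; ring
  have h2 : HasSum (fun N => PowerSeries.coeff N (F * G) * mc p L N h) (∑' ij, u ij) := by
    have h3 := (Finset.HasAntidiagonal.sigmaAntidiagonalEquivProd (A := ℕ)).hasSum_iff.2 hsum.hasSum
    refine (h3.sigma fun N => hasSum_fintype _).congr_fun' fun N => ?_
    rw [PowerSeries.coeff_mul, Finset.sum_mul, ← Finset.sum_coe_sort]
    refine Finset.sum_congr rfl fun ij _ => ?_
    have := Finset.HasAntidiagonal.mem_antidiagonal.1 ij.2
    simp [hu, this]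
  rw [← h2.tsum_eq] at h1
  exact h1

end

section

variable {p : ℕ} [hp : Fact p.Prime]
variable {L : Type} [NontriviallyNormedField L] [NormedAlgebra ℚ_[p] L] [IsUltrametricDist L]
  [CompleteSpace L]

/-- Polynomial functions of degree at most `d`. -/
def PF (p : ℕ) [Fact p.Prime] (L : Type) [NontriviallyNormedField L] [NormedAlgebra ℚ_[p] L] (d : ℕ) :
    Submodule L (ℤ_[p] → L) where
  carrier := {h | ∃ P : Polynomial L, P.natDegree ≤ d ∧ h = fun x : ℤ_[p] => P.eval (iotaL p L x)}
  add_mem' := by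
    rintro _ _ ⟨P, hP, rfl⟩ ⟨Q, hQ, rfl⟩
    exact ⟨P + Q, Polynomial.natDegree_add_le_of_degree_le hP hQ, by ext x; simp⟩
  zero_mem' := ⟨0, by simp, by ext x; simp⟩
  smul_mem' := by
    rintro c _ ⟨P, hP, rfl⟩
    exact ⟨Polynomial.C c * P, (Polynomial.natDegree_C_mul_le _ _).trans hP, by ext x; simp⟩

lemma mem_PF {d : ℕ} {h : ℤ_[p] → L} :
    h ∈ PF p L d ↔ ∃ P : Polynomial L, P.natDegree ≤ d ∧ h = fun x : ℤ_[p] => P.eval (iotaL p L x) := Iff.rfl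

lemma PF.affine {d : ℕ} {h : ℤ_[p] → L} (hh : h ∈ PF p L d) (a b : ℤ_[p]) : (fun x => h (a + b * x)) ∈ PF p L d := by
  obtain ⟨P, hP, rfl⟩ := hh
  refine ⟨P.comp (Polynomial.C (iotaL p L a) + Polynomial.C (iotaL p L b) * Polynomial.X), ?_, by ext x; simp⟩
  refine Polynomial.natDegree_comp_le.trans ((Nat.mul_le_mul hP ?_).trans (mul_one d).le)
  rw [add_comm]
  exact Polynomial.natDegree_linear_le

lemma PF.mc_eq_zero {d i : ℕ} {h : ℤ_[p] → L} (hh : h ∈ PF p L d) (hi : d < i) : mc p L i h = 0 := by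
  obtain ⟨P, hP, rfl⟩ := hh
  have h1 := congrFun (Polynomial.fwdDiff_iter_eq_zero_of_degree_lt (hP.trans_lt hi)) 0
  rw [fwdDiff_iter_eq_sum_shift] at h1
  rw [← fwdDiff_iter_eq_mc, fwdDiff_iter_eq_sum_shift]
  simpa using h1

lemma PF.continuous {d : ℕ} {h : ℤ_[p] → L} (hh : h ∈ PF p L d) : Continuous h := by
  obtain ⟨P, -, rfl⟩ := hh
  exact P.continuous.comp (continuous_iotaL.comp continuous_subtype_val)

lemma PF.eq_sum {d : ℕ} {h : ℤ_[p] → L} (hh : h ∈ PF p L d) :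
    h = ∑ i ∈ Finset.range (d + 1), mc p L i h • bin p L i := by
  ext x
  refine (hasSum_mahler_of_continuous (PF.continuous hh) x).unique ?_
  rw [Finset.sum_apply]
  refine hasSum_sum_of_ne_finset_zero fun i hi => ?_
  rw [PF.mc_eq_zero hh (by rw [Finset.mem_range] at hi; omega), zero_mul]

variable (L) in
lemma natDegree_binPoly_le (N : ℕ) : (binPoly L N).natDegree ≤ N := by
  cases N with
  | zero => simp [binPoly]
  | succ j =>
    rw [binPoly, add_comm j 1]
    refine Polynomial.natDegree_mul_le_of_le Polynomial.natDegree_linear_le ?_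
    refine (Polynomial.natDegree_prod_le _ _).trans ?_
    refine (Finset.sum_le_card_nsmul _ _ 1 fun i _ => ?_).trans (by simp)
    exact Polynomial.natDegree_linear_le

lemma PF_bin {d i : ℕ} (h : i ≤ d) : bin p L i ∈ PF p L d :=
  ⟨binPoly L i, (natDegree_binPoly_le L i).trans h, by ext x; rw [eval_binPoly]⟩

lemma PF_mon {d i : ℕ} (h : i ≤ d) : mon p L i ∈ PF p L d :=
  ⟨Polynomial.X ^ i, by simpa using h, by ext x; simp [mon]⟩

lemma PF.cr {d : ℕ} {h : ℤ_[p] → L} (hh : h ∈ PF p L d) (r : ℝ) : Cr r h := by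
  rw [PF.eq_sum hh]
  exact (CrS p L r).sum_mem fun i _ => (CrS p L r).smul_mem _ (crB_bin r i).1

/-- Functions that are polynomial of degree at most `d` on cosets of `p^n ℤ_p`. -/
def LP (p : ℕ) [Fact p.Prime] (L : Type) [NontriviallyNormedField L] [NormedAlgebra ℚ_[p] L] (d n : ℕ) :
    Submodule L (ℤ_[p] → L) where
  carrier := {h | ∀ a : ℤ_[p], (fun x => h (a + (p : ℤ_[p]) ^ n * x)) ∈ PF p L d}
  add_mem' := fun hf hg a => (PF p L d).add_mem (hf a) (hg a)
  zero_mem' := fun _ => (PF p L d).zero_mem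
  smul_mem' := fun c _ hf a => (PF p L d).smul_mem c (hf a)

lemma LP.succ {d n : ℕ} {h : ℤ_[p] → L} (hh : h ∈ LP p L d n) : h ∈ LP p L d (n + 1) := fun a => by
  have := PF.affine (hh a) 0 (p : ℤ_[p])
  simpa [pow_succ, mul_assoc] using this

lemma LP.mono {d n m : ℕ} {h : ℤ_[p] → L} (hh : h ∈ LP p L d n) (hm : n ≤ m) : h ∈ LP p L d m := by
  induction m, hm using Nat.le_induction with
  | base => exact hh
  | succ m _ ih => exact LP.succ ih

lemma LP.tau {d n : ℕ} {h : ℤ_[p] → L} (hh : h ∈ LP p L d n) (b : ℤ_[p]) : Paper.tau p L b h ∈ LP p L d n := fun a => by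
  have := hh (a + b)
  simpa [add_right_comm] using this

lemma LP_PL {d : ℕ} {Q : ℤ_[p] → L} (hQ : Q ∈ PF p L d) (b : ℤ_[p]) (n : ℕ) : PL L b n Q ∈ LP p L d n := fun a => by
  by_cases h : ∃ w, a = b + (p : ℤ_[p]) ^ n * w
  · obtain ⟨w, rfl⟩ := h
    have := PF.affine hQ w 1
    convert this using 2 with x
    rw [add_assoc, ← mul_add, PL_apply, one_mul]
  · convert (PF p L d).zero_mem using 1
    ext x
    refine PL_of_not _ fun ⟨w, hw⟩ => h ⟨w - x, ?_⟩
    rw [mul_sub, add_sub, ← hw]; ring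

lemma PL_cr {r : ℝ} (hr : 0 ≤ r) {Q : ℤ_[p] → L} (hQ : Cr r Q) (b : ℤ_[p]) (n : ℕ) : Cr r (PL L b n Q) :=
  (hQ.crB.PL hr b n).1

lemma LP.cr {d n : ℕ} {h : ℤ_[p] → L} (hh : h ∈ LP p L d n) {r : ℝ} (hr : 0 ≤ r) : Cr r h := by
  rw [eq_sum_PL h n]
  exact (CrS p L r).sum_mem fun a _ => PL_cr hr (PF.cr (hh _) r) _ _

lemma bin_affine_eq (N : ℕ) (a : ℤ_[p]) (m : ℕ) : (fun x => bin p L N (a + (p : ℤ_[p]) ^ m * x)) =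
    ∑ ij ∈ Finset.HasAntidiagonal.antidiagonal N, bin p L ij.1 a • fun x => bin p L ij.2 ((p : ℤ_[p]) ^ m * x) := by
  ext x; simp [bin_add, Finset.sum_apply]

lemma div_pow_le_one {n m : ℕ} (hm : n ≤ m) : (p : ℝ) ^ n / (p : ℝ) ^ m ≤ 1 :=
  div_le_one_of_le₀ (pow_le_pow_right₀ (one_lt_p p).le hm) (pow_pos (p_pos p) _).le

lemma norm_mc_bin_affine_le {N n m : ℕ} (h : N < p ^ (n + 1)) (hm : n ≤ m) (a : ℤ_[p]) (i : ℕ) :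
    ‖mc p L i (fun x => bin p L N (a + (p : ℤ_[p]) ^ m * x))‖ ≤ ((p : ℝ) ^ n / (p : ℝ) ^ m) ^ i := by
  have hp0 := p_pos p
  have h0 : 0 ≤ (p : ℝ) ^ n / (p : ℝ) ^ m := by positivity
  rw [bin_affine_eq, map_sum]
  refine norm_sum_le_of (by positivity) fun ij hij => ?_
  have hj : ij.2 < p ^ (n + 1) := by
    have := Finset.HasAntidiagonal.mem_antidiagonal.1 hij; omega
  rw [map_smul, norm_smul]
  refine (mul_le_of_le_one_left (norm_nonneg _) (norm_bin_le _ _)).trans ?_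
  obtain ⟨M, -, hM⟩ := binTail_eq (p := p) (L := L) 0 ij.2
  have e : (fun x : ℤ_[p] => bin p L ij.2 ((p : ℤ_[p]) ^ m * x)) =
      ∑ k ∈ Finset.Ico 0 M, ((binPoly L ij.2).coeff k * (p : L) ^ (m * k)) • mon p L k := by
    simp only [binTail, Finset.range_zero, Finset.sum_empty, sub_zero] at hM
    rw [hM]
    ext x
    rw [Finset.sum_apply, Finset.sum_apply]
    exact Finset.sum_congr rfl fun k _ => congrFun (mon_dilate k m _) x
  rw [e, map_sum]
  refine norm_sum_le_of (by positivity) fun k _ => ?_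
  rw [map_smul, norm_smul]
  by_cases hk : k < i
  · rw [PF.mc_eq_zero (PF_mon le_rfl) hk, norm_zero, mul_zero]; positivity
  · have h1 : ‖mc p L i (mon p L k)‖ ≤ 1 := norm_mc_le i zero_le_one fun x => by
      rw [mon, norm_pow]; exact pow_le_one₀ (norm_nonneg _) (by rw [norm_iotaL]; exact PadicInt.norm_le_one x)
    refine (mul_le_of_le_one_right (norm_nonneg _) h1).trans ((norm_coeff_mul_le hj m k).trans ?_)
    exact pow_le_pow_of_le_one h0 (div_pow_le_one hm) (not_lt.1 hk)

lemma sum_range_mul_eq {M : Type*} [AddCommMonoid M] (q k : ℕ) (G : ℕ → M) :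
    ∑ c ∈ Finset.range (q * k), G c = ∑ a ∈ Finset.range q, ∑ b ∈ Finset.range k, G (a + q * b) := by
  induction k with
  | zero => simp
  | succ k ih =>
    rw [mul_add, mul_one, Finset.sum_range_add, ih, ← Finset.sum_add_distrib]
    refine Finset.sum_congr rfl fun a _ => ?_
    rw [Finset.sum_range_succ, add_comm (q * k)]

/-- A tempered series is determined by its values on locally polynomial functions. -/
theorem Gr.eq_zero {r C : ℝ} (hr : 0 ≤ r) {J : ℕ} (hJ : r < J + 1) {F : PowerSeries L} (hF : Gr r C F)
    (h : ∀ n, ∀ g ∈ LP p L J n, pr p F g = 0) : F = 0 := by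
  have hp0 := p_pos p
  have hp1 := one_lt_p p
  ext N
  rw [map_zero, ← pr_bin (p := p)]
  set n := Nat.log p N with hn
  have hN : N < p ^ (n + 1) := Nat.lt_pow_succ_log_self hp.out.one_lt N
  have hKO := zero_le_one.trans (one_le_KO (p := p) hr)
  set Q : ℝ := (p : ℝ) ^ r / (p : ℝ) ^ (J + 1) with hQ
  have hA : 0 < (p : ℝ) ^ r := Real.rpow_pos_of_pos hp0 r
  have hQ0 : 0 ≤ Q := by positivity
  have hQ1 : Q < 1 := by
    rw [hQ, div_lt_one (by positivity), ← Real.rpow_natCast]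
    exact Real.rpow_lt_rpow_of_exponent_lt hp1 (by exact_mod_cast hJ)
  refine norm_le_zero_iff.1 (le_of_forall_pos_le_add fun ε hε => ?_)
  obtain ⟨m, hm, hmε⟩ := exists_pow_mul_le (C := C * (KO p r * KO p r * ((p : ℝ) ^ n) ^ (J + 1)))
    (mul_nonneg hF.nonneg (by positivity)) hQ0 hQ1 hε n
  set E : ℕ → ℤ_[p] → L := fun a => ∑ ij ∈ Finset.HasAntidiagonal.antidiagonal N,
    bin p L ij.1 (a : ℤ_[p]) • fun x => binTail p L (J + 1) ij.2 ((p : ℤ_[p]) ^ m * x) with hE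
  have hEb : ∀ a, CrB r (KO p r * ((p : ℝ) ^ n / (p : ℝ) ^ m) ^ (J + 1)) (E a) := fun a => by
    refine CrB.sum (by positivity) fun ij hij => ?_
    have hj : ij.2 < p ^ (n + 1) := by
      have := Finset.HasAntidiagonal.mem_antidiagonal.1 hij; omega
    refine (CrB.smul _ (crB_binTail_of_le hr hj (by positivity) fun k hk =>
      pow_le_pow_of_le_one (by positivity) (div_pow_le_one hm) hk)).mono ?_
    exact mul_le_of_le_one_left (by positivity) (norm_bin_le _ _)
  have hErr : CrB r (KO p r * ((p : ℝ) ^ r) ^ m * (KO p r * ((p : ℝ) ^ n / (p : ℝ) ^ m) ^ (J + 1)))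
      (∑ a ∈ Finset.range (p ^ m), PL L (a : ℤ_[p]) m (E a)) :=
    CrB.sum (by positivity) fun a _ => (hEb a).PL hr _ _
  have hLP : bin p L N - ∑ a ∈ Finset.range (p ^ m), PL L (a : ℤ_[p]) m (E a) ∈ LP p L J m := by
    have e : bin p L N - ∑ a ∈ Finset.range (p ^ m), PL L (a : ℤ_[p]) m (E a) = ∑ a ∈ Finset.range (p ^ m),
        PL L (a : ℤ_[p]) m ((fun x => bin p L N ((a : ℤ_[p]) + (p : ℤ_[p]) ^ m * x)) - E a) := by
      conv_lhs => rw [eq_sum_PL (bin p L N) m]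
      rw [← Finset.sum_sub_distrib]
      refine Finset.sum_congr rfl fun a _ => ?_
      obtain ⟨c, σ, hc⟩ := PL_eq_mul (L := L) (a : ℤ_[p]) m
      ext x; simp [hc, mul_sub]
    rw [e]
    refine (LP p L J m).sum_mem fun a _ => LP_PL ?_ _ _
    rw [bin_affine_eq, hE, ← Finset.sum_sub_distrib]
    refine (PF p L J).sum_mem fun ij _ => ?_
    rw [← smul_sub]
    refine (PF p L J).smul_mem _ ?_
    have : ((fun x => bin p L ij.2 ((p : ℤ_[p]) ^ m * x)) - fun x => binTail p L (J + 1) ij.2 ((p : ℤ_[p]) ^ m * x)) =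
        ∑ k ∈ Finset.range (J + 1), ((binPoly L ij.2).coeff k * (p : L) ^ (m * k)) • mon p L k := by
      ext x
      rw [Finset.sum_apply, Pi.sub_apply, binTail, Pi.sub_apply, sub_sub_cancel, Finset.sum_apply]
      exact Finset.sum_congr rfl fun k _ => congrFun (mon_dilate k m _) x
    rw [this]
    exact (PF p L J).sum_mem fun k hk => (PF p L J).smul_mem _ (PF_mon (Nat.lt_succ_iff.1 (Finset.mem_range.1 hk)))
  have h1 := h m _ hLP
  rw [hF.pr_sub (crB_bin r N).1 hErr.1, sub_eq_zero] at h1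
  rw [h1, zero_add]
  refine (hF.norm_pr_le hErr).trans (le_trans (le_of_eq ?_) hmε)
  rw [hQ, div_pow, div_pow, ← pow_mul, ← pow_mul, ← pow_mul, mul_comm m (J + 1)]
  ring

end

section

variable {p : ℕ} [hp : Fact p.Prime]
variable {L : Type} [NontriviallyNormedField L] [NormedAlgebra ℚ_[p] L] [IsUltrametricDist L]
  [CompleteSpace L]

/-- The Riemann sum of level `m` attached to a system `e` of local moments. -/
def av (p : ℕ) [Fact p.Prime] {L : Type} [NontriviallyNormedField L] [NormedAlgebra ℚ_[p] L] (d : ℕ)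
    (e : ℕ → ℤ_[p] → ℕ → L) (m : ℕ) (h : ℤ_[p] → L) : L :=
  ∑ a ∈ Finset.range (p ^ m), ∑ j ∈ Finset.range (d + 1),
    mc p L j (fun x => h ((a : ℤ_[p]) + (p : ℤ_[p]) ^ m * x)) * e m a j

/-- Compatibility of local moments under refinement. -/
def Compat (d : ℕ) (e : ℕ → ℤ_[p] → ℕ → L) : Prop := ∀ n b i, i ≤ d → e n b i =
  ∑ a ∈ Finset.range p, ∑ j ∈ Finset.range (d + 1),
    mc p L j (fun x => bin p L i ((a : ℤ_[p]) + (p : ℤ_[p]) * x)) * e (n + 1) (b + (p : ℤ_[p]) ^ n * a) j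

variable {d : ℕ} {e : ℕ → ℤ_[p] → ℕ → L}

lemma Compat.sum_eq (he : Compat d e) {Q : ℤ_[p] → L} (hQ : Q ∈ PF p L d) (n : ℕ) (b : ℤ_[p]) :
    ∑ j ∈ Finset.range (d + 1), mc p L j Q * e n b j = ∑ a ∈ Finset.range p, ∑ j ∈ Finset.range (d + 1),
      mc p L j (fun x => Q ((a : ℤ_[p]) + (p : ℤ_[p]) * x)) * e (n + 1) (b + (p : ℤ_[p]) ^ n * a) j := by
  have h1 : ∀ (a : ℕ) (j : ℕ), mc p L j (fun x => Q ((a : ℤ_[p]) + (p : ℤ_[p]) * x)) =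
      ∑ i ∈ Finset.range (d + 1), mc p L i Q * mc p L j (fun x => bin p L i ((a : ℤ_[p]) + (p : ℤ_[p]) * x)) := by
    intro a j
    have : (fun x => Q ((a : ℤ_[p]) + (p : ℤ_[p]) * x)) =
        ∑ i ∈ Finset.range (d + 1), mc p L i Q • (fun x => bin p L i ((a : ℤ_[p]) + (p : ℤ_[p]) * x)) := by
      ext x
      have := congrFun (PF.eq_sum hQ) ((a : ℤ_[p]) + (p : ℤ_[p]) * x)
      rw [this]; simp [Finset.sum_apply]
    rw [this, map_sum]; simp
  simp only [h1, Finset.sum_mul]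
  calc _ = ∑ i ∈ Finset.range (d + 1), ∑ a ∈ Finset.range p, ∑ j ∈ Finset.range (d + 1), mc p L i Q *
        mc p L j (fun x => bin p L i ((a : ℤ_[p]) + (p : ℤ_[p]) * x)) * e (n + 1) (b + (p : ℤ_[p]) ^ n * a) j := by
        refine Finset.sum_congr rfl fun i hi => ?_
        rw [he n b i (Nat.lt_succ_iff.1 (Finset.mem_range.1 hi)), Finset.mul_sum]
        refine Finset.sum_congr rfl fun a _ => ?_
        rw [Finset.mul_sum]
        exact Finset.sum_congr rfl fun j _ => (mul_assoc _ _ _).symm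
    _ = _ := by
        rw [Finset.sum_comm]
        exact Finset.sum_congr rfl fun a _ => Finset.sum_comm

lemma norm_av_succ_sub_le (he : Compat d e) {ρ C t : ℝ} (hC : 0 ≤ C)
    (hb : ∀ n b i, i ≤ d → ‖e n b i‖ ≤ C * ((p : ℝ) ^ ρ) ^ n) {h : ℤ_[p] → L} (hh : Continuous h) (ht : 0 ≤ t)
    (m : ℕ) (hm : ∀ (a : ℕ) i, d < i → ‖mc p L i (fun x => h ((a : ℤ_[p]) + (p : ℤ_[p]) ^ m * x))‖ ≤ t) :
    ‖av p d e (m + 1) h - av p d e m h‖ ≤ t * (C * ((p : ℝ) ^ ρ) ^ (m + 1)) := by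
  have hA : 0 < (p : ℝ) ^ ρ := Real.rpow_pos_of_pos (p_pos p) ρ
  set hl : ℕ → ℤ_[p] → L := fun a x => h ((a : ℤ_[p]) + (p : ℤ_[p]) ^ m * x) with hhl
  set Q : ℕ → ℤ_[p] → L := fun a => ∑ i ∈ Finset.range (d + 1), mc p L i (hl a) • bin p L i with hQ
  have hQP : ∀ a, Q a ∈ PF p L d := fun a => (PF p L d).sum_mem fun i hi =>
    (PF p L d).smul_mem _ (PF_bin (Nat.lt_succ_iff.1 (Finset.mem_range.1 hi)))
  have hQm : ∀ a, ∀ j ∈ Finset.range (d + 1), mc p L j (Q a) = mc p L j (hl a) := fun a j hj => by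
    rw [hQ, map_sum, Finset.sum_eq_single j]
    · simp [mc_bin]
    · intro i _ hij; simp [mc_bin, hij.symm]
    · exact fun h => absurd hj h
  have hsmall : ∀ a x, ‖(hl a - Q a) x‖ ≤ t := fun a x => by
    have hc : Continuous (hl a) := hh.comp (by fun_prop)
    have h1 := hasSum_mahler_of_continuous hc x
    have h2 : HasSum (fun i => if i ∈ Finset.range (d + 1) then mc p L i (hl a) * bin p L i x else 0) (Q a x) := by
      have : Q a x = ∑ i ∈ Finset.range (d + 1), if i ∈ Finset.range (d + 1) then mc p L i (hl a) * bin p L i x else 0 := by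
        simp only [hQ, Finset.sum_apply]
        exact Finset.sum_congr rfl fun i hi => by rw [if_pos hi]; rfl
      rw [this]
      exact hasSum_sum_of_ne_finset_zero fun i hi => if_neg hi
    refine norm_hasSum_le_of ht (fun i => ?_) (h1.sub h2)
    split_ifs with hi
    · rw [sub_self, norm_zero]; exact ht
    · rw [sub_zero, norm_mul]
      exact (mul_le_of_le_one_right (norm_nonneg _) (norm_bin_le _ _)).trans
        (hm a i (by rw [Finset.mem_range] at hi; omega))
  have e1 : av p d e (m + 1) h = ∑ a ∈ Finset.range (p ^ m), ∑ b ∈ Finset.range p, ∑ j ∈ Finset.range (d + 1),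
      mc p L j (fun x => hl a ((b : ℤ_[p]) + (p : ℤ_[p]) * x)) * e (m + 1) ((a : ℤ_[p]) + (p : ℤ_[p]) ^ m * b) j := by
    rw [av, pow_succ, sum_range_mul_eq]
    refine Finset.sum_congr rfl fun a _ => Finset.sum_congr rfl fun b _ => Finset.sum_congr rfl fun j _ => ?_
    congr 2
    · ext x
      simp only [hhl]
      congr 1
      push_cast; ring
    · push_cast; rfl
  have e2 : av p d e m h = ∑ a ∈ Finset.range (p ^ m), ∑ b ∈ Finset.range p, ∑ j ∈ Finset.range (d + 1),
      mc p L j (fun x => Q a ((b : ℤ_[p]) + (p : ℤ_[p]) * x)) * e (m + 1) ((a : ℤ_[p]) + (p : ℤ_[p]) ^ m * b) j := by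
    rw [av]
    refine Finset.sum_congr rfl fun a _ => ?_
    rw [← he.sum_eq (hQP a)]
    exact Finset.sum_congr rfl fun j hj => by rw [hQm a j hj]
  rw [e1, e2]
  simp only [← Finset.sum_sub_distrib, ← sub_mul, ← map_sub]
  refine norm_sum_le_of (by positivity) fun a _ => norm_sum_le_of (by positivity) fun b _ =>
    norm_sum_le_of (by positivity) fun j hj => ?_
  rw [norm_mul]
  exact mul_le_mul (norm_mc_le _ ht fun x => hsmall a _) (hb _ _ _ (Nat.lt_succ_iff.1 (Finset.mem_range.1 hj)))
    (norm_nonneg _) ht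

lemma norm_av_le {ρ C t : ℝ} (hC : 0 ≤ C)
    (hb : ∀ n b i, i ≤ d → ‖e n b i‖ ≤ C * ((p : ℝ) ^ ρ) ^ n) {h : ℤ_[p] → L} (ht : 0 ≤ t)
    (hh : ∀ x, ‖h x‖ ≤ t) (m : ℕ) : ‖av p d e m h‖ ≤ t * (C * ((p : ℝ) ^ ρ) ^ m) := by
  have hA : 0 < (p : ℝ) ^ ρ := Real.rpow_pos_of_pos (p_pos p) ρ
  refine norm_sum_le_of (by positivity) fun a _ => norm_sum_le_of (by positivity) fun j hj => ?_
  rw [norm_mul]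
  exact mul_le_mul (norm_mc_le _ ht fun x => hh _) (hb _ _ _ (Nat.lt_succ_iff.1 (Finset.mem_range.1 hj)))
    (norm_nonneg _) ht

lemma hasSum_av {h : ℤ_[p] → L} (hh : Continuous h) (m : ℕ) :
    HasSum (fun N => mc p L N h * av p d e m (bin p L N)) (av p d e m h) := by
  have h1 : ∀ (a j : ℕ), HasSum
      (fun N => mc p L N h * mc p L j (fun x => bin p L N ((a : ℤ_[p]) + (p : ℤ_[p]) ^ m * x)))
      (mc p L j (fun x => h ((a : ℤ_[p]) + (p : ℤ_[p]) ^ m * x))) := fun a j => by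
    have := hasSum_mc (F := fun N => mc p L N h • fun x => bin p L N ((a : ℤ_[p]) + (p : ℤ_[p]) ^ m * x))
      (f := fun x => h ((a : ℤ_[p]) + (p : ℤ_[p]) ^ m * x))
      (fun x => hasSum_mahler_of_continuous hh ((a : ℤ_[p]) + (p : ℤ_[p]) ^ m * x)) j
    exact HasSum.congr_fun' this fun N => by rw [map_smul]; rfl
  refine HasSum.congr_fun' (hasSum_sum fun a _ => hasSum_sum fun j _ => (h1 a j).mul_right (e m a j)) fun N => ?_
  simp only [av, Finset.mul_sum, mul_assoc]

/-- Compatible local moments of growth `ρ < d + 1` come from a power series of growth `ρ`. -/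
theorem Compat.exists_series (he : Compat d e) {ρ C : ℝ} (hρ : 0 ≤ ρ) (hρd : ρ < d + 1) (hC : 0 ≤ C)
    (hb : ∀ n b i, i ≤ d → ‖e n b i‖ ≤ C * ((p : ℝ) ^ ρ) ^ n) :
    ∃ F : PowerSeries L, Gr ρ ((p : ℝ) ^ ρ * C) F ∧ ∀ n, ∀ h ∈ LP p L d n, pr p F h = av p d e n h := by
  have hp0 := p_pos p
  have hp1 := one_lt_p p
  have hA : 0 < (p : ℝ) ^ ρ := Real.rpow_pos_of_pos hp0 ρ
  have hA1 : 1 ≤ (p : ℝ) ^ ρ := Real.one_le_rpow hp1.le hρ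
  set q : ℝ := (p : ℝ) ^ ρ / (p : ℝ) ^ (d + 1) with hq
  have hq0 : 0 < q := by positivity
  have hq1 : q < 1 := by
    rw [hq, div_lt_one (by positivity), ← Real.rpow_natCast]
    exact Real.rpow_lt_rpow_of_exponent_lt hp1 (by exact_mod_cast hρd)
  have hstep : ∀ N m, Nat.log p N ≤ m → ‖av p d e (m + 1) (bin p L N) - av p d e m (bin p L N)‖ ≤
      (p : ℝ) ^ ρ * C * ((p : ℝ) ^ ρ) ^ (Nat.log p N) * q ^ (m - Nat.log p N) := fun N m hm => by
    have hN : N < p ^ (Nat.log p N + 1) := Nat.lt_pow_succ_log_self hp.out.one_lt N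
    have h1 := norm_av_succ_sub_le he hC hb (continuous_bin N)
      (t := ((p : ℝ) ^ Nat.log p N / (p : ℝ) ^ m) ^ (d + 1)) (by positivity) m fun a i hi =>
        (norm_mc_bin_affine_le hN hm (a : ℤ_[p]) i).trans
          (pow_le_pow_of_le_one (by positivity) (div_pow_le_one hm) hi)
    refine h1.trans (le_of_eq ?_)
    obtain ⟨k, rfl⟩ := Nat.exists_eq_add_of_le hm
    rw [Nat.add_sub_cancel_left, hq, pow_add (p : ℝ) _ k, div_mul_eq_div_div, div_self (by positivity), div_pow,
      div_pow, one_pow, ← pow_mul, ← pow_mul, mul_comm k]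
    rw [pow_succ, pow_add]
    ring
  have hbd : ∀ N m, ‖av p d e m (bin p L N)‖ ≤ (p : ℝ) ^ ρ * C * ((p : ℝ) ^ ρ) ^ (Nat.log p N) := fun N m => by
    rcases le_total m (Nat.log p N) with hm | hm
    · refine (norm_av_le hC hb zero_le_one (norm_bin_le N) m).trans ?_
      rw [one_mul]
      refine mul_le_mul ?_ (pow_le_pow_right₀ hA1 hm) (by positivity) (by positivity)
      exact le_mul_of_one_le_left hC hA1
    · induction m, hm using Nat.le_induction with
      | base =>
        refine (norm_av_le hC hb zero_le_one (norm_bin_le N) _).trans ?_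
        rw [one_mul]
        exact mul_le_mul_of_nonneg_right (le_mul_of_one_le_left hC hA1) (by positivity)
      | succ m hm ih =>
        rw [← sub_add_cancel (av p d e (m + 1) (bin p L N)) (av p d e m (bin p L N))]
        refine norm_add_le_of ((hstep N m hm).trans ?_) ih
        exact mul_le_of_le_one_right (by positivity) (pow_le_one₀ hq0.le hq1.le)
  have hlim : ∀ N, ∃ c, Tendsto (fun m => av p d e m (bin p L N)) atTop (𝓝 c) := fun N => by
    refine cauchySeq_tendsto_of_complete (cauchySeq_of_le_geometric q
      ((p : ℝ) ^ ρ * C * ((p : ℝ) ^ ρ) ^ (Nat.log p N) * (q ^ Nat.log p N)⁻¹) hq1 fun m => ?_)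
    rw [dist_comm, dist_eq_norm]
    rcases le_total (Nat.log p N) m with hm | hm
    · refine (hstep N m hm).trans (le_of_eq ?_)
      rw [pow_sub₀ q hq0.ne' hm]; ring
    · refine (norm_sub_le_of (hbd N _) (hbd N _)).trans ?_
      rw [mul_assoc _ (q ^ Nat.log p N)⁻¹]
      refine le_mul_of_one_le_right (by positivity) ?_
      rw [mul_comm, ← div_eq_mul_inv, one_le_div (by positivity)]
      exact pow_le_pow_of_le_one hq0.le hq1.le hm
  choose c hc using hlim
  have hcb : ∀ N m, ‖av p d e m (bin p L N)‖ ≤ (p : ℝ) ^ ρ * C * wt ρ N := fun N m =>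
    (hbd N m).trans (mul_le_mul_of_nonneg_left (pow_log_le_wt hρ N) (by positivity))
  refine ⟨PowerSeries.mk c, fun N => ?_, fun n h hh => ?_⟩
  · rw [PowerSeries.coeff_mk]
    exact le_of_tendsto (hc N).norm (Eventually.of_forall fun m => hcb N m)
  · have hcr := LP.cr hh hρ
    have h1 := tendsto_tsum_of_ultrametric (f := fun m N => mc p L N h * av p d e m (bin p L N))
      (g := fun N => mc p L N h * c N) (u := fun N => (p : ℝ) ^ ρ * C * (wt ρ N * ‖mc p L N h‖))
      (by simpa using hcr.2.const_mul ((p : ℝ) ^ ρ * C))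
      (fun m N => by
        rw [norm_mul, mul_comm, ← mul_assoc]
        exact mul_le_mul_of_nonneg_right (hcb N m) (norm_nonneg _))
      (fun N => (hc N).const_mul _)
    have h2 : ∀ m, n ≤ m → av p d e m h = av p d e n h := fun m hm => by
      induction m, hm using Nat.le_induction with
      | base => rfl
      | succ m hm ih =>
        have := norm_av_succ_sub_le he hC hb hcr.1 le_rfl m fun a i hi => by
          rw [PF.mc_eq_zero (LP.mono hh hm a) hi, norm_zero]
        rw [zero_mul, norm_le_zero_iff, sub_eq_zero] at this
        rw [this, ih]
    have h3 : Tendsto (fun m => av p d e m h) atTop (𝓝 (av p d e n h)) :=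
      tendsto_const_nhds.congr' ((eventually_ge_atTop n).mono fun m hm => (h2 m hm).symm)
    rw [pr]
    refine tendsto_nhds_unique ?_ h3
    simp only [(hasSum_av hcr.1 _).tsum_eq] at h1
    simpa only [PowerSeries.coeff_mk, mul_comm] using h1

end

section

variable {p : ℕ} [hp : Fact p.Prime]
variable {L : Type} [NontriviallyNormedField L] [NormedAlgebra ℚ_[p] L] [IsUltrametricDist L]
  [CompleteSpace L]

/-- Polynomials acting on functions through translation by one. -/
def act (p : ℕ) [Fact p.Prime] (L : Type) [NontriviallyNormedField L] [NormedAlgebra ℚ_[p] L] :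
    Polynomial L →ₐ[L] Module.End L (ℤ_[p] → L) := Polynomial.aeval (tau p L 1)

lemma act_X_pow_sub_one (q : ℕ) : act p L (Polynomial.X ^ q - 1) = tau p L (q : ℤ_[p]) - 1 := by
  rw [act, map_sub, map_pow, Polynomial.aeval_X, map_one, tau_pow, mul_one]

lemma act_X_sub_one : act p L (Polynomial.X - 1) = del p L := by
  rw [act, map_sub, Polynomial.aeval_X, map_one]; rfl

lemma act_mul_apply (P Q : Polynomial L) (h : ℤ_[p] → L) : act p L (P * Q) h = act p L P (act p L Q h) := by
  rw [map_mul]; rfl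

lemma LP.act {d n : ℕ} {h : ℤ_[p] → L} (hh : h ∈ LP p L d n) (P : Polynomial L) : act p L P h ∈ LP p L d n := by
  rw [Paper.act, Polynomial.aeval_endomorphism, Polynomial.sum]
  refine (LP p L d n).sum_mem fun i _ => (LP p L d n).smul_mem _ ?_
  rw [tau_pow]
  exact LP.tau hh _

lemma LP.del_pow {d n : ℕ} {h : ℤ_[p] → L} (hh : h ∈ LP p L d n) (i : ℕ) : (del p L ^ i) h ∈ LP p L d n := by
  have := LP.act hh ((Polynomial.X - 1) ^ i)
  rwa [map_pow, act_X_sub_one] at this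

/-- Differences along `p^n` become differences of the restriction to a coset. -/
lemma del_pow_affine (n i : ℕ) (h : ℤ_[p] → L) (a x : ℤ_[p]) :
    (del p L ^ i) (fun x => h (a + (p : ℤ_[p]) ^ n * x)) x =
      ((tau p L (((p ^ n : ℕ) : ℤ_[p])) - 1) ^ i) h (a + (p : ℤ_[p]) ^ n * x) := by
  induction i generalizing h with
  | zero => rfl
  | succ i ih =>
    rw [pow_succ, pow_succ, Module.End.mul_apply, Module.End.mul_apply, ← ih]
    refine congrFun (congrArg _ ?_) x
    ext y
    rw [del_apply, LinearMap.sub_apply, Module.End.one_apply, Pi.sub_apply, tau_apply]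
    congr 2
    push_cast; ring

lemma mem_PF_of_mc {d : ℕ} {h : ℤ_[p] → L} (hc : Continuous h) (h0 : ∀ i, d < i → mc p L i h = 0) : h ∈ PF p L d := by
  have : h = ∑ i ∈ Finset.range (d + 1), mc p L i h • bin p L i := by
    ext x
    refine (hasSum_mahler_of_continuous hc x).unique ?_
    rw [Finset.sum_apply]
    refine hasSum_sum_of_ne_finset_zero fun i hi => ?_
    rw [h0 i (by rw [Finset.mem_range] at hi; omega), zero_mul]
  rw [this]
  exact (PF p L d).sum_mem fun i hi => (PF p L d).smul_mem _ (PF_bin (Nat.lt_succ_iff.1 (Finset.mem_range.1 hi)))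

lemma mem_LP_iff {d n : ℕ} {h : ℤ_[p] → L} :
    h ∈ LP p L d n ↔ Continuous h ∧ ((tau p L (((p ^ n : ℕ) : ℤ_[p])) - 1) ^ (d + 1)) h = 0 := by
  constructor
  · intro hh
    refine ⟨(LP.cr hh le_rfl).1, funext fun y => ?_⟩
    have h1 := del_pow_affine n (d + 1) h y 0
    rw [mul_zero, add_zero] at h1
    rw [← h1, ← mc_apply]
    exact PF.mc_eq_zero (hh y) (Nat.lt_succ_self d)
  · rintro ⟨hc, h0⟩ a
    refine mem_PF_of_mc (hc.comp (by fun_prop)) fun i hi => ?_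
    rw [mc_apply, del_pow_affine, ← Nat.sub_add_cancel (Nat.succ_le_of_lt hi), pow_add, Module.End.mul_apply, h0,
      map_zero]
    rfl

/-- `Σ_{i<p} X^{i p^n}`. -/
def theta (p : ℕ) (L : Type) [Field L] (n : ℕ) : Polynomial L := ∑ i ∈ Finset.range p, (Polynomial.X ^ p ^ n) ^ i

lemma theta_mul (n : ℕ) : theta p L n * (Polynomial.X ^ p ^ n - 1) = Polynomial.X ^ p ^ (n + 1) - 1 := by
  rw [theta, geom_sum_mul, ← pow_mul, pow_succ]

lemma isCoprime_theta (n : ℕ) : IsCoprime (Polynomial.X ^ p ^ n - 1 : Polynomial L) (theta p L n) := by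
  have h1 : (Polynomial.X ^ p ^ n - 1 : Polynomial L) ∣ theta p L n - Polynomial.C (p : L) := by
    have : theta p L n - Polynomial.C (p : L) = ∑ i ∈ Finset.range p, ((Polynomial.X ^ p ^ n) ^ i - 1) := by
      simp [theta]
    rw [this]
    exact Finset.dvd_sum fun i _ => by simpa using sub_one_dvd_pow_sub_one (Polynomial.X ^ p ^ n : Polynomial L) i
  obtain ⟨R, hR⟩ := h1
  have hp0 := natCast_prime_ne_zero p L
  refine ⟨-(Polynomial.C (p : L)⁻¹ * R), Polynomial.C (p : L)⁻¹, ?_⟩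
  have h2 : Polynomial.C (p : L)⁻¹ * Polynomial.C (p : L) = 1 := by rw [← Polynomial.C_mul, inv_mul_cancel₀ hp0, map_one]
  linear_combination Polynomial.C (p : L)⁻¹ * hR + h2

/-- A linear form killing `(τ_{p^n} - 1)^{d+1} LP (n+1)` for all `n` kills `Δ^{d+1}` of locally polynomial functions. -/
lemma kill_del_pow {d : ℕ} {φ : (ℤ_[p] → L) → L} (hadd : ∀ n, ∀ f ∈ LP p L d n, ∀ g ∈ LP p L d n, φ (f + g) = φ f + φ g)
    (h0 : φ 0 = 0) (hφ : ∀ n, ∀ g ∈ LP p L d (n + 1), φ (((tau p L (((p ^ n : ℕ) : ℤ_[p])) - 1) ^ (d + 1)) g) = 0)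
    (m : ℕ) : ∀ h ∈ LP p L d m, φ ((del p L ^ (d + 1)) h) = 0 := by
  induction m with
  | zero =>
    intro h hh
    have := (mem_LP_iff.1 hh).2
    rw [pow_zero, Nat.cast_one] at this
    rw [del, this, h0]
  | succ m ih =>
    intro h hh
    obtain ⟨A, B, hAB⟩ := (isCoprime_theta (p := p) (L := L) m).pow (m := d + 1) (n := d + 1)
    set ω : Polynomial L := Polynomial.X ^ p ^ m - 1 with hω
    have e1 : h = act p L (A * ω ^ (d + 1)) h + act p L (B * theta p L m ^ (d + 1)) h := by
      rw [← LinearMap.add_apply, ← map_add, hAB, map_one]; rfl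
    have h2 : act p L (B * theta p L m ^ (d + 1)) h ∈ LP p L d m := by
      rw [mem_LP_iff]
      refine ⟨(LP.cr (LP.act hh _) le_rfl).1, ?_⟩
      rw [← act_X_pow_sub_one, ← map_pow, ← act_mul_apply]
      have : (Polynomial.X ^ p ^ m - 1) ^ (d + 1) * (B * theta p L m ^ (d + 1)) =
          B * (Polynomial.X ^ p ^ (m + 1) - 1) ^ (d + 1) := by
        rw [← theta_mul m, mul_pow]; ring
      rw [this, act_mul_apply, map_pow, act_X_pow_sub_one, (mem_LP_iff.1 hh).2, map_zero]
    have h1 : act p L (A * ω ^ (d + 1)) h ∈ LP p L d (m + 1) := LP.act hh _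
    have e2 : (del p L ^ (d + 1)) h = (del p L ^ (d + 1)) (act p L (A * ω ^ (d + 1)) h) +
        (del p L ^ (d + 1)) (act p L (B * theta p L m ^ (d + 1)) h) := by
      rw [← map_add, ← e1]
    rw [e2, hadd (m + 1) _ (LP.del_pow h1 _) _ (LP.del_pow (LP.succ h2) _), ih _ h2, add_zero]
    have e3 : (del p L ^ (d + 1)) (act p L (A * ω ^ (d + 1)) h) =
        ((tau p L (((p ^ m : ℕ) : ℤ_[p])) - 1) ^ (d + 1)) (act p L ((Polynomial.X - 1) ^ (d + 1) * A) h) := by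
      rw [← act_X_pow_sub_one, ← map_pow, ← act_mul_apply, ← act_X_sub_one, ← map_pow, ← act_mul_apply]
      congr 2
      ring
    rw [e3]
    exact hφ m _ (LP.act hh _)

lemma Gr_X_pow (s : ℕ) : Gr 0 1 (PowerSeries.X ^ s : PowerSeries L) := fun N => by
  rw [PowerSeries.coeff_X_pow, wt, Real.rpow_zero]
  split_ifs <;> simp

lemma Gr.pr_X_pow_mul {r C : ℝ} (hr : 0 ≤ r) {F : PowerSeries L} (hF : Gr r C F) (s : ℕ) {h : ℤ_[p] → L} (hh : Cr r h) :
    pr p (PowerSeries.X ^ s * F) h = pr p F ((del p L ^ s) h) := by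
  have h1 := Gr.hasSum_pr_mul le_rfl hr (Gr_X_pow s) hF (h := h) (by rwa [zero_add])
  refine h1.unique ?_
  have := hasSum_single (f := fun i => PowerSeries.coeff i (PowerSeries.X ^ s : PowerSeries L) * pr p F ((del p L ^ i) h)) s
    fun i hi => by rw [PowerSeries.coeff_X_pow, if_neg hi, zero_mul]
  rwa [PowerSeries.coeff_X_pow, if_pos rfl, one_mul] at this

lemma tau_sub_one_pow_del_pow (b : ℤ_[p]) (s i : ℕ) (g : ℤ_[p] → L) :
    (del p L ^ i) (((tau p L b - 1) ^ s) g) = ((tau p L b - 1) ^ s) ((del p L ^ i) g) := by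
  have h1 : Commute (tau p L b - 1) (del p L) := by
    refine Commute.sub_left ?_ (Commute.one_left _)
    refine Commute.sub_right ?_ (Commute.one_right _)
    ext f x
    simp only [Module.End.mul_apply, tau_apply]
    congr 1; ring
  have := (h1.pow_pow s i).eq
  rw [← Module.End.mul_apply, ← Module.End.mul_apply, this]

/-- Killing is inherited by products. -/
lemma Gr.pr_mul_kill {r s C C' : ℝ} (hr : 0 ≤ r) (hs : 0 ≤ s) {F G : PowerSeries L} (hF : Gr r C F) (hG : Gr s C' G)
    {d n e : ℕ} {b : ℤ_[p]} (hk : ∀ g ∈ LP p L d n, pr p G (((tau p L b - 1) ^ e) g) = 0) {g : ℤ_[p] → L}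
    (hg : g ∈ LP p L d n) : pr p (F * G) (((tau p L b - 1) ^ e) g) = 0 := by
  have hmem : ((tau p L b - 1) ^ e) g ∈ LP p L d n := by
    clear hk
    induction e with
    | zero => exact hg
    | succ e ih =>
      rw [pow_succ', Module.End.mul_apply]
      exact (LP p L d n).sub_mem (LP.tau ih b) ih
  refine (Gr.hasSum_pr_mul hr hs hF hG (LP.cr hmem (add_nonneg hr hs))).unique ?_
  refine HasSum.congr_fun' hasSum_zero fun i => ?_
  rw [tau_sub_one_pow_del_pow, hk _ (LP.del_pow hg i), mul_zero]

end

section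

variable {p : ℕ} [hp : Fact p.Prime]
variable {L : Type} [NontriviallyNormedField L] [NormedAlgebra ℚ_[p] L] [IsUltrametricDist L]
  [CompleteSpace L]

/-- `log(1+X)/X`. -/
def uSer (p : ℕ) [Fact p.Prime] (L : Type) [NontriviallyNormedField L] [NormedAlgebra ℚ_[p] L] : PowerSeries L :=
  PowerSeries.mk fun j => bin p L j (-1) / ((j : L) + 1)

lemma constantCoeff_uSer : PowerSeries.constantCoeff (uSer p L) = 1 := by
  rw [← PowerSeries.coeff_zero_eq_constantCoeff_apply, uSer, PowerSeries.coeff_mk, bin_zero_right]; simp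

lemma uSer_ne_zero : uSer p L ≠ 0 := fun h => by
  have := constantCoeff_uSer (p := p) (L := L)
  rw [h, map_zero] at this
  exact zero_ne_one this

lemma norm_inv_succ_le (p : ℕ) [hp : Fact p.Prime] (L : Type) [NontriviallyNormedField L] [NormedAlgebra ℚ_[p] L] [IsUltrametricDist L]
    [CompleteSpace L] (j : ℕ) : ‖((j : L) + 1)⁻¹‖ ≤ (j : ℝ) + 1 := by
  have hp0 := p_pos p
  have h1 := norm_natCast_succ_ge (p := p) (L := L) (n := Nat.log p (j + 1) + 1) (i := j)
    (Nat.lt_pow_succ_log_self hp.out.one_lt _)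
  rw [pow_succ] at h1
  have h2 := le_of_mul_le_mul_right h1 (by positivity)
  rw [norm_inv]
  refine (inv_anti₀ (by positivity) h2).trans ?_
  rw [inv_pow, inv_inv]
  exact_mod_cast Nat.pow_log_le_self p (Nat.succ_ne_zero j)

lemma Gr_uSer : Gr 1 1 (uSer p L) := fun N => by
  rw [uSer, PowerSeries.coeff_mk, div_eq_mul_inv, norm_mul, one_mul, wt, Real.rpow_one]
  exact (mul_le_of_le_one_left (norm_nonneg _) (norm_bin_le _ _)).trans (norm_inv_succ_le p L N)

/-- `log(1+X)`. -/
def logSer (p : ℕ) [Fact p.Prime] (L : Type) [NontriviallyNormedField L] [NormedAlgebra ℚ_[p] L] : PowerSeries L :=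
  PowerSeries.X * uSer p L

lemma Gr_logSer : Gr 1 1 (logSer p L) := by
  have := Gr.mul le_rfl zero_le_one (Gr_X_pow (L := L) 1) (Gr_uSer (p := p))
  rwa [pow_one, zero_add, one_mul] at this

lemma coeff_zero_logSer : PowerSeries.coeff 0 (logSer p L) = 0 := by simp [logSer]

lemma coeff_succ_logSer (j : ℕ) : PowerSeries.coeff (j + 1) (logSer p L) = bin p L j (-1) / ((j : L) + 1) := by
  rw [logSer, PowerSeries.coeff_succ_X_mul, uSer, PowerSeries.coeff_mk]

lemma hasSum_mc_tau_sub_one {q : ℕ} (hq : 0 < q) (N : ℕ) (h : ℤ_[p] → L) :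
    HasSum (fun k => (if k = 0 then 0 else ((q - 1).choose (k - 1) : L) / k) * mc p L (k + N) h)
      (mc p L N ((tau p L (q : ℤ_[p]) - 1) h) / q) := by
  have hq0 : (q : L) ≠ 0 := by
    obtain ⟨j, rfl⟩ := Nat.exists_eq_succ_of_ne_zero hq.ne'
    simpa using natCast_succ_ne_zero' p L j
  have e1 : tau p L (q : ℤ_[p]) = (del p L + 1) ^ q := by
    rw [del, sub_add_cancel, tau_pow, mul_one]
  have e2 : mc p L N ((tau p L (q : ℤ_[p]) - 1) h) = ∑ k ∈ Finset.range q, (q.choose (k + 1) : L) * mc p L (N + (k + 1)) h := by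
    rw [e1, (Commute.one_right (del p L)).add_pow, LinearMap.sub_apply, LinearMap.sum_apply, Finset.sum_range_succ',
      map_sub, map_add, map_sum]
    simp only [one_pow, mul_one, pow_zero, one_mul, Nat.choose_zero_right, Nat.cast_one, add_sub_cancel_right]
    refine Finset.sum_congr rfl fun k _ => ?_
    rw [Module.End.mul_apply, ← nsmul_one (q.choose (k + 1)), LinearMap.smul_apply, map_nsmul, map_nsmul,
      Module.End.one_apply, mc_del_pow, nsmul_eq_mul]
  rw [e2, Finset.sum_div]
  have e3 : ∑ k ∈ Finset.range q, (q.choose (k + 1) : L) * mc p L (N + (k + 1)) h / q =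
      ∑ k ∈ Finset.range (q + 1), (if k = 0 then 0 else ((q - 1).choose (k - 1) : L) / k) * mc p L (k + N) h := by
    rw [Finset.sum_range_succ']
    simp only [if_true, zero_mul, add_zero, Nat.succ_ne_zero, if_false, Nat.add_sub_cancel]
    refine Finset.sum_congr rfl fun k _ => ?_
    obtain ⟨j, rfl⟩ := Nat.exists_eq_succ_of_ne_zero hq.ne'
    have h1 : ((j + 1 : ℕ) : L) * (j.choose k : L) = ((j + 1).choose (k + 1) : L) * ((k + 1 : ℕ) : L) := by
      exact_mod_cast congrArg (Nat.cast (R := L)) (Nat.add_one_mul_choose_eq j k)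
    have hk : ((k + 1 : ℕ) : L) ≠ 0 := by simpa using natCast_succ_ne_zero' p L k
    rw [add_comm N, Nat.succ_sub_one, mul_div_right_comm]
    congr 1
    rw [div_eq_div_iff hq0 hk, ← h1]; ring
  rw [e3]
  refine hasSum_sum_of_ne_finset_zero fun k hk => ?_
  rw [Finset.mem_range, not_lt] at hk
  rw [if_neg (by omega), Nat.choose_eq_zero_of_lt (by omega)]; simp

/-- The logarithm acts as differentiation. -/
lemma Gr.pr_log_mul {g C : ℝ} (hg : 0 ≤ g) {G : PowerSeries L} (hG : Gr g C G) {h h' : ℤ_[p] → L} (hh : Cr (g + 1) h)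
    (hlim : ∀ x, Tendsto (fun m : ℕ => (h (x + (p : ℤ_[p]) ^ m) - h x) / (p : L) ^ m) atTop (𝓝 (h' x))) :
    pr p (logSer p L * G) h = pr p G h' := by
  have hh1 : Cr 1 h := ⟨hh.1, squeeze_zero (fun N => mul_nonneg (wt_pos _ _).le (norm_nonneg _))
    (fun N => mul_le_mul_of_nonneg_right (Real.rpow_le_rpow_of_exponent_le
      (by linarith [N.cast_nonneg (α := ℝ)]) (by linarith)) (norm_nonneg _)) hh.2⟩
  have key : ∀ N, mc p L N h' = pr p (logSer p L) ((del p L ^ N) h) := fun N => by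
    have hN := hh1.del_pow zero_le_one N
    have t1 : Tendsto (fun m : ℕ => mc p L N ((tau p L ((p ^ m : ℕ) : ℤ_[p]) - 1) h) / ((p ^ m : ℕ) : L)) atTop
        (𝓝 (mc p L N h')) := by
      simp only [mc_sum]
      simp only [Finset.sum_div, mul_div_assoc]
      refine tendsto_finsetSum _ fun i _ => Tendsto.const_mul _ ?_
      refine (hlim _).congr fun m => ?_
      rw [LinearMap.sub_apply, Module.End.one_apply, Pi.sub_apply, tau_apply]
      push_cast; rfl
    refine tendsto_nhds_unique t1 ?_
    have hpm : ∀ m : ℕ, 0 < p ^ m := fun m => pow_pos hp.out.pos m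
    simp only [fun m => ((hasSum_mc_tau_sub_one (hpm m) N h).tsum_eq).symm]
    rw [pr]
    simp only [mc_del_pow]
    refine tendsto_tsum_of_ultrametric (u := fun k => wt 1 k * ‖mc p L (k + N) h‖)
      (by simpa only [mc_del_pow] using hN.2) (fun m k => ?_) (fun k => Tendsto.mul_const _ ?_)
    · rw [norm_mul]
      refine mul_le_mul_of_nonneg_right ?_ (norm_nonneg _)
      rcases k with _ | k
      · simpa using (wt_pos 1 0).le
      · rw [if_neg (Nat.succ_ne_zero k), div_eq_mul_inv, norm_mul, wt, Real.rpow_one]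
        refine (mul_le_of_le_one_left (norm_nonneg _) (norm_natCast_le_one p L _)).trans ?_
        have := norm_inv_succ_le p L k
        push_cast
        linarith
    · rcases k with _ | k
      · simpa [coeff_zero_logSer] using tendsto_const_nhds
      · rw [coeff_succ_logSer]
        simp only [Nat.succ_ne_zero, if_false, Nat.add_sub_cancel, Nat.cast_add, Nat.cast_one]
        refine Tendsto.div_const ?_ _
        have t2 : Tendsto (fun m : ℕ => (p : ℤ_[p]) ^ m - 1) atTop (𝓝 (-1)) := by
          have : Tendsto (fun m : ℕ => (p : ℤ_[p]) ^ m) atTop (𝓝 0) :=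
            tendsto_pow_atTop_nhds_zero_of_norm_lt_one (by rw [PadicInt.norm_p]; exact inv_lt_one_of_one_lt₀ (one_lt_p p))
          simpa using this.sub_const 1
        refine (((continuous_bin (L := L) k).tendsto (-1)).comp t2).congr fun m => ?_
        rw [← bin_natCast (p := p), Nat.cast_sub (hpm m), Nat.cast_pow, Nat.cast_one]
        rfl
  rw [mul_comm]
  have s1 := Gr.hasSum_pr_mul hg zero_le_one hG (Gr_logSer (p := p)) hh
  simp only [← key] at s1
  exact s1.tsum_eq.symm

lemma tendsto_PL_mon (b : ℤ_[p]) (n i : ℕ) (x : ℤ_[p]) :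
    Tendsto (fun m : ℕ => (PL L b n (mon p L i) (x + (p : ℤ_[p]) ^ m) - PL L b n (mon p L i) x) / (p : L) ^ m) atTop
      (𝓝 ((((i : L) * ((p : L) ^ n)⁻¹) • PL L b n (mon p L (i - 1))) x)) := by
  have hp0 := natCast_prime_ne_zero p L
  by_cases h : ∃ w, x = b + (p : ℤ_[p]) ^ n * w
  · obtain ⟨w, rfl⟩ := h
    have t0 : Tendsto (fun m : ℕ => (p : ℤ_[p]) ^ m) atTop (𝓝 0) :=
      tendsto_pow_atTop_nhds_zero_of_norm_lt_one (by rw [PadicInt.norm_p]; exact inv_lt_one_of_one_lt₀ (one_lt_p p))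
    have hc : Continuous fun t : ℤ_[p] => (∑ j ∈ Finset.range i, iotaL p L ((w + t : ℤ_[p]) : ℚ_[p]) ^ j *
        iotaL p L (w : ℚ_[p]) ^ (i - 1 - j)) * ((p : L) ^ n)⁻¹ := by
      have := continuous_iotaL (p := p) (L := L)
      fun_prop
    have t1 := (hc.tendsto 0).comp t0
    have e1 : (∑ j ∈ Finset.range i, iotaL p L ((w + 0 : ℤ_[p]) : ℚ_[p]) ^ j *
        iotaL p L (w : ℚ_[p]) ^ (i - 1 - j)) * ((p : L) ^ n)⁻¹ =
        (((i : L) * ((p : L) ^ n)⁻¹) • PL L b n (mon p L (i - 1))) (b + (p : ℤ_[p]) ^ n * w) := by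
      rw [Pi.smul_apply, PL_apply, mon, add_zero, smul_eq_mul]
      have : ∀ j ∈ Finset.range i, iotaL p L (w : ℚ_[p]) ^ j * iotaL p L (w : ℚ_[p]) ^ (i - 1 - j) =
          iotaL p L (w : ℚ_[p]) ^ (i - 1) := fun j hj => by
        rw [← pow_add]; congr 1; rw [Finset.mem_range] at hj; omega
      rw [Finset.sum_congr rfl this, Finset.sum_const, Finset.card_range, nsmul_eq_mul]; ring
    rw [e1] at t1
    refine (tendsto_add_atTop_iff_nat n).1 (t1.congr fun m => ?_)
    have e2 : b + (p : ℤ_[p]) ^ n * w + (p : ℤ_[p]) ^ (m + n) = b + (p : ℤ_[p]) ^ n * (w + (p : ℤ_[p]) ^ m) := by ring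
    rw [e2, PL_apply, PL_apply, mon, mon]
    have e3 := (Commute.all (iotaL p L ((w + (p : ℤ_[p]) ^ m : ℤ_[p]) : ℚ_[p])) (iotaL p L (w : ℚ_[p]))).geom_sum₂_mul i
    have e4 : iotaL p L ((w + (p : ℤ_[p]) ^ m : ℤ_[p]) : ℚ_[p]) - iotaL p L (w : ℚ_[p]) = (p : L) ^ m := by
      push_cast; simp
    rw [← e3, e4, Function.comp_apply, pow_add]
    field_simp
  · have h0 : ∀ m : ℕ, n ≤ m → ¬ ∃ w, x + (p : ℤ_[p]) ^ m = b + (p : ℤ_[p]) ^ n * w := by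
      rintro m hm ⟨w, hw⟩
      refine h ⟨w - (p : ℤ_[p]) ^ (m - n), ?_⟩
      rw [mul_sub, ← pow_add, Nat.add_sub_cancel' hm, add_sub, ← hw]; ring
    rw [Pi.smul_apply, PL_of_not (mon p L (i - 1)) h, smul_zero]
    refine tendsto_const_nhds.congr' ((eventually_ge_atTop n).mono fun m hm => ?_)
    simp only [PL_of_not _ (h0 m hm), PL_of_not _ h, sub_zero, zero_div]

lemma Gr.log_pow_mul {g C : ℝ} (hg : 0 ≤ g) {G : PowerSeries L} (hG : Gr g C G) (j : ℕ) :
    Gr (j + g) C (logSer p L ^ j * G) := by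
  induction j with
  | zero => simpa using hG
  | succ j ih =>
    rw [pow_succ', mul_assoc]
    have := Gr.mul zero_le_one (by positivity) (Gr_logSer (p := p)) ih
    rw [one_mul] at this
    refine this.mono_exp (le_of_eq ?_)
    push_cast; ring

lemma Gr.pr_log_pow_mul {g C : ℝ} (hg : 0 ≤ g) {G : PowerSeries L} (hG : Gr g C G) (b : ℤ_[p]) (n j i : ℕ) :
    pr p (logSer p L ^ j * G) (PL L b n (mon p L i)) =
      (i.descFactorial j : L) * (((p : L) ^ n)⁻¹) ^ j * pr p G (PL L b n (mon p L (i - j))) := by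
  induction j generalizing i with
  | zero => simp
  | succ j ih =>
    rw [pow_succ' (logSer p L), mul_assoc, Gr.pr_log_mul (by positivity) (hG.log_pow_mul hg j)
      (PL_cr (by positivity) (crB_mon (by positivity) i).1 _ _) (tendsto_PL_mon b n i), pr_smul, ih]
    rcases i with _ | i
    · simp
    · rw [Nat.succ_descFactorial_succ, Nat.add_sub_cancel, Nat.add_sub_add_right]
      push_cast; ring

end

section

variable {p : ℕ} [hp : Fact p.Prime]
variable {L : Type} [NontriviallyNormedField L] [NormedAlgebra ℚ_[p] L] [IsUltrametricDist L]
  [CompleteSpace L]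

lemma mon_affine_sub_mem (a c : ℤ_[p]) (d : ℕ) :
    (fun x => mon p L (d + 1) (a + c * x)) - (iotaL p L c ^ (d + 1)) • mon p L (d + 1) ∈ PF p L d := by
  refine ⟨(Polynomial.C (iotaL p L a) + Polynomial.C (iotaL p L c) * Polynomial.X) ^ (d + 1) -
    (Polynomial.C (iotaL p L c) * Polynomial.X) ^ (d + 1), ?_, ?_⟩
  · set Y := Polynomial.C (iotaL p L c) * Polynomial.X with hY
    have hYd : Y.natDegree ≤ 1 := by
      rw [hY]; exact (Polynomial.natDegree_C_mul_le _ _).trans Polynomial.natDegree_X_le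
    rw [← (Commute.all _ _).geom_sum₂_mul, add_sub_cancel_right, mul_comm]
    refine (Polynomial.natDegree_C_mul_le _ _).trans ?_
    refine Polynomial.natDegree_sum_le_of_forall_le _ _ fun i hi => ?_
    rw [Finset.mem_range] at hi
    refine (Polynomial.natDegree_mul_le).trans ?_
    refine (Nat.add_le_add Polynomial.natDegree_pow_le Polynomial.natDegree_pow_le).trans ?_
    have h1 : (Polynomial.C (iotaL p L a) + Y).natDegree ≤ 1 :=
      Polynomial.natDegree_add_le_of_degree_le (by simp) hYd
    calc _ ≤ i * 1 + (d + 1 - 1 - i) * 1 := by gcongr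
      _ ≤ d := by omega
  · ext x
    simp [mon, mul_pow]

lemma LP_pr_eq_zero {D : PowerSeries L} {d n : ℕ} (hadd : ∃ r C, 0 ≤ r ∧ Gr r C D)
    (h : ∀ a : ℕ, a < p ^ n → ∀ i ≤ d, pr p D (PL L (a : ℤ_[p]) n (mon p L i)) = 0) :
    ∀ g ∈ LP p L d n, pr p D g = 0 := by
  intro g hg
  obtain ⟨r, C, hr, hD⟩ := hadd
  rw [eq_sum_PL g n, hD.pr_sum fun a _ => PL_cr hr (PF.cr (hg _) r) _ _]
  refine Finset.sum_eq_zero fun a ha => ?_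
  obtain ⟨P, hP, hPe⟩ := hg (a : ℤ_[p])
  have e : (fun x => g ((a : ℤ_[p]) + (p : ℤ_[p]) ^ n * x)) = ∑ i ∈ Finset.range (d + 1), P.coeff i • mon p L i := by
    rw [hPe]
    ext x
    rw [Polynomial.eval_eq_sum_range' (Nat.lt_succ_of_le hP)]
    simp [Finset.sum_apply, mon]
  rw [e, PL_sum, hD.pr_sum fun i _ => PL_cr hr ((CrS p L r).smul_mem _ (crB_mon hr i).1) _ _]
  refine Finset.sum_eq_zero fun i hi => ?_
  have e2 : PL L (a : ℤ_[p]) n (P.coeff i • mon p L i) = P.coeff i • PL L (a : ℤ_[p]) n (mon p L i) := by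
    obtain ⟨c, σ, hc⟩ := PL_eq_mul (L := L) (a : ℤ_[p]) n
    ext x; simp [hc]; ring
  rw [e2, pr_smul, h a (Finset.mem_range.1 ha) i (Nat.lt_succ_iff.1 (Finset.mem_range.1 hi)), mul_zero]

/-- A series of growth `d+1` such that `X^{d+1} D` kills locally polynomial functions of degree `d` is a bounded
multiple of the corresponding power of `log(1+X)/X`. -/
theorem exists_bounded_quotient (p : ℕ) [hp : Fact p.Prime] (L : Type) [NontriviallyNormedField L]
    [NormedAlgebra ℚ_[p] L] [IsUltrametricDist L] [CompleteSpace L] (d : ℕ) : ∃ K : ℝ, 0 ≤ K ∧ ∀ (D : PowerSeries L) (C : ℝ),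
    Gr ((d : ℝ) + 1) C D → (∀ m, ∀ h ∈ LP p L d m, pr p D ((del p L ^ (d + 1)) h) = 0) →
    ∃ H, Gr 0 (K * C) H ∧ D = uSer p L ^ (d + 1) * H := by
  have hp0 := p_pos p
  have hs : (0 : ℝ) ≤ (d : ℝ) + 1 := by positivity
  have hK := zero_le_one.trans (one_le_KO (p := p) hs)
  have hfac : (((d + 1).factorial : ℕ) : L) ≠ 0 := by
    have := natCast_succ_ne_zero' p L ((d + 1).factorial - 1)
    rwa [← Nat.cast_one (R := L), ← Nat.cast_add, Nat.sub_add_cancel (Nat.factorial_pos _)] at this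
  refine ⟨KO p ((d : ℝ) + 1) * KO p ((d : ℝ) + 1) * ‖((((d + 1).factorial : ℕ) : L))⁻¹‖, by positivity,
    fun D C hD hkill => ?_⟩
  set D1 := PowerSeries.X ^ (d + 1) * D with hD1
  have hD1g : Gr ((d : ℝ) + 1) C D1 := by
    have := Gr.mul le_rfl hs (Gr_X_pow (L := L) (d + 1)) hD
    rwa [zero_add, one_mul] at this
  have hC := hD.nonneg
  have hk : ∀ m, ∀ h ∈ LP p L d m, pr p D1 h = 0 := fun m h hh => by
    rw [hD1, hD.pr_X_pow_mul hs _ (LP.cr hh hs)]; exact hkill m h hh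
  have hp0L := natCast_prime_ne_zero p L
  set e : ℕ → ℤ_[p] → ℕ → L := fun n b _ => (((p : L) ^ n) ^ (d + 1) * ((((d + 1).factorial : ℕ) : L))⁻¹) *
    pr p D1 (PL L b n (mon p L (d + 1))) with he
  have hcr : ∀ (b : ℤ_[p]) n, Cr ((d : ℝ) + 1) (PL L b n (mon p L (d + 1))) := fun b n =>
    PL_cr hs (crB_mon hs _).1 _ _
  have hpA : (p : ℝ) ^ ((d : ℝ) + 1) = (p : ℝ) ^ (d + 1) := by
    rw [← Real.rpow_natCast]; push_cast; rfl
  have hb : ∀ n b i, i ≤ 0 → ‖e n b i‖ ≤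
      KO p ((d : ℝ) + 1) * KO p ((d : ℝ) + 1) * ‖((((d + 1).factorial : ℕ) : L))⁻¹‖ * C * ((p : ℝ) ^ (0 : ℝ)) ^ n := by
    intro n b i _
    have h1 := hD1g.norm_pr_le ((crB_mon (p := p) (L := L) hs (d + 1)).PL hs b n)
    rw [he, norm_mul, norm_mul, norm_pow, norm_pow, norm_natCast_prime]
    rw [hpA] at h1
    rw [Real.rpow_zero, one_pow, mul_one]
    calc _ ≤ (((p : ℝ)⁻¹ ^ n) ^ (d + 1) * ‖((((d + 1).factorial : ℕ) : L))⁻¹‖) *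
          (C * (KO p ((d : ℝ) + 1) * ((p : ℝ) ^ (d + 1)) ^ n * KO p ((d : ℝ) + 1))) := by gcongr
      _ = _ := by
        rw [inv_pow, inv_pow, ← pow_mul, ← pow_mul, mul_comm n]
        field_simp
  have hcomp : Compat (p := p) 0 e := by
    intro n b i hi
    obtain rfl : i = 0 := Nat.le_zero.1 hi
    simp only [zero_add, Finset.sum_range_one]
    have e0 : ∀ a : ℕ, mc p L 0 (fun x => bin p L 0 ((a : ℤ_[p]) + (p : ℤ_[p]) * x)) = 1 := fun a => by
      rw [mc_apply, pow_zero, Module.End.one_apply, bin_zero_right]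
    simp only [e0, one_mul]
    simp only [he, ← Finset.mul_sum]
    rw [pow_succ (p : L) n, mul_pow]
    have e1 : PL L b n (mon p L (d + 1)) = ∑ a ∈ Finset.range p, (((p : L) ^ (d + 1)) •
        PL L (b + (p : ℤ_[p]) ^ n * (a : ℤ_[p])) (n + 1) (mon p L (d + 1)) + PL L (b + (p : ℤ_[p]) ^ n * (a : ℤ_[p])) (n + 1)
        ((fun x => mon p L (d + 1) ((a : ℤ_[p]) + (p : ℤ_[p]) * x)) - (iotaL p L (p : ℤ_[p]) ^ (d + 1)) • mon p L (d + 1))) := by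
      conv_lhs => rw [eq_sum_PL (mon p L (d + 1)) 1, PL_sum, pow_one]
      refine Finset.sum_congr rfl fun a _ => ?_
      rw [PL_PL]
      obtain ⟨c, σ, hc⟩ := PL_eq_mul (L := L) (b + (p : ℤ_[p]) ^ n * (a : ℤ_[p])) (n + 1)
      ext x
      simp [hc]; ring
    have e2 : ∀ a : ℕ, PL L (b + (p : ℤ_[p]) ^ n * (a : ℤ_[p])) (n + 1) ((fun x => mon p L (d + 1) ((a : ℤ_[p]) + (p : ℤ_[p]) * x)) -
        (iotaL p L (p : ℤ_[p]) ^ (d + 1)) • mon p L (d + 1)) ∈ LP p L d (n + 1) := fun a =>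
      LP_PL (mon_affine_sub_mem _ _ _) _ _
    rw [e1, hD1g.pr_sum fun a _ => (CrS p L _).add_mem ((CrS p L _).smul_mem _ (hcr _ _)) (LP.cr (e2 a) hs)]
    have e3 : ∀ a ∈ Finset.range p, pr p D1 (((p : L) ^ (d + 1)) •
        PL L (b + (p : ℤ_[p]) ^ n * (a : ℤ_[p])) (n + 1) (mon p L (d + 1)) + PL L (b + (p : ℤ_[p]) ^ n * (a : ℤ_[p])) (n + 1)
        ((fun x => mon p L (d + 1) ((a : ℤ_[p]) + (p : ℤ_[p]) * x)) - (iotaL p L (p : ℤ_[p]) ^ (d + 1)) • mon p L (d + 1))) =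
        (p : L) ^ (d + 1) * pr p D1 (PL L (b + (p : ℤ_[p]) ^ n * (a : ℤ_[p])) (n + 1) (mon p L (d + 1))) := fun a _ => by
      rw [hD1g.pr_add ((CrS p L _).smul_mem _ (hcr _ _)) (LP.cr (e2 a) hs), hk _ _ (e2 a), add_zero, pr_smul]
    rw [Finset.sum_congr rfl e3, ← Finset.mul_sum]
    ring
  obtain ⟨H, hH, hHe⟩ := hcomp.exists_series le_rfl (by norm_num) (by positivity) hb
  rw [Real.rpow_zero, one_mul] at hH
  refine ⟨H, hH, ?_⟩
  have hav : ∀ n, ∀ a < p ^ n, pr p H (PL L (a : ℤ_[p]) n (mon p L 0)) = e n a 0 := fun n a ha => by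
    rw [hHe n _ (LP_PL (PF_mon le_rfl) _ _), av, Finset.sum_eq_single a]
    · simp only [zero_add, Finset.sum_range_one, PL_apply]
      rw [mc_apply, pow_zero, Module.End.one_apply, mon, pow_zero, one_mul]
    · intro a' ha' hne
      simp only [zero_add, Finset.sum_range_one]
      rw [mc_apply, pow_zero, Module.End.one_apply, mul_zero, add_zero, PL_of_not, zero_mul]
      rintro ⟨w, hw⟩
      exact hne (digit_unique (e := n) (Finset.mem_range.1 ha') ha (w := 0) (w' := w) (by rw [mul_zero, add_zero, hw]))
    · exact fun h => absurd (Finset.mem_range.2 ha) h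
  have hlog := hH.log_pow_mul (p := p) le_rfl (d + 1)
  rw [add_zero, Nat.cast_add, Nat.cast_one] at hlog
  have hz : D1 - logSer p L ^ (d + 1) * H = 0 := by
    refine Gr.eq_zero (p := p) (J := d + 1) hs (by push_cast; linarith)
      ((hD1g.mono (le_max_left _ _)).sub (hlog.mono (le_max_right _ _))) fun n =>
        LP_pr_eq_zero ⟨_, _, hs, (hD1g.mono (le_max_left _ _)).sub (hlog.mono (le_max_right _ _))⟩ fun a ha i hi => ?_
    have hcri : Cr ((d : ℝ) + 1) (PL L (a : ℤ_[p]) n (mon p L i)) := PL_cr hs (crB_mon hs _).1 _ _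
    rw [hD1g.pr_sub_left hlog hcri, hH.pr_log_pow_mul le_rfl, sub_eq_zero]
    rcases Nat.lt_or_ge i (d + 1) with h | h
    · rw [Nat.descFactorial_of_lt h, hk n _ (LP_PL (PF_mon (Nat.lt_succ_iff.1 h)) _ _)]; simp
    · obtain rfl : i = d + 1 := le_antisymm hi h
      rw [Nat.descFactorial_self, Nat.sub_self, hav n a ha, inv_pow]
      simp only [he]
      have hpn : ((p : L) ^ n) ^ (d + 1) ≠ 0 := pow_ne_zero _ (pow_ne_zero _ hp0L)
      generalize ((p : L) ^ n) ^ (d + 1) = y at hpn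
      field_simp
  rw [sub_eq_zero, hD1, logSer, mul_pow, mul_assoc] at hz
  exact mul_left_cancel₀ (pow_ne_zero _ PowerSeries.X_ne_zero) hz

end

section

variable {p : ℕ} [hp : Fact p.Prime]
variable {L : Type} [NontriviallyNormedField L] [NormedAlgebra ℚ_[p] L] [IsUltrametricDist L]
  [CompleteSpace L]

lemma iotaL_coe_injective : Function.Injective fun x : ℤ_[p] => iotaL p L x := fun x y h =>
  PadicInt.ext ((algebraMap ℚ_[p] L).injective h)

lemma norm_natCast_Q (a : ℕ) : ‖(a : ℚ_[p])‖ ≤ 1 := by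
  have := PadicInt.norm_le_one (a : ℤ_[p])
  rwa [PadicInt.norm_def, PadicInt.coe_natCast] at this

lemma poly_eq_of_eval (p : ℕ) [hp : Fact p.Prime] {L : Type} [NontriviallyNormedField L] [NormedAlgebra ℚ_[p] L]
    [IsUltrametricDist L] [CompleteSpace L] {P Q : Polynomial L}
    (h : ∀ x : ℤ_[p], P.eval (iotaL p L x) = Q.eval (iotaL p L x)) : P = Q :=
  Polynomial.eq_of_infinite_eval_eq P Q ((Set.infinite_range_of_injective
    (iotaL_coe_injective (p := p) (L := L))).mono (by rintro _ ⟨x, rfl⟩; exact h x))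

lemma poly_eq_sum (p : ℕ) [hp : Fact p.Prime] {L : Type} [NontriviallyNormedField L] [NormedAlgebra ℚ_[p] L]
    [IsUltrametricDist L] [CompleteSpace L] {P : Polynomial L} {d : ℕ} (hP : P.natDegree ≤ d) :
    P = ∑ j ∈ Finset.range (d + 1), mc p L j (fun x : ℤ_[p] => P.eval (iotaL p L x)) • binPoly L j := by
  refine poly_eq_of_eval p fun x => ?_
  have h : (fun x : ℤ_[p] => P.eval (iotaL p L x)) ∈ PF p L d := ⟨P, hP, rfl⟩
  have h1 := congrFun (PF.eq_sum h) x
  simp only [Finset.sum_apply, Pi.smul_apply, smul_eq_mul] at h1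
  rw [h1, Polynomial.eval_finsetSum]
  exact Finset.sum_congr rfl fun j _ => by rw [Polynomial.eval_smul, smul_eq_mul, eval_binPoly]

/-- A translated and dilated polynomial. -/
def aff (P : Polynomial L) (a b : L) : Polynomial L := P.comp (Polynomial.C a + Polynomial.C b * Polynomial.X)

lemma aff_eval (P : Polynomial L) (a b x : L) : (aff P a b).eval x = P.eval (a + b * x) := by
  simp [aff, Polynomial.eval_comp]

lemma aff_natDegree {P : Polynomial L} {d : ℕ} (hP : P.natDegree ≤ d) (a b : L) : (aff P a b).natDegree ≤ d := by
  refine Polynomial.natDegree_comp_le.trans ?_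
  have : (Polynomial.C a + Polynomial.C b * Polynomial.X).natDegree ≤ 1 := by
    refine Polynomial.natDegree_add_le_of_degree_le (by simp) ?_
    exact (Polynomial.natDegree_C_mul_le _ _).trans Polynomial.natDegree_X_le
  calc _ ≤ d * 1 := Nat.mul_le_mul hP this
    _ = d := mul_one d

namespace Par

variable (D : Par p L)

lemma norm_lam_eq : ‖D.lam‖ = (p : ℝ) ^ (D.d : ℝ) * ((p : ℝ) ^ (-(2 * D.r))) := by
  have hp0 := p_pos p
  have h := D.norm_lam
  rw [inv_pow, ← div_eq_mul_inv, div_eq_iff (by positivity)] at h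
  rw [h, ← Real.rpow_neg hp0.le, ← Real.rpow_natCast, ← Real.rpow_natCast, ← Real.rpow_mul hp0.le, mul_comm]
  congr 2; push_cast; ring

lemma norm_lam_lt_one : ‖D.lam‖ < 1 := by
  have hp0 := p_pos p
  rw [norm_lam_eq, ← Real.rpow_add hp0]
  refine Real.rpow_lt_one_of_one_lt_of_neg (one_lt_p p) ?_
  have := D.hsum; have := D.hrr'; linarith

/-- The scalar of the second eigenline. -/
def chi' : L := D.chi * p / D.lam

lemma chi'_ne : D.chi' ≠ 0 :=
  div_ne_zero (mul_ne_zero D.chi_ne (natCast_prime_ne_zero p L)) D.lam_ne_zero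

lemma norm_chi'_inv : ‖D.chi'⁻¹‖ = (p : ℝ) ^ D.r' := by
  have hp0 := p_pos p
  rw [chi', norm_inv, norm_div, norm_mul, D.norm_chi, norm_natCast_prime p L, norm_lam_eq, ← Real.rpow_neg hp0.le,
    ← Real.rpow_add hp0, show ((p : ℝ))⁻¹ = (p : ℝ) ^ (-1 : ℝ) from (Real.rpow_neg_one _).symm, ← Real.rpow_add hp0,
    ← Real.rpow_sub hp0, ← Real.rpow_neg hp0.le]
  congr 1
  have := D.hsum; linarith

/-- The value on `ℤ_p` of the spherical function. -/
def kap : L := (1 - (p : L)⁻¹) / (1 - D.lam / p)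

lemma kap_den : 1 - D.lam / p ≠ 0 := by
  have := D.lam_ne
  rw [sub_ne_zero]; intro h
  rw [eq_div_iff (natCast_prime_ne_zero p L), one_mul] at h
  exact this h.symm

lemma kap_ne : D.kap - D.lam⁻¹ ≠ 0 := by
  have h1 := D.kap_den
  have h2 := D.lam_ne_zero
  have h3 := natCast_prime_ne_zero p L
  have h4 : D.lam ≠ 1 := fun h => by simpa [h] using D.norm_lam_lt_one
  intro h
  rw [kap, sub_eq_zero, div_eq_iff h1] at h
  field_simp at h
  apply h4
  have : (D.lam - 1) * p = 0 := by linear_combination h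
  rcases mul_eq_zero.1 this with h | h
  · exact sub_eq_zero.1 h
  · exact absurd h h3

/-- The spherical function. -/
def W (z : ℚ_[p]) : L := if ‖z‖ ≤ 1 then D.kap else D.lam ^ z.valuation

lemma W_int {z : ℚ_[p]} (hz : ‖z‖ ≤ 1) : D.W z = D.kap := if_pos hz

lemma W_out {z : ℚ_[p]} (hz : ¬ ‖z‖ ≤ 1) : D.W z = D.lam ^ z.valuation := if_neg hz

lemma valuation_eq_of_norm_eq {x y : ℚ_[p]} (hx : x ≠ 0) (h : ‖x‖ = ‖y‖) : x.valuation = y.valuation := by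
  have hy : y ≠ 0 := by rw [← norm_ne_zero_iff, ← h]; exact norm_ne_zero_iff.2 hx
  rw [Padic.norm_eq_zpow_neg_valuation hx, Padic.norm_eq_zpow_neg_valuation hy] at h
  have := zpow_right_injective₀ (p_pos p) (one_lt_p p).ne' h
  simpa using this

lemma norm_add_eq_of_lt {x y : ℚ_[p]} (h : ‖y‖ < ‖x‖) : ‖x + y‖ = ‖x‖ := by
  rw [Padic.add_eq_max_of_ne h.ne', max_eq_left h.le]

lemma W_add {z w : ℚ_[p]} (hw : ‖w‖ ≤ 1) : D.W (z + w) = D.W z := by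
  by_cases hz : ‖z‖ ≤ 1
  · rw [D.W_int hz, D.W_int ((Padic.nonarchimedean _ _).trans (max_le hz hw))]
  · have h := norm_add_eq_of_lt (hw.trans_lt (not_le.1 hz))
    have hz' : ¬ ‖z + w‖ ≤ 1 := by rwa [h]
    rw [D.W_out hz, D.W_out hz', valuation_eq_of_norm_eq (by rintro h0; rw [h0] at hz'; simp at hz') h]

/-- The modification of the spherical function invariant under `p⁻¹ℤ_p`. -/
def Wt (z : ℚ_[p]) : L := D.W z - (D.kap - D.lam⁻¹) * blk (fun _ => 1) z

lemma Wt_small {z : ℚ_[p]} (hz : ‖z‖ ≤ p) : D.Wt z = D.lam⁻¹ := by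
  by_cases h : ‖z‖ ≤ 1
  · obtain ⟨x, rfl⟩ : ∃ x : ℤ_[p], (x : ℚ_[p]) = z := ⟨⟨z, h⟩, rfl⟩
    rw [Wt, W_int _ h, blk_coe]; ring
  · have h1 : ‖z‖ = p := by
      refine le_antisymm hz ?_
      by_contra hlt
      apply h
      have := (Padic.norm_le_pow_iff_norm_lt_pow_add_one z 0).2 (by simpa using hlt)
      simpa using this
    have h2 : z.valuation = -1 := by
      have hz0 : z ≠ 0 := by rintro rfl; simp at h
      rw [Padic.norm_eq_zpow_neg_valuation hz0] at h1
      have := zpow_right_injective₀ (p_pos p) (one_lt_p p).ne' (h1.trans (zpow_one _).symm)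
      omega
    rw [Wt, W_out _ h, blk_of_not _ h, h2]; simp

lemma Wt_big {z : ℚ_[p]} (hz : ¬ ‖z‖ ≤ p) : D.Wt z = D.lam ^ z.valuation := by
  have h : ¬ ‖z‖ ≤ 1 := fun h => hz (h.trans (one_lt_p p).le)
  rw [Wt, W_out _ h, blk_of_not _ h]; simp

lemma Wt_add {z w : ℚ_[p]} (hw : ‖w‖ ≤ p) : D.Wt (z + w) = D.Wt z := by
  by_cases hz : ‖z‖ ≤ p
  · rw [D.Wt_small hz, D.Wt_small ((Padic.nonarchimedean _ _).trans (max_le hz hw))]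
  · have h := norm_add_eq_of_lt (hw.trans_lt (not_le.1 hz))
    have hz' : ¬ ‖z + w‖ ≤ p := by rwa [h]
    rw [D.Wt_big hz, D.Wt_big hz', valuation_eq_of_norm_eq (by rintro h0; rw [h0] at hz'; simp at hz') h]

lemma Wt_eq_of_val {z : ℚ_[p]} (hz : ¬ ‖z‖ ≤ 1) : D.Wt z = D.lam ^ z.valuation := by
  rw [Wt, W_out _ hz, blk_of_not _ hz]; simp

lemma norm_div_p (z : ℚ_[p]) : ‖z / p‖ = ‖z‖ * p := by
  rw [norm_div, Padic.norm_p, div_inv_eq_mul]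

lemma sum_W (z : ℚ_[p]) : ∑ a ∈ Finset.range p, D.W ((z - (a : ℚ_[p])) / p) = ((p : L) / D.lam) * D.W z := by
  have hp0 := natCast_prime_ne_zero p L
  have hl := D.lam_ne_zero
  have hW : ∀ x, D.W x = D.Wt x + (D.kap - D.lam⁻¹) * blk (fun _ => 1) x := fun x => by rw [Wt]; ring
  have hWt : ∀ a : ℕ, D.Wt ((z - (a : ℚ_[p])) / p) = D.Wt (z / p) := fun a => by
    rw [sub_div, sub_eq_add_neg, D.Wt_add]
    rw [norm_neg, norm_div_p]
    exact mul_le_of_le_one_left (p_pos p).le (norm_natCast_Q a)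
  simp only [hW ((z - _) / _), hWt, Finset.sum_add_distrib, ← Finset.mul_sum, Finset.sum_const, Finset.card_range,
    nsmul_eq_mul]
  by_cases hz : ‖z‖ ≤ 1
  · obtain ⟨x, rfl⟩ : ∃ x : ℤ_[p], (x : ℚ_[p]) = z := ⟨⟨z, hz⟩, rfl⟩
    obtain ⟨a, ha, w, rfl⟩ := exists_digit x 1
    rw [pow_one] at ha
    rw [Finset.sum_eq_single_of_mem a (Finset.mem_range.2 ha)]
    · rw [D.Wt_small, D.W_int hz]
      · have : (((a : ℤ_[p]) + (p : ℤ_[p]) ^ 1 * w : ℤ_[p]) - (a : ℚ_[p])) / p = (w : ℚ_[p]) := by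
          have := pQ_ne_zero (p := p)
          push_cast; field_simp; ring
        rw [this, blk_coe]
        have h := D.kap_den
        have hk : D.kap * (1 - D.lam / p) = 1 - (p : L)⁻¹ := by rw [kap, div_mul_cancel₀ _ h]
        have hk' : D.kap * (p - D.lam) = p - 1 := by
          field_simp at hk; linear_combination hk
        field_simp
        linear_combination -hk'
      · rw [norm_div_p]; exact mul_le_of_le_one_left (p_pos p).le hz
    · intro b hb hba
      refine blk_of_not _ fun hle => hba ?_
      rw [norm_div_p] at hle
      have : ‖((a : ℤ_[p]) + (p : ℤ_[p]) ^ 1 * w) - b‖ ≤ (p : ℝ) ^ (-(1 : ℕ) : ℤ) := by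
        rw [Nat.cast_one, zpow_neg_one, ← one_div, le_div_iff₀ (p_pos p)]
        refine le_of_eq_of_le ?_ hle
        rw [PadicInt.norm_def]
        push_cast
        rfl
      rw [PadicInt.norm_le_pow_iff_mem_span_pow] at this
      obtain ⟨w', hw'⟩ := Ideal.mem_span_singleton.1 this
      exact digit_unique (e := 1) (by simpa using hb) (by simpa using ha) (w := w') (w' := w)
        (by rw [← hw']; ring)
  · have h1 : ¬ ‖z / p‖ ≤ 1 := fun h => hz (by
      rw [norm_div_p] at h
      exact (le_mul_of_one_le_right (norm_nonneg _) (one_lt_p p).le).trans h)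
    rw [D.Wt_eq_of_val h1, D.W_out hz, Finset.sum_eq_zero, mul_zero, add_zero, div_eq_mul_inv z, Padic.valuation_mul, Padic.valuation_inv, Padic.valuation_p,
      ← sub_eq_add_neg, zpow_sub₀ hl, zpow_one]
    · field_simp
    · rintro rfl; simp at hz
    · exact inv_ne_zero pQ_ne_zero
    · intro a _
      refine blk_of_not _ fun h => hz ?_
      rw [norm_div_p] at h
      have h2 : ‖z - a‖ ≤ 1 := (le_mul_of_one_le_right (norm_nonneg _) (one_lt_p p).le).trans h
      have h3 : ‖(a : ℚ_[p])‖ ≤ 1 := norm_natCast_Q a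
      have := (Padic.nonarchimedean (z - (a : ℚ_[p])) a).trans (max_le h2 h3)
      simpa using this

/-- A polynomial times the spherical function. -/
def QW : Polynomial L →ₗ[L] (ℚ_[p] → L) where
  toFun P := fun z => P.eval (iotaL p L z) * D.W z
  map_add' P Q := by ext z; simp [add_mul]
  map_smul' c P := by ext z; simp [mul_assoc]

lemma QW_apply (P : Polynomial L) (z : ℚ_[p]) : D.QW P z = P.eval (iotaL p L z) * D.W z := rfl

lemma T_QW (n : ℤ) (b : ℚ_[p]) (P : Polynomial L) : D.T n b (D.QW P) =
    D.chi'⁻¹ • ∑ a ∈ Finset.range p, D.T (n + 1) (b + (p : ℚ_[p]) ^ n * a) (D.QW (aff P a p)) := by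
  have hp0 := natCast_prime_ne_zero p L
  have hpQ := pQ_ne_zero (p := p)
  have hl := D.lam_ne_zero
  have hc := D.chi_ne
  ext z
  set w := (z - b) / (p : ℚ_[p]) ^ n with hw
  have h1 : ∀ a : ℕ, (z - (b + (p : ℚ_[p]) ^ n * a)) / (p : ℚ_[p]) ^ (n + 1) = (w - a) / p := fun a => by
    have := zpow_ne_zero n hpQ
    rw [hw, zpow_add₀ hpQ, zpow_one]
    field_simp
    ring
  have h2 : ∀ a : ℕ, (aff P a p).eval (iotaL p L ((w - a) / p)) = P.eval (iotaL p L w) := fun a => by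
    rw [aff_eval]
    congr 1
    simp only [iotaL_div, iotaL_sub, iotaL_natCast]
    field_simp
    ring
  simp only [Pi.smul_apply, Finset.sum_apply, T_apply, QW_apply, h1, h2, ← Finset.mul_sum, smul_eq_mul]
  rw [sum_W, ← hw, zpow_add₀ hc, zpow_one, chi']
  field_simp

lemma T_QW_add (n : ℤ) (b : ℚ_[p]) (w : ℤ_[p]) (P : Polynomial L) :
    D.T n (b + (p : ℚ_[p]) ^ n * w) (D.QW P) = D.T n b (D.QW (aff P (-iotaL p L w) 1)) := by
  have hpQ := zpow_ne_zero n (pQ_ne_zero (p := p))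
  ext z
  have h1 : (z - (b + (p : ℚ_[p]) ^ n * w)) / (p : ℚ_[p]) ^ n = (z - b) / (p : ℚ_[p]) ^ n + (-(w : ℚ_[p])) := by
    field_simp; ring
  rw [T_apply, T_apply, h1, QW_apply, QW_apply, aff_eval, D.W_add (by rw [norm_neg]; exact PadicInt.norm_le_one w),
    iotaL_add, iotaL_neg]
  congr 3; ring

lemma QW_X_pow_mem {i : ℕ} (hi : i ≤ D.d) : D.QW (Polynomial.X ^ i) ∈ D.BS := by
  have hp0 := natCast_prime_ne_zero p L
  have hM := fun m : ℕ => (crB_mon (p := p) (L := L) D.hr.le m).1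
  have h1 : Cr D.r (fun z : ℤ_[p] => D.QW (Polynomial.X ^ i) ((p : ℚ_[p]) * z)) := by
    refine (congrArg (Cr D.r) (funext fun x => ?_)).mp ((CrS p L D.r).smul_mem (D.kap * (p : L) ^ i) (hM i))
    rw [QW_apply, D.W_int]
    · simp [mon, mul_pow]; ring
    · rw [norm_mul]; exact mul_le_one₀ (norm_natCast_Q p) (norm_nonneg _) (PadicInt.norm_le_one _)
  have h2 : Cr D.r (D.kap • mon p L (D.d - i) + ((1 - D.kap) * (p : L) ^ (D.d - i)) • PL L 0 1 (mon p L (D.d - i))) :=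
    (CrS p L D.r).add_mem ((CrS p L D.r).smul_mem _ (hM _)) ((CrS p L D.r).smul_mem _ (PL_cr D.hr.le (hM _) 0 1))
  refine (mem_BS D).2 ⟨max (crNorm p L D.r _) (crNorm p L D.r _), h1.crB.mono (le_max_left _ _), _,
    h2.crB.mono (le_max_right _ _), fun z hz => ?_⟩
  have hzQ : (z : ℚ_[p]) ≠ 0 := by simpa using hz
  have hiz : iotaL p L z ≠ 0 := by simpa using hz
  have hpow : iotaL p L (z : ℚ_[p]) ^ D.d * (iotaL p L ((z : ℚ_[p])⁻¹)) ^ i = iotaL p L z ^ (D.d - i) := by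
    rw [iotaL_inv, inv_pow, ← div_eq_mul_inv, pow_sub₀ _ hiz hi, div_eq_mul_inv]
  simp only [Pi.add_apply, Pi.smul_apply, smul_eq_mul, QW_apply, Polynomial.eval_pow, Polynomial.eval_X]
  by_cases hu : ∃ w, z = 0 + (p : ℤ_[p]) ^ 1 * w
  · obtain ⟨w, rfl⟩ := hu
    rw [PL_apply]
    have hn : ¬ ‖((0 + (p : ℤ_[p]) ^ 1 * w : ℤ_[p]) : ℚ_[p])⁻¹‖ ≤ 1 := by
      rw [norm_inv, not_le]
      refine (one_lt_inv₀ (norm_pos_iff.2 hzQ)).2 ?_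
      rw [← PadicInt.norm_def, zero_add, norm_mul, pow_one, PadicInt.norm_p]
      exact (mul_le_of_le_one_right (inv_nonneg.2 (p_pos p).le) (PadicInt.norm_le_one w)).trans_lt (inv_p_lt_one p)
    rw [D.W_out hn, Padic.valuation_inv, zpow_neg]
    have hl := zpow_ne_zero ((0 + (p : ℤ_[p]) ^ 1 * w : ℤ_[p]) : ℚ_[p]).valuation D.lam_ne_zero
    have : mon p L (D.d - i) (0 + (p : ℤ_[p]) ^ 1 * w) = (p : L) ^ (D.d - i) * mon p L (D.d - i) w := by
      simp [mon, mul_pow]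
    rw [this]
    have h3 : (p : L) ^ (D.d - i) * mon p L (D.d - i) w = iotaL p L ((0 + (p : ℤ_[p]) ^ 1 * w : ℤ_[p]) : ℚ_[p]) ^ (D.d - i) := this.symm
    rw [← hpow] at h3
    generalize D.lam ^ ((0 + (p : ℤ_[p]) ^ 1 * w : ℤ_[p]) : ℚ_[p]).valuation = t at hl ⊢
    calc _ = (p : L) ^ (D.d - i) * mon p L (D.d - i) w := by ring
      _ = _ := h3
      _ = _ := by field_simp
  · rw [PL_of_not _ hu]
    have hn : ‖z‖ = 1 := by
      by_contra h
      apply hu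
      have := lt_of_le_of_ne (PadicInt.norm_le_one z) h
      obtain ⟨w, hw⟩ := (PadicInt.norm_lt_one_iff_dvd z).1 this
      exact ⟨w, by rw [hw]; ring⟩
    have hn' : ‖((z : ℚ_[p]))⁻¹‖ ≤ 1 := by rw [norm_inv, ← PadicInt.norm_def, hn, inv_one]
    have hv : (z : ℚ_[p]).valuation = 0 := by
      have := valuation_eq_of_norm_eq (p := p) hzQ (y := 1) (by rw [← PadicInt.norm_def, hn, norm_one])
      rw [this, Padic.valuation_one]
    rw [D.W_int hn', hv]
    show D.kap * iotaL p L z ^ (D.d - i) + _ = _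
    rw [← hpow]; simp; ring

lemma QW_mem {P : Polynomial L} (hP : P.natDegree ≤ D.d) : D.QW P ∈ D.BS := by
  rw [P.as_sum_range_C_mul_X_pow' (Nat.lt_succ_of_le hP), map_sum]
  refine D.BS.sum_mem fun i hi => ?_
  rw [Polynomial.C_mul', map_smul]
  exact D.BS.smul_mem _ (D.QW_X_pow_mem (Nat.lt_succ_iff.1 (Finset.mem_range.1 hi)))

end Par

end

section

variable {p : ℕ} [hp : Fact p.Prime]
variable {L : Type} [NontriviallyNormedField L] [NormedAlgebra ℚ_[p] L] [IsUltrametricDist L]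
  [CompleteSpace L]

lemma tau_PL (c a : ℤ_[p]) (m : ℕ) (Q : ℤ_[p] → L) : tau p L c (PL L a m Q) = PL L (a - c) m Q := by
  ext x
  rw [tau_apply]
  by_cases h : ∃ w, x = (a - c) + (p : ℤ_[p]) ^ m * w
  · obtain ⟨w, rfl⟩ := h
    rw [PL_apply, show a - c + (p : ℤ_[p]) ^ m * w + c = a + (p : ℤ_[p]) ^ m * w by ring, PL_apply]
  · rw [PL_of_not _ h, PL_of_not]
    rintro ⟨w, hw⟩
    exact h ⟨w, by linear_combination hw⟩

lemma tau_sub_one_pow (b : ℤ_[p]) (s : ℕ) (g : ℤ_[p] → L) : ((tau p L b - 1) ^ s) g =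
    ∑ i ∈ Finset.range (s + 1), ((-1 : L) ^ i * (s.choose i : L)) • tau p L (((s - i : ℕ) : ℤ_[p]) * b) g := by
  have h := (Commute.one_left (tau p L b)).neg_left.add_pow s
  rw [show tau p L b - 1 = -1 + tau p L b by abel, h, LinearMap.sum_apply]
  refine Finset.sum_congr rfl fun i _ => ?_
  rw [tau_pow, neg_pow, one_pow, mul_one, ← nsmul_eq_mul', mul_smul, LinearMap.smul_apply, Nat.cast_smul_eq_nsmul]
  rcases neg_one_pow_eq_or (Module.End L (ℤ_[p] → L)) i with h1 | h1 <;>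
  rcases Nat.even_or_odd i with h2 | h2 <;>
  simp [h2.neg_one_pow]

lemma sum_LP_PL {d n : ℕ} {g : ℤ_[p] → L} (hg : g ∈ LP p L d n) : ∃ P : ℕ → Polynomial L, (∀ a, (P a).natDegree ≤ d) ∧
    g = ∑ a ∈ Finset.range (p ^ n), PL L (a : ℤ_[p]) n (fun x : ℤ_[p] => (P a).eval (iotaL p L x)) := by
  choose P hP h using fun a : ℕ => hg (a : ℤ_[p])
  refine ⟨P, hP, ?_⟩
  conv_lhs => rw [eq_sum_PL g n]
  exact Finset.sum_congr rfl fun a _ => by rw [h]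

namespace Par

variable (D : Par p L)

lemma T_monomialFun (n : ℤ) (b : ℚ_[p]) (j : ℕ) : D.T n b (monomialFun p L j) =
    ∑ m ∈ Finset.range (j + 1), (D.chi ^ n * (iotaL p L ((p : ℚ_[p]) ^ n) ^ j)⁻¹ * ((-iotaL p L b) ^ (j - m) * (j.choose m : L))) •
      monomialFun p L m := by
  ext z
  simp only [T_apply, monomialFun, iotaL_div, iotaL_sub, div_pow, Finset.sum_apply, Pi.smul_apply, smul_eq_mul]
  rw [sub_eq_add_neg, add_pow, div_eq_mul_inv, Finset.sum_mul, Finset.mul_sum]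
  exact Finset.sum_congr rfl fun m _ => by ring

lemma T_spec (n : ℤ) (b a : ℚ_[p]) (j : ℕ) : D.T n b (D.spec a j) =
    (D.chi ^ n * D.lam ^ (-n) * (iotaL p L ((p : ℚ_[p]) ^ n) ^ (D.d - j))⁻¹) • D.spec (b + (p : ℚ_[p]) ^ n * a) j := by
  have hpQ := zpow_ne_zero n (pQ_ne_zero (p := p))
  ext z
  have h : (z - b) / (p : ℚ_[p]) ^ n - a = (z - (b + (p : ℚ_[p]) ^ n * a)) * ((p : ℚ_[p]) ^ n)⁻¹ := by
    field_simp; ring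
  rw [T_apply, Pi.smul_apply, smul_eq_mul, spec, spec]
  by_cases hz : z = b + (p : ℚ_[p]) ^ n * a
  · have : (z - b) / (p : ℚ_[p]) ^ n = a := by rw [hz]; field_simp; ring
    rw [if_pos hz, if_pos this, mul_zero, mul_zero]
  · have h0 := sub_ne_zero.2 hz
    have : (z - b) / (p : ℚ_[p]) ^ n ≠ a := by
      rw [← sub_ne_zero, h]; exact mul_ne_zero h0 (inv_ne_zero hpQ)
    rw [if_neg hz, if_neg this, h, Padic.valuation_mul h0 (inv_ne_zero hpQ), Padic.valuation_inv, Padic.valuation_zpow,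
      Padic.valuation_p, mul_one, zpow_add₀ D.lam_ne_zero, iotaL_mul, iotaL_inv, mul_pow, inv_pow]
    ring

variable {D} in
lemma Dual.T {R : (ℚ_[p] → L) →ₗ[L] L} (hR : D.Dual R) (n : ℤ) (b : ℚ_[p]) : D.Dual (R ∘ₗ D.T n b) := by
  refine ⟨hR.1.T n b, fun j hj => ⟨?_, fun a => ?_⟩⟩
  · rw [LinearMap.comp_apply, T_monomialFun, map_sum]
    refine Finset.sum_eq_zero fun m hm => ?_
    have : (m : ℝ) < D.r := lt_of_le_of_lt (by exact_mod_cast Nat.lt_succ_iff.1 (Finset.mem_range.1 hm)) hj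
    rw [map_smul, (hR.2 m this).1, smul_zero]
  · rw [LinearMap.comp_apply, T_spec, map_smul, (hR.2 j hj).2, smul_zero]

/-- The power series of block moments. -/
def Fa (R : (ℚ_[p] → L) →ₗ[L] L) : PowerSeries L := PowerSeries.mk fun N => R (blk (bin p L N))

variable {D} in
lemma CN.Fa {R : (ℚ_[p] → L) →ₗ[L] L} {c : ℝ} (hR : D.CN R c) : Gr D.r c (Par.Fa R) := fun N => by
  rw [Par.Fa, PowerSeries.coeff_mk]
  simpa only [T_zero] using hR 0 0 _ _ (crB_bin D.r N)

variable {D} in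
lemma CN.pr_Fa {R : (ℚ_[p] → L) →ₗ[L] L} {c : ℝ} (hR : D.CN R c) {h : ℤ_[p] → L} (hh : Cr D.r h) :
    pr p (Par.Fa R) h = R (blk h) := by
  have h1 := hasSum_functional (D.blkF R 0 0) (fun h C hC => hR 0 0 h C hC) hh.crB
  simp only [blkF_apply, T_zero] at h1
  refine (hR.Fa.hasSum hh).unique (h1.congr_fun' fun N => ?_)
  rw [Par.Fa, PowerSeries.coeff_mk, mul_comm]

variable {D} in
lemma CN.pr_Fa_PL {R : (ℚ_[p] → L) →ₗ[L] L} {c : ℝ} (hR : D.CN R c) {h : ℤ_[p] → L} (hh : Cr D.r h) (b : ℤ_[p]) (m : ℕ) :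
    pr p (Par.Fa R) (PL L b m h) = D.chi⁻¹ ^ m * R (D.T m (b : ℚ_[p]) (blk h)) := by
  rw [hR.pr_Fa (PL_cr D.hr.le hh b m), T_blk_eq_blk_PL, map_smul, smul_eq_mul, inv_pow,
    inv_mul_cancel_left₀ (pow_ne_zero _ D.chi_ne)]

/-- Local moments against the spherical function. -/
def eB (R : (ℚ_[p] → L) →ₗ[L] L) (n : ℕ) (b : ℤ_[p]) (i : ℕ) : L :=
  D.chi'⁻¹ ^ n * R (D.T n (b : ℚ_[p]) (D.QW (binPoly L i)))

lemma eB_sum (R : (ℚ_[p] → L) →ₗ[L] L) (n : ℕ) (b : ℤ_[p]) {P : Polynomial L} (hP : P.natDegree ≤ D.d) :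
    ∑ j ∈ Finset.range (D.d + 1), mc p L j (fun x : ℤ_[p] => P.eval (iotaL p L x)) * D.eB R n b j =
      D.chi'⁻¹ ^ n * R (D.T n (b : ℚ_[p]) (D.QW P)) := by
  conv_rhs => rw [poly_eq_sum p hP, map_sum, map_sum, map_sum, Finset.mul_sum]
  refine Finset.sum_congr rfl fun j _ => ?_
  rw [map_smul, map_smul, map_smul, smul_eq_mul, eB]; ring

lemma compat_eB (R : (ℚ_[p] → L) →ₗ[L] L) : Compat D.d (D.eB R) := fun n b i hi => by
  rw [eB, T_QW, map_smul, map_sum, smul_eq_mul, ← mul_assoc, ← pow_succ, Finset.mul_sum]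
  refine Finset.sum_congr rfl fun a _ => ?_
  have h := D.eB_sum R (n + 1) (b + (p : ℤ_[p]) ^ n * a) (aff_natDegree ((natDegree_binPoly_le L i).trans hi) (a : L) (p : L))
  refine Eq.trans ?_ (h.symm.trans ?_)
  · push_cast; simp only [zpow_natCast]
  · refine Finset.sum_congr rfl fun j _ => ?_
    congr 3
    ext x
    rw [aff_eval, ← eval_binPoly]
    simp

/-- The defining property of the power series of moments against the spherical function. -/
def IsFb (R : (ℚ_[p] → L) →ₗ[L] L) (F : PowerSeries L) : Prop := ∀ (m : ℕ) (b : ℤ_[p]) (P : Polynomial L), P.natDegree ≤ D.d →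
  pr p F (PL L b m (fun x : ℤ_[p] => P.eval (iotaL p L x))) = D.chi'⁻¹ ^ m * R (D.T m (b : ℚ_[p]) (D.QW P))

lemma av_eB (R : (ℚ_[p] → L) →ₗ[L] L) (m : ℕ) {a : ℕ} (ha : a < p ^ m) {P : Polynomial L} (hP : P.natDegree ≤ D.d) :
    av p D.d (D.eB R) m (PL L (a : ℤ_[p]) m (fun x : ℤ_[p] => P.eval (iotaL p L x))) =
      D.chi'⁻¹ ^ m * R (D.T m (a : ℚ_[p]) (D.QW P)) := by
  rw [av, Finset.sum_eq_single_of_mem a (Finset.mem_range.2 ha)]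
  · have h := D.eB_sum R m a hP
    rw [PadicInt.coe_natCast] at h
    rw [← h]
    simp only [PL_apply]
  · intro b hb hba
    refine Finset.sum_eq_zero fun j _ => ?_
    have : (fun x => PL L (a : ℤ_[p]) m (fun x : ℤ_[p] => P.eval (iotaL p L x)) ((b : ℤ_[p]) + (p : ℤ_[p]) ^ m * x)) = 0 := by
      ext x
      refine PL_of_not _ ?_
      rintro ⟨w, hw⟩
      exact hba (digit_unique (Finset.mem_range.1 hb) ha hw)
    rw [this, map_zero, zero_mul]

theorem exists_Fb : ∃ K, 0 ≤ K ∧ ∀ (R : (ℚ_[p] → L) →ₗ[L] L) (c : ℝ), D.Dual R → D.CN R c →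
    ∃ F, Gr D.r' (K * c) F ∧ D.IsFb R F := by
  have hp0 := p_pos p
  obtain ⟨C, hC0, hC⟩ := exists_CV D
  choose! B hB using fun i (hi : i ≤ D.d) => (mem_BS D).1 (D.QW_mem ((natDegree_binPoly_le L i).trans hi))
  obtain ⟨B', hB'0, hB'⟩ : ∃ B', 0 ≤ B' ∧ ∀ i ≤ D.d, B i ≤ B' :=
    ⟨∑ i ∈ Finset.range (D.d + 1), |B i|, Finset.sum_nonneg fun _ _ => abs_nonneg _, fun i hi => (le_abs_self _).trans
      (Finset.single_le_sum (f := fun i => |B i|) (fun _ _ => abs_nonneg _) (Finset.mem_range.2 (Nat.lt_succ_of_le hi)))⟩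
  refine ⟨(p : ℝ) ^ D.r' * (C * B'), by positivity, fun R c hR hc => ?_⟩
  have hc0 := hc.nonneg
  obtain ⟨F, hF, h⟩ := (D.compat_eB R).exists_series D.hr'.le (by have := D.hsum; have := D.hr; linarith)
    (C := C * c * B') (by positivity) fun n b i hi => by
      rw [eB, norm_mul, norm_pow, D.norm_chi'_inv, mul_comm]
      exact mul_le_mul_of_nonneg_right (hC _ c (hR.T n b) (hc.T n b) _ _ ((hB i hi).mono (hB' i hi))) (by positivity)
  refine ⟨F, hF.mono (by ring_nf; rfl), fun m b P hP => ?_⟩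
  obtain ⟨a, ha, w, rfl⟩ := exists_digit b m
  have h1 := D.T_QW_add m (a : ℚ_[p]) w P
  have h2 : PL L ((a : ℤ_[p]) + (p : ℤ_[p]) ^ m * w) m (fun x : ℤ_[p] => P.eval (iotaL p L x)) =
      PL L (a : ℤ_[p]) m (fun x : ℤ_[p] => (aff P (-iotaL p L w) 1).eval (iotaL p L x)) := by
    ext x
    by_cases hx : ∃ y, x = (a : ℤ_[p]) + (p : ℤ_[p]) ^ m * y
    · obtain ⟨y, rfl⟩ := hx
      rw [PL_apply, show (a : ℤ_[p]) + (p : ℤ_[p]) ^ m * y = ((a : ℤ_[p]) + (p : ℤ_[p]) ^ m * w) + (p : ℤ_[p]) ^ m * (y - w) by ring,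
        PL_apply, aff_eval]
      congr 1
      simp; ring
    · rw [PL_of_not _ hx, PL_of_not]
      rintro ⟨y, hy⟩
      exact hx ⟨w + y, by rw [hy]; ring⟩
  have hP' := aff_natDegree hP (-iotaL p L w) 1
  rw [h2, h m _ (LP_PL (mem_PF.2 ⟨_, hP', rfl⟩) _ _), D.av_eB R m ha hP']
  congr 2
  rw [← h1]
  push_cast
  simp only [zpow_natCast]

variable {D} in
lemma IsFb.unique {R : (ℚ_[p] → L) →ₗ[L] L} {F G : PowerSeries L} {C C' : ℝ} (hF : D.IsFb R F) (hG : D.IsFb R G)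
    (h1 : Gr D.r' C F) (h2 : Gr D.r' C' G) : F = G := by
  have hr' := D.hr'.le
  have h3 := (h1.mono (le_max_left C C')).sub (h2.mono (le_max_right C C'))
  refine sub_eq_zero.1 (h3.eq_zero (p := p) hr' (J := D.d) (by have := D.hsum; have := D.hr; linarith) fun n g hg => ?_)
  obtain ⟨P, hP, rfl⟩ := sum_LP_PL hg
  have hcr : ∀ a : ℕ, Cr D.r' (PL L (a : ℤ_[p]) n (fun x : ℤ_[p] => (P a).eval (iotaL p L x))) := fun a =>
    PL_cr hr' (PF.cr (mem_PF.2 ⟨_, hP a, rfl⟩) _) _ _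
  rw [h3.pr_sum fun a _ => hcr a]
  refine Finset.sum_eq_zero fun a _ => ?_
  rw [h1.pr_sub_left h2 (hcr a), hF n a _ (hP a), hG n a _ (hP a), sub_self]

/-- The power series of moments against the spherical function. -/
def Fb (R : (ℚ_[p] → L) →ₗ[L] L) : PowerSeries L :=
  if h : ∃ F, (∃ C, Gr D.r' C F) ∧ D.IsFb R F then h.choose else 0

theorem Fb_spec : ∃ K, 0 ≤ K ∧ ∀ (R : (ℚ_[p] → L) →ₗ[L] L) (c : ℝ), D.Dual R → D.CN R c →
    Gr D.r' (K * c) (D.Fb R) ∧ D.IsFb R (D.Fb R) := by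
  obtain ⟨K, hK, h⟩ := D.exists_Fb
  refine ⟨K, hK, fun R c hR hc => ?_⟩
  obtain ⟨F, h1, h2⟩ := h R c hR hc
  have hex : ∃ F, (∃ C, Gr D.r' C F) ∧ D.IsFb R F := ⟨F, ⟨_, h1⟩, h2⟩
  have : D.Fb R = F := by
    rw [Fb, dif_pos hex]
    obtain ⟨⟨C, h3⟩, h4⟩ := hex.choose_spec
    exact h4.unique h2 h3 h1
  rw [this]; exact ⟨h1, h2⟩

/-- The interpolation constants relating the two power series at level `n`. -/
def Cn (n : ℕ) : L := (D.kap - D.lam⁻¹) * (D.lam / p) ^ (n + 1)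

lemma sum_T_Wt (n : ℤ) (a : ℚ_[p]) {P : Polynomial L} (hP : P.natDegree ≤ D.d) :
    ∑ i ∈ Finset.range (D.d + 1 + 1), ((-1 : L) ^ i * ((D.d + 1).choose i : L)) •
      D.T (n + 1) (a - ((D.d + 1 - i : ℕ) : ℚ_[p]) * (p : ℚ_[p]) ^ n)
        (D.QW P - (D.kap - D.lam⁻¹) • blk (fun x : ℤ_[p] => P.eval (iotaL p L x))) = 0 := by
  have hp0 := natCast_prime_ne_zero p L
  have hpQ := pQ_ne_zero (p := p)
  have hpn := zpow_ne_zero n hpQ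
  have hf : ∀ y, (D.QW P - (D.kap - D.lam⁻¹) • blk (fun x : ℤ_[p] => P.eval (iotaL p L x))) y =
      P.eval (iotaL p L y) * D.Wt y := fun y => by
    have : blk (fun x : ℤ_[p] => P.eval (iotaL p L x)) y = P.eval (iotaL p L y) * blk (fun _ => 1) y := by
      by_cases hy : ‖y‖ ≤ 1
      · rw [blk, dif_pos hy, blk, dif_pos hy, mul_one]
      · rw [blk_of_not _ hy, blk_of_not _ hy, mul_zero]
    rw [Pi.sub_apply, Pi.smul_apply, smul_eq_mul, this, QW_apply, Wt]; ring
  ext z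
  rw [Finset.sum_apply, Pi.zero_apply]
  set y := (z - a) / (p : ℚ_[p]) ^ (n + 1) with hy
  have h1 : ∀ j : ℕ, (z - (a - (j : ℚ_[p]) * (p : ℚ_[p]) ^ n)) / (p : ℚ_[p]) ^ (n + 1) = y + (j : ℚ_[p]) / p := fun j => by
    rw [hy, zpow_add₀ hpQ, zpow_one]; field_simp; ring
  have h2 : ∀ j : ℕ, D.Wt (y + (j : ℚ_[p]) / p) = D.Wt y := fun j => D.Wt_add (by
    rw [norm_div_p]; exact mul_le_of_le_one_left (p_pos p).le (norm_natCast_Q j))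
  simp only [Pi.smul_apply, T_apply, h1, hf, h2, smul_eq_mul]
  have h3 : (fun x : ℤ_[p] => (aff P (iotaL p L y) (p : L)⁻¹).eval (iotaL p L x)) ∈ PF p L D.d :=
    ⟨_, aff_natDegree hP _ _, rfl⟩
  have h4 := PF.mc_eq_zero h3 (Nat.lt_succ_self D.d)
  rw [mc_sum] at h4
  have h5 : ∀ i : ℕ, (aff P (iotaL p L y) (p : L)⁻¹).eval (iotaL p L ((i : ℤ_[p]) : ℚ_[p])) = P.eval (iotaL p L (y + (i : ℚ_[p]) / p)) := fun i => by
    rw [aff_eval]; congr 1; simp [div_eq_inv_mul]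
  simp only [h5] at h4
  calc _ = (∑ i ∈ Finset.range (D.d + 1 + 1), (-1 : L) ^ i * ((D.d + 1).choose i : L) *
        P.eval (iotaL p L (y + ((D.d + 1 - i : ℕ) : ℚ_[p]) / p))) * (D.chi ^ (n + 1) * D.Wt y) := by
        rw [Finset.sum_mul]; exact Finset.sum_congr rfl fun i _ => by ring
    _ = 0 := by
      have h4' := h4
      simp only [Nat.succ_eq_add_one] at h4'
      rw [h4', zero_mul]

variable {D} in
lemma kill_Fb_sub {R : (ℚ_[p] → L) →ₗ[L] L} {c C : ℝ} (hc : D.CN R c) {F : PowerSeries L} (hF : Gr D.r' C F)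
    (hFb : D.IsFb R F) (n : ℕ) {g : ℤ_[p] → L} (hg : g ∈ LP p L D.d (n + 1)) :
    pr p (F - D.Cn n • Fa R) (((tau p L (((p ^ n : ℕ) : ℤ_[p])) - 1) ^ (D.d + 1)) g) = 0 := by
  have hr := D.hr.le
  have hp0 := natCast_prime_ne_zero p L
  have hl := D.lam_ne_zero
  have hch := D.chi_ne
  have hF1 := hF.mono_exp D.hrr'
  have hG1 := hc.Fa.smul (D.Cn n)
  have hFG := (hF1.mono (le_max_left C (‖D.Cn n‖ * c))).sub (hG1.mono (le_max_right _ _))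
  obtain ⟨P, hP, rfl⟩ := sum_LP_PL hg
  have hQ : ∀ a, (fun x : ℤ_[p] => (P a).eval (iotaL p L x)) ∈ PF p L D.d := fun a => mem_PF.2 ⟨_, hP a, rfl⟩
  rw [map_sum, hFG.pr_sum]
  swap
  · intro a _
    rw [tau_sub_one_pow]
    exact (CrS p L D.r).sum_mem fun i _ => (CrS p L D.r).smul_mem _ (LP.cr (LP.tau (LP_PL (hQ a) _ _) _) hr)
  refine Finset.sum_eq_zero fun a _ => ?_
  simp only [tau_sub_one_pow, tau_PL]
  rw [hFG.pr_sum fun i _ => (CrS p L D.r).smul_mem _ (PL_cr hr (PF.cr (hQ a) _) _ _)]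
  have h1 := congrArg (fun f => D.chi'⁻¹ ^ (n + 1) * R f) (D.sum_T_Wt n a (hP a))
  simp only [map_sum, map_zero, mul_zero, Finset.mul_sum] at h1
  refine Eq.trans (Finset.sum_congr rfl fun i _ => ?_) h1
  rw [pr_smul, hF1.pr_sub_left hG1 (PL_cr hr (PF.cr (hQ a) _) _ _), pr_smul_left, hFb _ _ _ (hP a),
    hc.pr_Fa_PL (PF.cr (hQ a) _)]
  rw [map_smul, map_sub, map_sub, map_smul, map_smul, smul_eq_mul, smul_eq_mul]
  have e1 : ((((a : ℤ_[p]) - ((D.d + 1 - i : ℕ) : ℤ_[p]) * ((p ^ n : ℕ) : ℤ_[p]) : ℤ_[p])) : ℚ_[p]) =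
      (a : ℚ_[p]) - ((D.d + 1 - i : ℕ) : ℚ_[p]) * (p : ℚ_[p]) ^ (n : ℤ) := by
    push_cast; simp only [zpow_natCast]
  rw [e1]
  have e2 : D.Cn n * D.chi⁻¹ ^ (n + 1) = D.chi'⁻¹ ^ (n + 1) * (D.kap - D.lam⁻¹) := by
    rw [Cn, chi', mul_assoc, ← mul_pow, mul_comm]
    congr 2
    field_simp
  push_cast
  rw [← mul_assoc (D.Cn n), e2]
  ring

/-- The determinant of the two power series is divisible by `(log(1+X)/X)^{d+1}` with bounded quotient. -/
theorem exists_H : ∃ K, 0 ≤ K ∧ ∀ (P Q : (ℚ_[p] → L) →ₗ[L] L) (c c' : ℝ), D.Dual P → D.CN P c → D.Dual Q → D.CN Q c' →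
    ∃ H, Gr 0 (K * (c * c')) H ∧ Fa P * D.Fb Q - D.Fb P * Fa Q = uSer p L ^ (D.d + 1) * H := by
  obtain ⟨K, hK, h⟩ := exists_bounded_quotient p L D.d
  obtain ⟨K1, hK1, hb⟩ := D.Fb_spec
  have hr := D.hr.le
  have hr' := D.hr'.le
  refine ⟨K * K1, by positivity, fun P Q c c' hP hc hQ hc' => ?_⟩
  obtain ⟨hP1, hP2⟩ := hb P c hP hc
  obtain ⟨hQ1, hQ2⟩ := hb Q c' hQ hc'
  have hc0 := hc.nonneg
  have hc'0 := hc'.nonneg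
  have h1 : Gr (D.r + D.r') (K1 * (c * c')) (Fa P * D.Fb Q) := (hc.Fa.mul hr hr' hQ1).mono (by ring_nf; rfl)
  have h2 : Gr (D.r + D.r') (K1 * (c * c')) (D.Fb P * Fa Q) := by
    rw [mul_comm (D.Fb P)]
    exact (hc'.Fa.mul hr hr' hP1).mono (by ring_nf; rfl)
  have h3 := h1.sub h2
  have hdd : D.r + D.r' = (D.d : ℝ) + 1 := D.hsum
  have hs : 0 ≤ D.r + D.r' := by positivity
  have key : ∀ n, ∀ g ∈ LP p L D.d (n + 1), pr p (Fa P * D.Fb Q - D.Fb P * Fa Q)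
      (((tau p L (((p ^ n : ℕ) : ℤ_[p])) - 1) ^ (D.d + 1)) g) = 0 := by
    intro n g hg
    have e1 : Fa P * D.Fb Q - D.Fb P * Fa Q = Fa P * (D.Fb Q - D.Cn n • Fa Q) - Fa Q * (D.Fb P - D.Cn n • Fa P) := by
      simp only [PowerSeries.smul_eq_C_mul]; ring
    have g1 : ∃ C, Gr D.r C (D.Fb Q - D.Cn n • Fa Q) := ⟨_, ((hQ1.mono_exp D.hrr').mono (le_max_left _ _)).sub
      ((hc'.Fa.smul (D.Cn n)).mono (le_max_right _ _))⟩
    have g2 : ∃ C, Gr D.r C (D.Fb P - D.Cn n • Fa P) := ⟨_, ((hP1.mono_exp D.hrr').mono (le_max_left _ _)).sub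
      ((hc.Fa.smul (D.Cn n)).mono (le_max_right _ _))⟩
    obtain ⟨C1, g1⟩ := g1
    obtain ⟨C2, g2⟩ := g2
    have k1 := hc.Fa.pr_mul_kill hr hr g1 (fun g hg => kill_Fb_sub hc' hQ1 hQ2 n hg) hg
    have k2 := hc'.Fa.pr_mul_kill hr hr g2 (fun g hg => kill_Fb_sub hc hP1 hP2 n hg) hg
    have hmem : ((tau p L (((p ^ n : ℕ) : ℤ_[p])) - 1) ^ (D.d + 1)) g ∈ LP p L D.d (n + 1) := by
      rw [tau_sub_one_pow]
      exact Submodule.sum_mem _ fun i _ => Submodule.smul_mem _ _ (LP.tau hg _)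
    rw [e1, (hc.Fa.mul hr hr g1).pr_sub_left (hc'.Fa.mul hr hr g2) (LP.cr hmem (by positivity)), k1, k2, sub_zero]
  obtain ⟨H, hH, e⟩ := h _ _ (hdd ▸ h3) (kill_del_pow
    (fun n f hf g hg => h3.pr_add (LP.cr hf hs) (LP.cr hg hs)) (pr_zero _) key)
  exact ⟨H, hH.mono (by ring_nf; rfl), e⟩

end Par

end

section

variable {p : ℕ} [hp : Fact p.Prime] {L : Type} [NontriviallyNormedField L] [NormedAlgebra ℚ_[p] L]
  [IsUltrametricDist L] [CompleteSpace L]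

lemma blk_zero : blk (0 : ℤ_[p] → L) = 0 := by
  have := blk_smul (0 : L) (0 : ℤ_[p] → L)
  rwa [zero_smul, zero_smul] at this

namespace Par

variable (D : Par p L)

/-- The span of the special functions. -/
def V : Submodule L (ℚ_[p] → L) :=
  Submodule.span L {f | ∃ j : ℕ, (j : ℝ) < D.r ∧ (f = monomialFun p L j ∨ ∃ a, f = D.spec a j)}

lemma T_mem_BS {f : ℚ_[p] → L} (hf : f ∈ D.BS) (n : ℤ) (b : ℚ_[p]) : D.T n b f ∈ D.BS := by
  obtain ⟨C, hC⟩ := hf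
  obtain ⟨C0, -, h⟩ := D.T_bounded n b
  exact ⟨_, h f C hC⟩

lemma block_mem_BS {h : ℤ_[p] → L} (hh : Cr D.r h) (n : ℤ) (b : ℚ_[p]) : D.T n b (blk h) ∈ D.BS := by
  obtain ⟨C0, -, H⟩ := D.BB_block_any n b
  exact ⟨_, H h _ hh.crB⟩

lemma Cr_PL {h : ℤ_[p] → L} (hh : Cr D.r h) (b : ℤ_[p]) (n : ℕ) : Cr D.r (PL L b n h) :=
  (hh.crB.PL D.hr.le b n).1

lemma monomialFun_mem_BS {j : ℕ} (hj : (j : ℝ) < D.r) : monomialFun p L j ∈ D.BS := by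
  have h := D.T_monomial 0 (D.le_d hj.le)
  have h0 : ((0 : ℕ) : ℤ) = 0 := rfl
  rw [h0, neg_zero, D.T_zero] at h
  rw [h]
  refine D.BS.add_mem (D.block_mem_BS (crB_mon D.hr.le j).1 0 0) ?_
  have h2 := D.norm_large_monomial 0 hj
  rw [h0, neg_zero] at h2
  exact ⟨_, h2⟩

lemma spec_mem_BS {j : ℕ} (hj : (j : ℝ) < D.r) (a : ℚ_[p]) : D.spec a j ∈ D.BS := by
  have key : D.spec 0 j ∈ D.BS := by
    have h := D.spec_eq 0 (D.le_d hj.le)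
    rw [PadicInt.coe_zero, mul_zero] at h
    rw [h]
    refine D.BS.add_mem (D.BS.smul_mem _ (D.block_mem_BS ?_ _ _)) ⟨_, D.BB_Inf (C := KO p D.r) ?_⟩
    · refine (((D.crB_etaD hj).affine D.hr.le (-0) 1).smul _).1
    · refine (congrArg (CrB D.r _) (funext fun x => ?_)).mp (crB_mon D.hr.le j)
      simp [mon]
  have h := D.T_spec 0 a 0 j
  have h2 := D.T_mem_BS key 0 a
  rw [h] at h2
  simpa using h2

lemma V_le_BS : D.V ≤ D.BS := by
  rw [V, Submodule.span_le]
  rintro f ⟨j, hj, rfl | ⟨a, rfl⟩⟩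
  exacts [D.monomialFun_mem_BS hj, D.spec_mem_BS hj a]

lemma dual_of_V {R : (ℚ_[p] → L) →ₗ[L] L} (hR : D.Bdd R) (h : ∀ l ∈ D.V, R l = 0) : D.Dual R :=
  ⟨hR, fun j hj => ⟨h _ (Submodule.subset_span ⟨j, hj, Or.inl rfl⟩),
    fun a => h _ (Submodule.subset_span ⟨j, hj, Or.inr ⟨a, rfl⟩⟩)⟩⟩

variable {D} in
lemma Dual.kill {R : (ℚ_[p] → L) →ₗ[L] L} (hR : D.Dual R) {l : ℚ_[p] → L} (hl : l ∈ D.V) : R l = 0 := by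
  have : D.V ≤ LinearMap.ker R := by
    rw [V, Submodule.span_le]
    rintro f ⟨j, hj, rfl | ⟨a, rfl⟩⟩
    exacts [(hR.2 j hj).1, (hR.2 j hj).2 a]
  exact this hl

/-- Every block function is supported on a large ball around `0`. -/
lemma exists_block_eq (n : ℤ) (b : ℚ_[p]) {h : ℤ_[p] → L} (hh : Cr D.r h) :
    ∃ m0 : ℕ, ∀ m ≥ m0, ∃ h', Cr D.r h' ∧ D.T n b (blk h) = D.T (-(m : ℤ)) 0 (blk h') := by
  obtain ⟨m1, hm1⟩ : ∃ m1 : ℕ, ‖b‖ ≤ (p : ℝ) ^ m1 :=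
    (pow_unbounded_of_one_lt ‖b‖ (one_lt_p p)).imp fun _ => le_of_lt
  refine ⟨max m1 (-n).toNat, fun m hm => ?_⟩
  have hb : ‖(p : ℚ_[p]) ^ m * b‖ ≤ 1 := by
    have hpp := p_pos p
    rw [norm_mul, norm_pow, Padic.norm_p, inv_pow, inv_mul_le_iff₀ (by positivity), mul_one]
    exact hm1.trans (pow_le_pow_right₀ (one_lt_p p).le ((le_max_left _ _).trans hm))
  obtain ⟨e, he⟩ : ∃ e : ℕ, n + m = e := by
    refine ⟨(n + m).toNat, ?_⟩
    have := (le_max_right m1 (-n).toNat).trans hm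
    omega
  set a : ℤ_[p] := ⟨(p : ℚ_[p]) ^ m * b, hb⟩ with ha
  have h1 := D.T_blk_eq_blk_PL e a h
  refine ⟨D.chi ^ e • PL L a e h, ((D.Cr_PL hh a e).crB.smul _).1, ?_⟩
  rw [blk_smul, ← h1, D.T_T, ha]
  have hp0 := pQ_ne_zero (p := p)
  congr 2
  · omega
  · rw [zero_add, zpow_neg, zpow_natCast]; field_simp

/-- Functions supported on large balls, modulo special functions. -/
def BV (n0 : ℕ) : Submodule L (ℚ_[p] → L) where
  carrier := {f | ∃ n ≥ n0, ∃ h, Cr D.r h ∧ ∃ l ∈ D.V, f = l + D.T (-((n : ℕ) : ℤ)) 0 (blk h)}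
  add_mem' := by
    rintro f g ⟨n, hn, h, hh, l, hl, rfl⟩ ⟨n', hn', h', hh', l', hl', rfl⟩
    obtain ⟨m0, hm⟩ := D.exists_block_eq (-(n : ℤ)) 0 hh
    obtain ⟨m0', hm'⟩ := D.exists_block_eq (-(n' : ℤ)) 0 hh'
    obtain ⟨k, hk, e⟩ := hm (max m0 (max m0' n0)) (le_max_left _ _)
    obtain ⟨k', hk', e'⟩ := hm' (max m0 (max m0' n0)) ((le_max_left _ _).trans (le_max_right _ _))
    refine ⟨max m0 (max m0' n0), (le_max_right _ _).trans (le_max_right _ _), k + k', ?_, l + l', D.V.add_mem hl hl', ?_⟩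
    · exact ((hk.crB.mono (le_max_left _ _)).add (hk'.crB.mono (le_max_right _ _))).1
    · rw [blk_add, map_add, e, e']; abel
  zero_mem' := ⟨n0, le_rfl, 0, (CrB.zero (r := D.r) le_rfl).1, 0, D.V.zero_mem, by
    rw [blk_zero, map_zero, add_zero]⟩
  smul_mem' := by
    rintro c f ⟨n, hn, h, hh, l, hl, rfl⟩
    exact ⟨n, hn, c • h, (hh.crB.smul c).1, c • l, D.V.smul_mem c hl, by rw [blk_smul, map_smul, smul_add]⟩

variable [ProperSpace L]

/-- Density of functions with bounded support modulo special functions. -/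
theorem exists_approx {f : ℚ_[p] → L} (hf : f ∈ D.BS) {ε : ℝ} (hε : 0 < ε) (n0 : ℕ) :
    ∃ n ≥ n0, ∃ h, Cr D.r h ∧ ∃ l ∈ D.V, D.BB ε (f - l - D.T (-((n : ℕ) : ℤ)) 0 (blk h)) := by
  by_contra hne
  have hle : D.BV n0 ≤ D.BS := by
    rintro _ ⟨n, hn, h, hh, l, hl, rfl⟩
    exact D.BS.add_mem (D.V_le_BS hl) (D.block_mem_BS hh _ _)
  obtain ⟨R, hR, hR0, hRf⟩ := D.exists_separating hle hf hε (by
    rintro _ ⟨n, hn, h, hh, l, hl, rfl⟩ hB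
    exact hne ⟨n, hn, h, hh, l, hl, by rwa [sub_sub]⟩)
  have z : Cr D.r (0 : ℤ_[p] → L) := (CrB.zero (r := D.r) le_rfl).1
  have hD : D.Dual R := D.dual_of_V hR fun l hl => hR0 _ ⟨n0, le_rfl, 0, z, l, hl, by
    rw [blk_zero, map_zero, add_zero]⟩
  have hCN : D.CN R 0 := fun n b h C hh => by
    obtain ⟨m0, hm⟩ := D.exists_block_eq n b hh.1
    obtain ⟨k, hk, e⟩ := hm (max m0 n0) (le_max_left _ _)
    rw [e, hR0 _ ⟨max m0 n0, le_max_right _ _, k, hk, 0, D.V.zero_mem, by rw [zero_add]⟩]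
    simp
  obtain ⟨C, -, hC⟩ := D.exists_CV
  obtain ⟨C', hC'⟩ := hf
  have := hC R 0 hD hCN f C' hC'
  simp at this
  exact hRf this

/-- A function killed by all dual functionals is in the closure of the special functions. -/
theorem mem_closure_of_dual {f : ℚ_[p] → L} (hf : f ∈ D.BS) (h : ∀ R, D.Dual R → R f = 0) {ε : ℝ} (hε : 0 < ε) :
    ∃ l ∈ D.V, D.BB ε (f - l) := by
  by_contra hne
  obtain ⟨R, hR, hR0, hRf⟩ := D.exists_separating D.V_le_BS hf hε (by
    intro l hl hB; exact hne ⟨l, hl, hB⟩)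
  exact hRf (h R (D.dual_of_V hR hR0))

end Par

end

section

variable {L : Type} [NontriviallyNormedField L] [IsUltrametricDist L]

lemma norm_eq_of_norm_sub_lt {x y : L} (h : ‖x - y‖ < ‖y‖) : ‖x‖ = ‖y‖ := by
  have := IsUltrametricDist.norm_add_eq_max_of_norm_ne_norm h.ne
  rwa [sub_add_cancel, max_eq_right h.le] at this

/-- A bounded sequence has an entry of maximal norm dominating the earlier ones strictly. -/
lemma exists_dominant [ProperSpace L] {H : ℕ → L} {C : ℝ} (hC : ∀ i, ‖H i‖ ≤ C) (h0 : H 0 ≠ 0) :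
    ∃ m c, 0 ≤ c ∧ c < 1 ∧ H m ≠ 0 ∧ (∀ i, ‖H i‖ ≤ ‖H m‖) ∧ ∀ i < m, ‖H i‖ ≤ c * ‖H m‖ := by
  have hK : IsCompact (closure (Set.range H)) := by
    refine (isCompact_closedBall (0 : L) C).of_isClosed_subset isClosed_closure
      (closure_minimal ?_ Metric.isClosed_closedBall)
    rintro _ ⟨i, rfl⟩
    rw [mem_closedBall_zero_iff]; exact hC i
  obtain ⟨x, hx, hmax⟩ := hK.exists_isMaxOn ⟨H 0, subset_closure ⟨0, rfl⟩⟩ continuous_norm.continuousOn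
  have hle : ∀ i, ‖H i‖ ≤ ‖x‖ := fun i => hmax (subset_closure ⟨i, rfl⟩)
  have hx0 : 0 < ‖x‖ := (norm_pos_iff.2 h0).trans_le (hle 0)
  have hex : ∃ i, ‖x‖ ≤ ‖H i‖ := by
    obtain ⟨_, ⟨i, rfl⟩, hi⟩ := Metric.mem_closure_iff.1 hx _ hx0
    rw [dist_comm, dist_eq_norm] at hi
    exact ⟨i, (norm_eq_of_norm_sub_lt hi).ge⟩
  set m := Nat.find hex with hm
  have hmx : ‖H m‖ = ‖x‖ := le_antisymm (hle m) (Nat.find_spec hex)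
  have hlt : ∀ i < m, ‖H i‖ < ‖H m‖ := fun i hi => by
    rw [hmx]; exact not_le.1 (Nat.find_min hex hi)
  have hc : ∀ k ≤ m, ∃ c : ℝ, 0 ≤ c ∧ c < 1 ∧ ∀ i < k, ‖H i‖ ≤ c * ‖H m‖ := by
    intro k hk
    induction k with
    | zero => exact ⟨0, le_rfl, one_pos, fun i hi => absurd hi (Nat.not_lt_zero _)⟩
    | succ k ih =>
      obtain ⟨c, c0, c1, hc⟩ := ih (by omega)
      refine ⟨max c (‖H k‖ / ‖H m‖), le_max_of_le_left c0, max_lt c1 ?_, fun i hi => ?_⟩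
      · rw [div_lt_one (hmx ▸ hx0)]; exact hlt k (by omega)
      · rcases Nat.lt_succ_iff_lt_or_eq.1 hi with h | rfl
        · exact (hc i h).trans (mul_le_mul_of_nonneg_right (le_max_left _ _) (norm_nonneg _))
        · have hpos : (0 : ℝ) < ‖H m‖ := hmx ▸ hx0
          calc ‖H i‖ = ‖H i‖ / ‖H m‖ * ‖H m‖ := by field_simp
            _ ≤ _ := mul_le_mul_of_nonneg_right (le_max_right _ _) (norm_nonneg _)
  obtain ⟨c, c0, c1, hc⟩ := hc m le_rfl
  exact ⟨m, c, c0, c1, norm_pos_iff.1 (hmx ▸ hx0), fun i => hmx ▸ hle i, hc⟩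

lemma norm_le_of_recurrence {H a : ℕ → L} {m l0 : ℕ} {c δ A : ℝ} (hm : H m ≠ 0) (h1 : ∀ i, ‖H i‖ ≤ ‖H m‖)
    (hc : 0 ≤ c) (h2 : ∀ i < m, ‖H i‖ ≤ c * ‖H m‖) (ha : Tendsto a atTop (𝓝 0)) (hδ : 0 < δ)
    (hs : ∀ l, ∃ s, HasSum (fun i => H i * a (i + l)) s ∧ ‖s‖ ≤ ‖H m‖ * δ)
    (hA : ∀ i ≥ l0, ‖a i‖ ≤ A) : ∀ i ≥ l0 + m, ‖a i‖ ≤ max δ (c * A) := by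
  set B := max δ (c * A) with hB
  have hB0 : 0 < B := lt_max_of_lt_left hδ
  have hHm := norm_pos_iff.2 hm
  obtain ⟨N, hN⟩ := (Metric.tendsto_atTop.1 ha) B hB0
  have key : ∀ k i, l0 + m ≤ i → N ≤ i + k → ‖a i‖ ≤ B := by
    intro k
    induction k with
    | zero => intro i _ hi; simpa using (hN i hi).le
    | succ k ih =>
      intro i hi hik
      obtain ⟨s, hs, hsle⟩ := hs (i - m)
      have h3 := hs.sub (hasSum_ite_eq m (H m * a i))
      have h4 := norm_hasSum_le_of (C := ‖H m‖ * B) (by positivity) (fun t => ?_) h3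
      · have h5 : ‖H m * a i‖ ≤ ‖H m‖ * B := by
          have h6 := norm_sub_le_of (hsle.trans (mul_le_mul_of_nonneg_left (le_max_left _ _) hHm.le)) h4
          rwa [sub_sub_cancel] at h6
        rw [norm_mul] at h5
        exact le_of_mul_le_mul_left h5 hHm
      · rcases lt_trichotomy t m with ht | rfl | ht
        · rw [if_neg ht.ne, sub_zero, norm_mul]
          calc ‖H t‖ * ‖a (t + (i - m))‖ ≤ (c * ‖H m‖) * A :=
                mul_le_mul (h2 t ht) (hA _ (by omega)) (norm_nonneg _) (by positivity)
            _ = ‖H m‖ * (c * A) := by ring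
            _ ≤ _ := mul_le_mul_of_nonneg_left (le_max_right _ _) hHm.le
        · rw [if_pos rfl, show t + (i - t) = i by omega, sub_self, norm_zero]; positivity
        · rw [if_neg ht.ne', sub_zero, norm_mul]
          exact mul_le_mul (h1 t) (ih _ (by omega) (by omega)) (norm_nonneg _) hHm.le
  exact fun i hi => key N i hi (by omega)

lemma norm_le_of_recurrence_iterate {H a : ℕ → L} {m : ℕ} {c δ A : ℝ} (hm : H m ≠ 0) (h1 : ∀ i, ‖H i‖ ≤ ‖H m‖)
    (hc : 0 ≤ c) (hc1 : c < 1) (h2 : ∀ i < m, ‖H i‖ ≤ c * ‖H m‖) (ha : Tendsto a atTop (𝓝 0)) (hδ : 0 < δ)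
    (hs : ∀ l, ∃ s, HasSum (fun i => H i * a (i + l)) s ∧ ‖s‖ ≤ ‖H m‖ * δ)
    (hA : ∀ i, ‖a i‖ ≤ A) (j : ℕ) : ∀ i ≥ j * m, ‖a i‖ ≤ max δ (c ^ j * A) := by
  induction j with
  | zero => intro i _; rw [pow_zero, one_mul]; exact le_max_of_le_right (hA i)
  | succ j ih =>
    intro i hi
    refine (norm_le_of_recurrence hm h1 hc h2 ha hδ hs ih i (by rw [Nat.succ_mul] at hi; exact hi)).trans ?_
    refine max_le (le_max_left _ _) ?_
    rw [mul_max_of_nonneg _ _ hc]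
    refine max_le (le_max_of_le_left ?_) (le_max_of_le_right ?_)
    · exact mul_le_of_le_one_left hδ.le hc1.le
    · rw [pow_succ]; ring_nf; rfl

end

section

variable {p : ℕ} [hp : Fact p.Prime] {L : Type} [NontriviallyNormedField L] [NormedAlgebra ℚ_[p] L]
  [IsUltrametricDist L] [CompleteSpace L]

lemma Cr.eventually_del_pow {r : ℝ} (hr : 0 ≤ r) {h : ℤ_[p] → L} (hh : Cr r h) {ε : ℝ} (hε : 0 < ε) :
    ∃ i0, ∀ i ≥ i0, CrB r ε ((del p L ^ i) h) := by
  obtain ⟨N, hN⟩ := (Metric.tendsto_atTop.1 hh.2) ε hε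
  refine ⟨N, fun i hi => ⟨hh.del_pow hr i, fun n => ?_⟩⟩
  rw [mc_del_pow]
  have h1 := hN (n + i) (by omega)
  rw [dist_zero_right, Real.norm_of_nonneg (mul_nonneg (wt_pos _ _).le (norm_nonneg _))] at h1
  exact (mul_le_mul_of_nonneg_right (wt_mono hr (Nat.le_add_right _ _)) (norm_nonneg _)).trans h1.le

namespace Par

variable (D : Par p L)

/-- Dual functionals of norm at most `c`. -/
def DC (c : ℝ) (R : (ℚ_[p] → L) →ₗ[L] L) : Prop := D.Dual R ∧ D.CN R c

/-- Translation by `p^{-n}`. -/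
def um (n : ℕ) : Module.End L (ℚ_[p] → L) := D.T 0 (-((p : ℚ_[p]) ^ n)⁻¹)

lemma um_pow (n e : ℕ) : D.um (n + e) ^ (p ^ e) = D.um n := by
  have hp0 := pQ_ne_zero (p := p)
  have key : ∀ k : ℕ, D.um (n + e) ^ k = D.T 0 (-(k * ((p : ℚ_[p]) ^ (n + e))⁻¹)) := by
    intro k
    induction k with
    | zero => ext f : 1; simp [D.T_zero]
    | succ k ih =>
      rw [pow_succ, ih]
      refine LinearMap.ext fun f => ?_
      rw [Module.End.mul_apply, um, T_T]
      congr 2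
      push_cast; rw [zpow_zero]; ring
  rw [key, um]
  congr 2
  push_cast; rw [pow_add]; field_simp

lemma um_sub_one_pow_block (n i : ℕ) (h : ℤ_[p] → L) :
    D.T (-(n : ℤ)) 0 (blk ((del p L ^ i) h)) = ((D.um n - 1) ^ i) (D.T (-(n : ℤ)) 0 (blk h)) := by
  have step : ∀ h : ℤ_[p] → L, D.T (-(n : ℤ)) 0 (blk (del p L h)) = (D.um n - 1) (D.T (-(n : ℤ)) 0 (blk h)) := by
    intro h
    have h1 : blk (del p L h) = D.T 0 (-1) (blk h) - blk h := by
      ext z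
      rw [Pi.sub_apply, T_apply]
      simp only [zpow_zero, one_mul, div_one, sub_neg_eq_add]
      by_cases hz : ‖z‖ ≤ 1
      · obtain ⟨x, rfl⟩ : ∃ x : ℤ_[p], (x : ℚ_[p]) = z := ⟨⟨z, hz⟩, rfl⟩
        rw [← PadicInt.coe_one, ← PadicInt.coe_add, blk_coe, blk_coe, blk_coe, del_apply]
      · rw [blk_of_not _ hz, blk_of_not _ hz, blk_of_not, sub_zero]
        intro hz'
        refine hz ?_
        have := norm_sub_le_of (L := ℚ_[p]) hz' (le_of_eq (norm_one (α := ℚ_[p])))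
        rwa [add_sub_cancel_right] at this
    rw [h1, map_sub, T_T, LinearMap.sub_apply, Module.End.one_apply, um, T_T]
    congr 3
    · omega
    · rw [zpow_neg, zpow_natCast]; ring
  induction i with
  | zero => simp
  | succ i ih =>
    rw [pow_succ', pow_succ', Module.End.mul_apply, Module.End.mul_apply, step, ih]

variable {D}

lemma DC.T {c : ℝ} {R : (ℚ_[p] → L) →ₗ[L] L} (hR : D.DC c R) (n : ℤ) (b : ℚ_[p]) : D.DC c (R ∘ₗ D.T n b) :=
  ⟨hR.1.T n b, hR.2.T n b⟩

lemma DC.sub {c : ℝ} {R R' : (ℚ_[p] → L) →ₗ[L] L} (hR : D.DC c R) (hR' : D.DC c R') : D.DC c (R - R') := by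
  refine ⟨⟨?_, fun j hj => ⟨?_, fun a => ?_⟩⟩, fun n b h C hh => ?_⟩
  · obtain ⟨C, C0, hC⟩ := hR.1.1
    obtain ⟨C', C0', hC'⟩ := hR'.1.1
    refine ⟨max C C', le_max_of_le_left C0, fun f B hf => ?_⟩
    have hB := hf.nonneg
    exact norm_sub_le_of ((hC f B hf).trans (mul_le_mul_of_nonneg_right (le_max_left _ _) hB))
      ((hC' f B hf).trans (mul_le_mul_of_nonneg_right (le_max_right _ _) hB))
  · rw [LinearMap.sub_apply, (hR.1.2 j hj).1, (hR'.1.2 j hj).1, sub_zero]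
  · rw [LinearMap.sub_apply, (hR.1.2 j hj).2, (hR'.1.2 j hj).2, sub_zero]
  · exact norm_sub_le_of (hR.2 n b h C hh) (hR'.2 n b h C hh)

lemma DC.um {c : ℝ} {R : (ℚ_[p] → L) →ₗ[L] L} (hR : D.DC c R) (n i : ℕ) : D.DC c (R ∘ₗ ((D.um n - 1) ^ i)) := by
  induction i with
  | zero => exact hR
  | succ i ih =>
    refine (congrArg (D.DC c) (LinearMap.ext fun f => ?_)).mp ((ih.T 0 (-((p : ℚ_[p]) ^ n)⁻¹)).sub ih)
    rw [pow_succ, LinearMap.comp_apply, Module.End.mul_apply, LinearMap.sub_apply (D.um n), map_sub, map_sub]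
    rfl

end Par

end

section

variable {p : ℕ} [hp : Fact p.Prime] {L : Type} [NontriviallyNormedField L] [NormedAlgebra ℚ_[p] L]
  [IsUltrametricDist L] [CompleteSpace L]

namespace Par

variable (D : Par p L)

/-- Closed under translations and dilations, and containing the special functions. -/
structure Stable (S : Submodule L (ℚ_[p] → L)) : Prop where
  le : S ≤ D.BS
  ge : D.V ≤ S
  T_mem : ∀ f ∈ S, ∀ n b, D.T n b f ∈ S

variable {D}

lemma Stable.um_mem {S : Submodule L (ℚ_[p] → L)} (hS : D.Stable S) {f : ℚ_[p] → L} (hf : f ∈ S) (n i : ℕ) :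
    ((D.um n - 1) ^ i) f ∈ S := by
  induction i with
  | zero => exact hf
  | succ i ih =>
    rw [pow_succ', Module.End.mul_apply, LinearMap.sub_apply, Module.End.one_apply]
    exact S.sub_mem (hS.T_mem _ ih _ _) ih

lemma norm_block_of_approx {CV : ℝ} (hCV : ∀ (R : (ℚ_[p] → L) →ₗ[L] L) (c : ℝ), D.Dual R → D.CN R c →
      ∀ (f : ℚ_[p] → L) (C' : ℝ), D.BB C' f → ‖R f‖ ≤ CV * c * C')
    {S : Submodule L (ℚ_[p] → L)} (hS : D.Stable S) {P : (ℚ_[p] → L) →ₗ[L] L} {c : ℝ} (hP : D.DC c P)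
    (hPS : ∀ f ∈ S, P f = 0) {f l : ℚ_[p] → L} (hf : f ∈ S) (hl : l ∈ D.V) {ε : ℝ} {n : ℕ} {h : ℤ_[p] → L}
    (hB : D.BB ε (f - l - D.T (-(n : ℤ)) 0 (blk h))) (i : ℕ) : ‖P (blk ((del p L ^ i) h))‖ ≤ CV * c * ε := by
  have h1 : blk ((del p L ^ i) h) = D.T n 0 (D.T (-(n : ℤ)) 0 (blk ((del p L ^ i) h))) := by
    rw [T_T, mul_zero, add_zero, add_neg_cancel, T_zero]
  rw [h1, um_sub_one_pow_block]
  have h2 := hCV _ c ((hP.T n 0).um n i).1 ((hP.T n 0).um n i).2 _ ε hB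
  rw [LinearMap.comp_apply, LinearMap.comp_apply, map_sub ((D.um n - 1) ^ i), map_sub (D.T n 0), map_sub P,
    hPS _ (hS.T_mem _ (hS.um_mem (S.sub_mem hf (hS.ge hl)) n i) _ _), zero_sub, norm_neg] at h2
  exact h2

/-- Cramer's rule for the determinants. -/
lemma cramer {P Q R : (ℚ_[p] → L) →ₗ[L] L} {H H1 H2 : PowerSeries L}
    (e : Fa P * D.Fb Q - D.Fb P * Fa Q = uSer p L ^ (D.d + 1) * H)
    (e1 : Fa R * D.Fb Q - D.Fb R * Fa Q = uSer p L ^ (D.d + 1) * H1)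
    (e2 : Fa P * D.Fb R - D.Fb P * Fa R = uSer p L ^ (D.d + 1) * H2) :
    H * Fa R = H1 * Fa P + H2 * Fa Q := by
  refine mul_left_cancel₀ (pow_ne_zero (D.d + 1) (uSer_ne_zero (p := p) (L := L))) ?_
  rw [← mul_assoc, mul_add, ← mul_assoc, ← mul_assoc, ← e, ← e1, ← e2]
  ring

lemma Gr.hasSum_pr_Fa {C c : ℝ} {F : PowerSeries L} (hF : Gr 0 C F) {R : (ℚ_[p] → L) →ₗ[L] L} (hR : D.CN R c)
    {h : ℤ_[p] → L} (hh : Cr D.r h) (j : ℕ) :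
    HasSum (fun i => PowerSeries.coeff i F * R (blk ((del p L ^ (i + j)) h))) (pr p (F * Fa R) ((del p L ^ j) h)) := by
  have hd := hh.del_pow D.hr.le j
  have h1 := hF.hasSum_pr_mul le_rfl D.hr.le hR.Fa (h := (del p L ^ j) h) (by rw [zero_add]; exact hd)
  refine h1.congr_fun' fun i => ?_
  rw [hR.pr_Fa (hd.del_pow D.hr.le i), pow_add]
  rfl

lemma exists_recurrence_bound {S : Submodule L (ℚ_[p] → L)} (hS : D.Stable S) {P Q : (ℚ_[p] → L) →ₗ[L] L}
    {c c' : ℝ} (hP : D.DC c P) (hQ : D.DC c' Q) (hPS : ∀ f ∈ S, P f = 0) (hQS : ∀ f ∈ S, Q f = 0)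
    {H : PowerSeries L} {CH : ℝ} (hH : Gr 0 CH H)
    (e : Fa P * D.Fb Q - D.Fb P * Fa Q = uSer p L ^ (D.d + 1) * H) :
    ∃ E, 0 < E ∧ ∀ R, D.DC 1 R → ∀ f ∈ S, ∀ l ∈ D.V, ∀ (ε : ℝ) (n : ℕ) (h : ℤ_[p] → L), Cr D.r h →
      D.BB ε (f - l - D.T (-(n : ℤ)) 0 (blk h)) →
      (∀ j, ∃ s, HasSum (fun i => PowerSeries.coeff i H * R (D.T (-(n : ℤ)) 0 (blk ((del p L ^ (i + j)) h)))) s ∧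
        ‖s‖ ≤ E * ε) ∧
      Tendsto (fun i => R (D.T (-(n : ℤ)) 0 (blk ((del p L ^ i) h)))) atTop (𝓝 0) ∧
      ∀ i, ‖R (((D.um n - 1) ^ i) f) - R (D.T (-(n : ℤ)) 0 (blk ((del p L ^ i) h)))‖ ≤ E * ε := by
  obtain ⟨CV, hCV0, hCV⟩ := D.exists_CV
  obtain ⟨K, hK0, hK⟩ := D.exists_H
  have hc := hP.2.nonneg
  have hc' := hQ.2.nonneg
  refine ⟨K * (c * c') * CV + CV + 1, by positivity, fun R hR f hf l hl ε n h hh hB => ?_⟩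
  have hε := hB.nonneg
  set R' := R ∘ₗ D.T (-(n : ℤ)) 0 with hR'
  have hRT : D.DC 1 R' := hR.T _ _
  obtain ⟨H1, hH1, e1⟩ := hK R' Q 1 c' hRT.1 hRT.2 hQ.1 hQ.2
  obtain ⟨H2, hH2, e2⟩ := hK P R' c 1 hP.1 hP.2 hRT.1 hRT.2
  have hcr := cramer e e1 e2
  have hle : K * (c * c') * CV * ε ≤ (K * (c * c') * CV + CV + 1) * ε :=
    mul_le_mul_of_nonneg_right (by linarith) hε
  refine ⟨fun j => ⟨_, Gr.hasSum_pr_Fa hH hRT.2 hh j, ?_⟩, ?_, fun i => ?_⟩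
  · refine le_trans ?_ hle
    have hd := hh.del_pow D.hr.le j
    have g1 := hH1.mul le_rfl D.hr.le hP.2.Fa
    have g2 := hH2.mul le_rfl D.hr.le hQ.2.Fa
    have a1 := Gr.hasSum_pr_Fa hH1 hP.2 hh j
    have a2 := Gr.hasSum_pr_Fa hH2 hQ.2 hh j
    have hs := (((g1.mono (le_max_left _ _)).add (g2.mono (le_max_right _ _))).hasSum (by rw [zero_add]; exact hd) :
      HasSum _ (pr p (H1 * Fa P + H2 * Fa Q) ((del p L ^ j) h)))
    have hadd : pr p (H1 * Fa P + H2 * Fa Q) ((del p L ^ j) h) =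
        pr p (H1 * Fa P) ((del p L ^ j) h) + pr p (H2 * Fa Q) ((del p L ^ j) h) := by
      refine hs.unique (((g1.hasSum (by rw [zero_add]; exact hd)).add
        (g2.hasSum (by rw [zero_add]; exact hd))).congr_fun' fun N => ?_)
      rw [map_add, add_mul]
    rw [hcr, hadd]
    refine norm_add_le_of (norm_hasSum_le_of (by positivity) (fun i => ?_) a1)
      (norm_hasSum_le_of (by positivity) (fun i => ?_) a2)
    · rw [norm_mul]
      have b1 := hH1 i
      have b2 := norm_block_of_approx hCV hS hP hPS hf hl hB (i + j)
      rw [wt, Real.rpow_zero, mul_one, one_mul] at b1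
      calc _ ≤ (K * c') * (CV * c * ε) := mul_le_mul b1 b2 (norm_nonneg _) (by positivity)
        _ = _ := by ring
    · rw [norm_mul]
      have b1 := hH2 i
      have b2 := norm_block_of_approx hCV hS hQ hQS hf hl hB (i + j)
      rw [wt, Real.rpow_zero, mul_one, mul_one] at b1
      calc _ ≤ (K * c) * (CV * c' * ε) := mul_le_mul b1 b2 (norm_nonneg _) (by positivity)
        _ = _ := by ring
  · rw [Metric.tendsto_atTop]
    intro η hη
    obtain ⟨i0, hi0⟩ := hh.eventually_del_pow D.hr.le (half_pos hη)
    refine ⟨i0, fun i hi => ?_⟩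
    rw [dist_zero_right]
    have := hR.2 (-(n : ℤ)) 0 _ _ (hi0 i hi)
    linarith
  · have h2 := hCV _ 1 (hR.um n i).1 (hR.um n i).2 _ ε hB
    rw [LinearMap.comp_apply, map_sub ((D.um n - 1) ^ i), map_sub ((D.um n - 1) ^ i), map_sub R, map_sub R] at h2
    have h3 : R (((D.um n - 1) ^ i) l) = 0 := (hR.um n i).1.kill hl
    rw [h3, sub_zero, ← um_sub_one_pow_block] at h2
    refine h2.trans (mul_le_mul_of_nonneg_right ?_ hε)
    have : 0 ≤ K * (c * c') * CV := by positivity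
    linarith

end Par

end

section

variable {p : ℕ} [hp : Fact p.Prime] {L : Type} [NontriviallyNormedField L] [NormedAlgebra ℚ_[p] L]
  [IsUltrametricDist L] [CompleteSpace L]

namespace Par

variable (D : Par p L)

/-- The dual seminorm is at most `B`. -/
def NB (B : ℝ) (f : ℚ_[p] → L) : Prop := ∀ R, D.DC 1 R → ‖R f‖ ≤ B

/-- Operators not increasing the dual seminorm. -/
def NE : Subring (Module.End L (ℚ_[p] → L)) where
  carrier := {φ | ∀ B f, 0 ≤ B → D.NB B f → D.NB B (φ f)}
  mul_mem' := fun {φ ψ} hφ hψ B f hB hf => hφ B _ hB (hψ B f hB hf)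
  one_mem' := fun B f _ hf => hf
  add_mem' := fun {φ ψ} hφ hψ B f hB hf R hR => by
    rw [LinearMap.add_apply, map_add]
    exact norm_add_le_of (hφ B f hB hf R hR) (hψ B f hB hf R hR)
  zero_mem' := fun B f hB hf R hR => by
    rw [LinearMap.zero_apply, map_zero, norm_zero]; exact hB
  neg_mem' := fun {φ} hφ B f hB hf R hR => by
    rw [LinearMap.neg_apply, map_neg, norm_neg]; exact hφ B f hB hf R hR

lemma um_mem_NE (n : ℕ) : D.um n ∈ D.NE := fun _ _ _ hf R hR => hf _ (hR.T 0 _)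

variable {D}

lemma NB.p_mul {B : ℝ} {f : ℚ_[p] → L} (hf : D.NB B f) {φ : Module.End L (ℚ_[p] → L)} (hB : 0 ≤ B)
    (hφ : φ ∈ D.NE) : D.NB (B / p) (((p : Module.End L (ℚ_[p] → L)) * φ) f) := fun R hR => by
  have h1 : ((p : Module.End L (ℚ_[p] → L)) * φ) f = (p : L) • φ f := by
    rw [← nsmul_eq_mul, LinearMap.smul_apply, Nat.cast_smul_eq_nsmul]
  rw [h1, map_smul, norm_smul, norm_natCast_prime, div_eq_inv_mul]
  exact mul_le_mul_of_nonneg_left (hφ B f hB hf R hR) (inv_nonneg.2 (p_pos p).le)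

variable [ProperSpace L] {S : Submodule L (ℚ_[p] → L)} {P Q : (ℚ_[p] → L) →ₗ[L] L} {c c' CH : ℝ}
  {H : PowerSeries L}

lemma exists_contraction (hS : D.Stable S) (hP : D.DC c P) (hQ : D.DC c' Q) (hPS : ∀ f ∈ S, P f = 0)
    (hQS : ∀ f ∈ S, Q f = 0) (hH : Gr 0 CH H)
    (e : Fa P * D.Fb Q - D.Fb P * Fa Q = uSer p L ^ (D.d + 1) * H) (h0 : PowerSeries.coeff 0 H ≠ 0) :
    ∃ M : ℕ, ∀ f ∈ S, ∀ B > 0, D.NB B f → ∀ n0 : ℕ, ∃ n ≥ n0, ∀ i ≥ M, D.NB (B / p) (((D.um n - 1) ^ i) f) := by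
  have hpp := p_pos p
  obtain ⟨E, hE, hrec⟩ := exists_recurrence_bound hS hP hQ hPS hQS hH e
  obtain ⟨m, q, q0, q1, hm, h1, h2⟩ := exists_dominant (H := fun i => PowerSeries.coeff i H) (C := CH)
    (fun i => by have := hH i; rwa [wt, Real.rpow_zero, mul_one] at this) h0
  obtain ⟨j, hj⟩ := exists_pow_lt_of_lt_one (inv_pos.2 hpp) q1
  refine ⟨j * m, fun f hf B hB hNB n0 => ?_⟩
  set Hm := PowerSeries.coeff m H with hHm
  have hm0 : 0 < ‖Hm‖ := norm_pos_iff.2 hm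
  set δ := B / p with hδ
  have hδ0 : 0 < δ := by positivity
  have hδB : δ ≤ B := div_le_self hB.le (one_lt_p p).le
  set ε := min δ (‖Hm‖ * δ) / E with hε
  have hε0 : 0 < ε := div_pos (lt_min hδ0 (by positivity)) hE
  have hEε : E * ε = min δ (‖Hm‖ * δ) := by rw [hε]; field_simp
  obtain ⟨n, hn, h, hh, l, hl, hBB⟩ := D.exists_approx (hS.le hf) hε0 n0
  refine ⟨n, hn, fun i hi R hR => ?_⟩
  obtain ⟨r1, r2, r3⟩ := hrec R hR f hf l hl ε n h hh hBB
  rw [hEε] at r1 r3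
  have hA : ∀ i, ‖R (D.T (-(n : ℤ)) 0 (blk ((del p L ^ i) h)))‖ ≤ B := fun i => by
    have a1 := norm_sub_le_of (hNB _ (hR.um n i)) ((r3 i).trans ((min_le_left _ _).trans hδB))
    rwa [LinearMap.comp_apply, sub_sub_cancel] at a1
  have a2 := norm_le_of_recurrence_iterate (H := fun i => PowerSeries.coeff i H)
    (a := fun i => R (D.T (-(n : ℤ)) 0 (blk ((del p L ^ i) h)))) hm h1 q0 q1 h2 r2 hδ0
    (fun l => (r1 l).imp fun s hs => ⟨hs.1, hs.2.trans (min_le_right _ _)⟩) hA j i hi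
  have a3 : ‖R (D.T (-(n : ℤ)) 0 (blk ((del p L ^ i) h)))‖ ≤ δ := by
    refine a2.trans (max_le le_rfl ?_)
    rw [hδ, div_eq_inv_mul]
    exact mul_le_mul_of_nonneg_right hj.le hB.le
  have a4 := norm_add_le_of ((r3 i).trans (min_le_left _ _)) a3
  rwa [sub_add_cancel] at a4

/-- `u_n` is reached from `u_N` inside the ring of nonexpanding operators. -/
lemma exists_um_sub_one (n e : ℕ) : ∃ s ∈ D.NE, D.um n - 1 = s * (D.um (n + e) - 1) := by
  refine ⟨∑ i ∈ Finset.range (p ^ e), D.um (n + e) ^ i, sum_mem fun i _ => pow_mem (D.um_mem_NE _) i, ?_⟩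
  rw [geom_sum_mul, um_pow]

lemma um_contraction (hS : D.Stable S) (hP : D.DC c P) (hQ : D.DC c' Q) (hPS : ∀ f ∈ S, P f = 0)
    (hQS : ∀ f ∈ S, Q f = 0) (hH : Gr 0 CH H)
    (e : Fa P * D.Fb Q - D.Fb P * Fa Q = uSer p L ^ (D.d + 1) * H) (h0 : PowerSeries.coeff 0 H ≠ 0)
    {f : ℚ_[p] → L} (hf : f ∈ S) {B : ℝ} (hB : 0 < B) (hNB : D.NB B f) (n : ℕ) : D.NB (B / p) ((D.um n - 1) f) := by
  have hpp := p_pos p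
  obtain ⟨M, hM⟩ := exists_contraction hS hP hQ hPS hQS hH e h0
  obtain ⟨t, ht⟩ : ∃ t, M ≤ p ^ t := ⟨M, (Nat.lt_pow_self hp.out.one_lt).le⟩
  obtain ⟨N, hN, hc⟩ := hM f hf B hB hNB (n + t)
  have h1 := hc _ ht
  obtain ⟨k, rfl⟩ : ∃ k, N = n + k + t := ⟨N - n - t, by omega⟩
  have hpB : 0 ≤ B / p := by positivity
  have key : D.NB (B / p) ((D.um (n + k) - 1) f) := by
    set v : D.NE := ⟨D.um (n + k + t), D.um_mem_NE _⟩ with hv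
    obtain ⟨r, hr⟩ := (Commute.one_right (v - 1)).exists_add_pow_prime_pow_eq hp.out t
    rw [sub_add_cancel, one_pow, mul_one] at hr
    have hr' := congrArg (Subtype.val) hr
    have e1 : D.um (n + k) - 1 = (D.um (n + k + t) - 1) ^ p ^ t +
        (p : Module.End L (ℚ_[p] → L)) * (((v - 1) * r : D.NE) : Module.End L (ℚ_[p] → L)) := by
      rw [← D.um_pow (n + k) t]
      push_cast at hr' ⊢
      rw [hv] at hr' ⊢
      simp only at hr' ⊢
      rw [hr', mul_assoc]
      abel
    rw [e1]
    intro R hR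
    rw [LinearMap.add_apply, map_add]
    exact norm_add_le_of (h1 R hR) (hNB.p_mul hB.le ((v - 1) * r).2 R hR)
  obtain ⟨s, hs, es⟩ := D.exists_um_sub_one n k
  rw [es, Module.End.mul_apply]
  exact hs _ _ hpB key

lemma um_contraction_iterate (hS : D.Stable S) (hP : D.DC c P) (hQ : D.DC c' Q) (hPS : ∀ f ∈ S, P f = 0)
    (hQS : ∀ f ∈ S, Q f = 0) (hH : Gr 0 CH H)
    (e : Fa P * D.Fb Q - D.Fb P * Fa Q = uSer p L ^ (D.d + 1) * H) (h0 : PowerSeries.coeff 0 H ≠ 0)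
    {f : ℚ_[p] → L} (hf : f ∈ S) {B : ℝ} (hB : 0 < B) (hNB : D.NB B f) (k n : ℕ) :
    D.NB (B / p ^ k) ((D.um n - 1) f) := by
  have hpp := p_pos p
  have Z := fun {f} (hf : f ∈ S) {B : ℝ} (hB : 0 < B) hNB =>
    um_contraction (D := D) (f := f) (B := B) hS hP hQ hPS hQS hH e h0 hf hB hNB
  induction k generalizing n with
  | zero =>
    rw [pow_zero, div_one]
    exact (sub_mem (D.um_mem_NE n) (one_mem _) : D.um n - 1 ∈ D.NE) B f hB.le hNB
  | succ k ih =>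
    set v := D.um (n + 1) with hv
    have hvm : v ∈ D.NE := D.um_mem_NE _
    set g := (v - 1) f with hg
    have hgS : g ∈ S := by
      have := hS.um_mem hf (n + 1) 1
      rwa [pow_one] at this
    have hB' : 0 < B / p ^ k := by positivity
    have e1 : D.um n - 1 = (p : Module.End L (ℚ_[p] → L)) * 1 * (v - 1) +
        (∑ i ∈ Finset.range p, ∑ j ∈ Finset.range i, v ^ j) * (v - 1) * (v - 1) := by
      have h1 : D.um n - 1 = (∑ i ∈ Finset.range p, v ^ i) * (v - 1) := by
        rw [geom_sum_mul, hv, ← D.um_pow n 1, pow_one]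
      rw [h1, ← add_mul]
      congr 1
      rw [Finset.sum_mul]
      simp only [geom_sum_mul, Finset.sum_sub_distrib, Finset.sum_const, Finset.card_range, nsmul_eq_mul, mul_one]
      abel
    rw [e1]
    intro R hR
    have e2 : B / (p : ℝ) ^ (k + 1) = B / p ^ k / p := by rw [pow_succ, div_div]
    rw [LinearMap.add_apply, map_add, e2, Module.End.mul_apply, Module.End.mul_apply, Module.End.mul_apply]
    refine norm_add_le_of ((ih (n + 1)).p_mul hB'.le (one_mem _) R hR) ?_
    exact (sum_mem fun i _ => sum_mem fun j _ => pow_mem hvm j :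
      (∑ i ∈ Finset.range p, ∑ j ∈ Finset.range i, v ^ j) ∈ D.NE) _ _ (by positivity) (Z hgS hB' (ih (n + 1)) (n + 1)) R hR

/-- If the determinant of two functionals killing `S` does not vanish at the origin, `S` is killed by all
dual functionals. -/
theorem dual_eq_zero_of_det (hS : D.Stable S) (hP : D.DC c P) (hQ : D.DC c' Q) (hPS : ∀ f ∈ S, P f = 0)
    (hQS : ∀ f ∈ S, Q f = 0) (hH : Gr 0 CH H)
    (e : Fa P * D.Fb Q - D.Fb P * Fa Q = uSer p L ^ (D.d + 1) * H) (h0 : PowerSeries.coeff 0 H ≠ 0)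
    {f : ℚ_[p] → L} (hf : f ∈ S) {R : (ℚ_[p] → L) →ₗ[L] L} (hR : D.Dual R) : R f = 0 := by
  have hpp := p_pos p
  obtain ⟨CV, hCV0, hCV⟩ := D.exists_CV
  have hNB : ∀ f ∈ S, ∃ B > 0, D.NB B f := fun f hf => by
    obtain ⟨C, hC⟩ := hS.le hf
    have := hC.nonneg
    exact ⟨CV * C + 1, by positivity, fun R hR => (hCV R 1 hR.1 hR.2 f C hC).trans (by linarith)⟩
  have hzero : ∀ f ∈ S, ∀ R, D.DC 1 R → ∀ n, R ((D.um n - 1) f) = 0 := fun f hf R hR n => by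
    obtain ⟨B, hB, hN⟩ := hNB f hf
    rw [← norm_le_zero_iff]
    have ht : Tendsto (fun k : ℕ => B / (p : ℝ) ^ k) atTop (𝓝 0) := by
      have := (tendsto_pow_atTop_nhds_zero_of_lt_one (inv_nonneg.2 hpp.le) (inv_p_lt_one p)).const_mul B
      simpa only [mul_zero, inv_pow, ← div_eq_mul_inv] using this
    exact ge_of_tendsto' ht fun k => um_contraction_iterate hS hP hQ hPS hQS hH e h0 hf hB hN k n R hR
  have hone : ∀ R, D.DC 1 R → R f = 0 := fun R hR => by
    obtain ⟨E, hE, hrec⟩ := exists_recurrence_bound hS hP hQ hPS hQS hH e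
    have hCH : 0 ≤ CH := hH.nonneg
    have h0' := norm_pos_iff.2 h0
    have main : ∀ ε > 0, ‖PowerSeries.coeff 0 H‖ * ‖R f‖ ≤ (1 + CH + ‖PowerSeries.coeff 0 H‖) * (E * ε) := by
      intro ε hε
      obtain ⟨n, -, h, hh, l, hl, hBB⟩ := D.exists_approx (hS.le hf) hε 0
      obtain ⟨r1, -, r3⟩ := hrec R hR f hf l hl ε n h hh hBB
      obtain ⟨s, hs, hsE⟩ := r1 0
      set a := fun i => R (D.T (-(n : ℤ)) 0 (blk ((del p L ^ i) h))) with ha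
      have ha1 : ∀ i ≠ 0, ‖a i‖ ≤ E * ε := fun i hi => by
        obtain ⟨i, rfl⟩ := Nat.exists_eq_succ_of_ne_zero hi
        have := r3 (i + 1)
        rw [pow_succ', Module.End.mul_apply, hzero _ (hS.um_mem hf n i) R hR n, zero_sub, norm_neg] at this
        exact this
      have hEε : 0 < E * ε := by positivity
      have h3 := hs.sub (hasSum_ite_eq 0 (PowerSeries.coeff 0 H * a 0))
      have h4 := norm_hasSum_le_of (C := CH * (E * ε)) (by positivity) (fun t => ?_) h3
      · have h5 : ‖PowerSeries.coeff 0 H * a 0‖ ≤ (1 + CH) * (E * ε) := by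
          have h6 := norm_sub_le_of (hsE.trans (by nlinarith : E * ε ≤ (1 + CH) * (E * ε)))
            (h4.trans (by nlinarith : CH * (E * ε) ≤ (1 + CH) * (E * ε)))
          rwa [sub_sub_cancel] at h6
        have h7 := r3 0
        rw [pow_zero, Module.End.one_apply] at h7
        have h8 : ‖R f‖ ≤ ‖a 0‖ + E * ε := by
          have := norm_add_le (a 0) (R f - a 0)
          rw [add_sub_cancel] at this
          exact this.trans (by gcongr)
        rw [norm_mul] at h5
        nlinarith
      · by_cases ht : t = 0
        · subst ht; simp only [if_pos, add_zero]; rw [ha]; simp only [pow_zero]; rw [sub_self, norm_zero]; positivity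
        · rw [if_neg ht, sub_zero, norm_mul, add_zero]
          have b1 := hH t
          rw [wt, Real.rpow_zero, mul_one] at b1
          exact mul_le_mul b1 (ha1 t ht) (norm_nonneg _) hCH
    by_contra hne
    have hpos : 0 < ‖PowerSeries.coeff 0 H‖ * ‖R f‖ := mul_pos h0' (norm_pos_iff.2 hne)
    set A := ‖PowerSeries.coeff 0 H‖ * ‖R f‖ with hA
    set G := (1 + CH + ‖PowerSeries.coeff 0 H‖) * E with hG
    have hG0 : 0 < G := by positivity
    have := main (A / (2 * G)) (by positivity)
    rw [← mul_assoc, ← hG, show G * (A / (2 * G)) = A / 2 by field_simp] at this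
    linarith
  obtain ⟨x, hx⟩ := hR.exists_CN
  obtain ⟨y, hy⟩ := NormedField.exists_lt_norm L (max x 0)
  have hy0 : y ≠ 0 := norm_pos_iff.1 ((le_max_right _ _).trans_lt hy)
  have := hone (y⁻¹ • R) ⟨⟨?_, fun j hj => ⟨?_, fun a => ?_⟩⟩, fun n b h C hh => ?_⟩
  · rw [LinearMap.smul_apply, smul_eq_zero] at this
    exact this.resolve_left (inv_ne_zero hy0)
  · obtain ⟨C, C0, hC⟩ := hR.1
    refine ⟨‖y⁻¹‖ * C, by positivity, fun f C' hf => ?_⟩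
    rw [LinearMap.smul_apply, norm_smul, mul_assoc]
    exact mul_le_mul_of_nonneg_left (hC f C' hf) (norm_nonneg _)
  · rw [LinearMap.smul_apply, (hR.2 j hj).1, smul_zero]
  · rw [LinearMap.smul_apply, (hR.2 j hj).2, smul_zero]
  · have hC := hh.nonneg
    rw [LinearMap.smul_apply, norm_smul, norm_inv, inv_mul_le_iff₀ (norm_pos_iff.2 hy0), one_mul]
    exact (hx n b h C hh).trans (mul_le_mul_of_nonneg_right ((le_max_left _ _).trans hy.le) hC)

end Par

end

section

variable {p : ℕ} [hp : Fact p.Prime] {L : Type} [NontriviallyNormedField L] [NormedAlgebra ℚ_[p] L]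
  [IsUltrametricDist L] [CompleteSpace L]

variable (p L) in
/-- The indicator function of `ℤ_p`. -/
def ind : ℚ_[p] → L := blk (fun _ : ℤ_[p] => (1 : L))

lemma ind_of_le {z : ℚ_[p]} (hz : ‖z‖ ≤ 1) : ind p L z = 1 := by
  rw [ind, blk, dif_pos hz]

lemma ind_of_not {z : ℚ_[p]} (hz : ¬ ‖z‖ ≤ 1) : ind p L z = 0 := blk_of_not _ hz

lemma ind_add {z w : ℚ_[p]} (hw : ‖w‖ ≤ 1) : ind p L (z + w) = ind p L z := by
  by_cases hz : ‖z‖ ≤ 1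
  · rw [ind_of_le hz, ind_of_le ((Padic.nonarchimedean _ _).trans (max_le hz hw))]
  · rw [ind_of_not hz, ind_of_not]
    intro h
    refine hz ?_
    have := norm_sub_le_of (L := ℚ_[p]) h hw
    rwa [add_sub_cancel_right] at this

lemma bin_zero_eq_one : bin p L 0 = fun _ => (1 : L) := by
  ext x; rw [bin_zero_right]

/-- A polynomial vanishing on small elements of `ℚ_p` has zero coefficients. -/
lemma coeff_eq_zero_of_small {d : ℕ} {q : ℕ → L} {m : ℕ}
    (h : ∀ c : ℚ_[p], ‖c‖ ≤ ((p : ℝ)⁻¹) ^ m → ∑ i ∈ Finset.range (d + 1), q i * iotaL p L c ^ i = 0) :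
    ∀ i ≤ d, q i = 0 := by
  set P : Polynomial L := ∑ i ∈ Finset.range (d + 1), Polynomial.C (q i) * Polynomial.X ^ i with hP
  have hP0 : P = 0 := by
    refine Polynomial.eq_zero_of_infinite_isRoot P ?_
    refine (Set.infinite_range_of_injective (f := fun k : ℕ => iotaL p L ((p : ℚ_[p]) ^ (m + k))) ?_).mono ?_
    · intro k k' hk
      have h1 := congrArg norm hk
      simp only [norm_iotaL, norm_pow, Padic.norm_p] at h1
      have h2 := (pow_right_injective₀ (inv_pos.2 (p_pos p)) (inv_p_lt_one p).ne) h1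
      omega
    · rintro _ ⟨k, rfl⟩
      have h1 := h ((p : ℚ_[p]) ^ (m + k)) (by
        rw [norm_pow, Padic.norm_p]
        exact pow_le_pow_of_le_one (inv_nonneg.2 (p_pos p).le) (inv_p_lt_one p).le (by omega))
      simp only [Set.mem_ofPred_eq, Polynomial.IsRoot, hP, Polynomial.eval_finsetSum, Polynomial.eval_mul,
        Polynomial.eval_C, Polynomial.eval_pow, Polynomial.eval_X]
      exact h1
  intro i hi
  have h1 := congrArg (fun Q => Polynomial.coeff Q i) hP0
  simp only [hP, Polynomial.finsetSum_coeff, Polynomial.coeff_C_mul, Polynomial.coeff_X_pow, Polynomial.coeff_zero,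
    mul_ite, mul_one, mul_zero] at h1
  rwa [Finset.sum_ite_eq, if_pos (Finset.mem_range.2 (by omega))] at h1

namespace Par

variable (D : Par p L)

lemma ind_mem_BS : ind p L ∈ D.BS := by
  have := D.block_mem_BS (h := fun _ => 1) (by rw [← bin_zero_eq_one]; exact (crB_bin D.r 0).1) 0 0
  rwa [T_zero] at this

lemma T_ind (n : ℤ) (b : ℚ_[p]) : D.T n b (ind p L) =
    D.chi⁻¹ • ∑ a ∈ Finset.range p, D.T (n + 1) (b + (p : ℚ_[p]) ^ n * a) (ind p L) := by
  have := D.T_blk_eq_sum n b (fun _ => 1) 1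
  rw [pow_one] at this
  rw [Finset.smul_sum]
  simpa only [ind, pow_one, Nat.cast_one] using this

lemma chi_sub_ne : D.chi - D.chi' ≠ 0 := by
  have h1 := D.lam_ne
  have h2 := D.lam_ne_zero
  rw [chi', sub_ne_zero]
  intro h
  rw [eq_div_iff h2] at h
  exact h1 (mul_left_cancel₀ D.chi_ne h)

lemma QW_one : D.QW 1 = D.W := by ext z; rw [QW_apply]; simp

lemma aff_one (a b : L) : aff (1 : Polynomial L) a b = 1 := by simp [aff]

lemma W_mem_BS : D.W ∈ D.BS := by
  rw [← QW_one]; exact D.QW_mem (by simp)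

lemma T_W (n : ℤ) (b : ℚ_[p]) : D.T n b D.W =
    D.chi'⁻¹ • ∑ a ∈ Finset.range p, D.T (n + 1) (b + (p : ℚ_[p]) ^ n * a) D.W := by
  have := D.T_QW n b 1
  simpa only [aff_one, QW_one] using this

lemma W_sub_T_W {w : ℚ_[p]} (hw : ‖w‖ ≤ p) :
    D.W - D.T 0 w D.W = (D.kap - D.lam⁻¹) • (ind p L - D.T 0 w (ind p L)) := by
  ext z
  have h1 : ∀ x, D.W x = D.Wt x + (D.kap - D.lam⁻¹) * ind p L x := fun x => by rw [Wt, ind]; ring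
  have h2 : D.Wt (z - w) = D.Wt z := by rw [sub_eq_add_neg]; exact D.Wt_add (by rwa [norm_neg])
  simp only [Pi.sub_apply, Pi.smul_apply, T_apply, zpow_zero, one_mul, div_one, smul_eq_mul, h1, h2]
  ring

/-- Compatibility of `S` with lower unipotent matrices close to the identity. -/
def LowerStable (S : Submodule L (ℚ_[p] → L)) : Prop := ∀ φ ∈ S, ∀ j n : ℕ,
  (∀ z : ℚ_[p], (p : ℝ) ^ j < ‖z‖ → φ z = 0) → (∀ z w : ℚ_[p], ‖w‖ ≤ ((p : ℝ)⁻¹) ^ n → φ (z + w) = φ z) →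
  ∀ c : ℚ_[p], ‖c‖ ≤ ((p : ℝ)⁻¹) ^ (2 * j + n + 1) → (fun z => iotaL p L (1 - c * z) ^ D.d * φ z) ∈ S

variable {D}

/-- Functionals killing `S` kill the polynomial multiples of its locally constant members. -/
lemma LowerStable.kill {S : Submodule L (ℚ_[p] → L)} (hS : D.LowerStable S) {P : (ℚ_[p] → L) →ₗ[L] L}
    (hP : ∀ f ∈ S, P f = 0) {φ : ℚ_[p] → L} (hφ : φ ∈ S) {j n : ℕ} (h1 : ∀ z : ℚ_[p], (p : ℝ) ^ j < ‖z‖ → φ z = 0)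
    (h2 : ∀ z w : ℚ_[p], ‖w‖ ≤ ((p : ℝ)⁻¹) ^ n → φ (z + w) = φ z) {i : ℕ} (hi : i ≤ D.d) :
    P (fun z => iotaL p L z ^ i * φ z) = 0 := by
  have : CharZero L := (RingHom.charZero_iff (algebraMap ℚ_[p] L).injective).1 inferInstance
  have key := coeff_eq_zero_of_small (p := p) (d := D.d) (m := 2 * j + n + 1)
    (q := fun i => (-1) ^ i * (D.d.choose i : L) * P (fun z => iotaL p L z ^ i * φ z)) (fun c hc => ?_) i hi
  · rcases mul_eq_zero.1 key with h | h
    · exfalso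
      rcases mul_eq_zero.1 h with h | h
      · exact pow_ne_zero _ (neg_ne_zero.2 one_ne_zero) h
      · exact (Nat.choose_pos hi).ne' (Nat.cast_eq_zero.1 h)
    · exact h
  · have h3 := hP _ (hS φ hφ j n h1 h2 c hc)
    rw [← h3]
    have e : (fun z => iotaL p L (1 - c * z) ^ D.d * φ z) = ∑ i ∈ Finset.range (D.d + 1),
        ((-1) ^ i * (D.d.choose i : L) * iotaL p L c ^ i) • (fun z => iotaL p L z ^ i * φ z) := by
      ext z
      rw [Finset.sum_apply, iotaL_sub, iotaL_one, iotaL_mul, sub_eq_add_neg, add_comm, add_pow, Finset.sum_mul]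
      refine Finset.sum_congr rfl fun i _ => ?_
      rw [Pi.smul_apply, smul_eq_mul, neg_eq_neg_one_mul, mul_pow, mul_pow, one_pow]
      ring
    rw [e, map_sum]
    refine Finset.sum_congr rfl fun i _ => ?_
    rw [map_smul, smul_eq_mul]; ring

end Par

end

section

variable {p : ℕ} [hp : Fact p.Prime] {L : Type} [NontriviallyNormedField L] [NormedAlgebra ℚ_[p] L]
  [IsUltrametricDist L] [CompleteSpace L]

lemma eq_zero_of_mul_pow_le {x : L} {t C : ℝ} (ht : 1 < t) (h : ∀ n : ℕ, t ^ n * ‖x‖ ≤ C) : x = 0 := by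
  by_contra hx
  have hx' := norm_pos_iff.2 hx
  obtain ⟨n, hn⟩ := pow_unbounded_of_one_lt (C / ‖x‖) ht
  rw [div_lt_iff₀ hx'] at hn
  exact absurd (h n) (not_le.2 hn)

namespace Par

variable (D : Par p L)

/-- The bounded functionals killing `S`. -/
def Kills (S : Submodule L (ℚ_[p] → L)) (P : (ℚ_[p] → L) →ₗ[L] L) : Prop := D.Bdd P ∧ ∀ f ∈ S, P f = 0

variable {D} {S : Submodule L (ℚ_[p] → L)} {P : (ℚ_[p] → L) →ₗ[L] L}

lemma Kills.dual (hS : D.Stable S) (hP : D.Kills S P) : D.Dual P := D.dual_of_V hP.1 fun l hl => hP.2 l (hS.ge hl)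

lemma Kills.T (hS : D.Stable S) (hP : D.Kills S P) (n : ℤ) (b : ℚ_[p]) : D.Kills S (P ∘ₗ D.T n b) :=
  ⟨hP.1.T n b, fun f hf => hP.2 _ (hS.T_mem f hf n b)⟩

/-- If `S` contains the indicator function of `ℤ_p`, no nonzero functional kills `S`. -/
lemma kills_eq_zero (hS : D.Stable S) (hL : D.LowerStable S) (hi : ind p L ∈ S) (hP : D.Kills S P)
    {f : ℚ_[p] → L} (hf : f ∈ D.BS) : P f = 0 := by
  have h1 : ∀ Q, D.Kills S Q → ∀ i ≤ D.d, Q (blk (mon p L i)) = 0 := fun Q hQ i hid => by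
    have := hL.kill hQ.2 hi (j := 0) (n := 0) (fun z hz => ind_of_not (by simpa using hz))
      (fun z w hw => ind_add (by simpa using hw)) hid
    rw [← this]
    congr 1
    ext z
    by_cases hz : ‖z‖ ≤ 1
    · rw [ind_of_le hz, mul_one, blk, dif_pos hz]; rfl
    · rw [ind_of_not hz, blk_of_not _ hz, mul_zero]
  have h2 : ∀ Q, D.Kills S Q → ∀ h, Cr D.r h → Q (blk h) = 0 := fun Q hQ h hh => by
    obtain ⟨c, hc⟩ := (hQ.dual hS).exists_CN
    have h0 : Fa Q = 0 := Gr.eq_zero (p := p) D.hr.le D.r_lt hc.Fa fun n =>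
      LP_pr_eq_zero ⟨_, _, D.hr.le, hc.Fa⟩ fun a ha i hid => by
        rw [hc.pr_Fa_PL (crB_mon D.hr.le i).1]
        have := h1 _ (hQ.T hS n ((a : ℤ_[p]) : ℚ_[p])) i hid
        rw [LinearMap.comp_apply] at this
        rw [this, mul_zero]
    rw [← hc.pr_Fa hh, h0]
    simp [pr]
  have hCN : D.CN P 0 := fun n b h C hh => by
    have := h2 _ (hP.T hS n b) h hh.1
    rw [LinearMap.comp_apply] at this
    rw [this]; simp
  obtain ⟨C, -, hC⟩ := D.exists_CV
  obtain ⟨C', hC'⟩ := hf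
  have := hC P 0 (hP.dual hS) hCN f C' hC'
  rw [mul_zero, zero_mul] at this
  exact norm_le_zero_iff.1 this

/-- If `S` contains the spherical function, functionals killing `S` do not see small translations. -/
lemma kills_T_ind_small (hS : D.Stable S) (hW : D.W ∈ S) (hP : D.Kills S P) {w : ℚ_[p]} (hw : ‖w‖ ≤ p) :
    P (D.T 0 w (ind p L)) = P (ind p L) := by
  have h1 : (D.kap - D.lam⁻¹) • (ind p L - D.T 0 w (ind p L)) ∈ S := by
    rw [← D.W_sub_T_W hw]; exact S.sub_mem hW (hS.T_mem _ hW _ _)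
  have h2 := hP.2 _ h1
  rw [map_smul, smul_eq_mul, map_sub] at h2
  exact (sub_eq_zero.1 ((mul_eq_zero.1 h2).resolve_left D.kap_ne)).symm

lemma kills_T_neg_one (hS : D.Stable S) (hW : D.W ∈ S) (hP : D.Kills S P) (b : ℚ_[p]) :
    P (D.T (-1) b (ind p L)) = D.chi⁻¹ * p * P (D.T 0 b (ind p L)) := by
  have h : ∀ a ∈ Finset.range p, P (D.T (-1 + 1) (b + (p : ℚ_[p]) ^ (-1 : ℤ) * a) (ind p L)) = P (D.T 0 b (ind p L)) :=
    fun a _ => by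
      have := kills_T_ind_small hS hW (hP.T hS 0 b) (w := (p : ℚ_[p]) ^ (-1 : ℤ) * a) (by
        rw [norm_mul, Padic.norm_p_zpow, neg_neg, zpow_one]
        exact mul_le_of_le_one_right (p_pos p).le (norm_natCast_Q a))
      rwa [LinearMap.comp_apply, LinearMap.comp_apply, D.T_T, zpow_zero, one_mul] at this
  rw [D.T_ind, map_smul, map_sum, Finset.sum_congr rfl h, Finset.sum_const, Finset.card_range, nsmul_eq_mul, smul_eq_mul,
    mul_assoc]

lemma kills_T_ind (hS : D.Stable S) (hW : D.W ∈ S) (hP : D.Kills S P) (w : ℚ_[p]) :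
    P (D.T 0 w (ind p L)) = P (ind p L) := by
  have key : ∀ m : ℕ, ∀ P, D.Kills S P → ∀ w : ℚ_[p], ‖w‖ ≤ (p : ℝ) ^ (m + 1) →
      P (D.T 0 w (ind p L)) = P (ind p L) := by
    intro m
    induction m with
    | zero => exact fun P hP w hw => kills_T_ind_small hS hW hP (by simpa using hw)
    | succ m ih =>
      intro P hP w hw
      have h1 := ih _ (hP.T hS (-1) 0) ((p : ℚ_[p]) * w) (by
        rw [norm_mul, Padic.norm_p, inv_mul_le_iff₀ (p_pos p), ← pow_succ']; exact hw)
      have e : (p : ℚ_[p])⁻¹ * (p * w) = w := inv_mul_cancel_left₀ pQ_ne_zero w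
      rw [LinearMap.comp_apply, LinearMap.comp_apply, D.T_T, add_zero, zero_add, zpow_neg_one, e,
        kills_T_neg_one hS hW hP, kills_T_neg_one hS hW hP, D.T_zero] at h1
      exact mul_left_cancel₀ (mul_ne_zero (inv_ne_zero D.chi_ne) (natCast_prime_ne_zero p L)) h1
  obtain ⟨m, hm⟩ := pow_unbounded_of_one_lt ‖w‖ (one_lt_p p)
  exact key m P hP w (hm.le.trans (pow_le_pow_right₀ (one_lt_p p).le (Nat.le_succ m)))

variable [ProperSpace L]

variable (D S) in
/-- Closedness of `S` in the Banach space. -/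
def IsClosedIn : Prop := ∀ f ∈ D.BS, (∀ ε > 0, ∃ s ∈ S, D.BB ε (f - s)) → f ∈ S

lemma mem_of_kills (hS : D.Stable S) (hc : D.IsClosedIn S) {f : ℚ_[p] → L} (hf : f ∈ D.BS)
    (h : ∀ P, D.Kills S P → P f = 0) : f ∈ S := by
  refine hc f hf fun ε hε => ?_
  by_contra hne
  obtain ⟨R, hR, hR0, hRf⟩ := D.exists_separating hS.le hf hε fun s hs hB => hne ⟨s, hs, hB⟩
  exact hRf (h R ⟨hR, hR0⟩)

lemma kills_ind_of_W (hS : D.Stable S) (hc : D.IsClosedIn S) (hL : D.LowerStable S) (hW : D.W ∈ S)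
    (hP : D.Kills S P) : P (ind p L) = 0 := by
  obtain ⟨c, hcn⟩ := (hP.dual hS).exists_CN
  have hpp := p_pos p
  rcases Nat.eq_zero_or_pos D.d with h0 | h0
  · have h1 : ∀ n : ℕ, P (ind p L) = (D.chi⁻¹ * p) ^ n * P (D.T n 0 (ind p L)) := by
      intro n
      induction n with
      | zero => rw [pow_zero, one_mul, Nat.cast_zero, D.T_zero]
      | succ n ih =>
        have := kills_T_neg_one hS hW (hP.T hS (n + 1) 0) 0
        rw [LinearMap.comp_apply, LinearMap.comp_apply, D.T_T, D.T_T, mul_zero, add_zero, add_zero,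
          add_neg_cancel_right] at this
        rw [ih, this, pow_succ]
        push_cast
        ring
    have hr1 : D.r < 1 := by have := D.r_lt; rw [h0] at this; simpa using this
    have hq : ‖D.chi⁻¹ * (p : L)‖ = (p : ℝ) ^ (D.r - 1) := by
      rw [norm_mul, norm_inv, D.norm_chi, inv_inv, norm_natCast_prime, Real.rpow_sub_one hpp.ne', div_eq_mul_inv]
    refine eq_zero_of_mul_pow_le (t := (p : ℝ) ^ (1 - D.r)) (C := c * wt D.r 0)
      (Real.one_lt_rpow (one_lt_p p) (by linarith)) fun n => ?_
    have h2 := hcn n 0 _ _ (crB_bin D.r 0)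
    rw [bin_zero_eq_one] at h2
    have h3 := congrArg norm (h1 n)
    rw [norm_mul, norm_pow, hq] at h3
    have h4 : ((p : ℝ) ^ (1 - D.r)) * (p : ℝ) ^ (D.r - 1) = 1 := by
      rw [← Real.rpow_add hpp]; simp
    rw [h3, ← mul_assoc, ← mul_pow, h4, one_pow, one_mul]
    exact h2
  · refine eq_zero_of_mul_pow_le (one_lt_p p) (C := c * KO p D.r) fun n => ?_
    set b : ℚ_[p] := (p : ℚ_[p]) ^ (-(n : ℤ)) with hb
    have hbn : ‖b‖ = (p : ℝ) ^ n := by rw [hb, Padic.norm_p_zpow, neg_neg, zpow_natCast]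
    have hφ : ind p L - D.T 0 b (ind p L) ∈ S := mem_of_kills hS hc
      (D.BS.sub_mem D.ind_mem_BS (D.T_mem_BS D.ind_mem_BS _ _)) fun Q hQ => by
        rw [map_sub, kills_T_ind hS hW hQ, sub_self]
    have hT : ∀ z, D.T 0 b (ind p L) z = ind p L (z - b) := fun z => by
      rw [T_apply, zpow_zero, one_mul, zpow_zero, div_one]
    have hone : (1 : ℝ) ≤ (p : ℝ) ^ n := one_le_pow₀ (one_lt_p p).le
    have h1 := hL.kill hP.2 hφ (j := n) (n := 0) (fun z hz => by
        rw [Pi.sub_apply, hT, ind_of_not (not_le.2 (hone.trans_lt hz)), ind_of_not, sub_zero]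
        intro h
        have := norm_add_le_of (L := ℚ_[p]) (h.trans hone) hbn.le
        rw [sub_add_cancel] at this
        exact absurd this (not_le.2 hz))
      (fun z w hw => by
        rw [pow_zero] at hw
        rw [Pi.sub_apply, Pi.sub_apply, hT, hT, ind_add hw, add_sub_right_comm, ind_add hw]) (i := 1) h0
    have e1 : ∀ z, iotaL p L z * ind p L z = blk (mon p L 1) z := fun z => by
      by_cases hz : ‖z‖ ≤ 1
      · rw [ind_of_le hz, mul_one, blk, dif_pos hz]; exact (pow_one _).symm
      · rw [ind_of_not hz, blk_of_not _ hz, mul_zero]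
    have e : (fun z => iotaL p L z ^ 1 * (ind p L - D.T 0 b (ind p L)) z) =
        blk (mon p L 1) - D.T 0 b (blk (mon p L 1)) - iotaL p L b • D.T 0 b (ind p L) := by
      ext z
      have e2 := e1 (z - b)
      rw [iotaL_sub] at e2
      simp only [Pi.sub_apply, Pi.smul_apply, T_apply, zpow_zero, one_mul, div_one, smul_eq_mul, pow_one]
      rw [← e1 z, ← e2]
      ring
    rw [e, map_sub, map_sub, map_smul, kills_T_ind hS hW hP, sub_eq_zero, smul_eq_mul] at h1
    rw [← hbn, ← norm_iotaL (p := p) (L := L), ← norm_mul, ← h1]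
    have h2 := hcn 0 0 _ _ (crB_mon (p := p) (L := L) D.hr.le 1)
    rw [T_zero] at h2
    exact norm_sub_le_of h2 (hcn 0 b _ _ (crB_mon D.hr.le 1))

/-- A combination of the indicator function and the spherical function in `S` forces `ind ∈ S`. -/
lemma ind_mem_of_comb (hS : D.Stable S) (hc : D.IsClosedIn S) (hL : D.LowerStable S) {x y : L} (hxy : x ≠ 0 ∨ y ≠ 0)
    (h : x • ind p L + y • D.W ∈ S) : ind p L ∈ S := by
  have hU : ∀ (c : L) (f : ℚ_[p] → L), c ≠ 0 → D.T 0 0 f = c⁻¹ • ∑ a ∈ Finset.range p,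
      D.T (0 + 1) (0 + (p : ℚ_[p]) ^ (0 : ℤ) * a) f → ∑ a ∈ Finset.range p, D.T 1 (a : ℚ_[p]) f = c • f := by
    intro c f hc0 hf
    rw [T_zero] at hf
    simp only [zero_add, zpow_zero, one_mul] at hf
    have h1 := congrArg (fun g => c • g) hf
    simp only [smul_smul, mul_inv_cancel₀ hc0, one_smul] at h1
    exact h1.symm
  have h1 : ∑ a ∈ Finset.range p, D.T 1 (a : ℚ_[p]) (x • ind p L + y • D.W) ∈ S :=
    S.sum_mem fun a _ => hS.T_mem _ h _ _
  have h2 : ∑ a ∈ Finset.range p, D.T 1 (a : ℚ_[p]) (x • ind p L + y • D.W) =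
      (x * D.chi) • ind p L + (y * D.chi') • D.W := by
    simp only [map_add, map_smul]
    rw [Finset.sum_add_distrib, ← Finset.smul_sum, ← Finset.smul_sum, hU _ _ D.chi_ne (D.T_ind 0 0),
      hU _ _ D.chi'_ne (D.T_W 0 0), smul_smul, smul_smul]
  rw [h2] at h1
  have hne := D.chi_sub_ne
  have hWi : D.W ∈ S → ind p L ∈ S := fun hW =>
    mem_of_kills hS hc D.ind_mem_BS fun Q hQ => kills_ind_of_W hS hc hL hW hQ
  by_cases hx : x = 0
  · have hy := hxy.resolve_left (fun h => h hx)
    rw [hx, zero_smul, zero_add] at h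
    exact hWi ((S.smul_mem_iff hy).1 h)
  · have h3 := S.sub_mem h1 (S.smul_mem D.chi' h)
    have e : (x * D.chi) • ind p L + (y * D.chi') • D.W - D.chi' • (x • ind p L + y • D.W) =
        (x * (D.chi - D.chi')) • ind p L := by
      ext z; simp only [Pi.add_apply, Pi.sub_apply, Pi.smul_apply, smul_eq_mul]; ring
    rw [e] at h3
    exact (S.smul_mem_iff (mul_ne_zero hx hne)).1 h3

lemma coeff_zero_Fa (P : (ℚ_[p] → L) →ₗ[L] L) : PowerSeries.coeff 0 (Fa P) = P (ind p L) := by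
  rw [Fa, PowerSeries.coeff_mk, bin_zero_eq_one, ind]

lemma coeff_zero_Fb (hP : D.Dual P) : PowerSeries.coeff 0 (D.Fb P) = P D.W := by
  obtain ⟨c, hc⟩ := hP.exists_CN
  obtain ⟨K, -, hK⟩ := D.Fb_spec
  have := (hK P c hP hc).2 0 0 1 (by simp)
  simp only [Polynomial.eval_one, ← bin_zero_eq_one] at this
  rw [PL_zero_zero, pr_bin, pow_zero, one_mul, Nat.cast_zero, PadicInt.coe_zero, T_zero, QW_one] at this
  exact this

/-- Topological irreducibility, in terms of functionals. -/
theorem dual_eq_zero_or_le (hS : D.Stable S) (hc : D.IsClosedIn S) (hL : D.LowerStable S) :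
    (∀ f ∈ S, ∀ R, D.Dual R → R f = 0) ∨ D.BS ≤ S := by
  by_cases hdet : ∃ P Q, D.Kills S P ∧ D.Kills S Q ∧ P (ind p L) * Q D.W - P D.W * Q (ind p L) ≠ 0
  · left
    obtain ⟨P, Q, hP, hQ, hPQ⟩ := hdet
    have hP' := hP.dual hS
    have hQ' := hQ.dual hS
    obtain ⟨c, hPc⟩ := hP'.exists_CN
    obtain ⟨c', hQc⟩ := hQ'.exists_CN
    obtain ⟨K, -, hK⟩ := D.exists_H
    obtain ⟨H, hH, e⟩ := hK P Q c c' hP' hPc hQ' hQc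
    refine fun f hf R hR => dual_eq_zero_of_det hS ⟨hP', hPc⟩ ⟨hQ', hQc⟩ hP.2 hQ.2 hH e (fun h0 => hPQ ?_) hf hR
    have h1 := congrArg (PowerSeries.coeff 0) e
    rw [map_sub] at h1
    have hm : ∀ F G : PowerSeries L, PowerSeries.coeff 0 (F * G) = PowerSeries.coeff 0 F * PowerSeries.coeff 0 G :=
      fun F G => by simp only [PowerSeries.coeff_zero_eq_constantCoeff, map_mul]
    rw [hm, hm, hm] at h1
    simp only [h0, mul_zero, coeff_zero_Fa, coeff_zero_Fb hP',
      coeff_zero_Fb hQ'] at h1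
    exact h1
  · right
    push Not at hdet
    have hi : ind p L ∈ S := by
      by_cases hex : ∃ P, D.Kills S P ∧ (P D.W ≠ 0 ∨ -P (ind p L) ≠ 0)
      · obtain ⟨P, hP, hP0⟩ := hex
        refine ind_mem_of_comb hS hc hL hP0 (mem_of_kills hS hc ?_ fun Q hQ => ?_)
        · exact D.BS.add_mem (D.BS.smul_mem _ D.ind_mem_BS) (D.BS.smul_mem _ D.W_mem_BS)
        · have := hdet P Q hP hQ
          rw [map_add, map_smul, map_smul, smul_eq_mul, smul_eq_mul]
          linear_combination -this
      · push Not at hex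
        exact mem_of_kills hS hc D.ind_mem_BS fun Q hQ => neg_eq_zero.1 (hex Q hQ).2
    exact fun f hf => mem_of_kills hS hc hf fun P hP => kills_eq_zero hS hL hi hP hf

end Par

end

section

variable {p : ℕ} [hp : Fact p.Prime] {L : Type} [NontriviallyNormedField L] [NormedAlgebra ℚ_[p] L]
  [IsUltrametricDist L] [CompleteSpace L]

lemma ne_zero_of_valL_pos {x : L} (h : 0 < valL p L x) : x ≠ 0 := by
  rintro rfl
  simp [valL] at h

lemma norm_eq_rpow_valL {x : L} (h : x ≠ 0) : ‖x‖ = (p : ℝ) ^ (-valL p L x) := by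
  rw [valL, neg_neg, Real.rpow_logb (p_pos p) (one_lt_p p).ne' (norm_pos_iff.2 h)]

/-- A continuous function on `ℤ_p` vanishing at small nonzero elements vanishes at `0`. -/
lemma apply_zero_of_small {g : ℤ_[p] → L} (hg : Continuous g) {ρ : ℝ} (hρ : 0 < ρ)
    (h : ∀ z ≠ 0, ‖z‖ < ρ → g z = 0) : g 0 = 0 := by
  have h0 : Tendsto (fun n : ℕ => (p : ℤ_[p]) ^ n) atTop (𝓝 0) :=
    tendsto_pow_atTop_nhds_zero_of_norm_lt_one (by rw [PadicInt.norm_p]; exact inv_p_lt_one p)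
  have h1 := (hg.tendsto 0).comp h0
  refine tendsto_nhds_unique (h1.congr' ?_) tendsto_const_nhds
  have h2 := h0.norm
  rw [norm_zero] at h2
  filter_upwards [h2.eventually_lt_const hρ] with n hn
  exact h _ (p_pow_ne_zero n) hn

/-- The parameters attached to `(k, α, β)`. -/
def Hyps.par {k : ℕ} {α β : L} (h : Hyps p L k α β) : Par p L where
  d := k - 2
  r := valL p L α
  r' := valL p L β
  lam := α * (p : L) / β
  chi := α⁻¹ * (α * (p : L) / β) * (p : L) ^ (k - 2)
  hr := h.2.2.1
  hr' := h.2.2.2.1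
  hrr' := h.2.2.2.2.2
  hsum := by
    rw [h.2.2.2.2.1, Nat.cast_sub h.1]; push_cast; ring
  norm_chi := by
    have hα := ne_zero_of_valL_pos h.2.2.1
    have hβ := ne_zero_of_valL_pos h.2.2.2.1
    have hpp := p_pos p
    have hs := h.2.2.2.2.1
    have hk : ((k - 2 : ℕ) : ℝ) = k - 2 := by rw [Nat.cast_sub h.1]; push_cast; ring
    rw [norm_mul, norm_mul, norm_div, norm_mul, norm_inv, norm_pow, norm_natCast_prime, norm_eq_rpow_valL (p := p) hα,
      norm_eq_rpow_valL (p := p) hβ, ← Real.rpow_neg_one (p : ℝ), ← Real.rpow_natCast, ← Real.rpow_mul hpp.le, hk,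
      ← Real.rpow_neg hpp.le, ← Real.rpow_neg hpp.le, ← Real.rpow_add hpp, ← Real.rpow_sub hpp, ← Real.rpow_add hpp,
      ← Real.rpow_add hpp]
    congr 1
    linarith
  norm_lam := by
    have hα := ne_zero_of_valL_pos h.2.2.1
    have hβ := ne_zero_of_valL_pos h.2.2.2.1
    have hpp := p_pos p
    have hs := h.2.2.2.2.1
    have hk : ((k - 2 : ℕ) : ℝ) = k - 2 := by rw [Nat.cast_sub h.1]; push_cast; ring
    rw [norm_div, norm_mul, norm_natCast_prime, norm_eq_rpow_valL (p := p) hα, norm_eq_rpow_valL (p := p) hβ,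
      ← Real.rpow_neg hpp.le, ← Real.rpow_neg_one, ← Real.rpow_natCast, ← Real.rpow_natCast, ← Real.rpow_mul hpp.le,
      ← Real.rpow_mul hpp.le, hk, ← Real.rpow_add hpp, ← Real.rpow_sub hpp, ← Real.rpow_add hpp]
    congr 1
    push_cast
    linarith
  lam_ne := by
    have hβ := ne_zero_of_valL_pos h.2.2.2.1
    have hp0 := natCast_prime_ne_zero p L
    intro e
    rw [div_eq_iff hβ, mul_comm] at e
    exact h.2.1 (mul_left_cancel₀ hp0 e)

variable {k : ℕ} {α β : L} (h : Hyps p L k α β)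

lemma Hyps.ext2_eq {f : ℚ_[p] → L} {g : ℤ_[p] → L} (hg : Continuous g) (hg2 : ∀ z : ℤ_[p], z ≠ 0 →
    g z = (α * (p : L) / β) ^ ((z : ℚ_[p]).valuation) * (iotaL p L (z : ℚ_[p])) ^ (k - 2) * f (((z : ℚ_[p]))⁻¹))
    (hf : ∃ g, Ext2 p L k α β f g) (h : Hyps p L k α β) : ext2 p L k α β f = g := by
  rw [ext2, dif_pos hf]
  obtain ⟨h1, h2⟩ := hf.choose_spec
  have h3 := ((isCr_iff h.2.2.1.le _).1 h1).1
  ext z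
  by_cases hz : z = 0
  · subst hz
    refine sub_eq_zero.1 (apply_zero_of_small (g := fun z => hf.choose z - g z) (h3.sub hg) one_pos fun z hz _ => ?_)
    rw [h2 z hz, hg2 z hz, sub_self]
  · rw [h2 z hz, hg2 z hz]

lemma Hyps.memB_iff (f : ℚ_[p] → L) : MemB p L k α β f ↔ f ∈ h.par.BS := by
  have hr : 0 ≤ valL p L α := h.2.2.1.le
  constructor
  · rintro ⟨h1, g, h2, h3⟩
    have h1' := ((isCr_iff hr _).1 h1).crB
    have h2' := ((isCr_iff hr _).1 h2).crB
    exact ⟨max _ _, h1'.mono (le_max_left _ _), g, h2'.mono (le_max_right _ _), h3⟩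
  · rintro ⟨C, h1, g, h2, h3⟩
    exact ⟨(isCr_iff hr _).2 h1.1, g, (isCr_iff hr _).2 h2.1, h3⟩

lemma Hyps.bNorm_le {f : ℚ_[p] → L} {C : ℝ} (hf : h.par.BB C f) : bNorm p L k α β f ≤ C := by
  obtain ⟨h1, g, h2, h3⟩ := hf
  have hr : 0 ≤ valL p L α := h.2.2.1.le
  rw [bNorm, Hyps.ext2_eq h2.1.1 h3 ⟨g, (isCr_iff hr _).2 h2.1, h3⟩ h]
  exact max_le h1.crNorm_le h2.crNorm_le

lemma Hyps.gAct_T (n : ℤ) (b : ℚ_[p]) (f : ℚ_[p] → L) :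
    gAct p L k α β !![(p : ℚ_[p]) ^ n, b; 0, 1] f = h.par.T n b f := by
  have hp0 := pQ_ne_zero (p := p)
  have hα := ne_zero_of_valL_pos h.2.2.1
  ext z
  simp only [gAct, det2, Matrix.of_apply, Matrix.cons_val', Matrix.cons_val_zero, Matrix.cons_val_one,
    Matrix.cons_val_fin_one, neg_zero, zero_mul, zero_add, mul_zero, sub_zero, mul_one, one_mul]
  rw [if_neg (zpow_ne_zero n hp0), Par.T_apply, Padic.valuation_zpow, Padic.valuation_p, mul_one]
  congr 1
  simp only [Hyps.par]
  rw [mul_zpow, mul_zpow, inv_zpow, zpow_neg, iotaL_zpow, ← zpow_natCast ((_ : L) ^ n), ← zpow_mul, iotaL_natCast,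
    mul_comm n, zpow_mul, zpow_natCast]

/-- Small lower unipotent matrices act on locally constant functions with compact support by a polynomial factor. -/
lemma Hyps.gAct_lower {φ : ℚ_[p] → L} (hφ : φ ∈ h.par.BS) {j n : ℕ} (h1 : ∀ z : ℚ_[p], (p : ℝ) ^ j < ‖z‖ → φ z = 0)
    (h2 : ∀ z w : ℚ_[p], ‖w‖ ≤ ((p : ℝ)⁻¹) ^ n → φ (z + w) = φ z) {c : ℚ_[p]}
    (hc : ‖c‖ ≤ ((p : ℝ)⁻¹) ^ (2 * j + n + 1)) :
    gAct p L k α β !![1, 0; c, 1] φ = fun z => iotaL p L (1 - c * z) ^ (k - 2) * φ z := by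
  have hpp := p_pos p
  have hp1 := one_lt_p p
  have hsmall : ∀ z : ℚ_[p], ‖z‖ ≤ (p : ℝ) ^ j → ‖c * z‖ * (p : ℝ) ^ j ≤ ((p : ℝ)⁻¹) ^ n ∧ ‖c * z‖ < 1 := fun z hz => by
    have e : ‖c * z‖ ≤ ((p : ℝ)⁻¹) ^ (2 * j + n + 1) * (p : ℝ) ^ j := by
      rw [norm_mul]; exact mul_le_mul hc hz (norm_nonneg _) (by positivity)
    have e2 : ((p : ℝ)⁻¹) ^ (2 * j + n + 1) * (p : ℝ) ^ j = ((p : ℝ)⁻¹) ^ (j + n + 1) := by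
      rw [show 2 * j + n + 1 = (j + n + 1) + j by ring, pow_add _ (j + n + 1), mul_assoc, ← mul_pow,
        inv_mul_cancel₀ hpp.ne', one_pow, mul_one]
    have e3 : ((p : ℝ)⁻¹) ^ (j + n + 1) * (p : ℝ) ^ j = ((p : ℝ)⁻¹) ^ (n + 1) := by
      rw [show j + n + 1 = (n + 1) + j by ring, pow_add _ (n + 1), mul_assoc, ← mul_pow,
        inv_mul_cancel₀ hpp.ne', one_pow, mul_one]
    rw [e2] at e
    refine ⟨(mul_le_mul_of_nonneg_right e (by positivity)).trans ?_, e.trans_lt ?_⟩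
    · rw [e3]; exact pow_le_pow_of_le_one (by positivity) (inv_p_lt_one p).le (by omega)
    · exact pow_lt_one₀ (by positivity) (inv_p_lt_one p) (by omega)
  have hone : ∀ x : ℚ_[p], ‖x‖ < 1 → ‖1 - x‖ = 1 := fun x hx => by
    have := Par.norm_add_eq_of_lt (x := (1 : ℚ_[p])) (y := -x) (by rwa [norm_neg, norm_one])
    rwa [norm_one, ← sub_eq_add_neg] at this
  ext z
  have ez : -c * z + 1 = 1 - c * z := by ring
  simp only [gAct, det2, Matrix.of_apply, Matrix.cons_val', Matrix.cons_val_zero, Matrix.cons_val_one,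
    Matrix.cons_val_fin_one, zero_mul, sub_zero, mul_one, one_mul, Padic.valuation_one, neg_zero, zpow_zero, ez]
  split_ifs with hz
  · have hbig : (p : ℝ) ^ j < ‖z‖ := by
      by_contra hle
      have := hone _ (hsmall z (not_lt.1 hle)).2
      rw [hz, norm_zero] at this
      exact zero_ne_one this
    rw [h1 z hbig, mul_zero]
    obtain ⟨C', -, g, hg2, hg3⟩ := hφ
    rw [Hyps.ext2_eq hg2.1.1 hg3 ⟨g, (isCr_iff h.2.2.1.le _).2 hg2.1, hg3⟩ h]
    rw [apply_zero_of_small hg2.1.1 (ρ := ((p : ℝ) ^ j)⁻¹) (by positivity) fun y hy hyn => ?_, mul_zero]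
    rw [hg3 y hy, h1, mul_zero]
    have hy0 : 0 < ‖y‖ := norm_pos_iff.2 hy
    rw [norm_inv]
    exact (lt_inv_comm₀ hy0 (by positivity)).1 hyn
  · by_cases hle : ‖z‖ ≤ (p : ℝ) ^ j
    · obtain ⟨hs1, hs2⟩ := hsmall z hle
      have hn := hone _ hs2
      have hv : (1 - c * z).valuation = 0 := by
        rw [← Padic.valuation_one (p := p)]
        exact Par.valuation_eq_of_norm_eq hz (by rw [hn, norm_one])
      have hw : z / (1 - c * z) = z + c * z * z / (1 - c * z) := by
        rw [div_eq_iff hz, add_mul, div_mul_cancel₀ _ hz]; ring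
      rw [hv, zpow_zero, one_mul, hw, h2]
      rw [norm_div, hn, div_one, norm_mul]
      exact (mul_le_mul_of_nonneg_left hle (norm_nonneg _)).trans hs1
    · rw [h1 z (not_le.1 hle), mul_zero, h1, mul_zero]
      by_contra hu
      set u := z / (1 - c * z) with hu'
      have hn := hone (-(c * u)) (by rw [norm_neg]; exact (hsmall u (not_lt.1 hu)).2)
      have hzu : z = u / (1 - -(c * u)) := by
        have h0 : (1 - -(c * u)) ≠ 0 := norm_ne_zero_iff.1 (by rw [hn]; exact one_ne_zero)
        rw [eq_div_iff h0]
        have : u * (1 - c * z) = z := div_mul_cancel₀ _ hz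
        linear_combination -this
      apply hle
      rw [hzu, norm_div, hn, div_one]
      exact not_lt.1 hu

end

/-- `Π(V) = B(α)/L(α)` is topologically irreducible as a `GL₂(ℚ_p)`-Banach
representation: a closed `GL₂(ℚ_p)`-stable subspace of `Π` (equivalently, a
closed `GL₂(ℚ_p)`-stable subspace of `B(α)` containing `L(α)`) is `0` or `Π`. -/
theorem statement12 (p : ℕ) [Fact p.Prime] (L : Type) [NontriviallyNormedField L]
    [NormedAlgebra ℚ_[p] L] [FiniteDimensional ℚ_[p] L] [IsUltrametricDist L]
    (k : ℕ) (α β : L) (h : Hyps p L k α β) :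
    ∀ S : Set (ℚ_[p] → L),
      (∀ f ∈ S, MemB p L k α β f) →
      (∀ f : ℚ_[p] → L, MemLalpha p L k α β f → f ∈ S) →
      (∀ f ∈ S, ∀ g ∈ S, f + g ∈ S) →
      (∀ c : L, ∀ f ∈ S, c • f ∈ S) →
      (∀ m : Matrix (Fin 2) (Fin 2) ℚ_[p], det2 p m ≠ 0 →
        ∀ f ∈ S, gAct p L k α β m f ∈ S) →
      (∀ f : ℚ_[p] → L, MemB p L k α β f →
        (∀ ε : ℝ, 0 < ε → ∃ g ∈ S, bNorm p L k α β (f - g) < ε) → f ∈ S) →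
      (∀ f ∈ S, MemLalpha p L k α β f) ∨ (∀ f : ℚ_[p] → L, MemB p L k α β f → f ∈ S) := by
  intro S hB hLa hadd hsmul hact hclosed
  have : CompleteSpace L := FiniteDimensional.complete ℚ_[p] L
  have : ProperSpace L := FiniteDimensional.proper ℚ_[p] L
  have hzero : ∀ ε : ℝ, 0 < ε → bNorm p L k α β 0 < ε := fun ε hε =>
    (h.bNorm_le (Par.BB.zero le_rfl)).trans_lt hε
  have hV : h.par.V ≤ h.par.BS := h.par.V_le_BS
  have hVS : ∀ l ∈ h.par.V, l ∈ S := fun l hl => hLa l ⟨(h.memB_iff l).2 (hV hl), fun ε hε =>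
    ⟨l, hl, by rw [sub_self]; exact hzero ε hε⟩⟩
  set S' : Submodule L (ℚ_[p] → L) :=
    { carrier := S
      add_mem' := fun hf hg => hadd _ hf _ hg
      zero_mem' := hVS 0 (zero_mem _)
      smul_mem' := hsmul } with hS'
  have hSt : h.par.Stable S' :=
    { le := fun f hf => (h.memB_iff f).1 (hB f hf)
      ge := hVS
      T_mem := fun f hf n b => by
        rw [← h.gAct_T]
        refine hact _ ?_ f hf
        simpa [det2] using zpow_ne_zero n (pQ_ne_zero (p := p)) }
  have hcl : h.par.IsClosedIn S' := fun f hf hs => hclosed f ((h.memB_iff f).2 hf) fun ε hε => by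
    obtain ⟨s, hs1, hs2⟩ := hs (ε / 2) (by positivity)
    exact ⟨s, hs1, (h.bNorm_le hs2).trans_lt (by linarith)⟩
  have hLo : h.par.LowerStable S' := fun φ hφ j n h1 h2 c hc => by
    have := h.gAct_lower (hSt.le hφ) h1 h2 hc
    have h3 := hact !![1, 0; c, 1] (by simp [det2]) φ hφ
    rw [this] at h3
    exact h3
  rcases Par.dual_eq_zero_or_le hSt hcl hLo with h0 | h0
  · left
    refine fun f hf => ⟨hB f hf, fun ε hε => ?_⟩
    obtain ⟨l, hl, hle⟩ := h.par.mem_closure_of_dual (hSt.le hf) (h0 f hf) (half_pos hε)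
    exact ⟨l, hl, (h.bNorm_le hle).trans_lt (by linarith)⟩
  · exact Or.inr fun f hf => h0 ((h.memB_iff f).1 hf)

end Paper

end
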